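/- There exist a constant c > 0 and B₀ (depending on the βⱼ and ηⱼ) such that for all B ≥ B₀, the number of quadruples of primes (p₁,p₂,p₃,p₄) with pⱼ ∈ I_j for j = 1,…,4 and β₁p₁ + β₂p₂ + β₃p₃ + β₄p₄ = 0 is at least c·B(log B)^{−7}. -/

import Mathlib

/-- The interval `I = [ηB^{1/3} - B^{1/3}/log B, ηB^{1/3} + B^{1/3}/log B]`. -/
noncomputable def shortInterval (η B : ℝ) : Set ℝ :=
  Set.Icc (η * B ^ ((1 : ℝ) / 3) - B ^ ((1 : ℝ) / 3) / Real.log B)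
          (η * B ^ ((1 : ℝ) / 3) + B ^ ((1 : ℝ) / 3) / Real.log B)

/-- Quadruples of primes `(p₁,p₂,p₃,p₄)` with `pⱼ ∈ I_j` and `β₁p₁+β₂p₂+β₃p₃+β₄p₄ = 0`. -/
def primeQuad (β : Fin 4 → ℤ) (η : Fin 4 → ℝ) (B : ℝ) : Set (Fin 4 → ℕ) :=
  {p | (∀ j, (p j).Prime ∧ ((p j : ℝ) ∈ shortInterval (η j) B)) ∧
    β 0 * (p 0 : ℤ) + β 1 * (p 1 : ℤ) + β 2 * (p 2 : ℤ) + β 3 * (p 3 : ℤ) = 0}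



namespace PQ
open Finset

noncomputable def e (x : ℝ) : ℂ := Complex.exp (2 * Real.pi * x * Complex.I)

lemma e_add (x y : ℝ) : e (x + y) = e x * e y := by
  unfold e; rw [← Complex.exp_add]; congr 1; push_cast; ring

lemma e_zero : e 0 = 1 := by simp [e]

lemma norm_e (x : ℝ) : ‖e x‖ = 1 := by
  unfold e
  have := Complex.norm_exp_ofReal_mul_I (2 * Real.pi * x)
  push_cast at this; exact this

lemma e_int (m : ℤ) : e m = 1 := by
  unfold e
  rw [Complex.exp_eq_one_iff]; exact ⟨m, by push_cast; ring⟩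

lemma e_nat (m : ℕ) : e m = 1 := by simpa using e_int m

lemma e_add_int (x : ℝ) (m : ℤ) : e (x + m) = e x := by rw [e_add, e_int, mul_one]

lemma e_nat_mul (n : ℕ) (x : ℝ) : e (n * x) = e x ^ n := by
  unfold e; rw [← Complex.exp_nat_mul]; congr 1; push_cast; ring

lemma e_neg (x : ℝ) : e (-x) = starRingEnd ℂ (e x) := by
  unfold e; rw [← Complex.exp_conj]; congr 1
  simp only [map_mul, Complex.conj_ofReal, Complex.conj_I, Complex.conj_ofNat]; push_cast; ring

lemma continuous_e : Continuous e := by unfold e; fun_prop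

/-- distance to the nearest integer -/
noncomputable def nint (x : ℝ) : ℝ := |x - round x|

lemma nint_nonneg (x : ℝ) : 0 ≤ nint x := abs_nonneg _

lemma nint_le_half (x : ℝ) : nint x ≤ 1 / 2 := abs_sub_round x

lemma nint_le (x : ℝ) (m : ℤ) : nint x ≤ |x - m| := round_le x m

lemma norm_one_sub_e (x : ℝ) : 4 * nint x ≤ ‖1 - e x‖ := by
  have h1 : e x = e (x - round x) := by
    have := e_add_int (x - round x) (round x)
    rw [sub_add_cancel] at this; exact this
  have h2 := abs_sub_round x
  unfold nint
  set y := x - round x with hy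
  rw [h1]
  have h3 : ‖1 - e y‖ = 2 * |Real.sin (Real.pi * y)| := by
    have hm : ‖1 - e y‖ ^ 2 = (2 * |Real.sin (Real.pi * y)|) ^ 2 := by
      rw [mul_pow, sq_abs, ← Complex.normSq_eq_norm_sq, Complex.normSq_apply]
      have : e y = ⟨Real.cos (2 * (Real.pi * y)), Real.sin (2 * (Real.pi * y))⟩ := by
        unfold e
        have hh : (2 * Real.pi * y * Complex.I : ℂ) = ((2 * (Real.pi * y) : ℝ) : ℂ) * Complex.I := by
          push_cast; ring
        rw [hh]
        apply Complex.ext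
        · rw [Complex.exp_ofReal_mul_I_re]
        · rw [Complex.exp_ofReal_mul_I_im]
      rw [this]
      simp only [Complex.sub_re, Complex.sub_im, Complex.one_re, Complex.one_im]
      rw [Real.cos_two_mul, Real.sin_two_mul]
      have := Real.sin_sq_add_cos_sq (Real.pi * y)
      have h5 : Real.cos (Real.pi * y) ^ 2 = 1 - Real.sin (Real.pi * y) ^ 2 := by linarith
      ring_nf
      rw [show Real.cos (Real.pi * y) ^ 4 = (Real.cos (Real.pi * y) ^ 2) ^ 2 by ring, h5]
      ring
    exact (pow_left_inj₀ (norm_nonneg _) (by positivity) two_ne_zero).1 hm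
  rw [h3]
  have h4 : Real.sin (Real.pi * |y|) ≤ |Real.sin (Real.pi * y)| := by
    rcases abs_cases y with ⟨h, _⟩ | ⟨h, _⟩
    · rw [h]; exact le_abs_self _
    · rw [h, mul_neg, Real.sin_neg]; exact neg_le_abs _
  have h5 := Real.mul_le_sin (x := Real.pi * |y|) (by positivity)
    (by nlinarith [Real.pi_pos])
  have h6 : 2 / Real.pi * (Real.pi * |y|) = 2 * |y| := by field_simp
  linarith

/-- total variation of a sequence on `[0,N]` -/
noncomputable def TV (v : ℕ → ℝ) (N : ℕ) : ℝ := |v 0| + ∑ n ∈ range N, |v (n + 1) - v n|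

lemma TV_nonneg (v : ℕ → ℝ) (N : ℕ) : 0 ≤ TV v N := by unfold TV; positivity

lemma sum_parts (v : ℕ → ℝ) (N : ℕ) (z : ℂ) :
    (1 - z) * ∑ n ∈ range (N + 1), (v n : ℂ) * z ^ n
      = v 0 + ∑ n ∈ range N, ((v (n + 1) - v n : ℝ) : ℂ) * z ^ (n + 1) - v N * z ^ (N + 1) := by
  induction N with
  | zero => simp; ring
  | succ k ih =>
    rw [sum_range_succ, mul_add, ih, sum_range_succ _ k]; push_cast; ring

lemma bv_sum (v : ℕ → ℝ) (N : ℕ) (hv : v N = 0) (θ : ℝ) :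
    ‖∑ n ∈ range N, (v n : ℂ) * e (n * θ)‖ * (4 * nint θ) ≤ TV v N := by
  have h := sum_parts v N (e θ)
  rw [sum_range_succ, hv] at h
  simp only [Complex.ofReal_zero, zero_mul, add_zero, sub_zero] at h
  simp_rw [e_nat_mul]
  calc _ ≤ ‖∑ n ∈ range N, (v n : ℂ) * e θ ^ n‖ * ‖1 - e θ‖ := by
        gcongr; exact norm_one_sub_e θ
    _ = ‖(1 - e θ) * ∑ n ∈ range N, (v n : ℂ) * e θ ^ n‖ := by rw [norm_mul, mul_comm]
    _ ≤ _ := by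
        rw [h]; unfold TV
        refine (norm_add_le _ _).trans ?_
        gcongr
        · simp
        · refine (norm_sum_le _ _).trans ?_
          gcongr with i hi
          rw [norm_mul, norm_pow, norm_e, one_pow, mul_one, Complex.norm_real, Real.norm_eq_abs]

lemma TV_mul (u v : ℕ → ℝ) (N : ℕ) (U V : ℝ) (hu : ∀ n ≤ N, |u n| ≤ U) (hv : ∀ n ≤ N, |v n| ≤ V) :
    TV (fun n => u n * v n) N ≤ U * TV v N + V * TV u N := by
  have hU : 0 ≤ U := (abs_nonneg _).trans (hu 0 (Nat.zero_le _))
  have hV : 0 ≤ V := (abs_nonneg _).trans (hv 0 (Nat.zero_le _))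
  unfold TV
  have h0 : |u 0 * v 0| ≤ U * |v 0| + V * |u 0| := by
    rw [abs_mul]
    have := hu 0 (Nat.zero_le _)
    nlinarith [abs_nonneg (u 0), abs_nonneg (v 0), mul_nonneg hV (abs_nonneg (u 0))]
  have h1 : ∑ n ∈ range N, |u (n + 1) * v (n + 1) - u n * v n| ≤
      ∑ n ∈ range N, (U * |v (n + 1) - v n| + V * |u (n + 1) - u n|) := by
    apply sum_le_sum
    intro i hi
    have hi' : i < N := mem_range.1 hi
    have : u (i + 1) * v (i + 1) - u i * v i =
      u (i + 1) * (v (i + 1) - v i) + v i * (u (i + 1) - u i) := by ring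
    rw [this]
    refine (abs_add_le _ _).trans ?_
    rw [abs_mul, abs_mul]
    gcongr
    · exact hu _ hi'
    · exact hv _ hi'.le
  rw [sum_add_distrib, ← mul_sum, ← mul_sum] at h1
  linarith

lemma TV_mono (u : ℕ → ℝ) (N : ℕ) (hu : Monotone u) (h0 : 0 ≤ u 0) : TV u N = u N := by
  unfold TV
  have : ∀ n ∈ range N, |u (n + 1) - u n| = u (n + 1) - u n := fun n _ =>
    abs_of_nonneg (sub_nonneg.2 (hu (Nat.le_succ n)))
  rw [sum_congr rfl this, sum_range_sub, abs_of_nonneg h0]; ring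

lemma TV_sub (u v : ℕ → ℝ) (N : ℕ) : TV (fun n => u n - v n) N ≤ TV u N + TV v N := by
  unfold TV
  have h1 : ∑ n ∈ range N, |u (n + 1) - v (n + 1) - (u n - v n)| ≤
      ∑ n ∈ range N, (|u (n + 1) - u n| + |v (n + 1) - v n|) := by
    apply sum_le_sum
    intro i _
    have : u (i + 1) - v (i + 1) - (u i - v i) = (u (i + 1) - u i) - (v (i + 1) - v i) := by ring
    rw [this]; exact abs_sub _ _
  rw [sum_add_distrib] at h1
  have := abs_sub (u 0) (v 0)
  linarith

/-- spacing -/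
lemma nint_lower (α : ℝ) (r : ℚ) (hα : |α - r| ≤ 1 / (r.den : ℝ) ^ 2) (h : ℤ) (h0 : h ≠ 0)
    (hq : 2 * |h| ≤ r.den) : 1 / (2 * (r.den : ℝ)) ≤ nint (h * α) := by
  have hq0 : (0 : ℝ) < r.den := by exact_mod_cast r.den_pos
  set m := round (h * α) with hm
  have key : (1 : ℝ) / r.den ≤ |h * (r : ℝ) - m| := by
    have hr : (r : ℝ) = r.num / r.den := by exact_mod_cast (Rat.num_div_den r).symm
    have hne : h * r.num - m * r.den ≠ 0 := by
      intro hz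
      have h1 : (r.den : ℤ) ∣ h * r.num := ⟨m, by linarith⟩
      have hc : IsCoprime (r.den : ℤ) r.num := by
        rw [Int.isCoprime_iff_gcd_eq_one, Int.gcd_comm]; exact r.reduced
      have h2 := hc.dvd_of_dvd_mul_right h1
      have h3 := Int.le_of_dvd (abs_pos.2 h0) ((dvd_abs _ _).2 h2)
      have : (0 : ℤ) < r.den := by exact_mod_cast r.den_pos
      have := abs_pos.2 h0
      omega
    have h1 : (1 : ℝ) ≤ |(h : ℝ) * r.num - m * r.den| := by exact_mod_cast Int.one_le_abs hne
    have h2 : (h : ℝ) * r - m = (h * r.num - m * r.den) / r.den := by rw [hr]; field_simp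
    rw [h2, abs_div, abs_of_pos hq0]; gcongr
  have h2 : |(h : ℝ) * (α - r)| ≤ 1 / (2 * (r.den : ℝ)) := by
    rw [abs_mul]
    have : |(h : ℝ)| ≤ r.den / 2 := by
      have : (2 * |(h : ℝ)|) ≤ r.den := by exact_mod_cast hq
      linarith
    calc _ ≤ (r.den / 2 : ℝ) * (1 / (r.den : ℝ) ^ 2) := by gcongr
      _ = _ := by field_simp
  unfold nint
  rw [← hm]
  have h3 : (h : ℝ) * r - m = (h * α - m) - h * (α - r) := by ring
  have h4 : |(h : ℝ) * r - m| ≤ |h * α - m| + |h * (α - r)| := by rw [h3]; exact abs_sub _ _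
  have h5 : (1 : ℝ) / r.den = 1 / (2 * r.den) + 1 / (2 * r.den) := by field_simp; norm_num
  linarith

lemma block (α : ℝ) (r : ℚ) (hα : |α - r| ≤ 1 / (r.den : ℝ) ^ 2) (s : Finset ℕ)
    (hs : ∀ h ∈ s, ∀ h' ∈ s, 2 * |(h : ℤ) - h'| ≤ r.den) (b : ℕ → ℝ) (Y : ℝ) (hY : 0 ≤ Y)
    (hb : ∀ h ∈ s, b h ≤ Y) (hb' : ∀ h ∈ s, b h * nint (h * α) ≤ 1) :
    ∑ h ∈ s, b h ≤ 2 * Y + 8 * r.den * (1 + Real.log (2 * r.den)) := by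
  classical
  set q := r.den with hqd
  have hq0 : (0 : ℝ) < q := by exact_mod_cast r.den_pos
  have hq1 : 1 ≤ q := r.den_pos
  -- signed distance
  let x : ℕ → ℝ := fun h => h * α - round (h * α)
  have hx : ∀ h, |x h| ≤ 1 / 2 := fun h => abs_sub_round _
  let c : ℕ → ℤ := fun h => ⌊x h * (2 * q)⌋
  have hinj : Set.InjOn c s := by
    intro h hh h' hh' hc
    by_contra hne
    have hz : (h : ℤ) - h' ≠ 0 := sub_ne_zero.2 (by exact_mod_cast hne)
    have h1 := nint_lower α r hα ((h : ℤ) - h') hz (hs h hh h' hh')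
    have h2 := nint_le ((((h : ℤ) - h' : ℤ) : ℝ) * α) (round (h * α) - round (h' * α))
    have h3 : (((h : ℤ) - h' : ℤ) : ℝ) * α - ((round (h * α) - round (h' * α) : ℤ) : ℝ)
      = x h - x h' := by simp only [x]; push_cast; ring
    rw [h3] at h2
    have h4 := Int.abs_sub_lt_one_of_floor_eq_floor hc
    rw [← sub_mul, abs_mul, abs_of_pos (by positivity : (0 : ℝ) < 2 * q)] at h4
    have h5 : 1 ≤ |x h - x h'| * (2 * q) := by
      have := h1.trans h2
      rw [div_le_iff₀ (by positivity)] at this; linarith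
    linarith
  let F : ℤ → ℝ := fun k => if k = 0 ∨ k = -1 then Y else if 0 < k then 2 * q / k else 2 * q / (-k - 1)
  have hF0 : ∀ k : ℤ, 0 ≤ F k := by
    intro k; simp only [F]; split_ifs with h1 h2
    · exact hY
    · have : (0 : ℝ) < k := by exact_mod_cast h2
      positivity
    · have : (1 : ℤ) ≤ -k - 1 := by omega
      have : (1 : ℝ) ≤ -k - 1 := by exact_mod_cast this
      positivity
  have hbF : ∀ h ∈ s, b h ≤ F (c h) := by
    intro h hh
    simp only [F]; split_ifs with h1 h2
    · exact hb h hh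
    · have hk : (0 : ℝ) < c h := by exact_mod_cast h2
      have h3 : (c h : ℝ) ≤ x h * (2 * q) := Int.floor_le _
      have h4 := hb' h hh
      have h5 : nint (h * α) = |x h| := rfl
      have h6 : 0 < x h := by
        by_contra hcon; push Not at hcon; nlinarith
      rw [h5, abs_of_pos h6] at h4
      rw [le_div_iff₀ hk]
      by_cases hbn : b h ≤ 0
      · nlinarith
      · push Not at hbn; nlinarith
    · have hk' : (1 : ℤ) ≤ -c h - 1 := by omega
      have hk : (1 : ℝ) ≤ -c h - 1 := by exact_mod_cast hk'
      have h3 : x h * (2 * q) < c h + 1 := Int.lt_floor_add_one _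
      have h4 := hb' h hh
      have h5 : nint (h * α) = |x h| := rfl
      have h6 : x h < 0 := by
        by_contra hcon; push Not at hcon; nlinarith
      rw [h5, abs_of_neg h6] at h4
      rw [le_div_iff₀ (by linarith)]
      by_cases hbn : b h ≤ 0
      · nlinarith
      · push Not at hbn; nlinarith
  have hcr : ∀ h ∈ s, c h ∈ Finset.Icc (-(q : ℤ)) q := by
    intro h _
    have := abs_le.1 (hx h)
    rw [mem_Icc]; constructor
    · apply Int.le_floor.2; push_cast; nlinarith
    · have : (c h : ℝ) ≤ q := (Int.floor_le _).trans (by nlinarith)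
      exact_mod_cast this
  have hH : ∑ k ∈ Finset.Icc 1 q, (2 * q / (k : ℝ)) ≤ 2 * q * (1 + Real.log (2 * q)) := by
    have h1 := harmonic_le_one_add_log q
    rw [harmonic_eq_sum_Icc] at h1
    push_cast at h1
    have h2 : ∑ k ∈ Finset.Icc 1 q, (2 * q / (k : ℝ)) = 2 * q * ∑ k ∈ Finset.Icc 1 q, (k : ℝ)⁻¹ := by
      rw [mul_sum]; rfl
    rw [h2]
    gcongr
    refine h1.trans ?_
    gcongr
    linarith
  calc ∑ h ∈ s, b h ≤ ∑ h ∈ s, F (c h) := sum_le_sum hbF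
    _ = ∑ k ∈ s.image c, F k := (sum_image hinj).symm
    _ ≤ ∑ k ∈ ({0, -1} ∪ ((Finset.Icc 1 q).image (fun k : ℕ => (k : ℤ)) ∪
          (Finset.Icc 1 q).image (fun k : ℕ => -(k : ℤ) - 1))), F k := by
        apply sum_le_sum_of_subset_of_nonneg
        · intro k hk
          obtain ⟨h, hh, rfl⟩ := mem_image.1 hk
          have h1 := mem_Icc.1 (hcr h hh)
          simp only [mem_union, mem_insert, mem_singleton, mem_image, mem_Icc]
          rcases lt_trichotomy (c h) 0 with h2 | h2 | h2
          · by_cases h3 : c h = -1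
            · left; right; exact h3
            · right; right; exact ⟨(-c h - 1).toNat, by omega, by omega⟩
          · left; left; exact h2
          · right; left; exact ⟨(c h).toNat, by omega, by omega⟩
        · intro k _ _; exact hF0 k
    _ ≤ ∑ k ∈ ({0, -1} : Finset ℤ), F k + (∑ k ∈ (Finset.Icc 1 q).image (fun k : ℕ => (k : ℤ)), F k +
          ∑ k ∈ (Finset.Icc 1 q).image (fun k : ℕ => -(k : ℤ) - 1), F k) := by
        have hun : ∀ A B : Finset ℤ, ∑ k ∈ A ∪ B, F k ≤ ∑ k ∈ A, F k + ∑ k ∈ B, F k := by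
          intro A B
          rw [← sum_union_inter]
          have : 0 ≤ ∑ k ∈ A ∩ B, F k := sum_nonneg fun k _ => hF0 k
          linarith
        refine (hun _ _).trans ?_
        gcongr
        exact hun _ _
    _ ≤ 2 * Y + (2 * q * (1 + Real.log (2 * q)) + 2 * q * (1 + Real.log (2 * q))) := by
        gcongr
        · rw [sum_pair (by norm_num)]; simp [F]; linarith
        · rw [sum_image (by intro a _ b _ h; simpa using h)]
          refine le_trans (sum_le_sum fun k hk => ?_) hH
          have := (mem_Icc.1 hk).1
          simp only [F]
          rw [if_neg (by omega), if_pos (by omega)]; push_cast; exact le_rfl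
        · rw [sum_image (by intro a _ b _ h; simpa using h)]
          refine le_trans (sum_le_sum fun k hk => ?_) hH
          have := (mem_Icc.1 hk).1
          simp only [F]
          rw [if_neg (by omega), if_neg (by omega)]; push_cast; ring_nf; exact le_rfl
    _ ≤ _ := by
        have : 0 ≤ Real.log (2 * q) := Real.log_nonneg (by
          have : (1 : ℝ) ≤ q := by exact_mod_cast hq1
          linarith)
        nlinarith [mul_nonneg hq0.le this]

end PQ


namespace PQ
open Finset ArithmeticFunction

lemma blk_mem (q t h h' i : ℕ) (ht : t = q / 2 + 1) (h1 : h / t = i) (h2 : h' / t = i) :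
    2 * |(h : ℤ) - h'| ≤ q := by
  have ht0 : 0 < t := by omega
  have a1 : h < i * t + t := by
    have := Nat.lt_div_mul_add (a := h) ht0; rw [h1] at this; exact this
  have a2 : i * t ≤ h := by rw [← h1]; exact Nat.div_mul_le_self h t
  have a3 : h' < i * t + t := by
    have := Nat.lt_div_mul_add (a := h') ht0; rw [h2] at this; exact this
  have a4 : i * t ≤ h' := by rw [← h2]; exact Nat.div_mul_le_self h' t
  rcases abs_cases ((h : ℤ) - h') with ⟨e1, _⟩ | ⟨e1, _⟩ <;> rw [e1] <;> omega

lemma sumII (α : ℝ) (r : ℚ) (hα : |α - r| ≤ 1 / (r.den : ℝ) ^ 2) (H : ℕ) (b : ℕ → ℝ) (Y Lg : ℝ)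
    (hY : 0 ≤ Y) (hL : 1 + Real.log (2 * r.den) ≤ Lg)
    (hb : ∀ h < H, b h ≤ Y) (hb' : ∀ h < H, b h * nint (h * α) ≤ 1) :
    ∑ h ∈ range H, b h ≤ (2 * H / r.den + 1) * (2 * Y + 8 * r.den * Lg) := by
  set q := r.den with hqd
  have hq0 : (0 : ℝ) < q := by exact_mod_cast r.den_pos
  have hq1 : (1 : ℝ) ≤ q := by exact_mod_cast r.den_pos
  have hL0 : 0 ≤ Lg := by
    have : 0 ≤ Real.log (2 * q) := Real.log_nonneg (by linarith)
    linarith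
  obtain ⟨t, ht⟩ : ∃ t, t = q / 2 + 1 := ⟨_, rfl⟩
  have h1 : ∀ h ∈ range H, h / t ∈ range (H / t + 1) := by
    intro h hh; rw [mem_range] at *; exact Nat.lt_succ_of_le (Nat.div_le_div_right hh.le)
  rw [← sum_fiberwise_of_maps_to h1]
  calc _ ≤ ∑ i ∈ range (H / t + 1), (2 * Y + 8 * q * Lg) := by
        apply sum_le_sum
        intro i _
        refine (block α r hα _ ?_ b Y hY ?_ ?_).trans ?_
        · intro h hh h' hh'
          exact blk_mem q t h h' i ht (mem_filter.1 hh).2 (mem_filter.1 hh').2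
        · intro h hh; exact hb h (mem_range.1 (mem_filter.1 hh).1)
        · intro h hh; exact hb' h (mem_range.1 (mem_filter.1 hh).1)
        · gcongr
    _ = ((H / t : ℕ) + 1 : ℝ) * (2 * Y + 8 * q * Lg) := by
        rw [sum_const, card_range, nsmul_eq_mul]; push_cast; ring
    _ ≤ _ := by
        gcongr
        refine Nat.cast_div_le.trans ?_
        have : (q : ℝ) ≤ 2 * t := by
          have : q ≤ 2 * t := by omega
          exact_mod_cast this
        have ht0 : (0 : ℝ) < t := by
          have : 0 < t := by omega
          exact_mod_cast this
        rw [div_le_div_iff₀ ht0 hq0]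
        nlinarith [(Nat.cast_nonneg H : (0 : ℝ) ≤ H)]

lemma sumI (α : ℝ) (r : ℚ) (hα : |α - r| ≤ 1 / (r.den : ℝ) ^ 2) (M : ℕ) (b : ℕ → ℝ) (X Lg : ℝ)
    (hX : 0 ≤ X) (hL : 1 + Real.log (2 * r.den) ≤ Lg) (hM : 1 + Real.log M ≤ Lg)
    (hb : ∀ m ∈ Icc 1 M, b m ≤ X / m) (hb' : ∀ m ∈ Icc 1 M, b m * nint (m * α) ≤ 1) :
    ∑ m ∈ Icc 1 M, b m ≤ 16 * (X / r.den + M + r.den) * Lg := by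
  set q := r.den with hqd
  have hq0 : (0 : ℝ) < q := by exact_mod_cast r.den_pos
  have hq1 : (1 : ℝ) ≤ q := by exact_mod_cast r.den_pos
  have hq1' : 1 ≤ q := r.den_pos
  have hL0 : 1 ≤ Lg := by
    have : 0 ≤ Real.log (2 * q) := Real.log_nonneg (by linarith)
    linarith
  obtain ⟨t, ht⟩ : ∃ t, t = q / 2 + 1 := ⟨_, rfl⟩
  have ht0' : 0 < t := by omega
  have ht0 : (0 : ℝ) < t := by exact_mod_cast ht0'
  have ht1 : (1 : ℝ) ≤ t := by exact_mod_cast ht0'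
  have hqt : (q : ℝ) ≤ 2 * t := by
    have : q ≤ 2 * t := by omega
    exact_mod_cast this
  have htq : (t : ℝ) ≤ q := by
    have : t ≤ q := by omega
    exact_mod_cast this
  have h1 : ∀ h ∈ Icc 1 M, h / t ∈ range (M / t + 1) := by
    intro h hh; rw [mem_range]; exact Nat.lt_succ_of_le (Nat.div_le_div_right (mem_Icc.1 hh).2)
  rw [← sum_fiberwise_of_maps_to h1]
  set Z : ℝ := 8 * q * Lg with hZ
  have hblk : ∀ i, ∀ h ∈ (Icc 1 M).filter (fun h => h / t = i),
      ∀ h' ∈ (Icc 1 M).filter (fun h => h / t = i), 2 * |(h : ℤ) - h'| ≤ q := by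
    intro i h hh h' hh'
    exact blk_mem q t h h' i ht (mem_filter.1 hh).2 (mem_filter.1 hh').2
  rw [sum_range_succ']
  have hfirst : ∑ h ∈ (Icc 1 M).filter (fun h => h / t = 0), b h ≤ 4 * q + Z := by
    refine (block α r hα _ (hblk 0) b (2 * q) (by positivity) ?_ ?_).trans ?_
    · intro h hh
      obtain ⟨h2, h3⟩ := mem_filter.1 hh
      have h4 : h < t := by
        rcases (Nat.div_eq_zero_iff).1 h3 with h | h
        · omega
        · exact h
      have h5 := nint_lower α r hα h (by have := (mem_Icc.1 h2).1; omega) (by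
        rw [abs_of_nonneg (by omega)]; omega)
      have h6 := hb' h h2
      have h7 : ((h : ℤ) : ℝ) = h := by simp
      rw [h7] at h5
      by_contra hcon
      push Not at hcon
      have h8 : 1 ≤ 2 * q * nint (h * α) := by
        rw [div_le_iff₀ (by positivity)] at h5; linarith
      have h9 : 0 < nint (h * α) := lt_of_lt_of_le (by positivity) h5
      nlinarith
    · intro h hh; exact hb' h (mem_filter.1 hh).1
    · have : 8 * q * (1 + Real.log (2 * q)) ≤ Z := by rw [hZ]; gcongr
      linarith
  have hrest : ∑ i ∈ range (M / t), ∑ h ∈ (Icc 1 M).filter (fun h => h / t = i + 1), b h ≤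
      ∑ i ∈ range (M / t), (4 * (X / q) * ((i : ℝ) + 1)⁻¹ + Z) := by
    apply sum_le_sum
    intro i _
    refine (block α r hα _ (hblk (i + 1)) b (2 * (X / q) * ((i : ℝ) + 1)⁻¹) (by positivity) ?_ ?_).trans ?_
    · intro h hh
      obtain ⟨h2, h3⟩ := mem_filter.1 hh
      refine (hb h h2).trans ?_
      have h4 : (i + 1) * t ≤ h := by rw [← h3]; exact Nat.div_mul_le_self h t
      have h4' : ((i : ℝ) + 1) * t ≤ h := by exact_mod_cast h4
      have h5 : 2 * (X / q) * ((i : ℝ) + 1)⁻¹ = X / (((i : ℝ) + 1) * (q / 2)) := by field_simp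
      rw [h5]
      gcongr
      refine le_trans ?_ h4'
      gcongr; linarith
    · intro h hh; exact hb' h (mem_filter.1 hh).1
    · have : 8 * q * (1 + Real.log (2 * q)) ≤ Z := by rw [hZ]; gcongr
      linarith
  have hharm : ∑ i ∈ range (M / t), ((i : ℝ) + 1)⁻¹ ≤ Lg := by
    have h2 := harmonic_le_one_add_log (M / t)
    unfold harmonic at h2
    push_cast at h2
    refine h2.trans (le_trans ?_ hM)
    by_cases hz : M / t = 0
    · rw [hz]; simp
      by_cases hM0 : M = 0
      · simp [hM0]
      · exact Real.log_nonneg (by exact_mod_cast Nat.one_le_iff_ne_zero.2 hM0)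
    · gcongr
      exact Nat.div_le_self M t
  rw [sum_add_distrib, ← mul_sum, sum_const, card_range, nsmul_eq_mul] at hrest
  have hMt : ((M / t : ℕ) : ℝ) * q ≤ 2 * M := by
    have : ((M / t : ℕ) : ℝ) * t ≤ M := by exact_mod_cast Nat.div_mul_le_self M t
    nlinarith [(Nat.cast_nonneg (M / t) : (0 : ℝ) ≤ (M / t : ℕ))]
  have h3 : 4 * (X / q) * ∑ i ∈ range (M / t), ((i : ℝ) + 1)⁻¹ ≤ 4 * (X / q) * Lg := by gcongr
  have h4 : ((M / t : ℕ) : ℝ) * Z ≤ 16 * M * Lg := by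
    rw [hZ]; nlinarith
  have h5 : 0 ≤ X / q * Lg := by positivity
  have h6 : (4 : ℝ) * q ≤ 4 * q * Lg := by nlinarith
  have h7 : (16 * (X / q + M + q) * Lg) = 16 * (X / q * Lg) + 16 * M * Lg + 16 * q * Lg := by ring
  rw [h7]
  have h8 : 0 ≤ (q : ℝ) * Lg := by positivity
  linarith

lemma conv_sum (f g : ArithmeticFunction ℝ) (N : ℕ) (F : ℕ → ℂ) (hF : ∀ n, N < n → F n = 0) :
    ∑ n ∈ Icc 1 N, ((f * g) n : ℂ) * F n
      = ∑ m ∈ Icc 1 N, ∑ l ∈ Icc 1 N, (f m : ℂ) * (g l : ℂ) * F (m * l) := by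
  classical
  have h1 : ∑ m ∈ Icc 1 N, ∑ l ∈ Icc 1 N, (f m : ℂ) * (g l : ℂ) * F (m * l)
    = ∑ p ∈ (Icc 1 N ×ˢ Icc 1 N).filter (fun p => p.1 * p.2 ∈ Icc 1 N),
        (f p.1 : ℂ) * (g p.2 : ℂ) * F (p.1 * p.2) := by
    rw [← sum_product', sum_filter]
    apply sum_congr rfl
    intro p hp
    split_ifs with h
    · rfl
    · have hp' := mem_product.1 hp
      have h2 := (mem_Icc.1 hp'.1).1
      have h3 := (mem_Icc.1 hp'.2).1
      have h4 : 1 ≤ p.1 * p.2 := Nat.one_le_iff_ne_zero.2 (by positivity)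
      rw [hF, mul_zero]
      by_contra hcon
      exact h (mem_Icc.2 ⟨h4, by omega⟩)
  rw [h1, ← sum_fiberwise_of_maps_to (g := fun p : ℕ × ℕ => p.1 * p.2) (t := Icc 1 N)
    (fun p hp => (mem_filter.1 hp).2)]
  apply sum_congr rfl
  intro n hn
  have hn' := mem_Icc.1 hn
  rw [ArithmeticFunction.mul_apply]
  push_cast
  rw [sum_mul]
  apply sum_congr_of_eq_on_inter
  · intro p hp hp'
    exfalso; apply hp'
    obtain ⟨h2, h3⟩ := Nat.mem_divisorsAntidiagonal.1 hp
    have h4 : p.1 ≠ 0 := by rintro h; simp [h] at h2; omega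
    have h5 : p.2 ≠ 0 := by rintro h; simp [h] at h2; omega
    have h6 : p.1 ≤ n := by rw [← h2]; exact Nat.le_mul_of_pos_right _ (Nat.pos_of_ne_zero h5)
    have h7 : p.2 ≤ n := by rw [← h2]; exact Nat.le_mul_of_pos_left _ (Nat.pos_of_ne_zero h4)
    simp only [mem_filter, mem_product, mem_Icc]
    omega
  · intro p hp hp'
    exfalso; apply hp'
    have := (mem_filter.1 hp).2
    exact Nat.mem_divisorsAntidiagonal.2 ⟨this, by omega⟩
  · intro p hp _
    rw [(Nat.mem_divisorsAntidiagonal.1 hp).1]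

/-- truncations -/
def trunc (f : ArithmeticFunction ℝ) (U : ℕ) : ArithmeticFunction ℝ :=
  ⟨fun n => if n ≤ U then f n else 0, by simp⟩

def tail (f : ArithmeticFunction ℝ) (U : ℕ) : ArithmeticFunction ℝ :=
  ⟨fun n => if n ≤ U then 0 else f n, by simp⟩

lemma trunc_apply (f : ArithmeticFunction ℝ) (U n : ℕ) :
    trunc f U n = if n ≤ U then f n else 0 := rfl

lemma tail_apply (f : ArithmeticFunction ℝ) (U n : ℕ) :
    tail f U n = if n ≤ U then 0 else f n := rfl

lemma trunc_add_tail (f : ArithmeticFunction ℝ) (U : ℕ) : trunc f U + tail f U = f := by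
  ext n; rw [ArithmeticFunction.add_apply, trunc_apply, tail_apply]; split_ifs <;> simp

lemma vaughan (U : ℕ) :
    (vonMangoldt : ArithmeticFunction ℝ) = trunc vonMangoldt U
      + trunc ((moebius : ArithmeticFunction ℤ) : ArithmeticFunction ℝ) U * log
      - (trunc ((moebius : ArithmeticFunction ℤ) : ArithmeticFunction ℝ) U * trunc vonMangoldt U) * (zeta : ArithmeticFunction ℝ)
      + tail ((moebius : ArithmeticFunction ℤ) : ArithmeticFunction ℝ) U * (tail vonMangoldt U * (zeta : ArithmeticFunction ℝ)) := by
  have h1 := trunc_add_tail vonMangoldt U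
  have h2 := trunc_add_tail ((moebius : ArithmeticFunction ℤ) : ArithmeticFunction ℝ) U
  have h3 : (vonMangoldt : ArithmeticFunction ℝ) * (zeta : ArithmeticFunction ℝ) = log := vonMangoldt_mul_zeta
  have h4 : ((moebius : ArithmeticFunction ℤ) : ArithmeticFunction ℝ) * (zeta : ArithmeticFunction ℝ) = 1 :=
    coe_moebius_mul_coe_zeta
  set m1 := trunc ((moebius : ArithmeticFunction ℤ) : ArithmeticFunction ℝ) U
  set m2 := tail ((moebius : ArithmeticFunction ℤ) : ArithmeticFunction ℝ) U
  set l1 := trunc vonMangoldt U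
  set l2 := tail vonMangoldt U
  rw [← h3]
  have e2 : m2 = ((moebius : ArithmeticFunction ℤ) : ArithmeticFunction ℝ) - m1 := by rw [← h2]; ring
  have e1 : l1 = vonMangoldt - l2 := by rw [← h1]; ring
  rw [e2, e1]
  linear_combination (-l2) * h4

end PQ


namespace PQ
open Finset ArithmeticFunction

/-- admissible weights -/
structure Wt (w : ℕ → ℝ) (U N : ℕ) : Prop where
  nn : ∀ n, 0 ≤ w n
  le1 : ∀ n, w n ≤ 1
  small : ∀ n ≤ U, w n = 0
  large : ∀ n, N < n → w n = 0
  tv : ∀ k M, 1 ≤ k → TV (fun m => w (m * k)) M ≤ 2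

lemma sum_range_Icc (N : ℕ) (f : ℕ → ℂ) (h0 : f 0 = 0) :
    ∑ l ∈ range (N + 1), f l = ∑ l ∈ Icc 1 N, f l := by
  rw [sum_range_succ', h0, add_zero]
  rw [range_eq_Ico, sum_Ico_add' f 0 N 1]
  rfl

lemma inner_bd (v : ℕ → ℝ) (N m : ℕ) (hm : 1 ≤ m) (α V T : ℝ) (h0 : v 0 = 0) (hV : ∀ l, |v l| ≤ V)
    (hV0 : ∀ l, N < m * l → v l = 0) (hT : TV v (N + 1) ≤ 4 * T) :
    ‖∑ l ∈ Icc 1 N, (v l : ℂ) * e (l * (m * α))‖ ≤ V * (N / m) ∧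
    ‖∑ l ∈ Icc 1 N, (v l : ℂ) * e (l * (m * α))‖ * nint (m * α) ≤ T := by
  have hVn : 0 ≤ V := (abs_nonneg _).trans (hV 0)
  constructor
  · have h1 : ∑ l ∈ Icc 1 N, (v l : ℂ) * e (l * (m * α))
        = ∑ l ∈ Icc 1 (N / m), (v l : ℂ) * e (l * (m * α)) := by
      symm
      apply sum_subset
      · exact Icc_subset_Icc le_rfl (Nat.div_le_self N m)
      · intro l hl hl'
        rw [hV0 l, Complex.ofReal_zero, zero_mul]
        by_contra hcon
        push Not at hcon
        apply hl'
        refine mem_Icc.2 ⟨(mem_Icc.1 hl).1, ?_⟩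
        rw [Nat.le_div_iff_mul_le (by omega)]; linarith
    rw [h1]
    refine (norm_sum_le _ _).trans ?_
    calc _ ≤ ∑ l ∈ Icc 1 (N / m), V := by
          apply sum_le_sum
          intro l _
          rw [norm_mul, norm_e, mul_one, Complex.norm_real]; exact hV l
      _ = V * ((N / m : ℕ) : ℝ) := by
          rw [sum_const, Nat.card_Icc, nsmul_eq_mul]; simp [mul_comm]
      _ ≤ _ := by gcongr; exact Nat.cast_div_le
  · have h1 := bv_sum v (N + 1) (hV0 _ (by nlinarith)) (m * α)
    rw [sum_range_Icc N _ (by rw [h0]; simp)] at h1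
    linarith

lemma Wt.tv' {w : ℕ → ℝ} {U N : ℕ} (hw : Wt w U N) (k M : ℕ) (hk : 1 ≤ k) :
    TV (fun m => w (k * m)) M ≤ 2 := by
  have := hw.tv k M hk
  simpa only [mul_comm] using this

lemma log_mono_nat : Monotone (fun n : ℕ => Real.log n) := by
  intro a b hab
  rcases Nat.eq_zero_or_pos a with h | h
  · subst h; simp only [Nat.cast_zero, Real.log_zero]; exact Real.log_natCast_nonneg b
  · exact Real.log_le_log (by exact_mod_cast h) (by exact_mod_cast hab)

lemma bound_Ia (w : ℕ → ℝ) (U N : ℕ) (hw : Wt w U N) (α : ℝ) (r : ℚ)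
    (hα : |α - r| ≤ 1 / (r.den : ℝ) ^ 2) (Lg : ℝ) (hN : 1 ≤ N) (hL : 1 + Real.log (2 * N) ≤ Lg)
    (hq : r.den ≤ N) (hU : 1 ≤ U) (hUN : U ≤ N) (c : ℕ → ℝ) (hc : ∀ m, |c m| ≤ 1) (hc0 : ∀ m, U < m → c m = 0) :
    ‖∑ m ∈ Icc 1 N, ∑ l ∈ Icc 1 N, (c m : ℂ) * (Real.log l : ℂ) * ((w (m * l) : ℂ) * e ((m * l : ℕ) * α))‖
     ≤ Lg * (16 * (N / r.den + U + r.den) * Lg) := by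
  have hN' : (1 : ℝ) ≤ N := by exact_mod_cast hN
  have hlog2N : 0 ≤ Real.log (2 * N) := Real.log_nonneg (by linarith)
  have hL1 : 1 ≤ Lg := by linarith
  set I : ℕ → ℂ := fun m => ∑ l ∈ Icc 1 N, ((Real.log l * w (m * l) : ℝ) : ℂ) * e (l * (m * α)) with hI
  have h0 : ∑ m ∈ Icc 1 N, ∑ l ∈ Icc 1 N, (c m : ℂ) * (Real.log l : ℂ) * ((w (m * l) : ℂ) * e ((m * l : ℕ) * α))
      = ∑ m ∈ Icc 1 N, (c m : ℂ) * I m := by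
    apply sum_congr rfl; intro m _
    rw [hI]; simp only; rw [mul_sum]
    apply sum_congr rfl; intro l _
    push_cast
    rw [show (m : ℝ) * l * α = l * (m * α) by ring]; ring
  have h1 : ∑ m ∈ Icc 1 N, (c m : ℂ) * I m = ∑ m ∈ Icc 1 U, (c m : ℂ) * I m := by
    symm
    apply sum_subset (Icc_subset_Icc le_rfl hUN)
    intro m hm hm'
    rw [hc0, Complex.ofReal_zero, zero_mul]
    by_contra hcon; push Not at hcon
    exact hm' (mem_Icc.2 ⟨(mem_Icc.1 hm).1, hcon⟩)
  have hbd : ∀ m ∈ Icc 1 U, ‖I m‖ ≤ Lg * (N / m) ∧ ‖I m‖ * nint (m * α) ≤ Lg := by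
    intro m hm
    have hm1 := (mem_Icc.1 hm).1
    have hlog : ∀ n ≤ N + 1, |Real.log ((n : ℕ) : ℝ)| ≤ Lg := by
      intro n hn
      rw [abs_of_nonneg (Real.log_natCast_nonneg n)]
      have h2 : Real.log n ≤ Real.log ((N + 1 : ℕ) : ℝ) := log_mono_nat hn
      have h3 : Real.log ((N + 1 : ℕ) : ℝ) ≤ Real.log (2 * N) :=
        Real.log_le_log (by positivity) (by push_cast; linarith)
      linarith
    apply inner_bd _ N m hm1 α Lg Lg
    · simp
    · intro l
      rw [abs_mul, abs_of_nonneg (hw.nn _)]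
      by_cases hl : l ≤ N
      · have := hlog l (by omega)
        have h5 := hw.le1 (m * l)
        have h6 := hw.nn (m * l)
        nlinarith [abs_nonneg (Real.log l)]
      · rw [hw.large (m * l) (by nlinarith)]; simp; linarith
    · intro l hl; rw [hw.large _ hl, mul_zero]
    · refine (TV_mul (fun l => Real.log l) (fun l => w (m * l)) (N + 1) Lg 1 hlog ?_).trans ?_
      · intro n _; rw [abs_of_nonneg (hw.nn _)]; exact hw.le1 _
      · have h2 := hw.tv' m (N + 1) hm1
        have h3 := TV_mono (fun l : ℕ => Real.log l) (N + 1) log_mono_nat (by simp)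
        have h4 := hlog (N + 1) le_rfl
        rw [h3]
        have := le_abs_self (Real.log ((N + 1 : ℕ) : ℝ))
        nlinarith
  rw [h0, h1]
  have hs := sumI α r hα U (fun m => ‖I m‖ / Lg) N Lg (by positivity) ?_ ?_ ?_ ?_
  · rw [← sum_div, div_le_iff₀ (by linarith)] at hs
    refine (norm_sum_le _ _).trans ?_
    refine (sum_le_sum (g := fun m => ‖I m‖) ?_).trans (by linarith)
    intro m _
    rw [norm_mul, Complex.norm_real]
    have := hc m
    rw [Real.norm_eq_abs]
    nlinarith [norm_nonneg (I m)]
  · refine le_trans ?_ hL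
    gcongr
  · refine le_trans ?_ hL
    have : (U : ℝ) ≤ N := by exact_mod_cast hUN
    gcongr
    linarith
  · intro m hm
    rw [div_le_iff₀ (by linarith)]; linarith [(hbd m hm).1]
  · intro m hm
    rw [div_mul_eq_mul_div, div_le_iff₀ (by linarith)]; linarith [(hbd m hm).2]

lemma bound_Ib (w : ℕ → ℝ) (U N M : ℕ) (hw : Wt w U N) (α : ℝ) (r : ℚ)
    (hα : |α - r| ≤ 1 / (r.den : ℝ) ^ 2) (Lg : ℝ) (hN : 1 ≤ N) (hL : 1 + Real.log (2 * N) ≤ Lg)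
    (hq : r.den ≤ N) (hM : 1 ≤ M) (hMN : M ≤ N) (c : ℕ → ℝ) (hc : ∀ m, |c m| ≤ Real.log m)
    (hc0 : ∀ m, M < m → c m = 0) :
    ‖∑ m ∈ Icc 1 N, ∑ l ∈ Icc 1 N, (c m : ℂ) * (1 : ℂ) * ((w (m * l) : ℂ) * e ((m * l : ℕ) * α))‖
     ≤ Lg * (16 * (N / r.den + M + r.den) * Lg) := by
  have hN' : (1 : ℝ) ≤ N := by exact_mod_cast hN
  have hlog2N : 0 ≤ Real.log (2 * N) := Real.log_nonneg (by linarith)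
  have hL1 : 1 ≤ Lg := by linarith
  set I : ℕ → ℂ := fun m => ∑ l ∈ Icc 1 N, ((w (m * l) : ℝ) : ℂ) * e (l * (m * α)) with hI
  have h0 : ∑ m ∈ Icc 1 N, ∑ l ∈ Icc 1 N, (c m : ℂ) * (1 : ℂ) * ((w (m * l) : ℂ) * e ((m * l : ℕ) * α))
      = ∑ m ∈ Icc 1 N, (c m : ℂ) * I m := by
    apply sum_congr rfl; intro m _
    rw [hI]; simp only; rw [mul_sum]
    apply sum_congr rfl; intro l _
    push_cast
    rw [show (m : ℝ) * l * α = l * (m * α) by ring]; ring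
  have h1 : ∑ m ∈ Icc 1 N, (c m : ℂ) * I m = ∑ m ∈ Icc 1 M, (c m : ℂ) * I m := by
    symm
    apply sum_subset (Icc_subset_Icc le_rfl hMN)
    intro m hm hm'
    rw [hc0, Complex.ofReal_zero, zero_mul]
    by_contra hcon; push Not at hcon
    exact hm' (mem_Icc.2 ⟨(mem_Icc.1 hm).1, hcon⟩)
  have hbd : ∀ m ∈ Icc 1 M, ‖I m‖ ≤ 1 * (N / m) ∧ ‖I m‖ * nint (m * α) ≤ 1 := by
    intro m hm
    have hm1 := (mem_Icc.1 hm).1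
    apply inner_bd _ N m hm1 α 1 1
    · rw [mul_zero]; exact hw.small 0 (by omega)
    · intro l
      rw [abs_of_nonneg (hw.nn _)]; exact hw.le1 _
    · intro l hl; exact hw.large _ hl
    · have h2 := hw.tv' m (N + 1) hm1
      linarith
  rw [h0, h1]
  have hMl : (M : ℝ) ≤ N := by exact_mod_cast hMN
  have hM1 : (1 : ℝ) ≤ M := by exact_mod_cast hM
  have hlM : 1 + Real.log M ≤ Lg := by
    refine le_trans ?_ hL
    gcongr
    linarith
  have hs := sumI α r hα M (fun m => ‖I m‖) N Lg (by positivity) ?_ hlM ?_ ?_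
  · refine (norm_sum_le _ _).trans ?_
    refine (sum_le_sum (g := fun m => Lg * ‖I m‖) ?_).trans ?_
    · intro m hm
      rw [norm_mul, Complex.norm_real, Real.norm_eq_abs]
      have := hc m
      have h3 : Real.log m ≤ Real.log M := log_mono_nat (mem_Icc.1 hm).2
      gcongr
      linarith
    · rw [← mul_sum]; gcongr
  · refine le_trans ?_ hL
    gcongr
  · intro m hm
    linarith [(hbd m hm).1]
  · intro m hm
    exact (hbd m hm).2

lemma tail_zeta_bd (U k : ℕ) : 0 ≤ (tail vonMangoldt U * (zeta : ArithmeticFunction ℝ)) k ∧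
    (tail vonMangoldt U * (zeta : ArithmeticFunction ℝ)) k ≤ Real.log k ∧
    (k ≤ U → (tail vonMangoldt U * (zeta : ArithmeticFunction ℝ)) k = 0) := by
  rw [coe_mul_zeta_apply]
  refine ⟨?_, ?_, ?_⟩
  · apply sum_nonneg; intro i _; rw [tail_apply]; split_ifs
    · exact le_rfl
    · exact vonMangoldt_nonneg
  · rw [← vonMangoldt_sum]
    apply sum_le_sum; intro i _; rw [tail_apply]; split_ifs
    · exact vonMangoldt_nonneg
    · exact le_rfl
  · intro hk
    apply sum_eq_zero; intro i hi; rw [tail_apply, if_pos]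
    exact (Nat.divisor_le hi).trans hk

lemma mu_lam_bd (U m : ℕ) :
    |(trunc ((moebius : ArithmeticFunction ℤ) : ArithmeticFunction ℝ) U * trunc vonMangoldt U) m| ≤ Real.log m
    ∧ (U ^ 2 < m → (trunc ((moebius : ArithmeticFunction ℤ) : ArithmeticFunction ℝ) U * trunc vonMangoldt U) m = 0) := by
  rw [mul_apply]
  constructor
  · refine (abs_sum_le_sum_abs _ _).trans ?_
    rw [← vonMangoldt_sum, Nat.sum_divisorsAntidiagonal' (f := fun a b => |trunc ((moebius : ArithmeticFunction ℤ) : ArithmeticFunction ℝ) U a * trunc vonMangoldt U b|)]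
    apply sum_le_sum
    intro i _
    rw [abs_mul]
    have h1 : |trunc ((moebius : ArithmeticFunction ℤ) : ArithmeticFunction ℝ) U (m / i)| ≤ 1 := by
      rw [trunc_apply]; split_ifs
      · rw [intCoe_apply]
        have := abs_moebius_le_one (n := m / i)
        exact_mod_cast this
      · simp
    have h2 : |trunc vonMangoldt U i| ≤ vonMangoldt i := by
      rw [trunc_apply]; split_ifs
      · rw [abs_of_nonneg vonMangoldt_nonneg]
      · simp
    calc _ ≤ 1 * vonMangoldt i := by gcongr
      _ = _ := one_mul _
  · intro hm
    apply sum_eq_zero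
    intro p hp
    have hp1 := (Nat.mem_divisorsAntidiagonal.1 hp).1
    rw [trunc_apply, trunc_apply]
    by_cases h1 : p.1 ≤ U
    · have h2 : ¬ p.2 ≤ U := by
        intro h2
        have : p.1 * p.2 ≤ U * U := Nat.mul_le_mul h1 h2
        nlinarith
      rw [if_neg h2, mul_zero]
    · rw [if_neg h1, zero_mul]

lemma inner_II (w : ℕ → ℝ) (U N : ℕ) (hw : Wt w U N) (α : ℝ) (k k' : ℕ) (hk : 1 ≤ k') (hkk : k' ≤ k) :
    ‖∑ m ∈ Icc 1 N, ((m * w (m * k) * w (m * k') : ℝ) : ℂ) * e (m * ((k - k' : ℕ) * α))‖ ≤ (N / k : ℝ) ^ 2 ∧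
    ‖∑ m ∈ Icc 1 N, ((m * w (m * k) * w (m * k') : ℝ) : ℂ) * e (m * ((k - k' : ℕ) * α))‖ *
      nint ((k - k' : ℕ) * α) ≤ 2 * (N / k) := by
  have hk1 : 1 ≤ k := by omega
  have hk0 : (0 : ℝ) < k := by exact_mod_cast hk1
  set v : ℕ → ℝ := fun m => (m : ℝ) * w (m * k) * w (m * k') with hv
  have hmk : ∀ m : ℕ, w (m * k) ≠ 0 → (m : ℝ) ≤ N / k := by
    intro m hm
    rw [le_div_iff₀ hk0]
    by_contra hcon
    push Not at hcon
    exact hm (hw.large _ (by exact_mod_cast hcon))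
  have hv0 : ∀ m, N < m * k → v m = 0 := by
    intro m hm; simp only [hv]; rw [hw.large _ hm]; ring
  have hvb : ∀ m, |v m| ≤ N / k := by
    intro m
    simp only [hv]
    by_cases h : w (m * k) = 0
    · rw [h]; simp; positivity
    · have h1 := hmk m h
      rw [abs_of_nonneg (mul_nonneg (mul_nonneg (Nat.cast_nonneg _) (hw.nn _)) (hw.nn _))]
      calc _ ≤ (m : ℝ) * 1 * 1 := by
            have := hw.nn (m * k); have := hw.nn (m * k'); have := hw.le1 (m * k); have := hw.le1 (m * k')
            gcongr
        _ ≤ _ := by linarith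
  constructor
  · have h1 : ∑ m ∈ Icc 1 N, ((v m : ℝ) : ℂ) * e (m * ((k - k' : ℕ) * α))
        = ∑ m ∈ Icc 1 (N / k), ((v m : ℝ) : ℂ) * e (m * ((k - k' : ℕ) * α)) := by
      symm
      apply sum_subset
      · exact Icc_subset_Icc le_rfl (Nat.div_le_self N k)
      · intro l hl hl'
        rw [hv0 l, Complex.ofReal_zero, zero_mul]
        by_contra hcon
        push Not at hcon
        apply hl'
        refine mem_Icc.2 ⟨(mem_Icc.1 hl).1, ?_⟩
        rw [Nat.le_div_iff_mul_le (by omega)]; linarith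
    rw [h1]
    refine (norm_sum_le _ _).trans ?_
    calc _ ≤ ∑ l ∈ Icc 1 (N / k), (N / k : ℝ) := by
          apply sum_le_sum
          intro l _
          rw [norm_mul, norm_e, mul_one, Complex.norm_real]; exact hvb l
      _ = ((N / k : ℕ) : ℝ) * (N / k : ℝ) := by
          rw [sum_const, Nat.card_Icc, nsmul_eq_mul]; simp
      _ ≤ _ := by
          rw [sq]; gcongr; exact Nat.cast_div_le
  · have h1 := bv_sum v (N + 1) (hv0 _ (by nlinarith)) ((k - k' : ℕ) * α)
    rw [sum_range_Icc N _ (by simp [hv])] at h1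
    have h2 : v = fun m : ℕ => (min (m : ℝ) (N / k)) * (w (m * k) * w (m * k')) := by
      ext m
      simp only [hv]
      by_cases h : w (m * k) = 0
      · rw [h]; ring
      · rw [min_eq_left (hmk m h)]; ring
    have h3 : TV v (N + 1) ≤ (N / k) * TV (fun m : ℕ => w (m * k) * w (m * k')) (N + 1)
        + 1 * TV (fun m : ℕ => min (m : ℝ) (N / k)) (N + 1) := by
      rw [h2]
      apply TV_mul
      · intro n _
        rw [abs_of_nonneg (by positivity)]; exact min_le_right _ _
      · intro n _
        rw [abs_of_nonneg (mul_nonneg (hw.nn _) (hw.nn _))]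
        exact mul_le_one₀ (hw.le1 _) (hw.nn _) (hw.le1 _)
    have h4 : TV (fun m : ℕ => min (m : ℝ) (N / k)) (N + 1) ≤ N / k := by
      rw [TV_mono]
      · exact min_le_right _ _
      · intro a b hab
        have : (a : ℝ) ≤ b := by exact_mod_cast hab
        exact min_le_min_right _ this
      · positivity
    have h5 : TV (fun m => w (m * k) * w (m * k')) (N + 1) ≤ 1 * 2 + 1 * 2 := by
      refine (TV_mul (fun m => w (m * k)) (fun m => w (m * k')) (N + 1) 1 1 ?_ ?_).trans ?_
      · intro n _; rw [abs_of_nonneg (hw.nn _)]; exact hw.le1 _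
      · intro n _; rw [abs_of_nonneg (hw.nn _)]; exact hw.le1 _
      · have := hw.tv k (N + 1) hk1
        have := hw.tv k' (N + 1) hk
        linarith
    have h6 : 0 ≤ (N / k : ℝ) := by positivity
    nlinarith

lemma sum_II_k (w : ℕ → ℝ) (U N : ℕ) (hw : Wt w U N) (α : ℝ) (r : ℚ)
    (hα : |α - r| ≤ 1 / (r.den : ℝ) ^ 2) (Lg : ℝ) (hN : 1 ≤ N) (hL : 1 + Real.log (2 * r.den) ≤ Lg)
    (k : ℕ) (hk : 1 ≤ k) :
    ∑ k' ∈ Icc 1 k, ‖∑ m ∈ Icc 1 N, ((m * w (m * k) * w (m * k') : ℝ) : ℂ) * e (m * ((k - k' : ℕ) * α))‖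
      ≤ 8 * N ^ 2 / (r.den * k) + 32 * N * Lg + 4 * N ^ 2 / k ^ 2 + 16 * N * r.den * Lg / k := by
  have hk0 : (0 : ℝ) < k := by exact_mod_cast hk
  have hN0 : (0 : ℝ) < N := by exact_mod_cast hN
  have hq0 : (0 : ℝ) < r.den := by exact_mod_cast r.den_pos
  set G : ℕ → ℝ := fun k' => ‖∑ m ∈ Icc 1 N, ((m * w (m * k) * w (m * k') : ℝ) : ℂ) * e (m * ((k - k' : ℕ) * α))‖ with hG
  have h1 : ∑ k' ∈ Icc 1 k, G k' = ∑ h ∈ range k, G (k - h) := by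
    rw [range_eq_Ico]
    have := Finset.sum_Ico_reflect G 0 (m := k) (n := k) (by omega)
    rw [this]
    apply sum_congr _ (fun _ _ => rfl)
    ext x; simp only [mem_Icc, mem_Ico]; omega
  rw [h1]
  have h2 := sumII α r hα k (fun h => G (k - h) / (2 * (N / k))) (N / k) Lg (by positivity) hL ?_ ?_
  · rw [← sum_div, div_le_iff₀ (by positivity)] at h2
    refine h2.trans (le_of_eq ?_)
    field_simp
    ring
  · intro h hh
    rw [div_le_iff₀ (by positivity)]
    have h3 := (inner_II w U N hw α k (k - h) (by omega) (by omega)).1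
    have : 0 ≤ (N / k : ℝ) ^ 2 := by positivity
    simp only [hG]
    nlinarith
  · intro h hh
    have h3 := (inner_II w U N hw α k (k - h) (by omega) (by omega)).2
    rw [show k - (k - h) = h by omega] at h3
    rw [div_mul_eq_mul_div, div_le_iff₀ (by positivity), one_mul]
    simp only [hG]
    rw [show k - (k - h) = h by omega]
    exact h3

end PQ


namespace PQ
open Finset ArithmeticFunction

lemma sum_sym (K : Finset ℕ) (J : ℕ → ℕ → ℝ) (h0 : ∀ k k', 0 ≤ J k k') (hs : ∀ k k', J k k' = J k' k)
    (hK : ∀ k ∈ K, 1 ≤ k) :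
    ∑ k ∈ K, ∑ k' ∈ K, J k k' ≤ 2 * ∑ k ∈ K, ∑ k' ∈ Icc 1 k, J k k' := by
  have h1 : ∑ k ∈ K, ∑ k' ∈ K, J k k' ≤ ∑ k ∈ K, ∑ k' ∈ K, ((if k' ≤ k then J k k' else 0) +
      (if k ≤ k' then J k' k else 0)) := by
    apply sum_le_sum; intro k _
    apply sum_le_sum; intro k' _
    have := h0 k k'
    have := h0 k' k
    rcases le_total k' k with h | h
    · rw [if_pos h]; split_ifs <;> linarith
    · rw [if_pos h, hs k k']; split_ifs <;> linarith
  have h2 : ∑ k ∈ K, ∑ k' ∈ K, (if k ≤ k' then J k' k else 0) = ∑ k ∈ K, ∑ k' ∈ K, (if k' ≤ k then J k k' else 0) := by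
    rw [sum_comm]
  simp_rw [sum_add_distrib] at h1
  rw [h2] at h1
  have h3 : ∑ k ∈ K, ∑ k' ∈ K, (if k' ≤ k then J k k' else 0) ≤ ∑ k ∈ K, ∑ k' ∈ Icc 1 k, J k k' := by
    apply sum_le_sum; intro k _
    rw [← sum_filter]
    apply sum_le_sum_of_subset_of_nonneg
    · intro x hx
      rw [mem_filter] at hx
      exact mem_Icc.2 ⟨hK x hx.1, hx.2⟩
    · intro i _ _; exact h0 _ _
  linarith

lemma sum_m_T (w : ℕ → ℝ) (U N : ℕ) (hw : Wt w U N) (α : ℝ) (r : ℚ)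
    (hα : |α - r| ≤ 1 / (r.den : ℝ) ^ 2) (Lg : ℝ) (hN : 1 ≤ N) (hL : 1 + Real.log (2 * N) ≤ Lg)
    (hq : r.den ≤ N) (hU : 1 ≤ U) (b : ℕ → ℝ) (hb : ∀ k, 0 ≤ b k) (hb' : ∀ k ≤ N, b k ≤ Lg) :
    ∑ m ∈ Icc 1 N, (m : ℝ) * ‖∑ k ∈ Icc (U + 1) (N / U), (b k : ℂ) * ((w (m * k) : ℂ) * e ((m * k : ℕ) * α))‖ ^ 2
      ≤ 72 * Lg ^ 4 * (N ^ 2 / r.den + N ^ 2 / U + N * r.den) := by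
  set K := Icc (U + 1) (N / U) with hKd
  have hN' : (1 : ℝ) ≤ N := by exact_mod_cast hN
  have hU' : (1 : ℝ) ≤ U := by exact_mod_cast hU
  have hlog2N : 0 ≤ Real.log (2 * N) := Real.log_nonneg (by linarith)
  have hL1 : 1 ≤ Lg := by linarith
  have hq0 : (0 : ℝ) < r.den := by exact_mod_cast r.den_pos
  have hLq : 1 + Real.log (2 * r.den) ≤ Lg := by
    refine le_trans ?_ hL
    gcongr
  set J : ℕ → ℕ → ℂ := fun k k' => ∑ m ∈ Icc 1 N, ((m * w (m * k) * w (m * k') : ℝ) : ℂ) *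
    (e ((m * k : ℕ) * α) * (starRingEnd ℂ) (e ((m * k' : ℕ) * α))) with hJ
  have hKN : ∀ k ∈ K, k ≤ N := fun k hk => (mem_Icc.1 hk).2.trans (Nat.div_le_self _ _)
  have hK1 : ∀ k ∈ K, 1 ≤ k := fun k hk => by have := (mem_Icc.1 hk).1; omega
  have h1 : ((∑ m ∈ Icc 1 N, (m : ℝ) * ‖∑ k ∈ K, (b k : ℂ) * ((w (m * k) : ℂ) * e ((m * k : ℕ) * α))‖ ^ 2 : ℝ) : ℂ)
      = ∑ k ∈ K, ∑ k' ∈ K, ((b k * b k' : ℝ) : ℂ) * J k k' := by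
    push_cast
    simp_rw [← Complex.mul_conj', map_sum, map_mul, sum_mul_sum, mul_sum, hJ, mul_sum]
    rw [sum_comm]
    apply sum_congr rfl; intro k _
    rw [sum_comm]
    apply sum_congr rfl; intro k' _
    apply sum_congr rfl; intro m _
    simp only [Complex.conj_ofReal]; push_cast; ring
  have h2 : ∑ m ∈ Icc 1 N, (m : ℝ) * ‖∑ k ∈ K, (b k : ℂ) * ((w (m * k) : ℂ) * e ((m * k : ℕ) * α))‖ ^ 2
      ≤ Lg ^ 2 * ∑ k ∈ K, ∑ k' ∈ K, ‖J k k'‖ := by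
    have h3 : ∑ m ∈ Icc 1 N, (m : ℝ) * ‖∑ k ∈ K, (b k : ℂ) * ((w (m * k) : ℂ) * e ((m * k : ℕ) * α))‖ ^ 2
      = ‖∑ k ∈ K, ∑ k' ∈ K, ((b k * b k' : ℝ) : ℂ) * J k k'‖ := by
      rw [← h1, Complex.norm_real, Real.norm_of_nonneg (by positivity)]
    rw [h3, mul_sum]
    refine (norm_sum_le _ _).trans (sum_le_sum fun k hk => ?_)
    rw [mul_sum]
    refine (norm_sum_le _ _).trans (sum_le_sum fun k' hk' => ?_)
    rw [norm_mul, Complex.norm_real, Real.norm_of_nonneg (mul_nonneg (hb _) (hb _)), sq]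
    have := hb k; have := hb k'; have := hb' k (hKN k hk); have := hb' k' (hKN k' hk')
    gcongr
  have hJs : ∀ k k', ‖J k k'‖ = ‖J k' k‖ := by
    intro k k'
    rw [← Complex.norm_conj]
    congr 1
    simp only [hJ, map_sum, map_mul, Complex.conj_ofReal, Complex.conj_conj]
    apply sum_congr rfl; intro m _
    push_cast; ring
  have h4 := sum_sym K (fun k k' => ‖J k k'‖) (fun _ _ => norm_nonneg _) hJs hK1
  have h5 : ∀ k ∈ K, ∑ k' ∈ Icc 1 k, ‖J k k'‖ ≤
      8 * N ^ 2 / (r.den * k) + 32 * N * Lg + 4 * N ^ 2 / k ^ 2 + 16 * N * r.den * Lg / k := by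
    intro k hk
    refine le_trans (le_of_eq ?_) (sum_II_k w U N hw α r hα Lg hN hLq k (hK1 k hk))
    apply sum_congr rfl; intro k' hk'
    congr 1
    simp only [hJ]
    apply sum_congr rfl; intro m _
    congr 1
    rw [← e_neg, ← e_add]
    congr 1
    rw [Nat.cast_sub (mem_Icc.1 hk').2]; push_cast; ring
  have hharm : ∑ k ∈ K, ((k : ℝ))⁻¹ ≤ Lg := by
    have h2 := harmonic_le_one_add_log N
    rw [harmonic_eq_sum_Icc] at h2
    push_cast at h2
    have h3 : ∑ k ∈ K, ((k : ℝ))⁻¹ ≤ ∑ k ∈ Icc 1 N, ((k : ℝ))⁻¹ := by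
      apply sum_le_sum_of_subset_of_nonneg
      · intro x hx; exact mem_Icc.2 ⟨hK1 x hx, hKN x hx⟩
      · intros; positivity
    have h4 : Real.log N ≤ Real.log (2 * N) := Real.log_le_log (by linarith) (by linarith)
    linarith
  have h6 : ∑ k ∈ K, ∑ k' ∈ Icc 1 k, ‖J k k'‖ ≤ ∑ k ∈ K, ((8 * N ^ 2 / r.den + 4 * N ^ 2 / U + 16 * N * r.den * Lg) * (k : ℝ)⁻¹
      + 32 * N * Lg) := by
    apply sum_le_sum; intro k hk
    refine (h5 k hk).trans ?_
    have hk0 : (0 : ℝ) < k := by exact_mod_cast hK1 k hk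
    have hUk : (U : ℝ) ≤ k := by
      have := (mem_Icc.1 hk).1
      exact_mod_cast (by omega : U ≤ k)
    have h7 : 4 * (N : ℝ) ^ 2 / k ^ 2 ≤ 4 * N ^ 2 / U * (k : ℝ)⁻¹ := by
      rw [← div_eq_mul_inv, div_div, sq (k : ℝ)]
      gcongr
    have h8 : 8 * (N : ℝ) ^ 2 / (r.den * k) = 8 * N ^ 2 / r.den * (k : ℝ)⁻¹ := by field_simp
    have h9 : 16 * N * r.den * Lg / k = 16 * N * r.den * Lg * (k : ℝ)⁻¹ := by field_simp
    rw [h8, h9]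
    linarith
  rw [sum_add_distrib, ← mul_sum, sum_const, nsmul_eq_mul] at h6
  have hcard : (K.card : ℝ) ≤ N / U := by
    rw [hKd, Nat.card_Icc]
    refine le_trans ?_ (Nat.cast_div_le (m := N) (n := U))
    have hz : N / U + 1 - (U + 1) ≤ N / U := by generalize N / U = z; omega
    exact_mod_cast hz
  set P := (N : ℝ) ^ 2 / r.den with hP
  set R := (N : ℝ) ^ 2 / U with hR
  set S := (N : ℝ) * r.den with hS
  have hP0 : 0 ≤ P := by positivity
  have hR0 : 0 ≤ R := by positivity
  have hS0 : 0 ≤ S := by positivity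
  have h10 : (K.card : ℝ) * (32 * N * Lg) ≤ 32 * R * Lg := by
    calc _ ≤ (N / U : ℝ) * (32 * N * Lg) := by gcongr
      _ = _ := by rw [hR]; ring
  have h11 : (8 * N ^ 2 / r.den + 4 * N ^ 2 / U + 16 * N * r.den * Lg) * ∑ i ∈ K, ((i : ℝ))⁻¹ ≤
      (8 * P + 4 * R + 16 * S * Lg) * Lg := by
    have : (8 * N ^ 2 / r.den + 4 * N ^ 2 / U + 16 * N * r.den * Lg) = (8 * P + 4 * R + 16 * S * Lg) := by
      rw [hP, hR, hS]; ring
    rw [this]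
    gcongr
  have h12 : ∑ k ∈ K, ∑ k' ∈ Icc 1 k, ‖J k k'‖ ≤ 36 * Lg ^ 2 * (P + R + S) := by
    refine h6.trans ((add_le_add h11 h10).trans ?_)
    have a1 : Lg ≤ Lg ^ 2 := by nlinarith
    have a2 := mul_le_mul_of_nonneg_left a1 hP0
    have a3 := mul_le_mul_of_nonneg_left a1 hR0
    have a4 : 0 ≤ S * Lg ^ 2 := by positivity
    have a5 : 0 ≤ P * Lg ^ 2 := by positivity
    nlinarith
  calc _ ≤ Lg ^ 2 * (2 * (36 * Lg ^ 2 * (P + R + S))) := by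
        refine h2.trans ?_
        gcongr
        refine h4.trans ?_
        gcongr
    _ = _ := by ring

lemma bound_II (w : ℕ → ℝ) (U N : ℕ) (hw : Wt w U N) (α : ℝ) (r : ℚ)
    (hα : |α - r| ≤ 1 / (r.den : ℝ) ^ 2) (Lg : ℝ) (hN : 1 ≤ N) (hL : 1 + Real.log (2 * N) ≤ Lg)
    (hq : r.den ≤ N) (hU : 1 ≤ U) (b c : ℕ → ℝ) (hb : ∀ k, 0 ≤ b k) (hb' : ∀ k ≤ N, b k ≤ Lg)
    (hb0 : ∀ k ≤ U, b k = 0) (hc : ∀ m, |c m| ≤ 1) (hc0 : ∀ m ≤ U, c m = 0) :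
    ‖∑ m ∈ Icc 1 N, ∑ k ∈ Icc 1 N, (c m : ℂ) * (b k : ℂ) * ((w (m * k) : ℂ) * e ((m * k : ℕ) * α))‖ ^ 2
      ≤ 72 * Lg ^ 5 * (N ^ 2 / r.den + N ^ 2 / U + N * r.den) := by
  have hN' : (1 : ℝ) ≤ N := by exact_mod_cast hN
  have hlog2N : 0 ≤ Real.log (2 * N) := Real.log_nonneg (by linarith)
  have hL1 : 1 ≤ Lg := by linarith
  set T : ℕ → ℂ := fun m => ∑ k ∈ Icc (U + 1) (N / U), (b k : ℂ) * ((w (m * k) : ℂ) * e ((m * k : ℕ) * α)) with hT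
  have h1 : ∑ m ∈ Icc 1 N, ∑ k ∈ Icc 1 N, (c m : ℂ) * (b k : ℂ) * ((w (m * k) : ℂ) * e ((m * k : ℕ) * α))
      = ∑ m ∈ Icc 1 N, (c m : ℂ) * T m := by
    apply sum_congr rfl; intro m _
    by_cases hm : m ≤ U
    · rw [hc0 m hm]; simp
    · rw [hT]; simp only; rw [mul_sum]
      rw [sum_congr rfl (fun k _ => (mul_assoc (c m : ℂ) (b k : ℂ) _))]
      symm
      apply sum_subset
      · intro x hx
        have := mem_Icc.1 hx
        exact mem_Icc.2 ⟨by omega, this.2.trans (Nat.div_le_self _ _)⟩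
      · intro k hk hk'
        by_cases hkU : k ≤ U
        · rw [hb0 k hkU]; simp
        · have h2 : N / U < k := by
            by_contra hcon
            exact hk' (mem_Icc.2 ⟨by omega, by omega⟩)
          rw [Nat.div_lt_iff_lt_mul (by omega)] at h2
          rw [hw.large (m * k) (by nlinarith)]; simp
  rw [h1]
  have h2 : ‖∑ m ∈ Icc 1 N, (c m : ℂ) * T m‖ ≤ ∑ m ∈ Icc 1 N, ‖T m‖ := by
    refine (norm_sum_le _ _).trans (sum_le_sum fun m _ => ?_)
    rw [norm_mul, Complex.norm_real, Real.norm_eq_abs]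
    nlinarith [hc m, norm_nonneg (T m)]
  have h3 : (∑ m ∈ Icc 1 N, ‖T m‖) ^ 2 ≤ (∑ m ∈ Icc 1 N, ((m : ℝ))⁻¹) * ∑ m ∈ Icc 1 N, (m : ℝ) * ‖T m‖ ^ 2 := by
    apply sum_sq_le_sum_mul_sum_of_sq_le_mul
    · intros; positivity
    · intros; positivity
    · intro m hm
      have : (m : ℝ) ≠ 0 := by
        have := (mem_Icc.1 hm).1
        exact_mod_cast (by omega : m ≠ 0)
      apply le_of_eq
      field_simp
  have h4 := sum_m_T w U N hw α r hα Lg hN hL hq hU b hb hb'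
  have hharm : ∑ k ∈ Icc 1 N, ((k : ℝ))⁻¹ ≤ Lg := by
    have h2 := harmonic_le_one_add_log N
    rw [harmonic_eq_sum_Icc] at h2
    push_cast at h2
    have h4 : Real.log N ≤ Real.log (2 * N) := Real.log_le_log (by linarith) (by linarith)
    linarith
  calc _ ≤ (∑ m ∈ Icc 1 N, ‖T m‖) ^ 2 := by gcongr
    _ ≤ _ := h3
    _ ≤ Lg * (72 * Lg ^ 4 * (N ^ 2 / r.den + N ^ 2 / U + N * r.den)) := by gcongr
    _ = _ := by ring

theorem minor_arc (w : ℕ → ℝ) (U N : ℕ) (hw : Wt w U N) (α : ℝ) (r : ℚ)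
    (hα : |α - r| ≤ 1 / (r.den : ℝ) ^ 2) (Lg : ℝ) (hN : 1 ≤ N) (hL : 1 + Real.log (2 * N) ≤ Lg)
    (hq : r.den ≤ N) (hU : 1 ≤ U) (hU3 : U ^ 3 ≤ N) :
    ‖∑ n ∈ Icc 1 N, (vonMangoldt n : ℂ) * ((w n : ℂ) * e (n * α))‖ ^ 2
      ≤ 6400 * Lg ^ 5 * (N ^ 2 / r.den + N ^ 2 / U + N * r.den) := by
  have hN' : (1 : ℝ) ≤ N := by exact_mod_cast hN
  have hU' : (1 : ℝ) ≤ U := by exact_mod_cast hU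
  have hU3' : (U : ℝ) ^ 3 ≤ N := by exact_mod_cast hU3
  have hq0 : (1 : ℝ) ≤ r.den := by exact_mod_cast r.den_pos
  have hqN : (r.den : ℝ) ≤ N := by exact_mod_cast hq
  have hlog2N : 0 ≤ Real.log (2 * N) := Real.log_nonneg (by linarith)
  have hL1 : 1 ≤ Lg := by linarith
  have hU2N : U ^ 2 ≤ N := le_trans (Nat.pow_le_pow_right hU (by norm_num)) hU3
  have hUN : U ≤ N := le_trans (Nat.le_self_pow (by norm_num) U) hU3
  set F : ℕ → ℂ := fun n => (w n : ℂ) * e (n * α) with hF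
  have hF0 : ∀ n, N < n → F n = 0 := by intro n hn; simp only [hF]; rw [hw.large n hn]; simp
  set m1 := trunc ((moebius : ArithmeticFunction ℤ) : ArithmeticFunction ℝ) U with hm1
  set m2 := tail ((moebius : ArithmeticFunction ℤ) : ArithmeticFunction ℝ) U with hm2
  set l1 := trunc vonMangoldt U with hl1
  set l2 := tail vonMangoldt U with hl2
  have hdec : ∑ n ∈ Icc 1 N, (vonMangoldt n : ℂ) * F n =
      ∑ n ∈ Icc 1 N, ((m1 * log) n : ℂ) * F n - ∑ n ∈ Icc 1 N, (((m1 * l1) * (zeta : ArithmeticFunction ℝ)) n : ℂ) * F n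
      + ∑ n ∈ Icc 1 N, ((m2 * (l2 * (zeta : ArithmeticFunction ℝ))) n : ℂ) * F n := by
    rw [← sum_sub_distrib, ← sum_add_distrib]
    apply sum_congr rfl; intro n _
    have hv := congrArg (fun f : ArithmeticFunction ℝ => f n) (show (vonMangoldt : ArithmeticFunction ℝ) + m1 * l1 * (zeta : ArithmeticFunction ℝ)
      = l1 + m1 * log + m2 * (l2 * (zeta : ArithmeticFunction ℝ)) by linear_combination vaughan U)
    simp only [ArithmeticFunction.add_apply] at hv
    have hz : (l1 n : ℂ) * F n = 0 := by
      rw [hl1, trunc_apply]; split_ifs with h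
      · simp only [hF]; rw [hw.small n h]; simp
      · simp
    have hv' := congrArg (fun x : ℝ => (x : ℂ)) hv
    push_cast at hv'
    linear_combination hz + F n * hv'
  have hmu : ∀ m, |((moebius : ArithmeticFunction ℤ) : ArithmeticFunction ℝ) m| ≤ 1 := by
    intro m
    rw [intCoe_apply]
    have := abs_moebius_le_one (n := m)
    exact_mod_cast this
  have hA : ‖∑ n ∈ Icc 1 N, ((m1 * log) n : ℂ) * F n‖ ≤ Lg * (16 * (N / r.den + U + r.den) * Lg) := by
    rw [conv_sum _ _ N F hF0]
    refine bound_Ia w U N hw α r hα Lg hN hL hq hU hUN m1 ?_ ?_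
    · intro m; rw [hm1, trunc_apply]; split_ifs
      · exact hmu m
      · simp
    · intro m hm; rw [hm1, trunc_apply, if_neg (by omega)]
  have hB : ‖∑ n ∈ Icc 1 N, (((m1 * l1) * (zeta : ArithmeticFunction ℝ)) n : ℂ) * F n‖ ≤ Lg * (16 * (N / r.den + (U ^ 2 : ℕ) + r.den) * Lg) := by
    rw [conv_sum _ _ N F hF0]
    have := bound_Ib w U N (U ^ 2) hw α r hα Lg hN hL hq (Nat.one_le_pow _ _ hU) hU2N (fun m => (m1 * l1) m)
      (fun m => (mu_lam_bd U m).1) (fun m => (mu_lam_bd U m).2)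
    refine le_trans (le_of_eq ?_) this
    congr 1
    apply sum_congr rfl; intro m _
    apply sum_congr rfl; intro l hl
    have : l ≠ 0 := by have := (mem_Icc.1 hl).1; omega
    rw [natCoe_apply, zeta_apply_ne this]; simp only [hF]; push_cast; ring
  have hC : ‖∑ n ∈ Icc 1 N, ((m2 * (l2 * (zeta : ArithmeticFunction ℝ))) n : ℂ) * F n‖ ^ 2 ≤ 72 * Lg ^ 5 * (N ^ 2 / r.den + N ^ 2 / U + N * r.den) := by
    rw [conv_sum _ _ N F hF0]
    refine bound_II w U N hw α r hα Lg hN hL hq hU (fun k => (l2 * (zeta : ArithmeticFunction ℝ)) k) m2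
      (fun k => (tail_zeta_bd U k).1) ?_ (fun k => (tail_zeta_bd U k).2.2) ?_ ?_
    · intro k hk
      refine (tail_zeta_bd U k).2.1.trans ?_
      have : Real.log k ≤ Real.log N := log_mono_nat hk
      have h4 : Real.log N ≤ Real.log (2 * N) := Real.log_le_log (by linarith) (by linarith)
      linarith
    · intro m; rw [hm2, tail_apply]; split_ifs
      · simp
      · exact hmu m
    · intro m hm; rw [hm2, tail_apply, if_pos hm]
  set E := (N : ℝ) ^ 2 / r.den + N ^ 2 / U + N * r.den with hE
  have hE0 : 0 ≤ E := by positivity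
  have hbound : ∀ V : ℝ, 0 ≤ V → V ^ 2 ≤ N ^ 2 / U → (N / r.den + V + r.den) ^ 2 ≤ 3 * E := by
    intro V hV hV2
    have a1 : ((N : ℝ) / r.den) ^ 2 ≤ N ^ 2 / r.den := by
      rw [div_pow]; gcongr; nlinarith
    have a2 : (r.den : ℝ) ^ 2 ≤ N * r.den := by nlinarith
    nlinarith [sq_nonneg ((N : ℝ) / r.den - V), sq_nonneg (V - r.den), sq_nonneg ((N : ℝ) / r.den - r.den)]
  have hV1 := hbound U (by positivity) (by
    rw [le_div_iff₀ (by positivity)]; nlinarith)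
  have hV2 := hbound ((U ^ 2 : ℕ) : ℝ) (by positivity) (by
    rw [le_div_iff₀ (by positivity)]; push_cast
    have a1 : ((U : ℝ) ^ 2) ^ 2 * U = (U : ℝ) ^ 5 := by ring
    have a2 : (U : ℝ) ^ 5 ≤ (U : ℝ) ^ 6 := pow_le_pow_right₀ hU' (by norm_num)
    have a3 : (U : ℝ) ^ 6 = ((U : ℝ) ^ 3) ^ 2 := by ring
    have a4 : ((U : ℝ) ^ 3) ^ 2 ≤ (N : ℝ) ^ 2 := by gcongr
    linarith)
  have hsq : ∀ V x : ℝ, 0 ≤ x → x ≤ Lg * (16 * V * Lg) → V ^ 2 ≤ 3 * E → x ^ 2 ≤ 768 * Lg ^ 5 * E := by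
    intro V x hx hxV hV
    calc x ^ 2 ≤ (Lg * (16 * V * Lg)) ^ 2 := by gcongr
      _ = 256 * Lg ^ 4 * V ^ 2 := by ring
      _ ≤ 256 * Lg ^ 4 * (3 * E) := by gcongr
      _ = 768 * Lg ^ 4 * E := by ring
      _ ≤ _ := by gcongr <;> norm_num
  have hA2 := hsq _ _ (norm_nonneg _) hA hV1
  have hB2 := hsq _ _ (norm_nonneg _) hB hV2
  rw [hdec]
  set a := ∑ n ∈ Icc 1 N, ((m1 * log) n : ℂ) * F n
  set b := ∑ n ∈ Icc 1 N, (((m1 * l1) * (zeta : ArithmeticFunction ℝ)) n : ℂ) * F n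
  set c := ∑ n ∈ Icc 1 N, ((m2 * (l2 * (zeta : ArithmeticFunction ℝ))) n : ℂ) * F n
  have htri : ‖a - b + c‖ ≤ ‖a‖ + ‖b‖ + ‖c‖ := (norm_add_le _ _).trans (by gcongr; exact norm_sub_le _ _)
  calc _ ≤ (‖a‖ + ‖b‖ + ‖c‖) ^ 2 := by gcongr
    _ ≤ 3 * (‖a‖ ^ 2 + ‖b‖ ^ 2 + ‖c‖ ^ 2) := by
        nlinarith [sq_nonneg (‖a‖ - ‖b‖), sq_nonneg (‖b‖ - ‖c‖), sq_nonneg (‖a‖ - ‖c‖)]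
    _ ≤ 3 * (768 * Lg ^ 5 * E + 768 * Lg ^ 5 * E + 72 * Lg ^ 5 * E) := by gcongr
    _ ≤ _ := by
        have : 0 ≤ Lg ^ 5 * E := by positivity
        linarith

end PQ


namespace PQ
open Finset MeasureTheory Filter Topology Complex
open DirichletCharacter hiding LFunction_ne_zero_of_one_le_re

section per
variable {q : ℕ} [NeZero q] (χ : DirichletCharacter ℂ q)

noncomputable def cmean : ℂ := (∑ n ∈ range q, χ (n : ZMod q)) / q

lemma cmean_norm : ‖cmean χ‖ ≤ 1 := by
  unfold cmean
  have hq : (0 : ℝ) < q := by exact_mod_cast Nat.pos_of_ne_zero (NeZero.ne q)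
  rw [norm_div, Complex.norm_natCast, div_le_one hq]
  refine (norm_sum_le _ _).trans ?_
  refine (sum_le_sum (fun n _ => χ.norm_le_one _)).trans ?_
  simp

lemma sum_range_zmod {M : Type*} [AddCommMonoid M] (q : ℕ) [NeZero q] (f : ZMod q → M) :
    ∑ n ∈ range q, f (n : ZMod q) = ∑ a : ZMod q, f a := by
  obtain ⟨k, rfl⟩ : ∃ k, q = k + 1 := ⟨q - 1, by have := NeZero.ne q; omega⟩
  rw [← Fin.sum_univ_eq_sum_range (fun n => f (n : ZMod (k + 1)))]
  apply sum_congr rfl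
  intro i _
  congr 1
  exact Fin.cast_val_eq_self i

lemma cmean_zero (h : χ ≠ 1) : cmean χ = 0 := by
  unfold cmean
  rw [sum_range_zmod q (fun a => χ a), MulChar.sum_eq_zero_of_ne_one h, zero_div]

noncomputable def gper (m : ℕ) : ℂ := ∑ n ∈ range m, (χ (n : ZMod q) - cmean χ)

lemma gper_add (m : ℕ) : gper χ (m + q) = gper χ m := by
  induction m with
  | zero =>
    unfold gper cmean
    rw [zero_add, sum_sub_distrib, sum_const, card_range, nsmul_eq_mul]
    have : (q : ℂ) ≠ 0 := by exact_mod_cast NeZero.ne q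
    field_simp
    simp
  | succ k ih =>
    unfold gper at *
    rw [show k + 1 + q = (k + q) + 1 by ring, sum_range_succ, ih, sum_range_succ]
    simp

lemma gper_bound (m : ℕ) : ‖gper χ m‖ ≤ 2 * q := by
  have hq : 0 < q := Nat.pos_of_ne_zero (NeZero.ne q)
  have h1 : gper χ m = gper χ (m % q) := by
    have : ∀ k r : ℕ, gper χ (r + k * q) = gper χ r := by
      intro k
      induction k with
      | zero => simp
      | succ k ih => intro r; rw [Nat.succ_mul, ← add_assoc, gper_add, ih]
    conv_lhs => rw [← Nat.mod_add_div m q, mul_comm]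
    rw [this]
  rw [h1]
  unfold gper
  refine (norm_sum_le _ _).trans ?_
  calc _ ≤ ∑ n ∈ range (m % q), (2 : ℝ) := by
        apply sum_le_sum; intro n _
        refine (norm_sub_le _ _).trans ?_
        have := χ.norm_le_one (n : ZMod q)
        have := cmean_norm χ
        linarith
    _ = 2 * (m % q : ℕ) := by simp [mul_comm]
    _ ≤ _ := by
        have := (Nat.mod_lt m hq).le
        gcongr

/-- truncated coefficients -/
noncomputable def ftail (N : ℕ) (k : ℕ) : ℂ := if k ≤ N then 0 else χ (k : ZMod q)

noncomputable def Rtail (N : ℕ) (t : ℝ) : ℂ := ∑ k ∈ Icc 1 ⌊t⌋₊, ftail χ N k - cmean χ * (t - N)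

lemma ftail_sum (N M : ℕ) (h : N ≤ M) : ∑ k ∈ Icc 1 M, ftail χ N k = gper χ (M + 1) - gper χ (N + 1) + cmean χ * (M - N) := by
  induction M, h using Nat.le_induction with
  | base =>
    rw [sum_eq_zero]
    · ring
    · intro k hk; unfold ftail; rw [if_pos (mem_Icc.1 hk).2]
  | succ M hM ih =>
    rw [sum_Icc_succ_top (by omega), ih]
    have : gper χ (M + 1 + 1) = gper χ (M + 1) + (χ ((M + 1 : ℕ) : ZMod q) - cmean χ) := by
      unfold gper; rw [sum_range_succ]
    rw [this]
    unfold ftail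
    rw [if_neg (by omega)]; push_cast; ring

lemma Rtail_bound (N : ℕ) (t : ℝ) (ht : N ≤ t) : ‖Rtail χ N t‖ ≤ 5 * q := by
  have ht0 : 0 ≤ t := (Nat.cast_nonneg N).trans ht
  have hq : (1 : ℝ) ≤ q := by exact_mod_cast Nat.pos_of_ne_zero (NeZero.ne q)
  unfold Rtail
  rw [ftail_sum χ N _ (Nat.le_floor ht)]
  have h1 : gper χ (⌊t⌋₊ + 1) - gper χ (N + 1) + cmean χ * (⌊t⌋₊ - N) - cmean χ * (t - N)
      = gper χ (⌊t⌋₊ + 1) - gper χ (N + 1) - cmean χ * ((t - ⌊t⌋₊ : ℝ) : ℂ) := by push_cast; ring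
  rw [h1]
  have h2 : ‖cmean χ * ((t - ⌊t⌋₊ : ℝ) : ℂ)‖ ≤ 1 := by
    rw [norm_mul, Complex.norm_real, Real.norm_eq_abs]
    have h3 := Nat.floor_le ht0
    have h4 := Nat.lt_floor_add_one t
    rw [abs_of_nonneg (by linarith)]
    have := cmean_norm χ
    nlinarith [norm_nonneg (cmean χ)]
  have := gper_bound χ (⌊t⌋₊ + 1)
  have := gper_bound χ (N + 1)
  refine (norm_sub_le _ _).trans ?_
  have := norm_sub_le (gper χ (⌊t⌋₊ + 1)) (gper χ (N + 1))
  linarith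

lemma Rtail_meas (N : ℕ) : Measurable (Rtail χ N) := by
  unfold Rtail
  apply Measurable.sub
  · have : Measurable (fun n : ℕ => ∑ k ∈ Icc 1 n, ftail χ N k) := measurable_of_countable _
    exact this.comp Nat.measurable_floor
  · fun_prop

noncomputable def Gf (N : ℕ) : ℝ → ℂ := Set.indicator (Set.Ioi (N : ℝ)) (Rtail χ N)

noncomputable def Gt (N : ℕ) (s : ℂ) : ℂ := s * mellin (Gf χ N) (-s)

lemma Gf_bound (N : ℕ) (t : ℝ) : ‖Gf χ N t‖ ≤ 5 * q := by
  unfold Gf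
  by_cases h : t ∈ Set.Ioi (N : ℝ)
  · rw [Set.indicator_of_mem h]; exact Rtail_bound χ N t (le_of_lt h)
  · rw [Set.indicator_of_notMem h, norm_zero]; positivity

lemma Gf_meas (N : ℕ) : Measurable (Gf χ N) := (Rtail_meas χ N).indicator measurableSet_Ioi

lemma Gt_diff (N : ℕ) (hN : 1 ≤ N) (s : ℂ) (hs : 0 < s.re) : DifferentiableAt ℂ (Gt χ N) s := by
  unfold Gt
  apply DifferentiableAt.mul differentiableAt_id
  have h : DifferentiableAt ℂ (mellin (Gf χ N)) (-s) := by
    apply mellin_differentiableAt_of_isBigO_rpow (a := 0) (b := -s.re - 1)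
    · apply LocallyIntegrable.locallyIntegrableOn
      refine (locallyIntegrable_const (5 * q : ℝ)).mono (Gf_meas χ N).aestronglyMeasurable ?_
      refine ae_of_all _ fun t => ?_
      rw [Real.norm_of_nonneg (by positivity)]; exact Gf_bound χ N t
    · apply Asymptotics.IsBigO.of_bound (5 * q)
      refine Eventually.of_forall fun t => ?_
      simpa using Gf_bound χ N t
    · simpa using hs
    · have : Gf χ N =ᶠ[𝓝[>] 0] 0 := by
        have h1 : Set.Iio (1 : ℝ) ∈ 𝓝[>] (0 : ℝ) := mem_nhdsWithin_of_mem_nhds (Iio_mem_nhds one_pos)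
        filter_upwards [h1] with t ht
        unfold Gf
        rw [Set.indicator_of_notMem]; rfl
        have : (1 : ℝ) ≤ N := by exact_mod_cast hN
        simp only [Set.mem_Iio, Set.mem_Ioi, not_lt] at *
        linarith
      exact this.trans_isBigO (Asymptotics.isBigO_zero _ _)
    · simp
  exact h.comp s differentiableAt_id.neg

lemma Gt_eq (N : ℕ) (s : ℂ) :
    Gt χ N s = s * ∫ t in Set.Ioi (N : ℝ), Rtail χ N t * (t : ℂ) ^ (-(s + 1)) := by
  unfold Gt mellin Gf
  congr 1
  rw [← integral_indicator measurableSet_Ioi, ← integral_indicator measurableSet_Ioi]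
  congr 1
  ext t
  by_cases h : t ∈ Set.Ioi (N : ℝ)
  · have h0 : t ∈ Set.Ioi (0 : ℝ) := Set.mem_Ioi.2 (lt_of_le_of_lt (Nat.cast_nonneg N) (Set.mem_Ioi.1 h))
    rw [Set.indicator_of_mem h, Set.indicator_of_mem h0, Set.indicator_of_mem h, smul_eq_mul, mul_comm]
    congr 2; ring
  · rw [Set.indicator_of_notMem h]
    by_cases h0 : t ∈ Set.Ioi (0 : ℝ)
    · rw [Set.indicator_of_mem h0, Set.indicator_of_notMem h, smul_zero]
    · rw [Set.indicator_of_notMem h0]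

lemma Gt_bound (N : ℕ) (hN : 1 ≤ N) (s : ℂ) (hs : 0 < s.re) :
    ‖Gt χ N s‖ ≤ 5 * q * ‖s‖ * (N : ℝ) ^ (-s.re) / s.re := by
  rw [Gt_eq, norm_mul]
  have hN0 : (0 : ℝ) < N := by exact_mod_cast hN
  have h1 : ‖∫ t in Set.Ioi (N : ℝ), Rtail χ N t * (t : ℂ) ^ (-(s + 1))‖ ≤
      ∫ t in Set.Ioi (N : ℝ), 5 * q * t ^ (-(s.re + 1)) := by
    apply norm_integral_le_of_norm_le
    · apply Integrable.const_mul
      exact integrableOn_Ioi_rpow_of_lt (by linarith) hN0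
    · refine (ae_restrict_iff' measurableSet_Ioi).2 (ae_of_all _ fun t ht => ?_)
      have ht0 : 0 < t := hN0.trans ht
      rw [norm_mul, norm_cpow_eq_rpow_re_of_pos ht0]
      simp only [neg_re, add_re, one_re]
      gcongr
      exact Rtail_bound χ N t (le_of_lt ht)
  rw [integral_const_mul, integral_Ioi_rpow_of_lt (by linarith) hN0] at h1
  have h2 : -(N : ℝ) ^ (-(s.re + 1) + 1) / (-(s.re + 1) + 1) = (N : ℝ) ^ (-s.re) / s.re := by
    rw [show -(s.re + 1) + 1 = - s.re by ring, neg_div_neg_eq]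
  rw [h2] at h1
  calc _ ≤ ‖s‖ * (5 * q * ((N : ℝ) ^ (-s.re) / s.re)) := by gcongr
    _ = _ := by ring

lemma tail_LSeries (N : ℕ) (hN : 1 ≤ N) (s : ℂ) (hs : 1 < s.re) :
    LSeries (ftail χ N) s = cmean χ * (N : ℂ) ^ (1 - s) / (s - 1) + Gt χ N s := by
  have hN0 : (0 : ℝ) < N := by exact_mod_cast hN
  have hN1 : (1 : ℝ) ≤ N := by exact_mod_cast hN
  have hs0 : s ≠ 0 := by rintro rfl; simp at hs; linarith
  have hs1 : s - 1 ≠ 0 := by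
    intro h
    have := congrArg Complex.re h
    simp at this; linarith
  have hnorm : ∀ k, ‖ftail χ N k‖ ≤ 1 := by
    intro k; unfold ftail; split_ifs
    · simp
    · exact χ.norm_le_one _
  rw [LSeries_eq_mul_integral' (ftail χ N) (r := 1) zero_le_one hs ?_]
  swap
  · apply Asymptotics.IsBigO.of_bound 1
    refine Eventually.of_forall fun n => ?_
    rw [Real.norm_of_nonneg (by positivity), Real.rpow_one, one_mul, Real.norm_of_nonneg (by positivity)]
    refine (sum_le_sum fun k _ => hnorm k).trans ?_
    simp
  have h1 : ∫ t in Set.Ioi (1 : ℝ), (∑ k ∈ Icc 1 ⌊t⌋₊, ftail χ N k) * (t : ℂ) ^ (-(s + 1))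
      = ∫ t in Set.Ioi (N : ℝ), (∑ k ∈ Icc 1 ⌊t⌋₊, ftail χ N k) * (t : ℂ) ^ (-(s + 1)) := by
    apply setIntegral_eq_of_subset_of_ae_sdiff_eq_zero measurableSet_Ioi.nullMeasurableSet
      (Set.Ioi_subset_Ioi hN1)
    refine ae_of_all _ fun t ht => ?_
    rw [sum_eq_zero, zero_mul]
    intro k hk
    unfold ftail
    rw [if_pos]
    have ht' : t ≤ N := by simpa using ht.2
    exact (mem_Icc.1 hk).2.trans (Nat.floor_le_of_le ht')
  rw [h1, Gt_eq]
  have hi1 : IntegrableOn (fun t : ℝ => Rtail χ N t * (t : ℂ) ^ (-(s + 1))) (Set.Ioi (N : ℝ)) := by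
    have hm : Measurable (fun t : ℝ => Rtail χ N t * (t : ℂ) ^ (-(s + 1))) :=
      (Rtail_meas χ N).mul (by fun_prop)
    refine Integrable.mono' (g := fun t => 5 * q * t ^ (-(s.re + 1))) ?_ hm.aestronglyMeasurable ?_
    · apply Integrable.const_mul
      exact integrableOn_Ioi_rpow_of_lt (by linarith) hN0
    · refine (ae_restrict_iff' measurableSet_Ioi).2 (ae_of_all _ fun t ht => ?_)
      have ht0 : 0 < t := hN0.trans ht
      rw [norm_mul, norm_cpow_eq_rpow_re_of_pos ht0]
      simp only [neg_re, add_re, one_re]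
      gcongr
      exact Rtail_bound χ N t (le_of_lt ht)
  have hi2 : IntegrableOn (fun t : ℝ => (t : ℂ) ^ (-s)) (Set.Ioi (N : ℝ)) :=
    integrableOn_Ioi_cpow_of_lt (by simpa using hs) hN0
  have hi3 : IntegrableOn (fun t : ℝ => (t : ℂ) ^ (-(s + 1))) (Set.Ioi (N : ℝ)) :=
    integrableOn_Ioi_cpow_of_lt (by simp; linarith) hN0
  have h2 : ∫ t in Set.Ioi (N : ℝ), (∑ k ∈ Icc 1 ⌊t⌋₊, ftail χ N k) * (t : ℂ) ^ (-(s + 1))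
      = (∫ t in Set.Ioi (N : ℝ), Rtail χ N t * (t : ℂ) ^ (-(s + 1)))
       + (cmean χ * (∫ t in Set.Ioi (N : ℝ), (t : ℂ) ^ (-s)) - cmean χ * N * ∫ t in Set.Ioi (N : ℝ), (t : ℂ) ^ (-(s + 1))) := by
    have hi4 : IntegrableOn (fun t : ℝ => cmean χ * (t : ℂ) ^ (-s) - cmean χ * N * (t : ℂ) ^ (-(s + 1)))
        (Set.Ioi (N : ℝ)) := (hi2.const_mul _).sub (hi3.const_mul _)
    rw [← integral_const_mul, ← integral_const_mul, ← integral_sub (hi2.const_mul _) (hi3.const_mul _),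
      ← integral_add hi1 hi4]
    apply setIntegral_congr_fun measurableSet_Ioi
    intro t ht
    have ht0 : (t : ℂ) ≠ 0 := by exact_mod_cast (hN0.trans ht).ne'
    have h3 : (t : ℂ) ^ (-s) = t * (t : ℂ) ^ (-(s + 1)) := by
      rw [show -s = 1 + (-(s + 1)) by ring, cpow_add _ _ ht0, cpow_one]
    simp only [Rtail, Pi.sub_apply]
    rw [h3]; ring
  rw [h2, integral_Ioi_cpow_of_lt (by simpa using hs) hN0, integral_Ioi_cpow_of_lt (by simp; linarith) hN0]
  have hNc : (N : ℂ) ≠ 0 := by exact_mod_cast hN0.ne'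
  have h4 : ((N : ℝ) : ℂ) ^ (-s + 1) = (N : ℂ) ^ (1 - s) := by
    rw [show -s + 1 = 1 - s by ring]; norm_cast
  have h5 : ((N : ℝ) : ℂ) ^ (-(s + 1) + 1) = (N : ℂ) ^ (1 - s) / N := by
    rw [show -(s + 1) + 1 = (1 - s) - 1 by ring, ofReal_natCast, cpow_sub _ _ hNc, cpow_one]
  rw [h4, h5]
  have hs2 : -s + 1 ≠ 0 := by intro h; apply hs1; linear_combination -h
  have hs3 : -(s + 1) + 1 ≠ 0 := by intro h; apply hs0; linear_combination -h
  field_simp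
  ring

end per
end PQ


namespace PQ
open Finset MeasureTheory Filter Topology Complex
open DirichletCharacter hiding LFunction_ne_zero_of_one_le_re

section lform
variable {q : ℕ} [NeZero q] (χ : DirichletCharacter ℂ q)

lemma exists_entire : ∃ E : ℂ → ℂ, Differentiable ℂ E ∧ ∀ s ≠ 1, E s = (s - 1) * LFunction χ s := by
  by_cases h : χ = 1
  · subst h
    refine ⟨LFunctionTrivChar₁ q, differentiable_LFunctionTrivChar₁ q, fun s hs => ?_⟩
    rw [LFunctionTrivChar₁, Function.update_of_ne hs]
  · refine ⟨fun s => (s - 1) * LFunction χ s, ?_, fun s _ => rfl⟩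
    have := differentiable_LFunction h
    fun_prop

lemma L_formula_right (N : ℕ) (hN : 1 ≤ N) (s : ℂ) (hs : 1 < s.re) :
    LFunction χ s = ∑ n ∈ Icc 1 N, χ (n : ZMod q) * (n : ℂ) ^ (-s)
      + (cmean χ * (N : ℂ) ^ (1 - s) / (s - 1) + Gt χ N s) := by
  rw [← tail_LSeries χ N hN s hs, LFunction_eq_LSeries χ hs]
  have hsum := LSeriesSummable_of_one_lt_re χ hs
  have h1 : (fun n : ℕ => χ (n : ZMod q)) = (fun n : ℕ => if n ≤ N then χ (n : ZMod q) else 0) + ftail χ N := by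
    ext n
    simp only [Pi.add_apply, ftail]
    split_ifs <;> simp
  have hfin : ∀ n ∉ Icc 1 N, LSeries.term (fun n : ℕ => if n ≤ N then χ (n : ZMod q) else 0) s n = 0 := by
    intro n hn
    rcases Nat.eq_zero_or_pos n with rfl | h0
    · simp
    · rw [LSeries.term_of_ne_zero (by omega), if_neg, zero_div]
      intro h; exact hn (mem_Icc.2 ⟨h0, h⟩)
  have hs1 : LSeriesSummable (fun n : ℕ => if n ≤ N then χ (n : ZMod q) else 0) s :=
    summable_of_ne_finset_zero hfin
  have hs2 : LSeriesSummable (ftail χ N) s := by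
    have h2 : ftail χ N = (fun n : ℕ => χ (n : ZMod q)) - (fun n : ℕ => if n ≤ N then χ (n : ZMod q) else 0) := by
      rw [h1]; simp
    rw [h2]
    exact hsum.sub hs1
  rw [h1, LSeries_add hs1 hs2]
  congr 1
  unfold LSeries
  rw [tsum_eq_sum hfin]
  apply sum_congr rfl
  intro n hn
  have := mem_Icc.1 hn
  rw [LSeries.term_of_ne_zero (by omega), if_pos this.2, cpow_neg, div_eq_mul_inv]

lemma halfplane_convex : Convex ℝ {s : ℂ | 0 < s.re} := convex_halfSpace_re_gt 0

lemma halfplane_open : IsOpen {s : ℂ | 0 < s.re} := isOpen_lt continuous_const continuous_re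

lemma ident_half {f g : ℂ → ℂ} (hf : DifferentiableOn ℂ f {s : ℂ | 0 < s.re})
    (hg : DifferentiableOn ℂ g {s : ℂ | 0 < s.re}) (h : ∀ s : ℂ, 1 < s.re → f s = g s) (s : ℂ)
    (hs : 0 < s.re) : f s = g s := by
  refine AnalyticOnNhd.eqOn_of_preconnected_of_eventuallyEq (𝕜 := ℂ)
    (hf.analyticOnNhd halfplane_open) (hg.analyticOnNhd halfplane_open)
    halfplane_convex.isPreconnected (z₀ := 2) (by simp) ?_ hs
  have : {s : ℂ | 1 < s.re} ∈ 𝓝 (2 : ℂ) :=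
    (isOpen_lt continuous_const continuous_re).mem_nhds (by simp)
  filter_upwards [this] with z hz
  exact h z hz

lemma poly_diff (N : ℕ) : Differentiable ℂ (fun s : ℂ => ∑ n ∈ Icc 1 N, χ (n : ZMod q) * (n : ℂ) ^ (-s)) := by
  apply Differentiable.fun_sum
  intro n hn
  have : (n : ℂ) ≠ 0 := by have := mem_Icc.1 hn; exact_mod_cast (by omega : n ≠ 0)
  apply Differentiable.const_mul
  intro s
  exact (differentiableAt_id.neg).const_cpow (Or.inl this)

lemma L_formula (N : ℕ) (hN : 1 ≤ N) (s : ℂ) (hs : 0 < s.re) (hs1 : s ≠ 1) :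
    LFunction χ s = ∑ n ∈ Icc 1 N, χ (n : ZMod q) * (n : ℂ) ^ (-s)
      + (cmean χ * (N : ℂ) ^ (1 - s) / (s - 1) + Gt χ N s) := by
  obtain ⟨E, hE, hEs⟩ := exists_entire χ
  have hN0 : (N : ℂ) ≠ 0 := by exact_mod_cast (by omega : N ≠ 0)
  have key := ident_half (f := E) (g := fun s => (s - 1) * (∑ n ∈ Icc 1 N, χ (n : ZMod q) * (n : ℂ) ^ (-s))
      + (cmean χ * (N : ℂ) ^ (1 - s) + (s - 1) * Gt χ N s)) hE.differentiableOn ?_ ?_ s hs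
  · rw [hEs s hs1] at key
    have h2 : s - 1 ≠ 0 := sub_ne_zero.2 hs1
    apply mul_left_cancel₀ h2
    rw [key]
    field_simp
  · intro z hz
    apply DifferentiableAt.differentiableWithinAt
    have h1 := Gt_diff χ N hN z hz
    have h2 := poly_diff χ N z
    have h3 : DifferentiableAt ℂ (fun s : ℂ => (N : ℂ) ^ (1 - s)) z :=
      (differentiableAt_id.const_sub 1).const_cpow (Or.inl hN0)
    fun_prop
  · intro z hz
    have hz1 : z ≠ 1 := by rintro rfl; simp at hz
    have h2 : z - 1 ≠ 0 := sub_ne_zero.2 hz1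
    rw [hEs z hz1, L_formula_right χ N hN z hz]
    field_simp

lemma L_formula_ne (hχ : χ ≠ 1) (N : ℕ) (hN : 1 ≤ N) (s : ℂ) (hs : 0 < s.re) :
    LFunction χ s = ∑ n ∈ Icc 1 N, χ (n : ZMod q) * (n : ℂ) ^ (-s) + Gt χ N s := by
  refine ident_half (f := LFunction χ) (g := fun s => ∑ n ∈ Icc 1 N, χ (n : ZMod q) * (n : ℂ) ^ (-s) + Gt χ N s)
    (differentiable_LFunction hχ).differentiableOn ?_ ?_ s hs
  · intro z hz
    apply DifferentiableAt.differentiableWithinAt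
    have h1 := Gt_diff χ N hN z hz
    have h2 := poly_diff χ N z
    fun_prop
  · intro z hz
    rw [L_formula_right χ N hN z hz, cmean_zero χ hχ]
    simp

/-- crude bound -/
lemma L_crude (hχ : χ ≠ 1) (s : ℂ) (hs : 1 / 2 ≤ s.re) : ‖LFunction χ s‖ ≤ 12 * q * ‖s‖ := by
  rw [L_formula_ne χ hχ 1 le_rfl s (by linarith)]
  have hb := Gt_bound χ 1 le_rfl s (by linarith)
  have hq : (1 : ℝ) ≤ q := by exact_mod_cast Nat.pos_of_ne_zero (NeZero.ne q)
  have hs2 : 1 / 2 ≤ ‖s‖ := hs.trans (re_le_norm s)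
  simp only [Nat.cast_one, Real.one_rpow, mul_one] at hb
  have h1 : 5 * q * ‖s‖ / s.re ≤ 10 * q * ‖s‖ := by
    rw [div_le_iff₀ (by linarith)]
    have : 0 ≤ q * ‖s‖ := by positivity
    nlinarith
  have h2 : (1 : ℝ) ≤ 2 * (q * ‖s‖) := by nlinarith
  refine (norm_add_le _ _).trans ?_
  simp only [Icc_self, sum_singleton, Nat.cast_one, map_one, one_cpow, mul_one, norm_one]
  linarith

end lform

/-- conductor-type quantity -/
noncomputable def VV (q : ℕ) (t : ℝ) : ℝ := q * (|t| + 2)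

lemma VV_ge (q : ℕ) [NeZero q] (t : ℝ) : 2 ≤ VV q t := by
  have hq : (1 : ℝ) ≤ q := by exact_mod_cast Nat.pos_of_ne_zero (NeZero.ne q)
  unfold VV
  nlinarith [abs_nonneg t]

lemma L_upper_aux (ε : ℝ) (hε : 0 < ε) (hε4 : ε ≤ 1 / 4) : ∃ C : ℝ, 1 ≤ C ∧
    ∀ (q : ℕ) [NeZero q] (χ : DirichletCharacter ℂ q) (s : ℂ), 1 - ε ≤ s.re → s.re ≤ 4 →
    ∃ N : ℕ, 1 ≤ N ∧ (N : ℝ) ^ ε ≤ C * VV q s.im ^ (2 * ε) ∧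
    ‖∑ n ∈ Icc 1 N, χ (n : ZMod q) * (n : ℂ) ^ (-s)‖ + ‖Gt χ N s‖ ≤ C * VV q s.im ^ (2 * ε) := by
  have hZ : Summable (fun n : ℕ => (n : ℝ) ^ (-1 - ε)) :=
    Real.summable_nat_rpow.2 (by linarith)
  set Z := ∑' n : ℕ, (n : ℝ) ^ (-1 - ε) with hZd
  have hZ0 : 0 ≤ Z := tsum_nonneg fun n => by positivity
  refine ⟨2 * Z + 20, by linarith, ?_⟩
  intro q _ χ s hs hs4
  have hV := VV_ge q s.im
  set V := VV q s.im with hVd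
  have hN1 : V ≤ (⌈V⌉₊ : ℝ) := Nat.le_ceil V
  have hN2 : (⌈V⌉₊ : ℝ) ≤ 2 * V := by
    have := Nat.ceil_lt_add_one (show 0 ≤ V by linarith); linarith
  set N := ⌈V⌉₊
  have hN : 1 ≤ N := by
    have : (1 : ℝ) ≤ N := by linarith
    exact_mod_cast this
  have hNN : (N : ℝ) ^ (2 * ε) ≤ 2 * V ^ (2 * ε) := by
    calc (N : ℝ) ^ (2 * ε) ≤ (2 * V) ^ (2 * ε) := by gcongr
      _ = 2 ^ (2 * ε) * V ^ (2 * ε) := Real.mul_rpow (by norm_num) (by linarith)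
      _ ≤ 2 ^ (1 : ℝ) * V ^ (2 * ε) := by gcongr <;> linarith
      _ = _ := by rw [Real.rpow_one]
  have hVp : 0 ≤ V ^ (2 * ε) := by positivity
  refine ⟨N, hN, ?_, ?_⟩
  · calc (N : ℝ) ^ ε ≤ (N : ℝ) ^ (2 * ε) := by
          apply Real.rpow_le_rpow_of_exponent_le (by exact_mod_cast hN); linarith
      _ ≤ _ := hNN.trans (by gcongr; linarith)
  · have h1 : ‖∑ n ∈ Icc 1 N, χ (n : ZMod q) * (n : ℂ) ^ (-s)‖ ≤ 2 * Z * V ^ (2 * ε) := by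
      calc _ ≤ ∑ n ∈ Icc 1 N, (N : ℝ) ^ (2 * ε) * (n : ℝ) ^ (-1 - ε) := by
            refine (norm_sum_le _ _).trans (sum_le_sum fun n hn => ?_)
            have hn' := mem_Icc.1 hn
            have hn0 : (0 : ℝ) < n := by exact_mod_cast hn'.1
            have hn1 : (1 : ℝ) ≤ n := by exact_mod_cast hn'.1
            have hnN : (n : ℝ) ≤ N := by exact_mod_cast hn'.2
            rw [norm_mul, norm_natCast_cpow_of_pos (by omega)]
            calc _ ≤ 1 * (n : ℝ) ^ (-s).re := by gcongr; exact χ.norm_le_one _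
              _ ≤ (n : ℝ) ^ (2 * ε + (-1 - ε)) := by
                rw [one_mul]
                apply Real.rpow_le_rpow_of_exponent_le hn1
                simp; linarith
              _ = (n : ℝ) ^ (2 * ε) * (n : ℝ) ^ (-1 - ε) := Real.rpow_add hn0 _ _
              _ ≤ _ := by gcongr
        _ = (N : ℝ) ^ (2 * ε) * ∑ n ∈ Icc 1 N, (n : ℝ) ^ (-1 - ε) := by rw [mul_sum]
        _ ≤ (2 * V ^ (2 * ε)) * Z := by
            gcongr
            exact hZ.sum_le_tsum _ (fun n _ => by positivity)
        _ = _ := by ring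
    have hsn : ‖s‖ ≤ 2 * (|s.im| + 2) := by
      refine (norm_le_abs_re_add_abs_im s).trans ?_
      rw [abs_of_nonneg (by linarith)]
      linarith [abs_nonneg s.im]
    have h2 : ‖Gt χ N s‖ ≤ 20 * V ^ (2 * ε) := by
      refine (Gt_bound χ N hN s (by linarith)).trans ?_
      rw [div_le_iff₀ (by linarith)]
      have h3 : (N : ℝ) ^ (-s.re) ≤ V ^ (2 * ε - 1) := by
        calc (N : ℝ) ^ (-s.re) ≤ V ^ (-s.re) :=
              Real.rpow_le_rpow_of_nonpos (by linarith) hN1 (by linarith)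
          _ ≤ _ := Real.rpow_le_rpow_of_exponent_le (by linarith) (by linarith)
      calc 5 * (q : ℝ) * ‖s‖ * (N : ℝ) ^ (-s.re) ≤ 5 * q * (2 * (|s.im| + 2)) * V ^ (2 * ε - 1) := by gcongr
        _ = 10 * (V * V ^ (2 * ε - 1)) := by rw [hVd, VV]; ring
        _ = 10 * V ^ (2 * ε) := by
            rw [Real.rpow_sub_one (by linarith)]; field_simp
        _ ≤ 20 * V ^ (2 * ε) * s.re := by nlinarith
    calc _ ≤ _ := add_le_add h1 h2
      _ = _ := by ring

lemma L_upper (ε : ℝ) (hε : 0 < ε) : ∃ δ > 0, δ ≤ 1 / 4 ∧ ∃ C : ℝ, 1 ≤ C ∧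
    ∀ (q : ℕ) [NeZero q] (χ : DirichletCharacter ℂ q) (s : ℂ), 1 - δ ≤ s.re → s.re ≤ 4 →
    (s ≠ 1 → ‖LFunction χ s‖ ≤ C * VV q s.im ^ ε * (1 + 1 / ‖s - 1‖)) ∧
    (χ ≠ 1 → ‖LFunction χ s‖ ≤ C * VV q s.im ^ ε) := by
  obtain ⟨δ, hδ, hδ4, hδε⟩ : ∃ δ > 0, δ ≤ 1 / 4 ∧ 2 * δ ≤ ε :=
    ⟨min (1 / 4) (ε / 2), by positivity, min_le_left _ _, by linarith [min_le_right (1 / 4) (ε / 2)]⟩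
  obtain ⟨C, hC, h⟩ := L_upper_aux δ hδ hδ4
  refine ⟨δ, hδ, hδ4, C, hC, ?_⟩
  intro q _ χ s hs hs4
  obtain ⟨N, hN, h1, h2⟩ := h q χ s hs hs4
  have hV := VV_ge q s.im
  have hN1 : (1 : ℝ) ≤ N := by exact_mod_cast hN
  have hVV : C * VV q s.im ^ (2 * δ) ≤ C * VV q s.im ^ ε := by
    gcongr; linarith
  refine ⟨fun hs1 => ?_, fun hχ => ?_⟩
  · rw [L_formula χ N hN s (by linarith) hs1]
    have hp : 0 < ‖s - 1‖ := norm_pos_iff.2 (sub_ne_zero.2 hs1)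
    have h3 : ‖cmean χ * (N : ℂ) ^ (1 - s) / (s - 1)‖ ≤ C * VV q s.im ^ ε * (1 / ‖s - 1‖) := by
      rw [norm_div, norm_mul, norm_natCast_cpow_of_pos (by omega), div_eq_mul_one_div]
      refine mul_le_mul_of_nonneg_right ?_ (by positivity)
      calc ‖cmean χ‖ * (N : ℝ) ^ (1 - s).re ≤ 1 * (N : ℝ) ^ δ := by
            gcongr
            · exact cmean_norm χ
            · simp; linarith
        _ ≤ _ := by rw [one_mul]; exact h1.trans hVV
    calc _ ≤ _ := norm_add_le _ _
      _ ≤ _ := add_le_add_right (norm_add_le _ _) _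
      _ ≤ _ := by rw [mul_add, mul_one]; linarith
  · rw [L_formula_ne χ hχ N hN s (by linarith)]
    exact (norm_add_le _ _).trans (h2.trans hVV)

end PQ


namespace PQ
open Finset MeasureTheory Filter Topology Complex
open DirichletCharacter hiding LFunction_ne_zero_of_one_le_re
open scoped ComplexOrder

lemma iter_inv_two (m : ℕ) : iteratedDeriv m (fun s : ℂ => (s - 1)⁻¹) 2 = (-1) ^ m * m.factorial := by
  rw [iteratedDeriv_comp_sub_const (n := m) (f := fun s : ℂ => s⁻¹) (s := 1)]
  have := iteratedDeriv_eq_iterate (n := m) (f := fun s : ℂ => s⁻¹)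
  rw [this]
  have h := iter_deriv_inv' (𝕜 := ℂ) m
  rw [h]
  norm_num

lemma estermann_aux (E : ℂ → ℂ) (hE : Differentiable ℂ E) (f : ℕ → ℂ) (hf : 0 ≤ f) (hf1 : f 1 = 1)
    (hsum : LSeries.abscissaOfAbsConv f ≤ 1)
    (hEf : ∀ s : ℂ, 1 < s.re → E s = (s - 1) * LSeries f s)
    (M : ℝ) (hM : ∀ s : ℂ, ‖s - 2‖ = 3 / 2 → ‖E s‖ ≤ M) (hM1 : ‖E 1‖ ≤ M)
    (β : ℝ) (hβ : 7 / 8 ≤ β) (hβ1 : β < 1)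
    (hz : E β = 0 ∨ ∀ x : ℝ, β ≤ x → x ≤ 2 → E x ≠ 0)
    (m0 : ℕ) (hm0 : 16 * M * (3 / 4) ^ m0 ≤ 1 / 2) :
    (1 - β) / 2 ≤ (E 1).re * (2 - β) ^ m0 := by
  set L := (E 1).re with hL
  have habs : ∀ x : ℝ, 1 < x → LSeries.abscissaOfAbsConv f < x := fun x hx =>
    lt_of_le_of_lt hsum (by exact_mod_cast hx)
  have hpos : ∀ x : ℝ, 1 < x → 0 < LSeries f x := fun x hx =>
    LSeries.positive hf (by rw [hf1]; exact one_pos) (habs x hx)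
  have him : ∀ x : ℝ, 1 < x → (E x).im = 0 := by
    intro x hx
    rw [hEf x (by simpa using hx)]
    have h := (Complex.pos_iff.1 (hpos x hx)).2
    rw [mul_im, ← h]; simp
  have hE1 : E 1 = (L : ℂ) := by
    have hc : Continuous (fun x : ℝ => (E x).im) := by
      have := hE.continuous; fun_prop
    have h1 : (1 : ℝ) ∈ closure (Set.Ioi (1 : ℝ)) := by simp
    have h2 : closure (Set.Ioi (1 : ℝ)) ⊆ {x : ℝ | (E x).im = 0} :=
      closure_minimal (fun x hx => him x hx) (isClosed_eq hc continuous_const)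
    have h3 := h2 h1
    simp only [Set.mem_ofPred_eq, ofReal_one] at h3
    apply Complex.ext
    · simp [hL]
    · simpa using h3
  set H := dslope E 1 with hH
  have hHd : Differentiable ℂ H := by
    have := (differentiableOn_dslope (f := E) (s := Set.univ) (c := 1) univ_mem).2 hE.differentiableOn
    exact differentiableOn_univ.1 this
  have hHs : ∀ s : ℂ, s ≠ 1 → H s = (E s - L) / (s - 1) := by
    intro s hs
    rw [hH, dslope_of_ne _ hs, slope_def_field, hE1]
  -- coefficients
  set b : ℕ → ℝ := fun m => ((-1) ^ m * iteratedDeriv m (LSeries f) 2).re / m.factorial with hb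
  have hder : ∀ m, iteratedDeriv m H 2 = (-1) ^ m * m.factorial * ((b m - L : ℝ) : ℂ) := by
    intro m
    have hev : H =ᶠ[𝓝 2] (fun s => LSeries f s - L * (s - 1)⁻¹) := by
      have : {s : ℂ | 1 < s.re} ∈ 𝓝 (2 : ℂ) :=
        (isOpen_lt continuous_const continuous_re).mem_nhds (by simp)
      filter_upwards [this] with s hs
      have hs1 : s ≠ 1 := by rintro rfl; simp at hs
      have hs2 := sub_ne_zero.2 hs1
      rw [hHs s hs1, hEf s hs]
      field_simp
    rw [hev.iteratedDeriv_eq]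
    have hF : ContDiffAt ℂ m (LSeries f) 2 := by
      have := LSeries_analyticOnNhd f 2 (by
        simpa using habs 2 (by norm_num))
      exact this.contDiffAt
    have hI : ContDiffAt ℂ m (fun s : ℂ => (L : ℂ) * (s - 1)⁻¹) 2 := by
      apply contDiffAt_const.mul
      exact (contDiffAt_id.sub contDiffAt_const).inv (by norm_num)
    have hI' : ContDiffAt ℂ m (fun s : ℂ => (s - 1)⁻¹) 2 :=
      (contDiffAt_id.sub contDiffAt_const).inv (by norm_num)
    rw [iteratedDeriv_fun_sub hF hI, iteratedDeriv_const_mul_field, iter_inv_two]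
    have halt := LSeries.iteratedDeriv_alternating hf (x := 2) (habs 2 (by norm_num)) m
    have h0 := (Complex.nonneg_iff.1 halt).2
    have h2 : (((b m) : ℝ) : ℂ) = ((-1) ^ m * iteratedDeriv m (LSeries f) 2) / m.factorial := by
      apply Complex.ext
      · rw [hb]; simp [div_natCast_re]
      · rw [div_natCast_im]
        rw [ofReal_ofNat] at h0
        rw [← h0]; simp
    have hm : (m.factorial : ℂ) ≠ 0 := by exact_mod_cast m.factorial_ne_zero
    push_cast
    rw [h2]
    field_simp
    have : ((-1 : ℂ) ^ m) * ((-1) ^ m) = 1 := by rw [← mul_pow]; simp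
    linear_combination (iteratedDeriv m (LSeries f) 2) * (-this)
  have hbnn : ∀ m, 0 ≤ b m := by
    intro m
    have halt := LSeries.iteratedDeriv_alternating hf (x := 2) (habs 2 (by norm_num)) m
    have h0 := (Complex.nonneg_iff.1 halt).1
    rw [ofReal_ofNat] at h0
    rw [hb]; positivity
  have hb0 : 1 ≤ b 0 := by
    simp only [hb, pow_zero, one_mul, iteratedDeriv_zero, Nat.factorial_zero, Nat.cast_one, div_one]
    have hs : LSeriesSummable f 2 := LSeriesSummable_of_abscissaOfAbsConv_lt_re (by simpa using habs 2 (by norm_num))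
    have hre := (Complex.hasSum_re hs.hasSum)
    have : (LSeries.term f 2 1).re ≤ (LSeries f 2).re := by
      refine le_hasSum hre 1 fun n _ => ?_
      rw [LSeries.term_def]
      split_ifs with h
      · simp
      · have h1 := (Complex.nonneg_iff.1 (hf n))
        have h2 : ((n : ℂ) ^ (2 : ℂ)) = ((n ^ 2 : ℕ) : ℂ) := by
          rw [show (2 : ℂ) = ((2 : ℕ) : ℂ) by norm_num, cpow_natCast]; push_cast; rfl
        rw [h2, div_natCast_re]
        have := h1.1
        have h3 : 0 ≤ (f n).re := this
        positivity
    simpa [LSeries.term_def, hf1] using this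
  have hMb : ∀ m, |b m - L| ≤ 4 * M * (2 / 3) ^ m := by
    intro m
    have h1 := Complex.norm_iteratedDeriv_le_of_forall_mem_sphere_norm_le (c := 2) (R := 3 / 2) (C := 4 * M) m
      (by norm_num) (hHd.diffContOnCl) (by
        intro z hz'
        have hz2 : ‖z - 2‖ = 3 / 2 := by simpa [dist_eq_norm] using hz'
        have hz1 : 1 / 2 ≤ ‖z - 1‖ := by
          have := norm_sub_norm_le (z - 2) (-1)
          rw [show z - 2 - (-1) = z - 1 by ring, hz2] at this
          norm_num at this; linarith
        have hz3 : z ≠ 1 := by rintro rfl; norm_num at hz1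
        rw [hHs z hz3, norm_div, div_le_iff₀ (by linarith)]
        have h2 := norm_sub_le (E z) (L : ℂ)
        rw [← hE1] at h2 ⊢
        have h3 := hM z hz2
        have hM0 : 0 ≤ M := (norm_nonneg _).trans hM1
        nlinarith)
    rw [hder m, norm_mul, norm_mul, norm_pow, norm_neg, norm_one, one_pow, one_mul, Complex.norm_natCast,
      norm_real, Real.norm_eq_abs] at h1
    have hm : (0 : ℝ) < m.factorial := by exact_mod_cast m.factorial_pos
    have h4 : |b m - L| ≤ 4 * M / (3 / 2) ^ m := by
      rw [mul_div_assoc] at h1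
      exact le_of_mul_le_mul_left h1 hm
    refine h4.trans (le_of_eq ?_)
    rw [div_eq_mul_inv, ← inv_pow]; norm_num
  have hsumC : ∀ x : ℝ, HasSum (fun m => (((b m - L) * (2 - x) ^ m : ℝ) : ℂ)) (H x) := by
    intro x
    have := Complex.hasSum_taylorSeries_of_entire hHd 2 x
    refine this.congr_fun ?_
    intro m
    rw [hder m]
    have hm : (m.factorial : ℂ) ≠ 0 := by exact_mod_cast m.factorial_ne_zero
    simp only [smul_eq_mul]
    push_cast
    rw [show (2 - x : ℂ) = (-1) * (x - 2) by ring, mul_pow]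
    field_simp
  have hHim : ∀ x : ℝ, (H x).im = 0 := by
    intro x
    have := (Complex.hasSum_im (hsumC x))
    simp only [ofReal_im] at this
    exact this.unique hasSum_zero
  have hHre : ∀ x : ℝ, HasSum (fun m => (b m - L) * (2 - x) ^ m) (H x).re := by
    intro x
    have := (Complex.hasSum_re (hsumC x))
    simpa only [ofReal_re] using this
  have hEx : ∀ x : ℝ, x ≠ 1 → E x = ((L + (x - 1) * (H x).re : ℝ) : ℂ) := by
    intro x hx
    have hx' : (x : ℂ) ≠ 1 := by exact_mod_cast hx
    have h1 : ((H x).re : ℂ) = H x := by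
      apply Complex.ext
      · simp
      · simp [hHim x]
    push_cast
    rw [h1, hHs x hx']
    have := sub_ne_zero.2 hx'
    field_simp
    ring
  have hgβ : 0 ≤ (E β).re := by
    rcases hz with hz | hz
    · rw [hz]; simp
    · by_contra hneg
      push Not at hneg
      have hc : ContinuousOn (fun x : ℝ => (E x).re) (Set.Icc β 2) := by
        have := hE.continuous; fun_prop
      have h2 : 0 ≤ (E ((2 : ℝ) : ℂ)).re := by
        rw [hEf _ (by simp)]
        have h := (Complex.pos_iff.1 (hpos 2 (by norm_num))).1
        have h' := (Complex.pos_iff.1 (hpos 2 (by norm_num))).2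
        rw [mul_re, ← h']
        simp at h ⊢
        norm_num
        linarith
      obtain ⟨x, hx, hx0⟩ := intermediate_value_Icc (by linarith) hc ⟨hneg.le, h2⟩
      apply hz x hx.1 hx.2
      by_cases hx1 : x = 1
      · rw [hx1] at hx0 ⊢
        simp only [ofReal_one] at hx0 ⊢
        rw [hE1, hL, hx0]; simp
      · have h3 := hEx x hx1
        simp only at hx0
        rw [h3, ofReal_re] at hx0
        rw [h3, hx0]; simp
  rw [hEx β hβ1.ne, ofReal_re] at hgβ
  -- tail bound
  have htail : |(H β).re - ∑ m ∈ range m0, (b m - L) * (2 - β) ^ m| ≤ 1 / 2 := by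
    have h1 := (hasSum_nat_add_iff' m0).2 (hHre β)
    have h2 : HasSum (fun m : ℕ => (4 * M * (3 / 4) ^ m0) * (3 / 4 : ℝ) ^ m) ((4 * M * (3 / 4) ^ m0) * 4) := by
      apply HasSum.mul_left
      have := hasSum_geometric_of_lt_one (r := (3 / 4 : ℝ)) (by norm_num) (by norm_num)
      rwa [show (1 - 3 / 4 : ℝ)⁻¹ = 4 by norm_num] at this
    have h3 := h1.norm_le_of_bounded h2 (by
      intro m
      rw [norm_mul, Real.norm_eq_abs, Real.norm_eq_abs, abs_of_nonneg (show 0 ≤ (2 - β) ^ (m + m0) by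
        apply pow_nonneg; linarith)]
      calc _ ≤ 4 * M * (2 / 3) ^ (m + m0) * (9 / 8) ^ (m + m0) := by
            have := hMb (m + m0)
            have hM0 : 0 ≤ M := (norm_nonneg _).trans hM1
            have hβ0 : 0 ≤ 2 - β := by linarith
            have hβ9 : 2 - β ≤ 9 / 8 := by linarith
            gcongr
        _ = 4 * M * (3 / 4) ^ (m + m0) := by
            rw [mul_assoc, ← mul_pow]; norm_num
        _ = _ := by rw [pow_add]; ring)
    rw [Real.norm_eq_abs] at h3
    linarith
  have hhead : 1 - L * (((2 - β) ^ m0 - 1) / (1 - β)) ≤ ∑ m ∈ range m0, (b m - L) * (2 - β) ^ m := by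
    have hgeo : ∑ m ∈ range m0, (2 - β) ^ m = ((2 - β) ^ m0 - 1) / (1 - β) := by
      rw [geom_sum_eq (by linarith)]; congr 1; ring
    rw [← hgeo]
    simp only [sub_mul, sum_sub_distrib, ← mul_sum]
    have hm0' : m0 ≠ 0 := by
      rintro rfl
      have h2 := hMb 0
      have h5 : 0 ≤ M := (norm_nonneg _).trans hM1
      have h6 : |L| ≤ M := by
        have := hM1; rw [hE1, norm_real] at this; exact this
      have h7 := abs_le.1 h6
      have h8 := abs_le.1 h2
      norm_num at h2 hm0
      norm_num at h8
      linarith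
    have : 1 ≤ ∑ m ∈ range m0, b m * (2 - β) ^ m := by
      calc 1 ≤ b 0 * (2 - β) ^ 0 := by simpa using hb0
        _ ≤ _ := single_le_sum (f := fun m => b m * (2 - β) ^ m)
          (fun m _ => mul_nonneg (hbnn m) (pow_nonneg (by linarith) _)) (mem_range.2 (Nat.pos_of_ne_zero hm0'))
    linarith
  have h1 := abs_le.1 htail
  have h2 : 1 / 2 - L * (((2 - β) ^ m0 - 1) / (1 - β)) ≤ (H β).re := by linarith
  have h3 : (1 - β) * (1 / 2 - L * (((2 - β) ^ m0 - 1) / (1 - β))) ≤ (1 - β) * (H β).re :=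
    mul_le_mul_of_nonneg_left h2 (by linarith)
  have h4 : (1 - β) * (1 / 2 - L * (((2 - β) ^ m0 - 1) / (1 - β))) = (1 - β) / 2 - L * ((2 - β) ^ m0 - 1) := by
    have : 1 - β ≠ 0 := by linarith
    field_simp
  rw [h4] at h3
  linarith

lemma estermann (E : ℂ → ℂ) (hE : Differentiable ℂ E) (f : ℕ → ℂ) (hf : 0 ≤ f) (hf1 : f 1 = 1)
    (hsum : LSeries.abscissaOfAbsConv f ≤ 1)
    (hEf : ∀ s : ℂ, 1 < s.re → E s = (s - 1) * LSeries f s)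
    (M : ℝ) (hM : ∀ s : ℂ, ‖s - 2‖ = 3 / 2 → ‖E s‖ ≤ M) (hM1 : ‖E 1‖ ≤ M) (hM2 : 1 ≤ M)
    (β : ℝ) (hβ : 7 / 8 ≤ β) (hβ1 : β < 1)
    (hz : E β = 0 ∨ ∀ x : ℝ, β ≤ x → x ≤ 2 → E x ≠ 0) :
    (1 - β) / 8 * (32 * M) ^ (-4 * (1 - β)) ≤ ‖E 1‖ := by
  set y := Real.log (32 * M) with hy
  have hy0 : 0 ≤ y := Real.log_nonneg (by linarith)
  set m0 := ⌈4 * y⌉₊ with hm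
  have h1 : 4 * y ≤ m0 := Nat.le_ceil _
  have h2 : (m0 : ℝ) ≤ 4 * y + 1 := (Nat.ceil_lt_add_one (by linarith)).le
  have hlog : Real.log (3 / 4) ≤ - (1 / 4) := by
    have := Real.log_le_sub_one_of_pos (show (0 : ℝ) < 3 / 4 by norm_num); linarith
  have h3 : 16 * M * (3 / 4 : ℝ) ^ m0 ≤ 1 / 2 := by
    have h4 : (3 / 4 : ℝ) ^ m0 ≤ 1 / (32 * M) := by
      rw [← Real.exp_log (show (0 : ℝ) < 3 / 4 by norm_num), ← Real.exp_nat_mul,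
        ← Real.exp_log (show 0 < 32 * M by linarith), ← hy, one_div, ← Real.exp_neg]
      apply Real.exp_le_exp.2
      nlinarith
    calc 16 * M * (3 / 4 : ℝ) ^ m0 ≤ 16 * M * (1 / (32 * M)) := by gcongr
      _ = 1 / 2 := by field_simp; norm_num
  have h := estermann_aux E hE f hf hf1 hsum hEf M hM hM1 β hβ hβ1 hz m0 h3
  have h5 : (2 - β) ^ m0 ≤ 3 * (32 * M) ^ (4 * (1 - β)) := by
    have : 2 - β ≤ Real.exp (1 - β) := by have := Real.add_one_le_exp (1 - β); linarith
    calc (2 - β) ^ m0 ≤ Real.exp (1 - β) ^ m0 := by gcongr; linarith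
      _ = Real.exp (m0 * (1 - β)) := by rw [Real.exp_nat_mul]
      _ ≤ Real.exp (1 + y * (4 * (1 - β))) := by
          apply Real.exp_le_exp.2; nlinarith
      _ = Real.exp 1 * (32 * M) ^ (4 * (1 - β)) := by
          rw [Real.exp_add, Real.rpow_def_of_pos (by linarith)]
      _ ≤ _ := by gcongr; exact (Real.exp_one_lt_d9.trans (by norm_num)).le
  have h6 : (E 1).re ≤ ‖E 1‖ := re_le_norm _
  have hp : 0 < (32 * M) ^ (4 * (1 - β)) := Real.rpow_pos_of_pos (by linarith) _
  rw [show -4 * (1 - β) = -(4 * (1 - β)) by ring, Real.rpow_neg (by linarith), ← div_eq_mul_inv, div_le_iff₀ hp]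
  have h7 : (E 1).re * (2 - β) ^ m0 ≤ ‖E 1‖ * (3 * (32 * M) ^ (4 * (1 - β))) := by
    have : 0 ≤ (2 - β) ^ m0 := pow_nonneg (by linarith) _
    calc _ ≤ ‖E 1‖ * (2 - β) ^ m0 := by gcongr
      _ ≤ _ := by gcongr
  have h8 : 0 ≤ ‖E 1‖ * (32 * M) ^ (4 * (1 - β)) := by positivity
  nlinarith

end PQ


namespace PQ
open Finset MeasureTheory Filter Topology Complex
open DirichletCharacter hiding LFunction_ne_zero_of_one_le_re
open scoped ComplexOrder
open ArithmeticFunction (vonMangoldt)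

/-- character as an arithmetic function -/
noncomputable def cf {q : ℕ} (χ : DirichletCharacter ℂ q) : ArithmeticFunction ℂ :=
  ⟨fun n => if n = 0 then 0 else χ (n : ZMod q), by simp⟩

noncomputable def cl {q : ℕ} (χ : DirichletCharacter ℂ q) : ArithmeticFunction ℂ :=
  ⟨fun n => χ (n : ZMod q) * (vonMangoldt n : ℂ), by simp⟩

noncomputable def Dl (f : ArithmeticFunction ℂ) : ArithmeticFunction ℂ :=
  ⟨fun n => f n * (Real.log n : ℂ), by simp⟩

lemma cf_apply {q : ℕ} (χ : DirichletCharacter ℂ q) {n : ℕ} (h : n ≠ 0) : cf χ n = χ (n : ZMod q) := by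
  simp [cf, h]

lemma Dl_mul (f g : ArithmeticFunction ℂ) : Dl (f * g) = Dl f * g + f * Dl g := by
  ext n
  rw [ArithmeticFunction.add_apply, ArithmeticFunction.mul_apply, ArithmeticFunction.mul_apply, ← sum_add_distrib]
  change (f * g) n * _ = _
  rw [ArithmeticFunction.mul_apply, sum_mul]
  apply sum_congr rfl
  intro x hx
  obtain ⟨h1, h2⟩ := Nat.mem_divisorsAntidiagonal.1 hx
  have h3 : x.1 ≠ 0 := by rintro h; rw [h] at h1; simp at h1; exact h2 h1.symm
  have h4 : x.2 ≠ 0 := by rintro h; rw [h] at h1; simp at h1; exact h2 h1.symm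
  have h5 : Real.log n = Real.log x.1 + Real.log x.2 := by
    rw [← h1]; push_cast
    exact Real.log_mul (by exact_mod_cast h3) (by exact_mod_cast h4)
  change _ = f x.1 * _ * g x.2 + f x.1 * (g x.2 * _)
  rw [h5]; push_cast; ring

lemma Dl_cf {q : ℕ} (χ : DirichletCharacter ℂ q) : Dl (cf χ) = cf χ * cl χ := by
  ext n
  change cf χ n * _ = _
  rw [ArithmeticFunction.mul_apply]
  rcases eq_or_ne n 0 with rfl | hn
  · simp
  have h := ArithmeticFunction.vonMangoldt_sum (n := n)
  rw [cf_apply _ hn, ← h]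
  push_cast
  rw [mul_sum, ← Nat.map_div_left_divisors, sum_map]
  apply sum_congr rfl
  intro d hd
  have hdn := Nat.dvd_of_mem_divisors hd
  have hd0 : n / d ≠ 0 := by
    have := Nat.div_pos (Nat.divisor_le hd) (Nat.pos_of_mem_divisors hd); omega
  change _ = cf χ (n / d) * (χ (d : ZMod q) * (vonMangoldt d : ℂ))
  rw [cf_apply _ hd0]
  rw [← mul_assoc, ← map_mul, ← Nat.cast_mul, Nat.div_mul_cancel hdn]

lemma nonneg_of_Dl (f d : ArithmeticFunction ℂ) (hf1 : f 1 = 1) (h : Dl f = f * d) (hd : ∀ n, 0 ≤ d n)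
    (hd1 : d 1 = 0) : ∀ n, 0 ≤ f n := by
  intro n
  induction n using Nat.strong_induction_on with
  | _ n ih =>
    rcases Nat.lt_or_ge n 2 with hn | hn
    · interval_cases n
      · simp
      · rw [hf1]; exact zero_le_one
    · have h1 : f n * (Real.log n : ℂ) = (f * d) n := by rw [← h]; rfl
      have h2 : 0 ≤ (f * d) n := by
        rw [ArithmeticFunction.mul_apply]
        apply sum_nonneg
        intro x hx
        obtain ⟨h3, h4⟩ := Nat.mem_divisorsAntidiagonal.1 hx
        by_cases hx2 : x.2 = 1
        · rw [hx2, hd1, mul_zero]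
        · apply mul_nonneg _ (hd _)
          apply ih
          rw [← h3]
          have : x.1 ≠ 0 := by rintro h; rw [h] at h3; simp at h3; omega
          have : x.2 ≠ 0 := by rintro h; rw [h] at h3; simp at h3; omega
          have : 2 ≤ x.2 := by omega
          nlinarith [Nat.pos_of_ne_zero ‹x.1 ≠ 0›]
      have hl : 0 < Real.log n := Real.log_pos (by exact_mod_cast hn)
      have h5 : f n = (f * d) n * ((Real.log n)⁻¹ : ℝ) := by
        have : (Real.log n : ℂ) ≠ 0 := by exact_mod_cast hl.ne'
        rw [← h1, ofReal_inv, mul_assoc, mul_inv_cancel₀ this, mul_one]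
      rw [h5]
      apply mul_nonneg h2
      exact_mod_cast (inv_pos.2 hl).le

lemma real_val {q : ℕ} {χ : DirichletCharacter ℂ q} (hχ : χ ^ 2 = 1) (n : ZMod q) :
    χ n = 0 ∨ χ n = 1 ∨ χ n = -1 := MulChar.isQuadratic_iff_sq_eq_one.mpr hχ n

lemma cf_one {q : ℕ} (χ : DirichletCharacter ℂ q) : cf χ 1 = 1 := by simp [cf]

lemma cl_one {q : ℕ} (χ : DirichletCharacter ℂ q) : cl χ 1 = 0 := by simp [cl]

lemma mul_one_apply' (f g : ArithmeticFunction ℂ) : (f * g) 1 = f 1 * g 1 := by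
  simp [ArithmeticFunction.mul_apply]

lemma one_add_nonneg {z : ℂ} (hz : z = 0 ∨ z = 1 ∨ z = -1) : 0 ≤ 1 + z := by
  rcases hz with rfl | rfl | rfl
  · simp
  · norm_num
  · simp

lemma nonnegA {q : ℕ} {χ : DirichletCharacter ℂ q} (hχ : χ ^ 2 = 1) :
    ∀ n, 0 ≤ (cf (1 : DirichletCharacter ℂ 1) * cf χ) n := by
  apply nonneg_of_Dl _ (cl (1 : DirichletCharacter ℂ 1) + cl χ)
  · rw [mul_one_apply', cf_one, cf_one, one_mul]
  · rw [Dl_mul, Dl_cf, Dl_cf]; ring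
  · intro n
    rw [ArithmeticFunction.add_apply]
    change 0 ≤ (1 : DirichletCharacter ℂ 1) n * (vonMangoldt n : ℂ) + χ (n : ZMod q) * (vonMangoldt n : ℂ)
    rw [MulChar.one_apply (isUnit_of_subsingleton _), ← add_mul]
    apply mul_nonneg (one_add_nonneg (real_val hχ _))
    exact_mod_cast ArithmeticFunction.vonMangoldt_nonneg
  · rw [ArithmeticFunction.add_apply, cl_one, cl_one, add_zero]

lemma nonnegB {q : ℕ} {χ ψ : DirichletCharacter ℂ q} (hχ : χ ^ 2 = 1) (hψ : ψ ^ 2 = 1) :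
    ∀ n, 0 ≤ (cf (1 : DirichletCharacter ℂ 1) * cf χ * cf ψ * cf (χ * ψ)) n := by
  apply nonneg_of_Dl _ (cl (1 : DirichletCharacter ℂ 1) + cl χ + cl ψ + cl (χ * ψ))
  · simp [mul_one_apply', cf_one]
  · rw [Dl_mul, Dl_mul, Dl_mul, Dl_cf, Dl_cf, Dl_cf, Dl_cf]; ring
  · intro n
    simp only [ArithmeticFunction.add_apply]
    change 0 ≤ (1 : DirichletCharacter ℂ 1) n * (vonMangoldt n : ℂ) + χ (n : ZMod q) * (vonMangoldt n : ℂ)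
      + ψ (n : ZMod q) * (vonMangoldt n : ℂ) + (χ * ψ) (n : ZMod q) * (vonMangoldt n : ℂ)
    rw [MulChar.one_apply (isUnit_of_subsingleton _), MulChar.mul_apply]
    have : 1 * (vonMangoldt n : ℂ) + χ (n : ZMod q) * (vonMangoldt n : ℂ)
      + ψ (n : ZMod q) * (vonMangoldt n : ℂ) + (χ n * ψ (n : ZMod q)) * (vonMangoldt n : ℂ)
      = (1 + χ (n : ZMod q)) * (1 + ψ (n : ZMod q)) * (vonMangoldt n : ℂ) := by ring
    rw [this]
    apply mul_nonneg (mul_nonneg (one_add_nonneg (real_val hχ _)) (one_add_nonneg (real_val hψ _)))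
    exact_mod_cast ArithmeticFunction.vonMangoldt_nonneg
  · simp [cl_one]

lemma cf_LSeries {q : ℕ} [NeZero q] (χ : DirichletCharacter ℂ q) {s : ℂ} (hs : 1 < s.re) :
    LSeriesHasSum (cf χ) s (LFunction χ s) := by
  rw [LFunction_eq_LSeries χ hs]
  have := (LSeriesSummable_of_one_lt_re χ hs).LSeriesHasSum
  refine (LSeriesHasSum_congr s _ ?_).1 this
  intro n hn
  rw [cf_apply _ hn]

lemma absc_le {f : ℕ → ℂ} (h : ∀ s : ℂ, 1 < s.re → LSeriesSummable f s) :
    LSeries.abscissaOfAbsConv f ≤ 1 := by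
  have := LSeries.abscissaOfAbsConv_le_of_forall_lt_LSeriesSummable (f := f) (x := 1)
    (fun y hy => h y (by simpa using hy))
  simpa using this

/-- regularized zeta -/
noncomputable def Zr : ℂ → ℂ := LFunctionTrivChar₁ 1

lemma Zr_diff : Differentiable ℂ Zr := differentiable_LFunctionTrivChar₁ 1

lemma Zr_one : Zr 1 = 1 := by simp [Zr]

lemma Zr_apply {s : ℂ} (hs : s ≠ 1) : Zr s = (s - 1) * LFunction (1 : DirichletCharacter ℂ 1) s := by
  rw [Zr, LFunctionTrivChar₁, Function.update_of_ne hs]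

lemma Zr_ne_zero {s : ℂ} (hs : 1 ≤ s.re) : Zr s ≠ 0 := by
  by_cases h : s = 1
  · rw [h, Zr_one]; exact one_ne_zero
  · rw [Zr_apply h]
    exact mul_ne_zero (sub_ne_zero.2 h) (DirichletCharacter.LFunction_ne_zero_of_one_le_re _ (Or.inr h) hs)

lemma Zr_near : ∃ ε > 0, ∀ x : ℝ, 1 - ε ≤ x → Zr x ≠ 0 := by
  have h1 : ∀ᶠ x : ℝ in 𝓝 1, Zr x ≠ 0 := by
    have hc : ContinuousAt (fun x : ℝ => Zr x) 1 := by
      have := Zr_diff.continuous; fun_prop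
    apply hc.eventually_ne
    simp [Zr_one]
  obtain ⟨δ, hδ, h⟩ := Metric.eventually_nhds_iff.1 h1
  refine ⟨δ / 2, by positivity, fun x hx => ?_⟩
  by_cases hx1 : 1 ≤ x
  · exact Zr_ne_zero (by simpa using hx1)
  · apply h
    rw [Real.dist_eq, abs_lt]; constructor <;> linarith

lemma Zr_bound : ∃ K : ℝ, 1 ≤ K ∧ ∀ s : ℂ, ‖s - 2‖ ≤ 3 / 2 → ‖Zr s‖ ≤ K := by
  obtain ⟨K, hK⟩ := (isCompact_closedBall (2 : ℂ) (3 / 2)).exists_bound_of_continuousOn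
    Zr_diff.continuous.continuousOn
  exact ⟨max K 1, le_max_right _ _, fun s hs => (hK s (by simpa [dist_eq_norm] using hs)).trans (le_max_left _ _)⟩

lemma prod_one_sub_ge (S : Finset ℕ) : (∀ p ∈ S, 2 ≤ p) → 1 / ((#S : ℝ) + 1) ≤ ∏ p ∈ S, (1 - 1 / (p : ℝ)) := by
  induction S using Finset.induction_on_max with
  | empty => intro _; simp
  | insert a s ha ih =>
    intro h
    have has : a ∉ s := fun h' => (lt_irrefl a (ha a h')).elim
    rw [prod_insert has, card_insert_of_notMem has]
    have h1 := ih (fun p hp => h p (mem_insert_of_mem hp))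
    have h2 : #s + 2 ≤ a := by
      have hsub : s ⊆ Finset.Ico 2 a := fun p hp =>
        mem_Ico.2 ⟨h p (mem_insert_of_mem hp), ha p hp⟩
      have := card_le_card hsub
      rw [Nat.card_Ico] at this
      have := h a (mem_insert_self _ _)
      omega
    have h2' : (#s : ℝ) + 2 ≤ a := by exact_mod_cast h2
    have hs0 : (0 : ℝ) ≤ #s := by positivity
    push_cast
    have h3 : 1 - 1 / ((#s : ℝ) + 2) ≤ 1 - 1 / (a : ℝ) := by gcongr
    have h4 : (0 : ℝ) ≤ 1 - 1 / ((#s : ℝ) + 2) := by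
      rw [sub_nonneg, div_le_one (by linarith)]; linarith
    calc 1 / ((#s : ℝ) + 1 + 1) = (1 - 1 / ((#s : ℝ) + 2)) * (1 / ((#s : ℝ) + 1)) := by
          field_simp; ring
      _ ≤ _ := mul_le_mul h3 h1 (by positivity) (h4.trans h3)

lemma omega_bound (ε : ℝ) (hε : 0 < ε) : ∃ C : ℝ, 1 ≤ C ∧ ∀ n : ℕ, n ≠ 0 → (#n.primeFactors : ℝ) + 1 ≤ C * (n : ℝ) ^ ε := by
  refine ⟨2 / ε + 1, by have : 0 < 2 / ε := by positivity
                        linarith, fun n hn => ?_⟩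
  have hn1 : (1 : ℝ) ≤ n := by exact_mod_cast Nat.pos_of_ne_zero hn
  have h1 : 2 ^ #n.primeFactors ≤ n := by
    calc 2 ^ #n.primeFactors = ∏ p ∈ n.primeFactors, 2 := by simp
      _ ≤ ∏ p ∈ n.primeFactors, p := prod_le_prod' fun p hp => (Nat.prime_of_mem_primeFactors hp).two_le
      _ ≤ n := Nat.le_of_dvd (Nat.pos_of_ne_zero hn) (Nat.prod_primeFactors_dvd n)
  have h2 : (#n.primeFactors : ℝ) * Real.log 2 ≤ Real.log n := by
    rw [← Real.log_pow]
    apply Real.log_le_log (by positivity)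
    exact_mod_cast h1
  have h3 : Real.log n ≤ (n : ℝ) ^ ε / ε := Real.log_le_rpow_div (by linarith) hε
  have h4 := Real.log_two_gt_d9
  have h5 : (#n.primeFactors : ℝ) ≤ 2 * ((n : ℝ) ^ ε / ε) := by
    have : (0 : ℝ) ≤ #n.primeFactors := by positivity
    nlinarith
  have h6 : 1 ≤ (n : ℝ) ^ ε := Real.one_le_rpow hn1 hε.le
  calc _ ≤ 2 * ((n : ℝ) ^ ε / ε) + (n : ℝ) ^ ε := by linarith
    _ = _ := by ring

lemma euler_factors (ε : ℝ) (hε : 0 < ε) : ∃ C : ℝ, 1 ≤ C ∧ ∀ (n q : ℕ) (χ : DirichletCharacter ℂ q), n ≠ 0 →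
    ‖∏ p ∈ n.primeFactors, (1 - χ (p : ZMod q) * (p : ℂ) ^ (-1 : ℂ))‖ ≤ C * (n : ℝ) ^ ε ∧
    1 ≤ C * (n : ℝ) ^ ε * ‖∏ p ∈ n.primeFactors, (1 - χ (p : ZMod q) * (p : ℂ) ^ (-1 : ℂ))‖ := by
  obtain ⟨C, hC, h⟩ := omega_bound ε hε
  refine ⟨C, hC, fun n q χ hn => ?_⟩
  have hS := prod_one_sub_ge n.primeFactors (fun p hp => (Nat.prime_of_mem_primeFactors hp).two_le)
  have hω : (0 : ℝ) < (#n.primeFactors : ℝ) + 1 := by positivity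
  have hx : ∀ p ∈ n.primeFactors, ‖χ (p : ZMod q) * (p : ℂ) ^ (-1 : ℂ)‖ ≤ 1 / (p : ℝ) := by
    intro p hp
    rw [cpow_neg_one, norm_mul, norm_inv, Complex.norm_natCast, one_div]
    have := χ.norm_le_one (p : ZMod q)
    have h0 : 0 ≤ (p : ℝ)⁻¹ := by positivity
    nlinarith
  have hp0 : ∀ p ∈ n.primeFactors, 1 / (p : ℝ) ≤ 1 / 2 := by
    intro p hp
    have : (2 : ℝ) ≤ p := by exact_mod_cast (Nat.prime_of_mem_primeFactors hp).two_le
    gcongr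
  have hpos : 0 < ∏ p ∈ n.primeFactors, (1 - 1 / (p : ℝ)) :=
    prod_pos fun p hp => by linarith [hp0 p hp]
  rw [norm_prod]
  constructor
  · refine le_trans ?_ (h n hn)
    calc _ ≤ ∏ p ∈ n.primeFactors, (1 - 1 / (p : ℝ))⁻¹ := by
          apply Finset.prod_le_prod (fun p _ => norm_nonneg _)
          intro p hp
          have h1 := hp0 p hp
          have h2 := hx p hp
          have h3 : 0 ≤ 1 / (p : ℝ) := by positivity
          refine (norm_sub_le _ _).trans ?_
          rw [norm_one, inv_eq_one_div, le_div_iff₀ (by linarith)]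
          nlinarith
      _ = (∏ p ∈ n.primeFactors, (1 - 1 / (p : ℝ)))⁻¹ := by rw [prod_inv_distrib]
      _ ≤ _ := by
          rw [inv_le_comm₀ hpos hω]
          simpa using hS
  · have h1 : ∏ p ∈ n.primeFactors, (1 - 1 / (p : ℝ)) ≤ ∏ p ∈ n.primeFactors, ‖1 - χ (p : ZMod q) * (p : ℂ) ^ (-1 : ℂ)‖ := by
      apply Finset.prod_le_prod
      · intro p hp; linarith [hp0 p hp]
      · intro p hp
        have h2 := norm_sub_norm_le (1 : ℂ) (χ (p : ZMod q) * (p : ℂ) ^ (-1 : ℂ))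
        rw [norm_one] at h2
        linarith [hx p hp]
    have h2 := hS.trans h1
    rw [div_le_iff₀ hω] at h2
    have h3 := h n hn
    have h4 : 0 ≤ ∏ p ∈ n.primeFactors, ‖1 - χ (p : ZMod q) * (p : ℂ) ^ (-1 : ℂ)‖ := prod_nonneg fun _ _ => norm_nonneg _
    nlinarith

end PQ


namespace PQ
open Finset MeasureTheory Filter Topology Complex
open DirichletCharacter hiding LFunction_ne_zero_of_one_le_re
open scoped ComplexOrder
open ArithmeticFunction (vonMangoldt)

lemma circ_re {s : ℂ} (hs : ‖s - 2‖ = 3 / 2) : 1 / 2 ≤ s.re ∧ ‖s‖ ≤ 7 / 2 := by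
  constructor
  · have := (abs_re_le_norm (s - 2))
    rw [hs, abs_le] at this
    simp at this; linarith
  · calc ‖s‖ = ‖(s - 2) + 2‖ := by ring_nf
      _ ≤ ‖s - 2‖ + ‖(2 : ℂ)‖ := norm_add_le _ _
      _ = 7 / 2 := by rw [hs]; norm_num

lemma circ_L {q : ℕ} [NeZero q] {χ : DirichletCharacter ℂ q} (hχ : χ ≠ 1) {s : ℂ} (hs : ‖s - 2‖ = 3 / 2 ∨ s = 1) :
    ‖LFunction χ s‖ ≤ 42 * q := by
  have hq : (0 : ℝ) ≤ q := by positivity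
  have h : 1 / 2 ≤ s.re ∧ ‖s‖ ≤ 7 / 2 := by
    rcases hs with hs | rfl
    · exact circ_re hs
    · norm_num
  have := L_crude χ hχ s h.1
  nlinarith [h.2]

lemma hsum_one {s : ℂ} (hs : 1 < s.re) : LSeriesHasSum (cf (1 : DirichletCharacter ℂ 1)) s (LFunction (1 : DirichletCharacter ℂ 1) s) :=
  cf_LSeries 1 hs

lemma siegelA {q : ℕ} [NeZero q] {χ : DirichletCharacter ℂ q} (hχ : χ ≠ 1) (hχ2 : χ ^ 2 = 1)
    (K : ℝ) (hK1 : 1 ≤ K) (hK : ∀ s : ℂ, ‖s - 2‖ ≤ 3 / 2 → ‖Zr s‖ ≤ K)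
    (β : ℝ) (hβ : 7 / 8 ≤ β) (hβ1 : β < 1) (hz : ∀ x : ℝ, β ≤ x → Zr x ≠ 0)
    (hL : ∀ x : ℝ, β ≤ x → x < 1 → LFunction χ x ≠ 0) :
    (1 - β) / 8 * (32 * (K * (42 * q))) ^ (-4 * (1 - β)) ≤ ‖LFunction χ 1‖ := by
  have hq1 : (1 : ℝ) ≤ q := by exact_mod_cast Nat.pos_of_ne_zero (NeZero.ne q)
  have key := estermann (fun s => Zr s * LFunction χ s) (Zr_diff.mul (differentiable_LFunction hχ))
    (cf (1 : DirichletCharacter ℂ 1) * cf χ : ArithmeticFunction ℂ) (nonnegA hχ2) (by rw [mul_one_apply', cf_one, cf_one, one_mul])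
    (absc_le fun s hs => (ArithmeticFunction.LSeriesHasSum_mul (hsum_one hs) (cf_LSeries χ hs)).LSeriesSummable)
    (by
      intro s hs
      have hs1 : s ≠ 1 := by rintro rfl; simp at hs
      rw [(ArithmeticFunction.LSeriesHasSum_mul (hsum_one hs) (cf_LSeries χ hs)).LSeries_eq, Zr_apply hs1]
      ring)
    (K * (42 * q))
    (by
      intro s hs
      rw [norm_mul]
      exact mul_le_mul (hK s hs.le) (circ_L hχ (Or.inl hs)) (norm_nonneg _) (by linarith))
    (by
      rw [norm_mul]
      exact mul_le_mul (hK 1 (by norm_num)) (circ_L hχ (Or.inr rfl)) (norm_nonneg _) (by linarith))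
    (by nlinarith) β hβ hβ1
    (Or.inr fun x hx hx2 => mul_ne_zero (hz x hx) (by
      by_cases h : x < 1
      · exact hL x hx h
      · exact DirichletCharacter.LFunction_ne_zero_of_one_le_re _ (Or.inl hχ) (by simpa using h)))
  simpa [Zr_one] using key

lemma siegelB {q : ℕ} [NeZero q] {χ ψ : DirichletCharacter ℂ q} (hχ : χ ≠ 1) (hχ2 : χ ^ 2 = 1)
    (hψ : ψ ≠ 1) (hψ2 : ψ ^ 2 = 1) (hχψ : χ * ψ ≠ 1)
    (K : ℝ) (hK1 : 1 ≤ K) (hK : ∀ s : ℂ, ‖s - 2‖ ≤ 3 / 2 → ‖Zr s‖ ≤ K)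
    (β : ℝ) (hβ : 7 / 8 ≤ β) (hβ1 : β < 1)
    (hL : LFunction χ β = 0) :
    (1 - β) / 8 * (32 * (K * (42 * q) ^ 3)) ^ (-4 * (1 - β)) ≤ ‖LFunction χ 1‖ * ‖LFunction ψ 1‖ * ‖LFunction (χ * ψ) 1‖ := by
  have hq1 : (1 : ℝ) ≤ q := by exact_mod_cast Nat.pos_of_ne_zero (NeZero.ne q)
  have hb : ∀ s : ℂ, (‖s - 2‖ = 3 / 2 ∨ s = 1) → ‖Zr s * LFunction χ s * LFunction ψ s * LFunction (χ * ψ) s‖ ≤ K * (42 * q) ^ 3 := by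
    intro s hs
    have h1 : ‖Zr s‖ ≤ K := hK s (by
      rcases hs with hs | rfl
      · exact hs.le
      · norm_num)
    rw [norm_mul, norm_mul, norm_mul]
    calc _ ≤ K * (42 * q) * (42 * q) * (42 * q) := by
          gcongr <;> exact circ_L ‹_› hs
      _ = _ := by ring
  have hs4 : ∀ s : ℂ, 1 < s.re → LSeriesHasSum (cf (1 : DirichletCharacter ℂ 1) * cf χ * cf ψ * cf (χ * ψ) : ArithmeticFunction ℂ) s
      (LFunction (1 : DirichletCharacter ℂ 1) s * LFunction χ s * LFunction ψ s * LFunction (χ * ψ) s) := by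
    intro s hs
    exact ArithmeticFunction.LSeriesHasSum_mul (ArithmeticFunction.LSeriesHasSum_mul
      (ArithmeticFunction.LSeriesHasSum_mul (hsum_one hs) (cf_LSeries χ hs)) (cf_LSeries ψ hs)) (cf_LSeries _ hs)
  have key := estermann (fun s => Zr s * LFunction χ s * LFunction ψ s * LFunction (χ * ψ) s)
    (((Zr_diff.mul (differentiable_LFunction hχ)).mul (differentiable_LFunction hψ)).mul (differentiable_LFunction hχψ))
    (cf (1 : DirichletCharacter ℂ 1) * cf χ * cf ψ * cf (χ * ψ) : ArithmeticFunction ℂ) (nonnegB hχ2 hψ2)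
    (by simp [mul_one_apply', cf_one])
    (absc_le fun s hs => (hs4 s hs).LSeriesSummable)
    (by
      intro s hs
      have hs1 : s ≠ 1 := by rintro rfl; simp at hs
      rw [(hs4 s hs).LSeries_eq, Zr_apply hs1]
      ring)
    (K * (42 * q) ^ 3)
    (fun s hs => hb s (Or.inl hs)) (hb 1 (Or.inr rfl))
    (by
      have : (1 : ℝ) ≤ (42 * q) ^ 3 := one_le_pow₀ (by linarith)
      nlinarith) β hβ hβ1
    (Or.inl (by simp [hL]))
  simpa [Zr_one] using key

/-- Siegel's theorem. -/
theorem siegel (ε : ℝ) (hε : 0 < ε) : ∃ c : ℝ, 0 < c ∧ ∀ (q : ℕ) [NeZero q] (χ : DirichletCharacter ℂ q),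
    χ ≠ 1 → χ ^ 2 = 1 → c * (q : ℝ) ^ (-ε) ≤ ‖LFunction χ 1‖ := by
  obtain ⟨ε0, hε0, hZ⟩ := Zr_near
  obtain ⟨K, hK1, hK⟩ := Zr_bound
  set d := min (ε / 15) (min (1 / 8) ε0) with hd
  have hd0 : 0 < d := by positivity
  have hd1 : 15 * d ≤ ε := by have := min_le_left (ε / 15) (min (1 / 8) ε0); linarith
  have hd2 : d ≤ 1 / 8 := (min_le_right _ _).trans (min_le_left _ _)
  have hd3 : d ≤ ε0 := (min_le_right _ _).trans (min_le_right _ _)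
  clear_value d
  by_cases hcase : ∃ (q : ℕ) (_ : NeZero q) (χ : DirichletCharacter ℂ q) (β : ℝ), χ ≠ 1 ∧ χ ^ 2 = 1 ∧
      1 - d ≤ β ∧ β < 1 ∧ LFunction χ β = 0
  · obtain ⟨q₁, hq₁, χ₁, β, hχ₁, hχ₁2, hβ, hβ1, hz⟩ := hcase
    obtain ⟨δ, hδ, -, C, hC, hU⟩ := L_upper d hd0
    obtain ⟨C', hC', hE⟩ := euler_factors d hd0
    have hLne : 0 < ‖LFunction χ₁ 1‖ := norm_pos_iff.2
      (DirichletCharacter.LFunction_ne_zero_of_one_le_re _ (Or.inl hχ₁) (by simp))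
    have hq₁1 : (1 : ℝ) ≤ q₁ := by exact_mod_cast Nat.pos_of_ne_zero (NeZero.ne q₁)
    set c₁ := ‖LFunction χ₁ 1‖ / (C' * C') with hc₁
    set c₂ := (1 - β) / 8 * (32 * (K * 42 ^ 3)) ^ (-4 * (1 - β)) / (C * 2 ^ d * (C * 2 ^ d) * C') with hc₂
    have hβ' : 0 < 1 - β := by linarith
    have hc₁0 : 0 < c₁ := by positivity
    have hc₂0 : 0 < c₂ := by positivity
    refine ⟨min c₁ c₂ * (q₁ : ℝ) ^ (-(15 * d)), by positivity, fun q hq χ hχ hχ2 => ?_⟩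
    have hq1 : (1 : ℝ) ≤ q := by exact_mod_cast Nat.pos_of_ne_zero (NeZero.ne q)
    set n := q₁ * q with hn
    have hn0 : n ≠ 0 := mul_ne_zero (NeZero.ne _) (NeZero.ne _)
    have : NeZero n := ⟨hn0⟩
    have hn1 : (1 : ℝ) ≤ n := by exact_mod_cast Nat.pos_of_ne_zero hn0
    have hdv1 : q₁ ∣ n := ⟨q, rfl⟩
    have hdv2 : q ∣ n := ⟨q₁, mul_comm _ _⟩
    have hred : min c₁ c₂ * (q₁ : ℝ) ^ (-(15 * d)) * (q : ℝ) ^ (-ε) ≤ min c₁ c₂ * (n : ℝ) ^ (-(15 * d)) := by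
      rw [hn]; push_cast
      rw [Real.mul_rpow (by linarith) (by linarith), ← mul_assoc]
      have : (q : ℝ) ^ (-ε) ≤ (q : ℝ) ^ (-(15 * d)) := Real.rpow_le_rpow_of_exponent_le hq1 (by linarith)
      gcongr
    refine hred.trans ?_
    set ψ₁ := changeLevel hdv1 χ₁ with hψ₁
    set ψ₂ := changeLevel hdv2 χ with hψ₂
    have h1 : LFunction ψ₁ 1 = LFunction χ₁ 1 * _ := LFunction_changeLevel hdv1 χ₁ (Or.inl hχ₁)
    have h2 : LFunction ψ₂ 1 = LFunction χ 1 * _ := LFunction_changeLevel hdv2 χ (Or.inl hχ)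
    have hb : LFunction ψ₁ β = 0 := by
      rw [hψ₁, LFunction_changeLevel hdv1 χ₁ (Or.inl hχ₁), hz, zero_mul]
    have hne1 : ψ₁ ≠ 1 := fun h => hχ₁ ((changeLevel_eq_one_iff hdv1).1 h)
    have hne2 : ψ₂ ≠ 1 := fun h => hχ ((changeLevel_eq_one_iff hdv2).1 h)
    have hs1 : ψ₁ ^ 2 = 1 := by rw [hψ₁, ← map_pow, hχ₁2, map_one]
    have hs2 : ψ₂ ^ 2 = 1 := by rw [hψ₂, ← map_pow, hχ2, map_one]
    obtain ⟨-, he1⟩ := hE n q₁ χ₁ hn0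
    obtain ⟨he2, -⟩ := hE n q χ hn0
    have g1 := congrArg norm h1
    have g2 := congrArg norm h2
    rw [norm_mul] at g1 g2
    set P₁ := ‖∏ p ∈ n.primeFactors, (1 - χ₁ (p : ZMod q₁) * (p : ℂ) ^ (-1 : ℂ))‖
    set P₂ := ‖∏ p ∈ n.primeFactors, (1 - χ (p : ZMod q) * (p : ℂ) ^ (-1 : ℂ))‖
    have hP1 : 0 ≤ P₁ := norm_nonneg _
    have hP2 : 0 ≤ P₂ := norm_nonneg _
    set nd := (n : ℝ) ^ d with hnd
    have hnd1 : 1 ≤ nd := Real.one_le_rpow hn1 hd0.le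
    have hn15 : (n : ℝ) ^ (-(15 * d)) = (nd ^ 15)⁻¹ := by
      rw [Real.rpow_neg (by linarith), hnd, mul_comm, Real.rpow_mul (by linarith)]
      norm_cast
    rw [hn15, ← div_eq_mul_inv, div_le_iff₀ (by positivity)]
    have hLχ0 : 0 ≤ ‖LFunction χ 1‖ := norm_nonneg _
    by_cases hprod : ψ₁ * ψ₂ = 1
    · have heq : ψ₁ = ψ₂ := by
        have : ψ₁ * ψ₂ = ψ₂ * ψ₂ := by rw [hprod, ← pow_two, hs2]
        exact mul_right_cancel this
      rw [heq, g2] at g1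
      refine (min_le_left _ _).trans ?_
      rw [hc₁, div_le_iff₀ (by positivity)]
      calc ‖LFunction χ₁ 1‖ ≤ ‖LFunction χ₁ 1‖ * (C' * nd * P₁) := le_mul_of_one_le_right hLne.le he1
        _ = (‖LFunction χ 1‖ * P₂) * (C' * nd) := by rw [g1]; ring
        _ ≤ (‖LFunction χ 1‖ * (C' * nd)) * (C' * nd) := by gcongr
        _ = ‖LFunction χ 1‖ * nd ^ 2 * (C' * C') := by ring
        _ ≤ _ := by
            have : nd ^ 2 ≤ nd ^ 15 := pow_le_pow_right₀ hnd1 (by norm_num)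
            gcongr
    · have key := siegelB hne1 hs1 hne2 hs2 hprod K hK1 hK β (by linarith) hβ1 hb
      have u1 := ((hU n ψ₁ 1 (by simp; linarith) (by norm_num)).2 hne1)
      have u2 := ((hU n (ψ₁ * ψ₂) 1 (by simp; linarith) (by norm_num)).2 hprod)
      have hV : VV n (1 : ℂ).im ^ d = 2 ^ d * nd := by
        simp only [VV, one_im, abs_zero, zero_add]
        rw [Real.mul_rpow (by linarith) (by norm_num), mul_comm]
      rw [hV] at u1 u2
      have hlow : (1 - β) / 8 * (32 * (K * 42 ^ 3)) ^ (-4 * (1 - β)) * (nd ^ 12)⁻¹ ≤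
          (1 - β) / 8 * (32 * (K * (42 * n) ^ 3)) ^ (-4 * (1 - β)) := by
        have e1 : 32 * (K * (42 * (n : ℝ)) ^ 3) = (32 * (K * 42 ^ 3)) * (n : ℝ) ^ 3 := by ring
        rw [e1, Real.mul_rpow (x := 32 * (K * 42 ^ 3)) (by positivity) (by positivity)]
        have e2 : (nd ^ 12)⁻¹ ≤ ((n : ℝ) ^ 3) ^ (-4 * (1 - β)) := by
          have : (nd ^ 12)⁻¹ = (n : ℝ) ^ (-(12 * d)) := by
            rw [Real.rpow_neg (by linarith), hnd, mul_comm 12 d, Real.rpow_mul (by linarith)]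
            norm_cast
          rw [this]
          have : ((n : ℝ) ^ 3) ^ (-4 * (1 - β)) = (n : ℝ) ^ (-(12 * (1 - β))) := by
            rw [← Real.rpow_natCast, ← Real.rpow_mul (by linarith)]
            congr 1; push_cast; ring
          rw [this]
          exact Real.rpow_le_rpow_of_exponent_le hn1 (by linarith)
        exact (mul_le_mul_of_nonneg_left e2 (by positivity)).trans_eq (by ring)
      have hup : ‖LFunction ψ₁ 1‖ * ‖LFunction ψ₂ 1‖ * ‖LFunction (ψ₁ * ψ₂) 1‖ ≤
          (C * (2 ^ d * nd)) * (‖LFunction χ 1‖ * (C' * nd)) * (C * (2 ^ d * nd)) := by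
        rw [g2]
        exact mul_le_mul (mul_le_mul u1 (mul_le_mul_of_nonneg_left he2 hLχ0) (by positivity) (by positivity)) u2
          (norm_nonneg _) (by positivity)
      have hall := (hlow.trans key).trans hup
      refine (min_le_right _ _).trans ?_
      rw [hc₂, div_le_iff₀ (by positivity)]
      rw [← div_eq_mul_inv, div_le_iff₀ (by positivity)] at hall
      calc _ ≤ _ := hall
        _ = _ := by ring
  · push Not at hcase
    refine ⟨d / 8 * (32 * (K * 42)) ^ (-4 * d), by positivity, fun q hq χ hχ hχ2 => ?_⟩
    have hq1 : (1 : ℝ) ≤ q := by exact_mod_cast Nat.pos_of_ne_zero (NeZero.ne q)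
    have := siegelA hχ hχ2 K hK1 hK (1 - d) (by linarith) (by linarith)
      (fun x hx => hZ x (by linarith)) (fun x hx hx1 => hcase q hq χ x hχ hχ2 hx hx1)
    refine le_trans ?_ this
    have e1 : 32 * (K * (42 * (q : ℝ))) = (32 * (K * 42)) * q := by ring
    rw [e1, Real.mul_rpow (x := 32 * (K * 42)) (by positivity) (by positivity)]
    have e2 : (1 : ℝ) - (1 - d) = d := by ring
    rw [e2]
    have : (q : ℝ) ^ (-ε) ≤ (q : ℝ) ^ (-4 * d) := Real.rpow_le_rpow_of_exponent_le hq1 (by linarith)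
    exact (mul_le_mul_of_nonneg_left this (by positivity)).trans_eq (by ring)

end PQ


namespace PQ
open Finset MeasureTheory Filter Topology Complex
open DirichletCharacter hiding LFunction_ne_zero_of_one_le_re
open ArithmeticFunction (vonMangoldt)

lemma VV_mono {q : ℕ} {s t a : ℝ} (ha : 1 ≤ a) (h : |s| + 2 ≤ a * (|t| + 2)) : VV q s ≤ a * VV q t := by
  have hq : (0 : ℝ) ≤ q := by positivity
  unfold VV
  calc (q : ℝ) * (|s| + 2) ≤ q * (a * (|t| + 2)) := by gcongr
    _ = _ := by ring

lemma VV_rpow_le {q : ℕ} [NeZero q] {s t a ε : ℝ} (hε : 0 < ε) (ha : 1 ≤ a) (h : |s| + 2 ≤ a * (|t| + 2)) :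
    VV q s ^ ε ≤ a ^ ε * VV q t ^ ε := by
  rw [← Real.mul_rpow (by linarith) (by linarith [VV_ge q t])]
  exact Real.rpow_le_rpow (by linarith [VV_ge q s]) (VV_mono ha h) hε.le

lemma L_diff_nhds {q : ℕ} [NeZero q] (χ : DirichletCharacter ℂ q) {z : ℂ} (h : χ ≠ 1 ∨ z ≠ 1) :
    DifferentiableAt ℂ (LFunction χ) z ∧ DifferentiableAt ℂ (deriv (LFunction χ)) z := by
  rcases h with h | h
  · exact ⟨differentiable_LFunction h z, (differentiable_LFunction h).deriv z⟩
  · have ho : IsOpen ({1}ᶜ : Set ℂ) := isOpen_compl_singleton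
    have hd : DifferentiableOn ℂ (LFunction χ) {1}ᶜ := fun w hw =>
      (differentiableAt_LFunction χ w (Or.inl hw)).differentiableWithinAt
    have hz : ({1}ᶜ : Set ℂ) ∈ 𝓝 z := ho.mem_nhds h
    exact ⟨hd.differentiableAt hz, (hd.deriv ho).differentiableAt hz⟩

lemma Lloc0 (ε : ℝ) (hε : 0 < ε) : ∃ ρ > 0, ρ ≤ 1 / 4 ∧ ∃ C : ℝ, 1 ≤ C ∧ ∀ (q : ℕ) [NeZero q] (χ : DirichletCharacter ℂ q) (t : ℝ),
    (χ ≠ 1 ∨ 1 ≤ |t|) → ∀ z : ℂ, 1 - ρ ≤ z.re → z.re ≤ 4 → |z.im - t| ≤ ρ →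
    (χ ≠ 1 ∨ z ≠ 1) ∧ ‖LFunction χ z‖ ≤ C * VV q t ^ ε := by
  obtain ⟨δ, hδ, hδ4, C, hC, hU⟩ := L_upper ε hε
  refine ⟨δ, hδ, hδ4, C * 2 ^ ε * 3, ?_, fun q _ χ t h z hz1 hz2 hz3 => ?_⟩
  · have : (1 : ℝ) ≤ 2 ^ ε := Real.one_le_rpow (by norm_num) hε.le
    nlinarith
  have him : |z.im| ≤ |t| + 1 := by
    have := abs_sub_abs_le_abs_sub z.im t; linarith
  have hV : VV q z.im ^ ε ≤ 2 ^ ε * VV q t ^ ε := VV_rpow_le hε (by norm_num) (by linarith [abs_nonneg t])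
  have hV0 : 0 ≤ VV q t ^ ε := Real.rpow_nonneg (by linarith [VV_ge q t]) _
  have h2 : (0 : ℝ) < 2 ^ ε := by positivity
  obtain ⟨u1, u2⟩ := hU q χ z hz1 hz2
  rcases h with h | h
  · refine ⟨Or.inl h, (u2 h).trans ?_⟩
    calc C * VV q z.im ^ ε ≤ C * (2 ^ ε * VV q t ^ ε) := by gcongr
      _ ≤ C * (2 ^ ε * VV q t ^ ε) * 3 := le_mul_of_one_le_right (by positivity) (by norm_num)
      _ = _ := by ring
  · have hz : 1 / 2 ≤ ‖z - 1‖ := by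
      have h1 := abs_im_le_norm (z - 1)
      have h2 := abs_sub_abs_le_abs_sub t z.im
      rw [abs_sub_comm t] at h2
      simp at h1; linarith
    have hz1 : z ≠ 1 := by rintro rfl; norm_num at hz
    refine ⟨Or.inr hz1, (u1 hz1).trans ?_⟩
    have h3 : 1 + 1 / ‖z - 1‖ ≤ 3 := by
      have : 1 / ‖z - 1‖ ≤ 2 := by rw [div_le_iff₀ (by linarith)]; linarith
      linarith
    calc C * VV q z.im ^ ε * (1 + 1 / ‖z - 1‖) ≤ C * (2 ^ ε * VV q t ^ ε) * 3 := by gcongr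
      _ = _ := by ring

lemma Lloc (ε : ℝ) (hε : 0 < ε) : ∃ ρ > 0, ρ ≤ 1 / 8 ∧ ∃ C : ℝ, 1 ≤ C ∧ ∀ (q : ℕ) [NeZero q] (χ : DirichletCharacter ℂ q) (t : ℝ),
    (χ ≠ 1 ∨ 1 ≤ |t|) → ∀ z : ℂ, 1 - ρ ≤ z.re → z.re ≤ 3 → |z.im - t| ≤ ρ →
    (χ ≠ 1 ∨ z ≠ 1) ∧ ‖LFunction χ z‖ ≤ C * VV q t ^ ε ∧ ‖deriv (LFunction χ) z‖ ≤ C * VV q t ^ ε := by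
  obtain ⟨ρ, hρ, hρ4, C, hC, h⟩ := Lloc0 ε hε
  have hρ' : 1 ≤ 1 / (ρ / 2) := by rw [le_div_iff₀ (by positivity)]; linarith
  refine ⟨ρ / 2, by positivity, by linarith, C * (1 / (ρ / 2)), by nlinarith, fun q _ χ t ht z hz1 hz2 hz3 => ?_⟩
  have hV0 : 0 ≤ VV q t ^ ε := Real.rpow_nonneg (by linarith [VV_ge q t]) _
  have hin : ∀ w ∈ Metric.closedBall z (ρ / 2), (χ ≠ 1 ∨ w ≠ 1) ∧ ‖LFunction χ w‖ ≤ C * VV q t ^ ε := by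
    intro w hw
    rw [mem_closedBall_iff_norm] at hw
    have h1 := (abs_re_le_norm (w - z)).trans hw
    have h2 := (abs_im_le_norm (w - z)).trans hw
    rw [sub_re, abs_le] at h1
    rw [sub_im, abs_le] at h2
    rw [abs_le] at hz3
    exact h q χ t ht w (by linarith) (by linarith) (abs_le.2 ⟨by linarith, by linarith⟩)
  obtain ⟨g1, g2⟩ := hin z (Metric.mem_closedBall_self (by positivity))
  refine ⟨g1, g2.trans ?_, ?_⟩
  · gcongr; nlinarith
  · have := Complex.norm_deriv_le_of_forall_mem_sphere_norm_le (c := z) (R := ρ / 2) (f := LFunction χ) (C := C * VV q t ^ ε)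
      (by positivity) ?_ (fun w hw => (hin w (Metric.sphere_subset_closedBall hw)).2)
    · calc _ ≤ _ := this
        _ = _ := by ring
    · apply DifferentiableOn.diffContOnCl
      rw [closure_ball _ (by positivity)]
      intro w hw
      exact (L_diff_nhds χ (hin w hw).1).1.differentiableWithinAt

lemma L341 (ε : ℝ) (hε : 0 < ε) : ∃ c > 0, ∀ (q : ℕ) [NeZero q] (χ : DirichletCharacter ℂ q) (x t D : ℝ),
    0 < x → x ≤ 1 → 1 ≤ D → (χ ^ 2 ≠ 1 ∨ 1 ≤ D * ‖(x : ℂ) + 2 * I * t‖) →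
    c * (VV q t ^ (-ε)) ^ 4 * x ^ 3 ≤ D * ‖LFunction χ (1 + x + I * t)‖ ^ 4 := by
  obtain ⟨δ, hδ, hδ4, C, hC, hU⟩ := L_upper ε hε
  refine ⟨(16 * 2 ^ ε * C ^ 4)⁻¹, by positivity, fun q _ χ x t D hx hx1 hD hD2 => ?_⟩
  have hV2 := VV_ge q t
  have hprod := norm_LFunction_product_ge_one χ hx t
  rw [norm_mul, norm_mul, norm_pow, norm_pow] at hprod
  set v := VV q t ^ ε with hv
  have hv0 : 0 < v := Real.rpow_pos_of_pos (by linarith) _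
  have hneg : VV q t ^ (-ε) = v⁻¹ := by rw [Real.rpow_neg (by linarith)]
  set y := ‖LFunction χ (1 + x + I * t)‖
  have hy : 0 ≤ y := norm_nonneg _
  have ha : ‖LFunctionTrivChar q (1 + x)‖ ≤ C * v * (2 / x) := by
    have hne : (1 + x : ℂ) ≠ 1 := by simpa using hx.ne'
    refine ((hU q 1 (1 + x) (by simp; linarith) (by simp; linarith)).1 hne).trans ?_
    have h1 : VV q (1 + x : ℂ).im ^ ε ≤ v := by
      have := VV_rpow_le (q := q) (s := (1 + x : ℂ).im) (t := t) hε le_rfl (by simp)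
      simpa using this
    have h2 : 1 + 1 / ‖(1 + x : ℂ) - 1‖ ≤ 2 / x := by
      rw [add_sub_cancel_left, norm_real, Real.norm_eq_abs, abs_of_pos hx, ← sub_nonneg]
      have : 2 / x - (1 + 1 / x) = (1 - x) / x := by field_simp; ring
      rw [this]; exact div_nonneg (by linarith) hx.le
    gcongr
  have hb : ‖LFunction (χ ^ 2) (1 + x + 2 * I * t)‖ ≤ C * (2 ^ ε * v) * (2 * D) := by
    obtain ⟨u1, u2⟩ := hU q (χ ^ 2) (1 + x + 2 * I * t) (by simp; linarith) (by simp; linarith)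
    have h1 : VV q (1 + x + 2 * I * t : ℂ).im ^ ε ≤ 2 ^ ε * v := by
      apply VV_rpow_le hε (by norm_num)
      simp [abs_mul]; linarith
    rcases hD2 with h | h
    · refine (u2 h).trans ?_
      calc C * VV q (1 + x + 2 * I * t : ℂ).im ^ ε ≤ C * (2 ^ ε * v) := by gcongr
        _ ≤ _ := le_mul_of_one_le_right (by positivity) (by linarith)
    · have hpos : 0 < ‖(x : ℂ) + 2 * I * t‖ := by
        by_contra h0
        have : ‖(x : ℂ) + 2 * I * t‖ = 0 := le_antisymm (not_lt.1 h0) (norm_nonneg _)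
        rw [this] at h; norm_num at h
      have he : (1 + x + 2 * I * t : ℂ) - 1 = x + 2 * I * t := by ring
      have hne : (1 + x + 2 * I * t : ℂ) ≠ 1 := by
        intro h0; rw [← sub_eq_zero, he] at h0; rw [h0] at hpos; simp at hpos
      refine (u1 hne).trans ?_
      have h2 : 1 + 1 / ‖(1 + x + 2 * I * t : ℂ) - 1‖ ≤ 2 * D := by
        rw [he]
        have : 1 / ‖(x : ℂ) + 2 * I * t‖ ≤ D := by rw [div_le_iff₀ hpos]; exact h
        linarith
      gcongr
  have hfin : 1 ≤ (C * v * (2 / x)) ^ 3 * y ^ 4 * (C * (2 ^ ε * v) * (2 * D)) := by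
    refine hprod.le.trans ?_
    gcongr
  have e1 : (C * v * (2 / x)) ^ 3 * y ^ 4 * (C * (2 ^ ε * v) * (2 * D)) = (16 * 2 ^ ε * C ^ 4) * v ^ 4 / x ^ 3 * (D * y ^ 4) := by
    field_simp; ring
  rw [e1, ← div_le_iff₀' (by positivity)] at hfin
  rw [hneg]
  calc _ = _ := by field_simp
    _ ≤ _ := hfin

end PQ


namespace PQ
open Finset MeasureTheory Filter Topology Complex
open DirichletCharacter hiding LFunction_ne_zero_of_one_le_re
open ArithmeticFunction (vonMangoldt)

lemma L_lip {q : ℕ} [NeZero q] {χ : DirichletCharacter ℂ q} {t ρ M : ℝ}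
    (h : ∀ z : ℂ, 1 - ρ ≤ z.re → z.re ≤ 3 → |z.im - t| ≤ ρ → (χ ≠ 1 ∨ z ≠ 1) ∧ ‖deriv (LFunction χ) z‖ ≤ M)
    {z w : ℂ} (hz1 : 1 - ρ ≤ z.re) (hz2 : z.re ≤ 3) (hz3 : |z.im - t| ≤ ρ)
    (hw1 : 1 - ρ ≤ w.re) (hw2 : w.re ≤ 3) (hw3 : |w.im - t| ≤ ρ) :
    ‖LFunction χ z‖ - M * ‖w - z‖ ≤ ‖LFunction χ w‖ := by
  have hconv : Convex ℝ (Set.Icc (1 - ρ) 3 ×ℂ Set.Icc (t - ρ) (t + ρ)) := by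
    intro z hz w hw a b ha hb hab
    have h1 := convex_Icc (1 - ρ) (3 : ℝ) hz.1 hw.1 ha hb hab
    have h2 := convex_Icc (t - ρ) (t + ρ) hz.2 hw.2 ha hb hab
    rw [mem_reProdIm]
    simpa using And.intro h1 h2
  have hmem : ∀ v : ℂ, v ∈ (Set.Icc (1 - ρ) 3 ×ℂ Set.Icc (t - ρ) (t + ρ)) → 1 - ρ ≤ v.re ∧ v.re ≤ 3 ∧ |v.im - t| ≤ ρ := by
    intro v hv
    rw [mem_reProdIm] at hv
    exact ⟨hv.1.1, hv.1.2, abs_le.2 ⟨by linarith [hv.2.1], by linarith [hv.2.2]⟩⟩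
  have hmem' : ∀ v : ℂ, 1 - ρ ≤ v.re → v.re ≤ 3 → |v.im - t| ≤ ρ → v ∈ (Set.Icc (1 - ρ) 3 ×ℂ Set.Icc (t - ρ) (t + ρ)) := by
    intro v h1 h2 h3
    rw [abs_le] at h3
    exact ⟨⟨h1, h2⟩, ⟨by linarith, by linarith⟩⟩
  have key := hconv.norm_image_sub_le_of_norm_deriv_le (f := LFunction χ) (C := M)
    (fun v hv => by
      obtain ⟨h1, h2, h3⟩ := hmem v hv
      exact (L_diff_nhds χ (h v h1 h2 h3).1).1)
    (fun v hv => by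
      obtain ⟨h1, h2, h3⟩ := hmem v hv
      exact (h v h1 h2 h3).2) (hmem' z hz1 hz2 hz3) (hmem' w hw1 hw2 hw3)
  have := norm_sub_norm_le (LFunction χ z) (LFunction χ w)
  rw [norm_sub_rev] at this
  linarith

lemma L_lower (ε : ℝ) (hε : 0 < ε) : ∃ c > 0, ∀ (q : ℕ) [NeZero q] (χ : DirichletCharacter ℂ q) (s : ℂ),
    (χ ≠ 1 ∨ 1 ≤ |s.im|) → 1 < s.re → s.re ≤ 2 → c * (VV q s.im ^ (-ε)) ^ 9 ≤ ‖LFunction χ s‖ := by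
  obtain ⟨ρ, hρ, hρ8, C, hC, hloc⟩ := Lloc ε hε
  obtain ⟨c₁, hc₁, h341⟩ := L341 ε hε
  obtain ⟨c₂, hc₂, hS⟩ := siegel ε hε
  set c₃ := min ρ (c₂ / (4 * C)) with hc₃
  have hc₃0 : 0 < c₃ := by positivity
  have hc₃1 : c₃ ≤ 1 / 8 := (min_le_left _ _).trans hρ8
  have hc₃ρ : c₃ ≤ ρ := min_le_left _ _
  have hc₃2 : c₃ * (4 * C) ≤ c₂ := by
    have := min_le_right ρ (c₂ / (4 * C)); rwa [le_div_iff₀ (by positivity)] at this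
  clear_value c₃
  set c₄ := c₁ * c₃ with hc₄
  have hc₄0 : 0 < c₄ := by positivity
  set c₅ := min 1 (c₄ / (16 * C ^ 4)) with hc₅
  have hc₅0 : 0 < c₅ := by positivity
  have hc₅1 : c₅ ≤ 1 := min_le_left _ _
  have hc₅2 : c₅ * (16 * C ^ 4) ≤ c₄ := by
    have := min_le_right 1 (c₄ / (16 * C ^ 4)); rwa [le_div_iff₀ (by positivity)] at this
  clear_value c₅
  set c₆ := min 1 (c₄ * c₃ ^ 3) with hc₆
  have hc₆0 : 0 < c₆ := by positivity
  refine ⟨min (C * c₅) (min c₆ (c₂ / 2)), by positivity, fun q _ χ s hχ hs1 hs2 => ?_⟩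
  have hV2 := VV_ge q s.im
  set V := VV q s.im with hV
  set u := V ^ (-ε) with hu
  have hu0 : 0 < u := Real.rpow_pos_of_pos (by linarith) _
  have hu1 : u ≤ 1 := Real.rpow_le_one_of_one_le_of_nonpos (by linarith) (by linarith)
  have hVu : V ^ ε = u⁻¹ := by rw [hu, Real.rpow_neg (by linarith), inv_inv]
  set t := s.im with ht
  set σ := s.re with hσ
  have hs : s = 1 + ((σ - 1 : ℝ) : ℂ) + I * t := by
    apply Complex.ext <;> simp [ht, hσ]
  have hloc' := hloc q χ t hχ
  rw [← hV, hVu] at hloc'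
  set τ := c₃ * u ^ 2 with hτ
  have hu2 : u ^ 2 ≤ 1 := pow_le_one₀ hu0.le hu1
  have hτ0 : 0 < τ := by positivity
  have hτ1 : τ ≤ c₃ := mul_le_of_le_one_right hc₃0.le hu2
  have hτD : 1 ≤ 1 / τ := by rw [le_div_iff₀ hτ0]; linarith
  -- universal lower bound
  have huniv : ∀ x : ℝ, 0 < x → x ≤ 1 → (χ ^ 2 ≠ 1 ∨ τ ≤ x ∨ τ ≤ |t|) →
      c₄ * u ^ 6 * x ^ 3 ≤ ‖LFunction χ (1 + x + I * t)‖ ^ 4 := by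
    intro x hx hx1 hh
    have := h341 q χ x t (1 / τ) hx hx1 hτD (by
      rcases hh with h | h | h
      · exact Or.inl h
      · right
        have h1 := abs_re_le_norm ((x : ℂ) + 2 * I * t)
        have e1 : ((x : ℂ) + 2 * I * t).re = x := by simp
        rw [e1, abs_of_pos hx] at h1
        rw [div_mul_eq_mul_div, one_mul, le_div_iff₀ hτ0]; linarith
      · right
        have h1 := abs_im_le_norm ((x : ℂ) + 2 * I * t)
        have e1 : ((x : ℂ) + 2 * I * t).im = 2 * t := by simp
        rw [e1, abs_mul, abs_two] at h1
        rw [div_mul_eq_mul_div, one_mul, le_div_iff₀ hτ0]; linarith [abs_nonneg t])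
    rw [div_mul_eq_mul_div, one_mul, le_div_iff₀ hτ0] at this
    calc c₄ * u ^ 6 * x ^ 3 = c₁ * u ^ 4 * x ^ 3 * τ := by rw [hc₄, hτ]; ring
      _ ≤ _ := this
  have hu9 : u ^ 9 ≤ u := by
    calc u ^ 9 = u ^ 8 * u := by ring
      _ ≤ 1 * u := by gcongr; exact pow_le_one₀ hu0.le hu1
      _ = u := one_mul u
  have hu93 : u ^ 9 ≤ u ^ 3 := pow_le_pow_of_le_one hu0.le hu1 (by norm_num)
  have hlip : ∀ z w : ℂ, 1 ≤ z.re → z.re ≤ 3 → |z.im - t| ≤ ρ → 1 ≤ w.re → w.re ≤ 3 → |w.im - t| ≤ ρ →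
      ‖LFunction χ z‖ - C * u⁻¹ * ‖w - z‖ ≤ ‖LFunction χ w‖ := by
    intro z w h1 h2 h3 h4 h5 h6
    exact L_lip (ρ := ρ) (t := t) (fun v a b c => ⟨(hloc' v a b c).1, (hloc' v a b c).2.2⟩) (by linarith) h2 h3 (by linarith) h5 h6
  by_cases hgood : χ ^ 2 ≠ 1 ∨ τ ≤ |t|
  · set x₀ := c₅ * u ^ 10 with hx₀
    have hx₀0 : 0 < x₀ := by positivity
    have hx₀1 : x₀ ≤ 1 := by
      have : u ^ 10 ≤ 1 := pow_le_one₀ hu0.le hu1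
      nlinarith
    have hmain : ∀ x : ℝ, x₀ ≤ x → x ≤ 1 → 2 * C * u⁻¹ * x₀ ≤ ‖LFunction χ (1 + x + I * t)‖ := by
      intro x hx hx1
      have h1 := huniv x (by linarith) hx1 (by tauto)
      have h2 : (2 * C * u⁻¹ * x₀) ^ 4 ≤ c₄ * u ^ 6 * x ^ 3 := by
        calc (2 * C * u⁻¹ * x₀) ^ 4 = (c₅ * (16 * C ^ 4)) * u ^ 6 * x₀ ^ 3 := by
              rw [hx₀]; field_simp; ring
          _ ≤ c₄ * u ^ 6 * x ^ 3 := by gcongr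
      exact le_of_pow_le_pow_left₀ (by norm_num) (norm_nonneg _) (h2.trans h1)
    have hval : C * u⁻¹ * x₀ = C * c₅ * u ^ 9 := by rw [hx₀]; field_simp
    have hgoal : C * u⁻¹ * x₀ ≤ ‖LFunction χ s‖ := by
      have hp : 0 ≤ C * u⁻¹ * x₀ := by positivity
      by_cases hσx : x₀ ≤ σ - 1
      · have := hmain (σ - 1) hσx (by linarith)
        rw [← hs] at this
        linarith
      · have h1 := hmain x₀ le_rfl hx₀1
        have h2 := hlip (1 + x₀ + I * t) s (by simp; linarith) (by simp; linarith) (by simp [hρ.le]) (by linarith) (by linarith)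
          (by simp [← ht, hρ.le])
        have h3 : ‖s - (1 + x₀ + I * t)‖ ≤ x₀ := by
          have : s - (1 + x₀ + I * t) = ((σ - 1 - x₀ : ℝ) : ℂ) := by
            conv_lhs => rw [hs]
            push_cast; ring
          rw [this, norm_real, Real.norm_eq_abs, abs_le]
          constructor <;> linarith
        have h4 : C * u⁻¹ * ‖s - (1 + x₀ + I * t)‖ ≤ C * u⁻¹ * x₀ := by gcongr
        linarith
    refine le_trans ?_ hgoal
    rw [hval]
    gcongr
    exact min_le_left _ _
  · push Not at hgood
    obtain ⟨hχ2, htτ⟩ := hgood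
    have hχ1 : χ ≠ 1 := by
      rcases hχ with h | h
      · exact h
      · linarith
    by_cases hστ : τ ≤ σ - 1
    · have h1 := huniv (σ - 1) (by linarith) (by linarith) (by tauto)
      rw [← hs] at h1
      have h2 : (c₆ * u ^ 3) ^ 4 ≤ c₄ * u ^ 6 * (σ - 1) ^ 3 := by
        have e1 : c₆ ^ 4 ≤ c₄ * c₃ ^ 3 := by
          calc c₆ ^ 4 = c₆ ^ 3 * c₆ := by ring
            _ ≤ 1 * c₆ := by gcongr; exact pow_le_one₀ hc₆0.le (min_le_left _ _)
            _ ≤ c₄ * c₃ ^ 3 := by rw [one_mul]; exact min_le_right _ _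
        calc (c₆ * u ^ 3) ^ 4 = c₆ ^ 4 * u ^ 12 := by ring
          _ ≤ c₄ * c₃ ^ 3 * u ^ 12 := by gcongr
          _ = c₄ * u ^ 6 * τ ^ 3 := by rw [hτ]; ring
          _ ≤ _ := by gcongr
      have h3 := le_of_pow_le_pow_left₀ (by norm_num) (norm_nonneg _) (h2.trans h1)
      refine le_trans ?_ h3
      gcongr
      exact (min_le_right _ _).trans (min_le_left _ _)
    · have h1 := hS q χ hχ1 hχ2
      have h2 := hlip 1 s (by simp) (by norm_num) (by simp; linarith) (by linarith) (by linarith) (by simp [← ht, hρ.le])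
      have h3 : ‖s - 1‖ ≤ 2 * τ := by
        refine (norm_le_abs_re_add_abs_im _).trans ?_
        simp only [sub_re, one_re, sub_im, one_im, sub_zero, ← ht, ← hσ]
        rw [abs_of_pos (by linarith : 0 < σ - 1)]
        linarith
      have h4 : C * u⁻¹ * ‖s - 1‖ ≤ c₂ / 2 * u := by
        calc C * u⁻¹ * ‖s - 1‖ ≤ C * u⁻¹ * (2 * τ) := by gcongr
          _ = (c₃ * (4 * C)) / 2 * u := by rw [hτ]; field_simp; ring
          _ ≤ _ := by gcongr
      have h5 : u ≤ (q : ℝ) ^ (-ε) := by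
        have hq1 : (1 : ℝ) ≤ q := by exact_mod_cast Nat.pos_of_ne_zero (NeZero.ne q)
        rw [hu]
        apply Real.rpow_le_rpow_of_nonpos (by linarith) _ (by linarith)
        rw [hV]; unfold VV; nlinarith [abs_nonneg t]
      have h6 : c₂ * u ≤ c₂ * (q : ℝ) ^ (-ε) := by gcongr
      have h7 : min (C * c₅) (min c₆ (c₂ / 2)) * u ^ 9 ≤ c₂ / 2 * u := by
        gcongr
        exact (min_le_right _ _).trans (min_le_right _ _)
      linarith

lemma L_disc (ε : ℝ) (hε : 0 < ε) : ∃ c > 0, ∃ C : ℝ, 0 < C ∧ ∀ (q : ℕ) [NeZero q] (χ : DirichletCharacter ℂ q) (s : ℂ),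
    (χ ≠ 1 ∨ 1 ≤ |s.im|) → 1 < s.re → s.re ≤ 2 → ∀ z : ℂ, ‖z - s‖ ≤ c * (VV q s.im ^ (-ε)) ^ 10 →
    (χ ≠ 1 ∨ z ≠ 1) ∧ LFunction χ z ≠ 0 ∧ ‖LFunction χ z‖ ≤ C * ((VV q s.im ^ (-ε)) ^ 10)⁻¹ ∧
      ‖logDeriv (LFunction χ) z‖ ≤ C * ((VV q s.im ^ (-ε)) ^ 10)⁻¹ := by
  obtain ⟨ρ, hρ, hρ8, C, hC, hloc⟩ := Lloc ε hε
  obtain ⟨c, hc, hlow⟩ := L_lower ε hε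
  set c' := min ρ (c / (2 * C)) with hc'
  have hc'0 : 0 < c' := by positivity
  have hc'ρ : c' ≤ ρ := min_le_left _ _
  have hc'2 : c' * (2 * C) ≤ c := by
    have := min_le_right ρ (c / (2 * C)); rwa [le_div_iff₀ (by positivity)] at this
  refine ⟨c', hc'0, max C (2 * C / c), by positivity, fun q _ χ s hχ hs1 hs2 z hz => ?_⟩
  have hV2 := VV_ge q s.im
  set V := VV q s.im with hV
  set u := V ^ (-ε) with hu
  have hu0 : 0 < u := Real.rpow_pos_of_pos (by linarith) _
  have hu1 : u ≤ 1 := Real.rpow_le_one_of_one_le_of_nonpos (by linarith) (by linarith)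
  have hVu : V ^ ε = u⁻¹ := by rw [hu, Real.rpow_neg (by linarith), inv_inv]
  have hloc' := hloc q χ s.im hχ
  rw [← hV, hVu] at hloc'
  have hu10 : u ^ 10 ≤ 1 := pow_le_one₀ hu0.le hu1
  have hzρ : ‖z - s‖ ≤ ρ := hz.trans ((mul_le_of_le_one_right hc'0.le hu10).trans hc'ρ)
  have h1 := (abs_re_le_norm (z - s)).trans hzρ
  have h2 := (abs_im_le_norm (z - s)).trans hzρ
  rw [sub_re, abs_le] at h1
  rw [sub_im] at h2
  obtain ⟨g1, g2, g3⟩ := hloc' z (by linarith) (by linarith) h2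
  have hlip := L_lip (ρ := ρ) (t := s.im) (χ := χ) (fun v a b c => ⟨(hloc' v a b c).1, (hloc' v a b c).2.2⟩)
    (z := s) (w := z) (by linarith) (by linarith) (by simp [hρ.le]) (by linarith) (by linarith) h2
  have hl := hlow q χ s hχ hs1 hs2
  rw [← hV, ← hu] at hl
  have h4 : C * u⁻¹ * ‖z - s‖ ≤ c / 2 * u ^ 9 := by
    calc C * u⁻¹ * ‖z - s‖ ≤ C * u⁻¹ * (c' * u ^ 10) := by gcongr
      _ = (c' * (2 * C)) / 2 * u ^ 9 := by field_simp
      _ ≤ _ := by gcongr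
  have h5 : c / 2 * u ^ 9 ≤ ‖LFunction χ z‖ := by linarith
  have h6 : 0 < ‖LFunction χ z‖ := lt_of_lt_of_le (by positivity) h5
  have hui : u⁻¹ ≤ (u ^ 10)⁻¹ := by
    gcongr
    exact pow_le_of_le_one hu0.le hu1 (by norm_num)
  refine ⟨g1, norm_pos_iff.1 h6, g2.trans ?_, ?_⟩
  · exact mul_le_mul (le_max_left _ _) hui (by positivity) (by positivity)
  · rw [logDeriv_apply, norm_div, div_le_iff₀ h6]
    calc _ ≤ C * u⁻¹ := g3
      _ = 2 * C / c * (u ^ 10)⁻¹ * (c / 2 * u ^ 9) := by field_simp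
      _ ≤ _ := by
          gcongr
          exact le_max_right _ _

lemma cauchyk {f : ℂ → ℂ} {s : ℂ} {r M : ℝ} (hr : 0 < r) (k : ℕ)
    (hd : ∀ z, ‖z - s‖ ≤ r → DifferentiableAt ℂ f z) (hb : ∀ z, ‖z - s‖ ≤ r → ‖f z‖ ≤ M) :
    ‖iteratedDeriv k f s‖ ≤ k.factorial * M / r ^ k := by
  apply Complex.norm_iteratedDeriv_le_of_forall_mem_sphere_norm_le k hr
  · apply DifferentiableOn.diffContOnCl
    rw [closure_ball _ hr.ne']
    intro z hz
    exact (hd z (mem_closedBall_iff_norm.1 hz)).differentiableWithinAt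
  · intro z hz
    exact hb z (mem_sphere_iff_norm.1 hz).le

lemma logDeriv_diff {q : ℕ} [NeZero q] (χ : DirichletCharacter ℂ q) {z : ℂ} (h : χ ≠ 1 ∨ z ≠ 1)
    (h0 : LFunction χ z ≠ 0) : DifferentiableAt ℂ (logDeriv (LFunction χ)) z := by
  obtain ⟨h1, h2⟩ := L_diff_nhds χ h
  exact h2.div h1 h0

lemma pow_collect {V c C : ℝ} (hV : 2 ≤ V) (hc : 0 < c) (k : ℕ) :
    k.factorial * (C * ((V ^ (-(1 / (10 * (k + 1)) : ℝ))) ^ 10)⁻¹) / (c * (V ^ (-(1 / (10 * (k + 1)) : ℝ))) ^ 10) ^ k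
      = k.factorial * C / c ^ k * V := by
  set u := V ^ (-(1 / (10 * (k + 1)) : ℝ)) with hu
  have hu0 : 0 < u := Real.rpow_pos_of_pos (by linarith) _
  have hV : u ^ (10 * (k + 1)) = V⁻¹ := by
    rw [hu, ← Real.rpow_natCast, ← Real.rpow_mul (by linarith), ← Real.rpow_neg_one]
    congr 1
    push_cast
    field_simp
  have hV' : V = (u ^ (10 * (k + 1)))⁻¹ := by rw [hV, inv_inv]
  rw [hV', mul_pow, ← pow_mul]
  have : u ^ (10 * (k + 1)) = u ^ 10 * u ^ (10 * k) := by rw [← pow_add]; congr 1; ring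
  rw [this]
  field_simp

/-- bounds for derivatives of `L'/L`, nonprincipal characters -/
lemma LD_bound (k : ℕ) : ∃ C : ℝ, 0 < C ∧ ∀ (q : ℕ) [NeZero q] (χ : DirichletCharacter ℂ q) (s : ℂ),
    χ ≠ 1 → 1 < s.re → s.re ≤ 2 → ‖iteratedDeriv k (logDeriv (LFunction χ)) s‖ ≤ C * VV q s.im := by
  obtain ⟨c, hc, C, hC, h⟩ := L_disc (1 / (10 * (k + 1)) : ℝ) (by positivity)
  refine ⟨k.factorial * C / c ^ k, by positivity, fun q _ χ s hχ hs1 hs2 => ?_⟩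
  have hV2 := VV_ge q s.im
  have h' := h q χ s (Or.inl hχ) hs1 hs2
  have hr : 0 < c * (VV q s.im ^ (-(1 / (10 * (k + 1)) : ℝ))) ^ 10 := by
    have : 0 < VV q s.im ^ (-(1 / (10 * (k + 1)) : ℝ)) := Real.rpow_pos_of_pos (by linarith) _
    positivity
  have := cauchyk hr k (f := logDeriv (LFunction χ)) (fun z hz => logDeriv_diff χ (h' z hz).1 (h' z hz).2.1)
    (fun z hz => (h' z hz).2.2.2)
  rwa [pow_collect hV2 hc] at this

/-- `-ζ'/ζ - ζ` -/
noncomputable def Pz (s : ℂ) : ℂ := -logDeriv Zr s - dslope Zr 1 s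

lemma Pz_eq {s : ℂ} (hs : s ≠ 1) (h0 : LFunction (1 : DirichletCharacter ℂ 1) s ≠ 0) :
    Pz s = -logDeriv (LFunction (1 : DirichletCharacter ℂ 1)) s - LFunction (1 : DirichletCharacter ℂ 1) s := by
  have hs' : s - 1 ≠ 0 := sub_ne_zero.2 hs
  have hev : Zr =ᶠ[𝓝 s] fun z => (z - 1) * LFunction (1 : DirichletCharacter ℂ 1) z := by
    filter_upwards [isOpen_compl_singleton.mem_nhds hs] with z hz
    exact Zr_apply hz
  have h1 : logDeriv Zr s = 1 / (s - 1) + logDeriv (LFunction (1 : DirichletCharacter ℂ 1)) s := by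
    have hd := (L_diff_nhds (1 : DirichletCharacter ℂ 1) (Or.inr hs)).1
    rw [logDeriv_apply, hev.deriv_eq, hev.eq_of_nhds, ← logDeriv_apply (fun z => (z - 1) * LFunction (1 : DirichletCharacter ℂ 1) z),
      logDeriv_mul s hs' h0 (by fun_prop) hd, logDeriv_apply]
    simp
  rw [Pz, h1, dslope_of_ne _ hs, slope_def_field, Zr_one, Zr_apply hs]
  field_simp
  ring

lemma Pz_diff {s : ℂ} (h0 : Zr s ≠ 0) : DifferentiableAt ℂ Pz s := by
  have h1 : DifferentiableAt ℂ (logDeriv Zr) s := (Zr_diff.deriv s).div (Zr_diff s) h0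
  have h2 : DifferentiableAt ℂ (dslope Zr 1) s := by
    have : DifferentiableOn ℂ (dslope Zr 1) Set.univ :=
      (Complex.differentiableOn_dslope Filter.univ_mem).2 Zr_diff.differentiableOn
    exact this.differentiableAt Filter.univ_mem
  exact h1.neg.sub h2

lemma Pz_bound (k : ℕ) : ∃ C : ℝ, 0 < C ∧ ∀ s : ℂ, 1 < s.re → s.re ≤ 2 → ‖iteratedDeriv k Pz s‖ ≤ C * VV 1 s.im := by
  obtain ⟨c, hc, C, hC, h⟩ := L_disc (1 / (10 * (k + 1)) : ℝ) (by positivity)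
  -- compact part
  have hU : IsOpen {z : ℂ | Zr z ≠ 0} := isOpen_ne_fun Zr_diff.continuous continuous_const
  have hPd : DifferentiableOn ℂ Pz {z : ℂ | Zr z ≠ 0} := fun z hz => (Pz_diff hz).differentiableWithinAt
  have hcont : ContinuousOn (iteratedDeriv k Pz) (Set.Icc 1 2 ×ℂ Set.Icc (-1) 1) := by
    intro z hz
    have hz' : z ∈ {z : ℂ | Zr z ≠ 0} := Zr_ne_zero hz.1.1
    have han : AnalyticAt ℂ Pz z := hPd.analyticAt (hU.mem_nhds hz')
    rw [iteratedDeriv_eq_iterate]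
    exact (han.iterated_deriv k).continuousAt.continuousWithinAt
  obtain ⟨K, hK⟩ := (isCompact_Icc.reProdIm isCompact_Icc).exists_bound_of_continuousOn hcont
  refine ⟨k.factorial * (2 * C) / c ^ k + |K|, by positivity, fun s hs1 hs2 => ?_⟩
  have hV2 := VV_ge 1 s.im
  by_cases ht : 1 ≤ |s.im|
  · have h' := h 1 1 s (Or.inr ht) hs1 hs2
    have hr : 0 < c * (VV 1 s.im ^ (-(1 / (10 * (k + 1)) : ℝ))) ^ 10 := by
      have : 0 < VV 1 s.im ^ (-(1 / (10 * (k + 1)) : ℝ)) := Real.rpow_pos_of_pos (by linarith) _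
      positivity
    have := cauchyk hr k (s := s) (f := Pz) (M := 2 * C * ((VV 1 s.im ^ (-(1 / (10 * (k + 1)) : ℝ))) ^ 10)⁻¹) (fun z hz => ?_) (fun z hz => ?_)
    · rw [pow_collect hV2 hc] at this
      refine this.trans ?_
      gcongr
      linarith [abs_nonneg K]
    · obtain ⟨g1, g2, -⟩ := h' z hz
      have hz1 : z ≠ 1 := by tauto
      apply Pz_diff
      rw [Zr_apply hz1]
      exact mul_ne_zero (sub_ne_zero.2 hz1) g2
    · obtain ⟨g1, g2, g3, g4⟩ := h' z hz
      have hz1 : z ≠ 1 := by tauto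
      rw [Pz_eq hz1 g2]
      refine (norm_sub_le _ _).trans ?_
      rw [norm_neg]
      linarith
  · have hm : s ∈ (Set.Icc 1 2 ×ℂ Set.Icc (-1) 1) := by
      have := abs_le.1 (not_le.1 ht).le
      exact ⟨⟨hs1.le, hs2⟩, this⟩
    have h1 := hK s hm
    have h2 : 0 ≤ k.factorial * (2 * C) / c ^ k := by positivity
    nlinarith [le_abs_self K, abs_nonneg K]

end PQ


namespace PQ
open Finset MeasureTheory Filter Topology Complex

lemma exp_abs_bound (z : ℝ) : |z| ≤ 2 * Real.exp (z ^ 2 / 8) := by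
  have h := Real.add_one_le_exp (z ^ 2 / 8)
  have : |z| ^ 2 = z ^ 2 := sq_abs z
  nlinarith [sq_nonneg (|z| - 2)]

lemma exp_neg_sq_integrable {b : ℝ} (hb : 0 < b) : Integrable (fun t : ℝ => Real.exp (-b * t ^ 2)) :=
  integrable_exp_neg_mul_sq hb

lemma first_moment {b : ℝ} (hb : 0 < b) (t : ℝ) : |t| * Real.exp (-b * t ^ 2) ≤ 1 / √b * Real.exp (-(b / 2) * t ^ 2) * 1 := by
  have h := exp_abs_bound (2 * √b * t)
  have e1 : (2 * √b * t) ^ 2 / 8 = (b / 2) * t ^ 2 := by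
    rw [mul_pow, mul_pow, Real.sq_sqrt hb.le]; ring
  rw [e1, abs_mul, abs_mul, abs_two, abs_of_pos (Real.sqrt_pos.2 hb)] at h
  have hs := Real.sqrt_pos.2 hb
  have e2 : Real.exp (-b * t ^ 2) = Real.exp (-(b / 2) * t ^ 2) * Real.exp (-(b / 2) * t ^ 2) := by
    rw [← Real.exp_add]; congr 1; ring
  have e3 : Real.exp ((b / 2) * t ^ 2) * Real.exp (-(b / 2) * t ^ 2) = 1 := by
    rw [← Real.exp_add]; simp
  have h0 := Real.exp_pos (-(b / 2) * t ^ 2)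
  rw [e2, mul_one, div_mul_eq_mul_div, one_mul, le_div_iff₀ hs]
  have h3 : |t| * √b ≤ Real.exp (b / 2 * t ^ 2) := by linarith
  calc |t| * (Real.exp (-(b / 2) * t ^ 2) * Real.exp (-(b / 2) * t ^ 2)) * √b
      = (|t| * √b) * Real.exp (-(b / 2) * t ^ 2) * Real.exp (-(b / 2) * t ^ 2) := by ring
    _ ≤ Real.exp (b / 2 * t ^ 2) * Real.exp (-(b / 2) * t ^ 2) * Real.exp (-(b / 2) * t ^ 2) := by gcongr
    _ = _ := by rw [e3, one_mul]

lemma gauss_ft {δ : ℝ} (hδ : 0 < δ) (y : ℝ) :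
    ∫ t : ℝ, cexp (I * y * t) * (Real.exp (-δ ^ 2 * t ^ 2) : ℂ) = (√(Real.pi) / δ * Real.exp (-(1 / (4 * δ ^ 2)) * y ^ 2) : ℝ) := by
  have h := fourierIntegral_gaussian (b := ((δ ^ 2 : ℝ) : ℂ)) (by rw [ofReal_re]; positivity) (y : ℂ)
  have e1 : ((Real.pi : ℂ) / ((δ ^ 2 : ℝ) : ℂ)) ^ (1 / 2 : ℂ) = ((√(Real.pi) / δ : ℝ) : ℂ) := by
    rw [← ofReal_div]
    have : (1 / 2 : ℂ) = ((1 / 2 : ℝ) : ℂ) := by norm_num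
    rw [this, ← ofReal_cpow (by positivity), ← Real.sqrt_eq_rpow, Real.sqrt_div Real.pi_pos.le, Real.sqrt_sq hδ.le]
  rw [e1] at h
  push_cast at h ⊢
  rw [show (∫ t : ℝ, cexp (I * y * t) * cexp (-(δ : ℂ) ^ 2 * (t : ℂ) ^ 2)) = _ from h]
  congr 2
  field_simp

/-- the Gaussian-smoothed sum -/
lemma smooth_bound {b : ℕ → ℂ} {lam : ℕ → ℝ} (hb : Summable fun n => ‖b n‖) {δ : ℝ} (hδ : 0 < δ) (hδ1 : δ ≤ 1)
    {K : ℝ} (hK : 0 ≤ K) (hA : ∀ t : ℝ, ‖∑' n, b n * cexp (-(I * lam n * t))‖ ≤ K * (|t| + 2)) (v : ℝ) :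
    ‖∑' n, b n * (Real.exp (-(1 / (4 * δ ^ 2)) * (v - lam n) ^ 2) : ℂ)‖ ≤ 6 * K / δ := by
  have hδ2 : 0 < δ ^ 2 := by positivity
  set g : ℕ → ℝ → ℂ := fun n t => b n * (cexp (I * (v - lam n : ℝ) * t) * (Real.exp (-δ ^ 2 * t ^ 2) : ℂ)) with hg
  have hnorm : ∀ n t, ‖g n t‖ = ‖b n‖ * Real.exp (-δ ^ 2 * t ^ 2) := by
    intro n t
    simp only [hg]
    rw [norm_mul, norm_mul, norm_real, Real.norm_eq_abs, abs_of_pos (Real.exp_pos _)]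
    have : I * (v - lam n : ℝ) * (t : ℂ) = ((v - lam n) * t : ℝ) * I := by push_cast; ring
    rw [this, norm_exp_ofReal_mul_I, one_mul]
  have hgc : ∀ n, Continuous (g n) := by
    intro n; simp only [hg]; fun_prop
  have hIntg : ∀ n, Integrable (g n) := by
    intro n
    rw [← integrable_norm_iff (hgc n).aestronglyMeasurable]
    simp only [hnorm]
    exact (exp_neg_sq_integrable hδ2).const_mul _
  have hsum : Summable fun n => ∫ t, ‖g n t‖ := by
    simp only [hnorm, integral_const_mul]
    exact hb.mul_right _
  have key := hasSum_integral_of_summable_integral_norm hIntg hsum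
  have hIntg' : ∀ n, ∫ t, g n t = ((√(Real.pi) / δ : ℝ) : ℂ) * (b n * (Real.exp (-(1 / (4 * δ ^ 2)) * (v - lam n) ^ 2) : ℂ)) := by
    intro n
    simp only [hg]
    rw [integral_const_mul, gauss_ft hδ]
    push_cast; ring
  have hEq : ((√(Real.pi) / δ : ℝ) : ℂ) * ∑' n, b n * (Real.exp (-(1 / (4 * δ ^ 2)) * (v - lam n) ^ 2) : ℂ) =
      ∫ t, ∑' n, g n t := by
    rw [← key.tsum_eq, ← tsum_mul_left]
    exact tsum_congr fun n => (hIntg' n).symm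
  have hpt : ∀ t, ‖∑' n, g n t‖ ≤ K * (4 / δ) * Real.exp (-(δ ^ 2 / 2) * t ^ 2) := by
    intro t
    have e1 : ∑' n, g n t = (∑' n, b n * cexp (-(I * lam n * t))) * (cexp (I * v * t) * (Real.exp (-δ ^ 2 * t ^ 2) : ℂ)) := by
      rw [← tsum_mul_right]
      refine tsum_congr fun n => ?_
      simp only [hg]
      have : I * (v - lam n : ℝ) * (t : ℂ) = -(I * lam n * t) + I * v * t := by push_cast; ring
      rw [this, Complex.exp_add]; ring
    have e2 : ‖cexp (I * v * t)‖ = 1 := by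
      have : I * v * (t : ℂ) = (v * t : ℝ) * I := by push_cast; ring
      rw [this, norm_exp_ofReal_mul_I]
    rw [e1, norm_mul, norm_mul, e2, norm_real, Real.norm_eq_abs, abs_of_pos (Real.exp_pos _), one_mul]
    have h1 := first_moment hδ2 t
    rw [Real.sqrt_sq hδ.le, mul_one] at h1
    have h2 : Real.exp (-δ ^ 2 * t ^ 2) ≤ Real.exp (-(δ ^ 2 / 2) * t ^ 2) := by
      apply Real.exp_le_exp.2
      nlinarith [mul_nonneg hδ2.le (sq_nonneg t)]
    have h3 : 1 ≤ 1 / δ := by rw [le_div_iff₀ hδ]; linarith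
    have hE := Real.exp_pos (-(δ ^ 2 / 2) * t ^ 2)
    calc _ ≤ K * (|t| + 2) * Real.exp (-δ ^ 2 * t ^ 2) := by gcongr; exact hA t
      _ = K * (|t| * Real.exp (-δ ^ 2 * t ^ 2) + 2 * Real.exp (-δ ^ 2 * t ^ 2)) := by ring
      _ ≤ K * (1 / δ * Real.exp (-(δ ^ 2 / 2) * t ^ 2) + 2 * (1 / δ * Real.exp (-(δ ^ 2 / 2) * t ^ 2))) := by
          gcongr
          nlinarith
      _ = K * (3 / δ) * Real.exp (-(δ ^ 2 / 2) * t ^ 2) := by ring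
      _ ≤ _ := by gcongr; norm_num
  have hfin := norm_integral_le_of_norm_le ((exp_neg_sq_integrable (b := δ ^ 2 / 2) (by positivity)).const_mul (K * (4 / δ)))
    (Eventually.of_forall hpt)
  rw [integral_const_mul, integral_gaussian, ← hEq, norm_mul, norm_real, Real.norm_eq_abs, abs_of_pos (by positivity)] at hfin
  have e3 : √(Real.pi / (δ ^ 2 / 2)) = √2 * (√(Real.pi) / δ) := by
    rw [show Real.pi / (δ ^ 2 / 2) = 2 * (Real.pi / δ ^ 2) by field_simp, Real.sqrt_mul (by norm_num),
      Real.sqrt_div Real.pi_pos.le, Real.sqrt_sq hδ.le]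
  rw [e3] at hfin
  have hpos : 0 < √(Real.pi) / δ := by positivity
  have h4 : √2 ≤ 3 / 2 := by rw [Real.sqrt_le_left (by norm_num)]; norm_num
  have h5 : ‖∑' n, b n * (Real.exp (-(1 / (4 * δ ^ 2)) * (v - lam n) ^ 2) : ℂ)‖ ≤ K * (4 / δ) * √2 := by
    by_contra hcon
    push Not at hcon
    have := mul_lt_mul_of_pos_left hcon hpos
    linarith
  refine h5.trans ?_
  calc K * (4 / δ) * √2 ≤ K * (4 / δ) * (3 / 2) := by gcongr
    _ = _ := by ring

lemma tauber {b : ℕ → ℂ} {lam : ℕ → ℝ} (hb : Summable fun n => ‖b n‖) {δ : ℝ} (hδ : 0 < δ) (hδ1 : δ ≤ 1)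
    {K : ℝ} (hK : 0 ≤ K) (hA : ∀ t : ℝ, ‖∑' n, b n * cexp (-(I * lam n * t))‖ ≤ K * (|t| + 2))
    {G : ℝ → ℂ} {Lip M : ℝ} (hLip0 : 0 ≤ Lip) (hLip : ∀ u v, ‖G u - G v‖ ≤ Lip * |u - v|) (hM : ∀ u, ‖G u‖ ≤ M) (hGi : Integrable G) :
    ‖∑' n, b n * G (lam n)‖ ≤ 3 * δ * Lip * ∑' n, ‖b n‖ + 2 * K / δ ^ 2 * ∫ u, ‖G u‖ := by
  have hδ2 : 0 < δ ^ 2 := by positivity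
  set a := 1 / (4 * δ ^ 2) with ha
  have ha0 : 0 < a := by positivity
  have hGc : Continuous G := by
    have : LipschitzWith (Real.toNNReal Lip) G := LipschitzWith.of_dist_le_mul fun u v => by
      rw [dist_eq_norm, Real.dist_eq, Real.coe_toNNReal _ hLip0]; exact hLip u v
    exact this.continuous
  set N0 := ∫ y : ℝ, Real.exp (-a * y ^ 2) with hN0
  have hN0v : N0 = 2 * √Real.pi * δ := by
    rw [hN0, integral_gaussian, ha, show Real.pi / (1 / (4 * δ ^ 2)) = (2 * δ) ^ 2 * Real.pi by field_simp; ring,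
      Real.sqrt_mul (by positivity), Real.sqrt_sq (by positivity)]; ring
  have hN0p : 0 < N0 := by rw [hN0v]; positivity
  set h : ℕ → ℝ → ℂ := fun n v => G v * (b n * (Real.exp (-a * (v - lam n) ^ 2) : ℂ)) with hh
  have hek : ∀ n, Integrable (fun v : ℝ => Real.exp (-a * (v - lam n) ^ 2)) := fun n =>
    (exp_neg_sq_integrable ha0).comp_sub_right (lam n)
  have hekv : ∀ n, ∫ v : ℝ, Real.exp (-a * (v - lam n) ^ 2) = N0 := fun n =>
    integral_sub_right_eq_self (fun v : ℝ => Real.exp (-a * v ^ 2)) (lam n)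
  have hM0 : 0 ≤ M := (norm_nonneg _).trans (hM 0)
  have hnle : ∀ n v, ‖h n v‖ ≤ M * ‖b n‖ * Real.exp (-a * (v - lam n) ^ 2) := by
    intro n v
    simp only [hh]
    rw [norm_mul, norm_mul, norm_real, Real.norm_eq_abs, abs_of_pos (Real.exp_pos _), ← mul_assoc]
    gcongr
    exact hM v
  have hhc : ∀ n, Continuous (h n) := by intro n; simp only [hh]; fun_prop
  have hIntg : ∀ n, Integrable (h n) := fun n =>
    ((hek n).const_mul (M * ‖b n‖)).mono' (hhc n).aestronglyMeasurable (Eventually.of_forall (hnle n))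
  have hsum : Summable fun n => ∫ v, ‖h n v‖ := by
    refine Summable.of_nonneg_of_le (fun n => integral_nonneg fun v => norm_nonneg _) (fun n => ?_) ((hb.mul_left M).mul_right N0)
    calc ∫ v, ‖h n v‖ ≤ ∫ v, M * ‖b n‖ * Real.exp (-a * (v - lam n) ^ 2) :=
          integral_mono (hIntg n).norm ((hek n).const_mul _) (hnle n)
      _ = _ := by rw [integral_const_mul, hekv]
  have key := hasSum_integral_of_summable_integral_norm hIntg hsum
  have hsumG : Summable fun n => b n * G (lam n) := by
    refine Summable.of_norm_bounded (hb.mul_right M) fun n => ?_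
    rw [norm_mul]; gcongr; exact hM _
  have hdiff : ∀ n, ‖b n * G (lam n) * N0 - ∫ v, h n v‖ ≤ ‖b n‖ * (Lip * (2 * δ * (√2 * N0))) := by
    intro n
    have e1 : b n * G (lam n) * N0 = ∫ v : ℝ, b n * G (lam n) * (Real.exp (-a * (v - lam n) ^ 2) : ℂ) := by
      rw [integral_const_mul, integral_complex_ofReal, hekv]
    have hI2 : Integrable (fun v : ℝ => b n * G (lam n) * (Real.exp (-a * (v - lam n) ^ 2) : ℂ)) :=
      ((hek n).ofReal (𝕜 := ℂ)).const_mul _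
    rw [e1, ← integral_sub hI2 (hIntg n)]
    have hb2 : ∀ v : ℝ, ‖b n * G (lam n) * (Real.exp (-a * (v - lam n) ^ 2) : ℂ) - h n v‖ ≤
        ‖b n‖ * Lip * (2 * δ) * Real.exp (-(a / 2) * (v - lam n) ^ 2) := by
      intro v
      simp only [hh]
      have : b n * G (lam n) * (Real.exp (-a * (v - lam n) ^ 2) : ℂ) - G v * (b n * (Real.exp (-a * (v - lam n) ^ 2) : ℂ))
        = b n * (G (lam n) - G v) * (Real.exp (-a * (v - lam n) ^ 2) : ℂ) := by ring
      rw [this, norm_mul, norm_mul, norm_real, Real.norm_eq_abs, abs_of_pos (Real.exp_pos _)]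
      have h1 := hLip (lam n) v
      rw [abs_sub_comm] at h1
      have h2 := first_moment ha0 (v - lam n)
      have e3 : 1 / √a = 2 * δ := by
        rw [ha, show (1 : ℝ) / (4 * δ ^ 2) = (1 / (2 * δ)) ^ 2 by field_simp; ring, Real.sqrt_sq (by positivity), one_div_one_div]
      rw [e3, mul_one] at h2
      calc _ ≤ ‖b n‖ * (Lip * |v - lam n|) * Real.exp (-a * (v - lam n) ^ 2) := by gcongr
        _ = ‖b n‖ * Lip * (|v - lam n| * Real.exp (-a * (v - lam n) ^ 2)) := by ring
        _ ≤ ‖b n‖ * Lip * (2 * δ * Real.exp (-(a / 2) * (v - lam n) ^ 2)) := by gcongr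
        _ = _ := by ring
    have hI := norm_integral_le_of_norm_le
      (((exp_neg_sq_integrable (b := a / 2) (by positivity)).comp_sub_right (lam n)).const_mul (‖b n‖ * Lip * (2 * δ)))
      (Eventually.of_forall hb2)
    refine hI.trans ?_
    rw [integral_const_mul, integral_sub_right_eq_self (fun v : ℝ => Real.exp (-(a / 2) * v ^ 2)) (lam n), integral_gaussian]
    have e4 : √(Real.pi / (a / 2)) = √2 * N0 := by
      rw [hN0, integral_gaussian, ← Real.sqrt_mul (by norm_num)]
      congr 1; field_simp
    rw [e4]
    exact le_of_eq (by ring)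
  have hF : ‖∫ v, ∑' n, h n v‖ ≤ (6 * K / δ) * ∫ u, ‖G u‖ := by
    rw [← integral_const_mul]
    refine norm_integral_le_of_norm_le (hGi.norm.const_mul _) (Eventually.of_forall fun v => ?_)
    simp only [hh]
    rw [tsum_mul_left, norm_mul, mul_comm]
    gcongr
    exact smooth_bound hb hδ hδ1 hK hA v
  have htot : ‖(∑' n, b n * G (lam n)) * N0 - ∫ v, ∑' n, h n v‖ ≤ (∑' n, ‖b n‖) * (Lip * (2 * δ * (√2 * N0))) := by
    rw [← key.tsum_eq, ← tsum_mul_right, ← (hsumG.mul_right _).tsum_sub key.summable, ← tsum_mul_right]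
    exact tsum_of_norm_bounded (hb.mul_right _).hasSum hdiff
  have hfin : ‖∑' n, b n * G (lam n)‖ * N0 ≤ (∑' n, ‖b n‖) * (Lip * (2 * δ * (√2 * N0))) + (6 * K / δ) * ∫ u, ‖G u‖ := by
    have h1 := norm_sub_norm_le ((∑' n, b n * G (lam n)) * N0) (∫ v, ∑' n, h n v)
    rw [norm_mul, norm_real, Real.norm_eq_abs, abs_of_pos hN0p] at h1
    linarith
  have hI0 : 0 ≤ ∫ u, ‖G u‖ := integral_nonneg fun u => norm_nonneg _
  have hS0 : 0 ≤ ∑' n, ‖b n‖ := tsum_nonneg fun n => norm_nonneg _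
  have h4 : √2 ≤ 3 / 2 := by rw [Real.sqrt_le_left (by norm_num)]; norm_num
  have h5 : 3 / 2 ≤ √Real.pi := by
    apply Real.le_sqrt_of_sq_le; nlinarith [Real.pi_gt_three]
  refine le_of_mul_le_mul_right (hfin.trans ?_) hN0p
  rw [add_mul]
  apply add_le_add
  · calc (∑' n, ‖b n‖) * (Lip * (2 * δ * (√2 * N0))) ≤ (∑' n, ‖b n‖) * (Lip * (2 * δ * (3 / 2 * N0))) := by gcongr
      _ = _ := by ring
  · calc 6 * K / δ * ∫ u, ‖G u‖ = 2 * K / δ ^ 2 * (∫ u, ‖G u‖) * (2 * (3 / 2) * δ) := by field_simp; ring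
      _ ≤ _ := by rw [hN0v]; gcongr

end PQ


namespace PQ
open Finset MeasureTheory Filter Topology Complex
open DirichletCharacter hiding LFunction_ne_zero_of_one_le_re
open ArithmeticFunction (vonMangoldt)

/-! ### Tent weights and Siegel–Walfisz -/

lemma zeta_partial {ε : ℝ} (hε : 0 < ε) (N : ℕ) (hN : 1 ≤ N) :
    ∑ n ∈ range (N + 1), (n : ℝ) ^ (-1 - ε) ≤ 1 + 1 / ε - (N : ℝ) ^ (-ε) / ε := by
  induction N, hN using Nat.le_induction with
  | base =>
    rw [sum_range_succ, sum_range_one]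
    simp only [Nat.cast_zero, Nat.cast_one, Real.one_rpow]
    rw [Real.zero_rpow (by linarith)]
    linarith
  | succ N hN ih =>
    rw [sum_range_succ]
    have hN0 : (0 : ℝ) < N := by exact_mod_cast hN
    have hlog : 1 / ((N : ℝ) + 1) ≤ Real.log ((N + 1) / N) := by
      have := Real.one_sub_inv_le_log_of_pos (x := ((N : ℝ) + 1) / N) (by positivity)
      rw [inv_div] at this
      refine le_trans (le_of_eq ?_) this
      field_simp; ring
    have h1 : 1 + ε / (N + 1) ≤ (((N : ℝ) + 1) / N) ^ ε := by
      rw [Real.rpow_def_of_pos (by positivity)]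
      have := Real.add_one_le_exp (Real.log (((N : ℝ) + 1) / N) * ε)
      have h2 : ε / (N + 1) ≤ Real.log (((N : ℝ) + 1) / N) * ε := by
        calc ε / (N + 1) = 1 / ((N : ℝ) + 1) * ε := by ring
          _ ≤ _ := by gcongr
      linarith
    have h3 : (N : ℝ) ^ (-ε) = ((N : ℝ) + 1) ^ (-ε) * (((N : ℝ) + 1) / N) ^ ε := by
      rw [Real.div_rpow (by positivity) hN0.le, Real.rpow_neg hN0.le, Real.rpow_neg (by positivity)]
      have : ((N : ℝ) + 1) ^ ε ≠ 0 := (Real.rpow_pos_of_pos (by positivity) _).ne'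
      field_simp
    have h4 : ((N : ℝ) + 1) ^ (-1 - ε) = ((N : ℝ) + 1) ^ (-ε) / (N + 1) := by
      rw [show -1 - ε = -ε - 1 by ring, Real.rpow_sub_one (by positivity)]
    push_cast
    rw [h4]
    have h5 : ((N : ℝ) + 1) ^ (-ε) * (1 + ε / (N + 1)) ≤ (N : ℝ) ^ (-ε) := by
      rw [h3]; gcongr
    have h6 : ((N : ℝ) + 1) ^ (-ε) / (N + 1) ≤ (N : ℝ) ^ (-ε) / ε - ((N : ℝ) + 1) ^ (-ε) / ε := by
      rw [← sub_div, le_div_iff₀ hε]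
      have : ((N : ℝ) + 1) ^ (-ε) / (N + 1) * ε = ((N : ℝ) + 1) ^ (-ε) * (1 + ε / (N + 1)) - ((N : ℝ) + 1) ^ (-ε) := by ring
      linarith
    linarith

lemma zeta_tsum {ε : ℝ} (hε : 0 < ε) : (Summable fun n : ℕ => (n : ℝ) ^ (-1 - ε)) ∧ ∑' n : ℕ, (n : ℝ) ^ (-1 - ε) ≤ 1 + 1 / ε := by
  have h0 : ∀ n : ℕ, 0 ≤ (n : ℝ) ^ (-1 - ε) := fun n => by positivity
  have h1 : ∀ N, ∑ n ∈ range N, (n : ℝ) ^ (-1 - ε) ≤ 1 + 1 / ε := by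
    intro N
    have h2 := zeta_partial hε (N + 1) (by omega)
    have h3 : 0 ≤ ((N + 1 : ℕ) : ℝ) ^ (-ε) / ε := by positivity
    have h4 : ∑ n ∈ range N, (n : ℝ) ^ (-1 - ε) ≤ ∑ n ∈ range (N + 1 + 1), (n : ℝ) ^ (-1 - ε) :=
      sum_le_sum_of_subset_of_nonneg (range_subset_range.2 (by omega)) fun _ _ _ => h0 _
    linarith
  exact ⟨summable_of_sum_range_le h0 h1, Real.tsum_le_of_sum_range_le h0 h1⟩

lemma logMul_iter (a : ℕ → ℂ) (k n : ℕ) : (LSeries.logMul^[k] a) n = Complex.log n ^ k * a n := by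
  induction k with
  | zero => simp
  | succ k ih =>
    rw [Function.iterate_succ_apply', LSeries.logMul, ih]; ring

/-- coefficients -/
noncomputable def bco (a : ℕ → ℂ) (k : ℕ) (σ : ℝ) (n : ℕ) : ℂ := LSeries.term (LSeries.logMul^[k] a) σ n

lemma bco_twist (a : ℕ → ℂ) (k : ℕ) (σ t : ℝ) (n : ℕ) :
    bco a k σ n * cexp (-(I * Real.log n * t)) = LSeries.term (LSeries.logMul^[k] a) (σ + I * t) n := by
  unfold bco
  rcases Nat.eq_zero_or_pos n with rfl | hn
  · simp
  · have hn0 : (n : ℂ) ≠ 0 := by exact_mod_cast hn.ne'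
    rw [LSeries.term_of_ne_zero hn.ne', LSeries.term_of_ne_zero hn.ne', cpow_add _ _ hn0, div_mul_eq_mul_div, div_eq_div_iff
      (by rw [Ne, cpow_eq_zero_iff]; tauto) (by rw [Ne, mul_eq_zero, cpow_eq_zero_iff, cpow_eq_zero_iff]; tauto)]
    have : cexp (-(I * Real.log n * t)) * (n : ℂ) ^ (I * t) = 1 := by
      rw [cpow_def_of_ne_zero hn0, ← Complex.exp_add, natCast_log]
      rw [show -(I * Complex.log n * t) + Complex.log n * (I * t) = 0 by ring, Complex.exp_zero]
    linear_combination (LSeries.logMul^[k] a) n * (n : ℂ) ^ (σ : ℂ) * this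

lemma pow_log_le (m : ℕ) {l : ℝ} (hl : 0 < l) {n : ℕ} (hn : 1 ≤ n) :
    Real.log n ^ m ≤ m.factorial * (2 * l) ^ m * (n : ℝ) ^ (1 / (2 * l)) := by
  have hn0 : (0 : ℝ) < n := by exact_mod_cast hn
  have h0 : 0 ≤ Real.log n := Real.log_natCast_nonneg n
  have := Real.pow_div_factorial_le_exp (Real.log n / (2 * l)) (by positivity) m
  rw [Real.rpow_def_of_pos hn0, show Real.log n * (1 / (2 * l)) = Real.log n / (2 * l) by ring]
  rw [div_pow, div_div, div_le_iff₀ (by positivity)] at this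
  linarith

lemma bco_sum (k : ℕ) : ∃ C > 0, ∀ a : ℕ → ℂ, (∀ n, ‖a n‖ ≤ Real.log n + 1) → ∀ l : ℝ, 1 ≤ l →
    (Summable fun n => ‖bco a k (1 + 1 / l) n‖) ∧ ∑' n, ‖bco a k (1 + 1 / l) n‖ ≤ C * l ^ (k + 2) := by
  refine ⟨((k + 1).factorial * 2 ^ (k + 1) + k.factorial * 2 ^ k) * 3, by positivity, fun a ha l hl => ?_⟩
  have hl0 : 0 < l := by linarith
  obtain ⟨z1, z2⟩ := zeta_tsum (ε := 1 / (2 * l)) (by positivity)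
  have hb : ∀ n, ‖bco a k (1 + 1 / l) n‖ ≤ ((k + 1).factorial * 2 ^ (k + 1) + k.factorial * 2 ^ k) * l ^ (k + 1) * (n : ℝ) ^ (-1 - 1 / (2 * l)) := by
    intro n
    unfold bco
    rw [LSeries.norm_term_eq]
    split_ifs with hn
    · positivity
    · have hn1 : 1 ≤ n := Nat.one_le_iff_ne_zero.2 hn
      have hn0 : (0 : ℝ) < n := by exact_mod_cast hn1
      have h0 : 0 ≤ Real.log n := Real.log_natCast_nonneg n
      rw [logMul_iter, norm_mul, norm_pow, ← natCast_log, norm_real, Real.norm_eq_abs, abs_of_nonneg h0, ofReal_re]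
      have e1 : (n : ℝ) ^ (-1 - 1 / (2 * l)) = (n : ℝ) ^ (1 / (2 * l)) / (n : ℝ) ^ (1 + 1 / l) := by
        rw [← Real.rpow_sub hn0]; congr 1; field_simp; ring
      rw [e1, ← mul_div_assoc]
      refine div_le_div_of_nonneg_right ?_ (by positivity)
      have p1 := pow_log_le (k + 1) hl0 hn1
      have p2 := pow_log_le k hl0 hn1
      have p3 : l ^ k ≤ l ^ (k + 1) := pow_le_pow_right₀ hl (by omega)
      calc Real.log n ^ k * ‖a n‖ ≤ Real.log n ^ k * (Real.log n + 1) := by gcongr; exact ha n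
        _ = Real.log n ^ (k + 1) + Real.log n ^ k := by ring
        _ ≤ (k + 1).factorial * (2 * l) ^ (k + 1) * (n : ℝ) ^ (1 / (2 * l)) + k.factorial * (2 * l) ^ k * (n : ℝ) ^ (1 / (2 * l)) := by linarith
        _ = (k + 1).factorial * 2 ^ (k + 1) * l ^ (k + 1) * (n : ℝ) ^ (1 / (2 * l)) + k.factorial * 2 ^ k * l ^ k * (n : ℝ) ^ (1 / (2 * l)) := by
            rw [mul_pow, mul_pow]; ring
        _ ≤ (k + 1).factorial * 2 ^ (k + 1) * l ^ (k + 1) * (n : ℝ) ^ (1 / (2 * l)) + k.factorial * 2 ^ k * l ^ (k + 1) * (n : ℝ) ^ (1 / (2 * l)) := by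
            gcongr
        _ = _ := by ring
  have hs := Summable.of_nonneg_of_le (fun n => norm_nonneg _) hb (z1.mul_left _)
  refine ⟨hs, (hs.tsum_le_tsum hb (z1.mul_left _)).trans ?_⟩
  rw [tsum_mul_left]
  have z3 : 1 + 1 / (1 / (2 * l)) ≤ 3 * l := by rw [one_div_one_div]; linarith
  calc _ ≤ ((k + 1).factorial * 2 ^ (k + 1) + k.factorial * 2 ^ k) * l ^ (k + 1) * (3 * l) := by gcongr; linarith
    _ = _ := by ring

/-- The tent function. -/
noncomputable def tent (u0 h u : ℝ) : ℝ := max 0 (1 - |u - u0| / h)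

lemma tent_nonneg (u0 h u : ℝ) : 0 ≤ tent u0 h u := le_max_left _ _
lemma tent_le_one {u0 h u : ℝ} (hh : 0 < h) : tent u0 h u ≤ 1 := by
  unfold tent; apply max_le (by norm_num); have : 0 ≤ |u - u0| / h := by positivity
  linarith
lemma tent_out {u0 h u : ℝ} (hh : 0 < h) (hu : h ≤ |u - u0|) : tent u0 h u = 0 := by
  unfold tent; apply max_eq_left; have : 1 ≤ |u - u0| / h := by rwa [le_div_iff₀ hh, one_mul]
  linarith
lemma tent_lip {u0 h : ℝ} (hh : 0 < h) (u v : ℝ) : |tent u0 h u - tent u0 h v| ≤ |u - v| / h := by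
  unfold tent
  rw [max_comm 0, max_comm 0]
  refine (abs_max_sub_max_le_abs _ _ _).trans ?_
  have : (1 - |u - u0| / h) - (1 - |v - u0| / h) = (|v - u0| - |u - u0|) / h := by ring
  rw [this, abs_div, abs_of_pos hh]
  refine div_le_div_of_nonneg_right ?_ hh.le
  have := abs_abs_sub_abs_le_abs_sub (v - u0) (u - u0)
  rw [show v - u0 - (u - u0) = v - u by ring] at this
  rwa [abs_sub_comm u v]

lemma tent_mul_lip {u0 h : ℝ} (hh : 0 < h) {E : ℝ → ℂ} {M L1 : ℝ} (hM : ∀ u, |u - u0| ≤ h → ‖E u‖ ≤ M)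
    (hL : ∀ u v, |u - u0| ≤ h → |v - u0| ≤ h → ‖E u - E v‖ ≤ L1 * |u - v|) (u v : ℝ) :
    ‖(tent u0 h u : ℂ) * E u - (tent u0 h v : ℂ) * E v‖ ≤ (M / h + L1) * |u - v| := by
  have hM0 : 0 ≤ M := (norm_nonneg _).trans (hM u0 (by simpa using hh.le))
  have hL0 : 0 ≤ L1 := by
    have := hL u0 (u0 + h) (by simpa using hh.le) (by simp [abs_of_pos hh])
    have h2 := (norm_nonneg _).trans this
    have : |u0 - (u0 + h)| = h := by rw [show u0 - (u0 + h) = -h by ring, abs_neg, abs_of_pos hh]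
    rw [this] at h2
    by_contra hc; push Not at hc; nlinarith
  have key : ∀ u v : ℝ, |u - u0| ≤ h → h ≤ |v - u0| → ‖(tent u0 h u : ℂ) * E u - (tent u0 h v : ℂ) * E v‖ ≤ (M / h + L1) * |u - v| := by
    intro u v hu hv
    have h2 := tent_lip (u0 := u0) hh u v
    rw [tent_out hh hv] at h2 ⊢
    rw [sub_zero, abs_of_nonneg (tent_nonneg _ _ _)] at h2
    rw [ofReal_zero, zero_mul, sub_zero, norm_mul, norm_real, Real.norm_eq_abs, abs_of_nonneg (tent_nonneg _ _ _)]
    calc _ ≤ |u - v| / h * M := by gcongr; exact hM u hu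
      _ = M / h * |u - v| := by ring
      _ ≤ _ := by gcongr; linarith
  rcases le_total |u - u0| h with hu | hu <;> rcases le_total |v - u0| h with hv | hv
  · have e1 : (tent u0 h u : ℂ) * E u - (tent u0 h v : ℂ) * E v = ((tent u0 h u - tent u0 h v : ℝ) : ℂ) * E u + (tent u0 h v : ℂ) * (E u - E v) := by
      push_cast; ring
    rw [e1]
    refine (norm_add_le _ _).trans ?_
    rw [norm_mul, norm_mul, norm_real, norm_real, Real.norm_eq_abs, Real.norm_eq_abs, abs_of_nonneg (tent_nonneg _ _ v)]
    calc _ ≤ |u - v| / h * M + 1 * (L1 * |u - v|) := by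
          gcongr
          · exact tent_lip hh u v
          · exact hM u hu
          · exact tent_le_one hh
          · exact hL u v hu hv
      _ = _ := by ring
  · exact key u v hu hv
  · rw [norm_sub_rev, abs_sub_comm u v]; exact key v u hv hu
  · rw [tent_out hh hu, tent_out hh hv]; simp only [ofReal_zero, zero_mul, sub_self, norm_zero]; positivity

end PQ


namespace PQ
open Finset MeasureTheory Filter Topology Complex
open DirichletCharacter hiding LFunction_ne_zero_of_one_le_re
open ArithmeticFunction (vonMangoldt)

/-- The weight: a tent in `log n` around `log (η X)`, `X = exp l`, of width `cc / l`. -/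
noncomputable def wt (η cc l : ℝ) (n : ℕ) : ℝ := tent (Real.log η + l) (cc / l) (Real.log n)

/-- smooth part -/
noncomputable def Esm (k : ℕ) (l b u : ℝ) : ℂ := cexp (2 * Real.pi * (b * Real.exp u) * I) * (Real.exp ((1 + 1 / l) * u) / u ^ k : ℝ)

lemma Esm_deriv (k : ℕ) (l b u : ℝ) (hu : 0 < u) : HasDerivAt (Esm k l b)
    (Esm k l b u * (2 * Real.pi * b * Real.exp u * I + (1 + 1 / l) - k / u)) u := by
  have hu0 : (u : ℂ) ≠ 0 := by exact_mod_cast hu.ne'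
  have h1 : HasDerivAt (fun u : ℝ => cexp (2 * Real.pi * (b * Real.exp u) * I))
      (cexp (2 * Real.pi * (b * Real.exp u) * I) * (2 * Real.pi * (b * Real.exp u) * I)) u := by
    apply HasDerivAt.cexp
    have h2 : HasDerivAt (fun u : ℝ => ((Real.exp u : ℝ) : ℂ)) ((Real.exp u : ℝ) : ℂ) u := (Real.hasDerivAt_exp u).ofReal_comp
    exact ((h2.const_mul (b : ℂ)).const_mul (2 * Real.pi : ℂ)).mul_const I
  have h3 : HasDerivAt (fun u : ℝ => Real.exp ((1 + 1 / l) * u) / u ^ k)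
      ((Real.exp ((1 + 1 / l) * u) / u ^ k) * ((1 + 1 / l) - k / u)) u := by
    have h4 : HasDerivAt (fun u : ℝ => Real.exp ((1 + 1 / l) * u)) (Real.exp ((1 + 1 / l) * u) * (1 + 1 / l)) u := by
      apply HasDerivAt.exp
      simpa using (hasDerivAt_id u).const_mul (1 + 1 / l)
    have h5 := h4.div (hasDerivAt_pow k u) (by positivity)
    refine h5.congr_deriv ?_
    rcases k with _ | k
    · simp
    · simp only [Nat.add_sub_cancel]
      have : u ≠ 0 := hu.ne'
      have h7 : u ^ (k + 1) = u ^ k * u := pow_succ u k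
      generalize Real.exp ((1 + 1 / l) * u) = E
      generalize (1 + 1 / l) = σ
      have h8 : u ^ k ≠ 0 := by positivity
      rw [h7]
      field_simp
  have h6 := h1.mul h3.ofReal_comp
  have h9 : HasDerivAt (Esm k l b) _ u := h6
  refine h9.congr_deriv ?_
  unfold Esm
  push_cast
  ring

lemma wt_range {η cc l u : ℝ} (hcc : 0 < cc) (hcc1 : cc ≤ 1) (hl : 2 ≤ l) (hl2 : 2 * (|Real.log η| + 1) ≤ l)
    (hu : |u - (Real.log η + l)| ≤ cc / l) : l / 2 ≤ u ∧ u ≤ 2 * l := by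
  have h1 : cc / l ≤ 1 := by rw [div_le_one (by linarith)]; linarith
  have h2 := abs_le.1 (hu.trans h1)
  have h3 := abs_le.1 (le_refl |Real.log η|)
  constructor <;> linarith [h2.1, h2.2, h3.1, h3.2]

lemma exp_range {η cc l u : ℝ} (hη : 0 < η) (hcc1 : cc ≤ 1) (hl : 2 ≤ l)
    (hu : |u - (Real.log η + l)| ≤ cc / l) : Real.exp u ≤ 3 * η * Real.exp l := by
  have h1 : cc / l ≤ 1 := by rw [div_le_one (by linarith)]; linarith
  have h2 := abs_le.1 (hu.trans h1)
  have h3 : u ≤ Real.log η + l + 1 := by linarith [h2.2]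
  calc Real.exp u ≤ Real.exp (Real.log η + l + 1) := Real.exp_le_exp.2 h3
    _ = η * Real.exp l * Real.exp 1 := by rw [Real.exp_add, Real.exp_add, Real.exp_log hη]
    _ ≤ η * Real.exp l * 3 := by gcongr; exact Real.exp_one_lt_three.le
    _ = _ := by ring

lemma Esm_bound (k : ℕ) {η cc l b u : ℝ} (hη : 0 < η) (hcc : 0 < cc) (hcc1 : cc ≤ 1) (hl : 2 ≤ l) (hl2 : 2 * (|Real.log η| + 1) ≤ l)
    (hu : |u - (Real.log η + l)| ≤ cc / l) : ‖Esm k l b u‖ ≤ 27 * η * 2 ^ k * (Real.exp l / l ^ k) := by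
  obtain ⟨r1, r2⟩ := wt_range hcc hcc1 hl hl2 hu
  have h1 := exp_range hη hcc1 hl hu
  have hl0 : 0 < l := by linarith
  have hu0 : 0 < u := by linarith
  unfold Esm
  have e0 : (2 * Real.pi * (b * Real.exp u) * I : ℂ) = ((2 * Real.pi * (b * Real.exp u) : ℝ) : ℂ) * I := by push_cast; ring
  rw [norm_mul, e0, norm_exp_ofReal_mul_I, one_mul, norm_real, Real.norm_eq_abs, abs_of_pos (by positivity)]
  have h2 : Real.exp ((1 + 1 / l) * u) ≤ 27 * η * Real.exp l := by
    rw [add_mul, Real.exp_add, one_mul]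
    have : Real.exp (1 / l * u) ≤ 9 := by
      have h3 : 1 / l * u ≤ 2 := by
        rw [one_div, inv_mul_le_iff₀ hl0]; linarith
      calc _ ≤ Real.exp 2 := Real.exp_le_exp.2 h3
        _ = Real.exp 1 ^ 2 := by rw [← Real.exp_nat_mul]; norm_num
        _ ≤ 3 ^ 2 := by gcongr; exact Real.exp_one_lt_three.le
        _ = 9 := by norm_num
    calc _ ≤ 3 * η * Real.exp l * 9 := by gcongr
      _ = _ := by ring
  have h4 : (l / 2) ^ k ≤ u ^ k := by gcongr
  calc _ ≤ 27 * η * Real.exp l / (l / 2) ^ k := by gcongr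
    _ = _ := by rw [div_pow]; field_simp

lemma Esm_lip (k D : ℕ) {η cc l b : ℝ} (hη : 0 < η) (hcc : 0 < cc) (hcc1 : cc ≤ 1) (hl : 2 ≤ l) (hl2 : 2 * (|Real.log η| + 1) ≤ l)
    (hb : |b| ≤ l ^ D / Real.exp l) (u v : ℝ)
    (hu : |u - (Real.log η + l)| ≤ cc / l) (hv : |v - (Real.log η + l)| ≤ cc / l) :
    ‖Esm k l b u - Esm k l b v‖ ≤ 27 * η * 2 ^ k * (Real.exp l / l ^ k) * ((24 * η + 2 + k) * l ^ D) * |u - v| := by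
  have hl0 : 0 < l := by linarith
  have hconv : Convex ℝ (Metric.closedBall (Real.log η + l) (cc / l)) := convex_closedBall _ _
  have := hconv.norm_image_sub_le_of_norm_hasDerivWithin_le (f := Esm k l b)
    (f' := fun u => Esm k l b u * (2 * Real.pi * b * Real.exp u * I + (1 + 1 / l) - k / u))
    (C := 27 * η * 2 ^ k * (Real.exp l / l ^ k) * ((24 * η + 2 + k) * l ^ D)) (x := v) (y := u) ?_ ?_
    (by rwa [Metric.mem_closedBall, Real.dist_eq]) (by rwa [Metric.mem_closedBall, Real.dist_eq])
  · rwa [Real.norm_eq_abs] at this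
  · intro x hx
    rw [Metric.mem_closedBall, Real.dist_eq] at hx
    have := (wt_range hcc hcc1 hl hl2 hx).1
    exact (Esm_deriv k l b x (by linarith)).hasDerivWithinAt
  · intro x hx
    rw [Metric.mem_closedBall, Real.dist_eq] at hx
    obtain ⟨r1, r2⟩ := wt_range hcc hcc1 hl hl2 hx
    have h1 := exp_range hη hcc1 hl hx
    have hx1 : 1 ≤ x := by linarith
    have hlD : 1 ≤ l ^ D := one_le_pow₀ (by linarith)
    rw [norm_mul]
    gcongr
    · exact Esm_bound k hη hcc hcc1 hl hl2 hx
    · have n1 : ‖(2 * Real.pi * b * Real.exp x * I : ℂ)‖ ≤ 24 * η * l ^ D := by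
        have : (2 * Real.pi * b * Real.exp x * I : ℂ) = ((2 * Real.pi * b * Real.exp x : ℝ) : ℂ) * I := by push_cast; ring
        rw [this, norm_mul, norm_I, mul_one, norm_real, Real.norm_eq_abs, abs_mul, abs_mul, abs_of_pos (Real.exp_pos x),
          abs_of_pos Real.two_pi_pos]
        have hpi : 2 * Real.pi ≤ 8 := by linarith [Real.pi_le_four]
        calc _ ≤ 8 * (l ^ D / Real.exp l) * (3 * η * Real.exp l) := by gcongr
          _ = _ := by field_simp; ring
      have n2 : ‖(1 + 1 / l : ℂ)‖ ≤ 2 := by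
        have : (1 + 1 / l : ℂ) = ((1 + 1 / l : ℝ) : ℂ) := by push_cast; ring
        rw [this, norm_real, Real.norm_eq_abs, abs_of_pos (by positivity)]
        have : 1 / l ≤ 1 := by rw [div_le_one hl0]; linarith
        linarith
      have n3 : ‖(k / x : ℂ)‖ ≤ k := by
        rw [norm_div, norm_natCast, norm_real, Real.norm_eq_abs, abs_of_pos (by linarith)]
        exact div_le_self (by positivity) hx1
      calc _ ≤ ‖(2 * Real.pi * b * Real.exp x * I : ℂ)‖ + ‖(1 + 1 / l : ℂ)‖ + ‖(k / x : ℂ)‖ :=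
            (norm_sub_le _ _).trans (add_le_add_left (norm_add_le _ _) _)
        _ ≤ 24 * η * l ^ D + 2 * l ^ D + k * l ^ D := by
            have : (k : ℝ) ≤ k * l ^ D := le_mul_of_one_le_right (by positivity) hlD
            linarith
        _ = _ := by ring

lemma sw_core (η cc : ℝ) (hη : 0 < η) (hcc : 0 < cc) (hcc1 : cc ≤ 1) (k D : ℕ) : ∃ C > 0, ∃ L0 : ℝ, ∀ a : ℕ → ℂ,
    (∀ n, ‖a n‖ ≤ Real.log n + 1) → ∀ l, L0 ≤ l → ∀ b : ℝ, |b| ≤ l ^ D / Real.exp l → ∀ K δ : ℝ, 0 ≤ K → 0 < δ → δ ≤ 1 →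
    (∀ t : ℝ, ‖LSeries (LSeries.logMul^[k] a) ((1 + 1 / l : ℝ) + I * t)‖ ≤ K * (|t| + 2)) →
    ‖∑' n, a n * ((wt η cc l n : ℂ) * e (n * b))‖ ≤ C * Real.exp l * (δ * l ^ (D + 3) + K / (δ ^ 2 * l ^ k)) := by
  obtain ⟨Cb, hCb0, hCb⟩ := bco_sum k
  set c1 := 27 * η * 2 ^ k with hc1
  set c2 := 1 / cc + (24 * η + 2 + k) with hc2
  have hc1p : 0 < c1 := by positivity
  have hc2p : 0 < c2 := by positivity
  refine ⟨3 * c1 * c2 * Cb + 4 * c1, by positivity, max 2 (2 * (|Real.log η| + 1)), ?_⟩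
  intro a ha l hl b hb K δ hK hδ hδ1 hA
  have hl2 := (le_max_right _ _).trans hl
  replace hl := (le_max_left _ _).trans hl
  have hl0 : 0 < l := by linarith
  have hh : 0 < cc / l := by positivity
  obtain ⟨hs1, hs2⟩ := hCb a ha l (by linarith)
  set u0 := Real.log η + l with hu0
  set M := c1 * (Real.exp l / l ^ k) with hM
  have hMp : 0 < M := by positivity
  set G : ℝ → ℂ := fun u => (tent u0 (cc / l) u : ℂ) * Esm k l b u with hG
  have hEb : ∀ u, |u - u0| ≤ cc / l → ‖Esm k l b u‖ ≤ M := fun u hu => Esm_bound k hη hcc hcc1 hl hl2 hu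
  have hLip := tent_mul_lip hh hEb (fun u v hu hv => Esm_lip k D hη hcc hcc1 hl hl2 hb u v hu hv)
  set Lip := M / (cc / l) + 27 * η * 2 ^ k * (Real.exp l / l ^ k) * ((24 * η + 2 + k) * l ^ D) with hLipd
  have hLip0 : 0 ≤ Lip := by positivity
  have hLipb : Lip ≤ M * c2 * l ^ (D + 1) := by
    have p1 : l ≤ l ^ (D + 1) := le_self_pow₀ (by linarith) (by omega)
    have p2 : l ^ D ≤ l ^ (D + 1) := pow_le_pow_right₀ (by linarith) (by omega)
    calc Lip = M * (1 / cc) * l + M * (24 * η + 2 + k) * l ^ D := by rw [hLipd, ← hc1, hM]; field_simp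
      _ ≤ M * (1 / cc) * l ^ (D + 1) + M * (24 * η + 2 + k) * l ^ (D + 1) := by gcongr
      _ = _ := by rw [hc2]; ring
  have hGb : ∀ u, ‖G u‖ ≤ (Set.Icc (u0 - cc / l) (u0 + cc / l)).indicator (fun _ => M) u := by
    intro u
    by_cases hu : u ∈ Set.Icc (u0 - cc / l) (u0 + cc / l)
    · rw [Set.indicator_of_mem hu]
      have hu2 : |u - u0| ≤ cc / l := by rw [abs_le]; constructor <;> linarith [hu.1, hu.2]
      rw [hG, norm_mul, norm_real, Real.norm_eq_abs, abs_of_nonneg (tent_nonneg _ _ _)]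
      calc _ ≤ 1 * M := mul_le_mul (tent_le_one hh) (hEb u hu2) (norm_nonneg _) (by norm_num)
        _ = M := one_mul M
    · rw [Set.indicator_of_notMem hu]
      have hu2 : cc / l ≤ |u - u0| := by
        by_contra hc; push Not at hc
        apply hu; have := abs_lt.1 hc; constructor <;> linarith [this.1, this.2]
      simp only [hG]
      rw [tent_out hh hu2]; simp
  have hGc : Continuous G := by
    have : LipschitzWith (Real.toNNReal Lip) G := LipschitzWith.of_dist_le_mul fun u v => by
      rw [dist_eq_norm, Real.dist_eq, Real.coe_toNNReal _ hLip0]; exact hLip u v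
    exact this.continuous
  have hind : Integrable ((Set.Icc (u0 - cc / l) (u0 + cc / l)).indicator (fun _ => M)) :=
    (integrable_indicator_iff measurableSet_Icc).2 (integrableOn_const (by simp))
  have hGi : Integrable G := hind.mono' hGc.aestronglyMeasurable (Eventually.of_forall hGb)
  have hGI : ∫ u, ‖G u‖ ≤ 2 * M := by
    refine (integral_mono hGi.norm hind hGb).trans ?_
    rw [integral_indicator measurableSet_Icc, setIntegral_const, smul_eq_mul, Measure.real, Real.volume_Icc,
      ENNReal.toReal_ofReal (by linarith)]
    have : cc / l ≤ 1 := by rw [div_le_one (by linarith)]; linarith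
    gcongr; linarith
  have hGM : ∀ u, ‖G u‖ ≤ M := fun u => (hGb u).trans (Set.indicator_le_self' (fun _ _ => hMp.le) u)
  have hA2 : ∀ t : ℝ, ‖∑' n, bco a k (1 + 1 / l) n * cexp (-(I * Real.log n * t))‖ ≤ K * (|t| + 2) := by
    intro t
    simp_rw [bco_twist]
    exact hA t
  have hT := tauber (lam := fun n : ℕ => Real.log n) hs1 hδ hδ1 hK hA2 hLip0 hLip hGM hGi
  have hterm : ∀ n : ℕ, bco a k (1 + 1 / l) n * G (Real.log n) = a n * ((wt η cc l n : ℂ) * e (n * b)) := by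
    intro n
    simp only [hG]
    unfold wt
    rw [← hu0]
    by_cases hn : |Real.log n - u0| < cc / l
    · have hr := (wt_range hcc hcc1 hl hl2 hn.le).1
      have hlog : 0 < Real.log n := by linarith
      have hn0 : n ≠ 0 := by rintro rfl; simp at hlog
      have hn1 : (0 : ℝ) < n := by positivity
      have hnc : (n : ℂ) ≠ 0 := by exact_mod_cast hn0
      unfold bco Esm e
      rw [LSeries.term_of_ne_zero hn0, logMul_iter, ← natCast_log, Real.exp_log hn1]
      have e1 : (n : ℂ) ^ (((1 + 1 / l : ℝ)) : ℂ) = ((Real.exp ((1 + 1 / l) * Real.log n) : ℝ) : ℂ) := by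
        rw [mul_comm, ← Real.rpow_def_of_pos hn1, ofReal_cpow hn1.le]; simp
      rw [e1]
      have e2 : ((Real.exp ((1 + 1 / l) * Real.log n) : ℝ) : ℂ) ≠ 0 := by exact_mod_cast (Real.exp_pos _).ne'
      have e3 : (Real.log n : ℂ) ≠ 0 := by exact_mod_cast hlog.ne'
      rw [ofReal_div, ofReal_pow]
      generalize ((Real.exp ((1 + 1 / l) * Real.log n) : ℝ) : ℂ) = EE at *
      have e4 : cexp (2 * Real.pi * (b * (n : ℝ)) * I) = cexp (2 * Real.pi * ((n * b : ℝ) : ℂ) * I) := by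
        congr 1; push_cast; ring
      rw [e4]
      field_simp
    · rw [tent_out hh (not_lt.1 hn)]; simp
  have hT2 := (congrArg norm (tsum_congr hterm)).symm.le.trans hT
  refine hT2.trans ?_
  calc _ ≤ 3 * δ * (M * c2 * l ^ (D + 1)) * (Cb * l ^ (k + 2)) + 2 * K / δ ^ 2 * (2 * M) := by gcongr
    _ = 3 * c1 * c2 * Cb * Real.exp l * (δ * l ^ (D + 3)) + 4 * c1 * Real.exp l * (K / (δ ^ 2 * l ^ k)) := by
        rw [hM]; field_simp; ring
    _ ≤ _ := by
        have q1 : 0 ≤ δ * l ^ (D + 3) := by positivity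
        have q2 : 0 ≤ K / (δ ^ 2 * l ^ k) := by positivity
        have q3 : 0 ≤ 3 * c1 * c2 * Cb * Real.exp l := by positivity
        have q4 : 0 ≤ 4 * c1 * Real.exp l := by positivity
        nlinarith [mul_nonneg q3 q2, mul_nonneg q4 q1]

end PQ


namespace PQ
open Finset MeasureTheory Filter Topology Complex
open DirichletCharacter hiding LFunction_ne_zero_of_one_le_re
open ArithmeticFunction (vonMangoldt)

lemma sw_fin (η cc : ℝ) (hη : 0 < η) (hcc : 0 < cc) (hcc1 : cc ≤ 1) (D A : ℕ) : ∃ k : ℕ, ∀ CK > 0, ∃ L0 : ℝ, ∀ a : ℕ → ℂ,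
    (∀ n, ‖a n‖ ≤ Real.log n + 1) → ∀ l, L0 ≤ l → ∀ b : ℝ, |b| ≤ l ^ D / Real.exp l →
    (∀ t : ℝ, ‖LSeries (LSeries.logMul^[k] a) ((1 + 1 / l : ℝ) + I * t)‖ ≤ CK * l ^ D * (|t| + 2)) →
    ‖∑' n, a n * ((wt η cc l n : ℂ) * e (n * b))‖ ≤ Real.exp l / l ^ A := by
  refine ⟨D + 2 * (D + 4 + A) + A + 1, fun CK hCK => ?_⟩
  obtain ⟨C, hC, L0, h⟩ := sw_core η cc hη hcc hcc1 (D + 2 * (D + 4 + A) + A + 1) D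
  refine ⟨max L0 (max 1 (C * (1 + CK))), fun a ha l hl b hb hA => ?_⟩
  have hl1 := (le_max_left _ _).trans hl
  have hl2 := ((le_max_left _ _).trans (le_max_right _ _)).trans hl
  have hl3 := ((le_max_right _ _).trans (le_max_right _ _)).trans hl
  have hl0 : 0 < l := by linarith
  have := h a ha l hl1 b hb (CK * l ^ D) (1 / l ^ (D + 4 + A)) (by positivity) (by positivity)
    (by rw [div_le_one (by positivity)]; exact one_le_pow₀ hl2) hA
  refine this.trans ?_
  have e1 : 1 / l ^ (D + 4 + A) * l ^ (D + 3) = 1 / l ^ (A + 1) := by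
    rw [div_mul_eq_mul_div, one_mul, div_eq_div_iff (by positivity) (by positivity)]; ring
  have e2 : CK * l ^ D / ((1 / l ^ (D + 4 + A)) ^ 2 * l ^ (D + 2 * (D + 4 + A) + A + 1)) = CK / l ^ (A + 1) := by
    rw [div_pow, one_pow, div_mul_eq_mul_div, one_mul]
    rw [show l ^ (D + 2 * (D + 4 + A) + A + 1) = (l ^ (D + 4 + A)) ^ 2 * (l ^ D * l ^ (A + 1)) by ring]
    field_simp
  rw [e1, e2]
  calc C * Real.exp l * (1 / l ^ (A + 1) + CK / l ^ (A + 1)) = (C * (1 + CK)) * Real.exp l / l ^ (A + 1) := by ring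
    _ ≤ l * Real.exp l / l ^ (A + 1) := by gcongr
    _ = _ := by rw [pow_succ]; field_simp

lemma norm_logMul_eq {a : ℕ → ℂ} {F : ℂ → ℂ} (k : ℕ) (hsum : ∀ s : ℂ, 1 < s.re → LSeriesSummable a s)
    (hF : ∀ s : ℂ, 1 < s.re → LSeries a s = F s) {s : ℂ} (hs : 1 < s.re) :
    ‖LSeries (LSeries.logMul^[k] a) s‖ = ‖iteratedDeriv k F s‖ := by
  have h1 : LSeries.abscissaOfAbsConv a ≤ (1 : ℝ) :=
    LSeries.abscissaOfAbsConv_le_of_forall_lt_LSeriesSummable fun y hy => hsum y (by simpa using hy)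
  have h2 : LSeries.abscissaOfAbsConv a < s.re := h1.trans_lt (by exact_mod_cast hs)
  have h3 := LSeries_iteratedDeriv k h2
  have h4 : LSeries a =ᶠ[𝓝 s] F := by
    filter_upwards [(isOpen_lt continuous_const continuous_re).mem_nhds hs] with z hz using hF z hz
  rw [h4.iteratedDeriv_eq k] at h3
  rw [h3, norm_mul, norm_pow, norm_neg, norm_one, one_pow, one_mul]

lemma vM_le (n : ℕ) : vonMangoldt n ≤ Real.log n := ArithmeticFunction.vonMangoldt_le_log

lemma sw_char (η cc : ℝ) (hη : 0 < η) (hcc : 0 < cc) (hcc1 : cc ≤ 1) (D A : ℕ) : ∃ L0 : ℝ, ∀ l, L0 ≤ l →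
    ∀ (q : ℕ) [NeZero q] (χ : DirichletCharacter ℂ q), χ ≠ 1 → (q : ℝ) ≤ l ^ D → ∀ b : ℝ, |b| ≤ l ^ D / Real.exp l →
    ‖∑' n : ℕ, (χ (n : ZMod q) * (vonMangoldt n : ℂ)) * ((wt η cc l n : ℂ) * e (n * b))‖ ≤ Real.exp l / l ^ A := by
  obtain ⟨k, hk⟩ := sw_fin η cc hη hcc hcc1 D A
  obtain ⟨C, hC, hLD⟩ := LD_bound k
  obtain ⟨L0, hL⟩ := hk C hC
  refine ⟨max 1 L0, fun l hl q _ χ hχ hq b hb => ?_⟩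
  have hl1 := (le_max_left _ _).trans hl
  have hl0 : 0 < l := by linarith
  refine hL (fun n : ℕ => χ (n : ZMod q) * (vonMangoldt n : ℂ)) ?_ l ((le_max_right _ _).trans hl) b hb ?_
  · intro n
    rw [norm_mul, norm_real, Real.norm_eq_abs, abs_of_nonneg ArithmeticFunction.vonMangoldt_nonneg]
    have := χ.norm_le_one (n : ZMod q)
    have h2 := vM_le n
    have h3 : 0 ≤ vonMangoldt n := ArithmeticFunction.vonMangoldt_nonneg
    nlinarith
  · intro t
    have hs : 1 < ((1 + 1 / l : ℝ) + I * t : ℂ).re := by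
      simp only [add_re, ofReal_re, mul_re, I_re, I_im, ofReal_im]; ring_nf; linarith [inv_pos.2 hl0]
    have hs2 : ((1 + 1 / l : ℝ) + I * t : ℂ).re ≤ 2 := by
      simp only [add_re, ofReal_re, mul_re, I_re, I_im, ofReal_im]
      have : 1 / l ≤ 1 := by rw [div_le_one hl0]; exact hl1
      linarith
    have him : ((1 + 1 / l : ℝ) + I * t : ℂ).im = t := by simp
    rw [norm_logMul_eq (a := fun n : ℕ => χ (n : ZMod q) * (vonMangoldt n : ℂ)) (F := fun s => -logDeriv (LFunction χ) s) k (fun s hs => LSeriesSummable_twist_vonMangoldt χ hs) ?_ hs]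
    · rw [iteratedDeriv_fun_neg, norm_neg]
      refine (hLD q χ _ hχ hs hs2).trans ?_
      rw [him, VV]
      calc C * (q * (|t| + 2)) = C * q * (|t| + 2) := by ring
        _ ≤ _ := by gcongr
    · intro s hs
      have h1 := LSeries_twist_vonMangoldt_eq χ hs
      have h2 : (fun n : ℕ => χ (n : ZMod q) * (vonMangoldt n : ℂ)) = (fun n : ℕ => χ (n : ZMod q)) * (fun n : ℕ => (vonMangoldt n : ℂ)) := rfl
      rw [h2, h1]
      have h4 : LFunction χ =ᶠ[𝓝 s] LSeries (fun n : ℕ => χ (n : ZMod q)) := by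
        filter_upwards [(isOpen_lt continuous_const continuous_re).mem_nhds hs] with z hz using LFunction_eq_LSeries χ hz
      simp only [logDeriv_apply]
      rw [h4.deriv_eq, h4.eq_of_nhds, neg_div]

lemma sw_one (η cc : ℝ) (hη : 0 < η) (hcc : 0 < cc) (hcc1 : cc ≤ 1) (D A : ℕ) : ∃ L0 : ℝ, ∀ l, L0 ≤ l →
    ∀ b : ℝ, |b| ≤ l ^ D / Real.exp l →
    ‖∑' n : ℕ, ((vonMangoldt n : ℂ) - 1) * ((wt η cc l n : ℂ) * e (n * b))‖ ≤ Real.exp l / l ^ A := by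
  obtain ⟨k, hk⟩ := sw_fin η cc hη hcc hcc1 D A
  obtain ⟨C, hC, hLD⟩ := Pz_bound k
  obtain ⟨L0, hL⟩ := hk C hC
  refine ⟨max 1 L0, fun l hl b hb => ?_⟩
  have hl1 := (le_max_left _ _).trans hl
  have hl0 : 0 < l := by linarith
  refine hL (fun n : ℕ => (vonMangoldt n : ℂ) - 1) ?_ l ((le_max_right _ _).trans hl) b hb ?_
  · intro n
    refine (norm_sub_le _ _).trans ?_
    rw [norm_real, Real.norm_eq_abs, abs_of_nonneg ArithmeticFunction.vonMangoldt_nonneg, norm_one]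
    linarith [vM_le n]
  · intro t
    have hs : 1 < ((1 + 1 / l : ℝ) + I * t : ℂ).re := by
      simp only [add_re, ofReal_re, mul_re, I_re, I_im, ofReal_im]; ring_nf; linarith [inv_pos.2 hl0]
    have hs2 : ((1 + 1 / l : ℝ) + I * t : ℂ).re ≤ 2 := by
      simp only [add_re, ofReal_re, mul_re, I_re, I_im, ofReal_im]
      have : 1 / l ≤ 1 := by rw [div_le_one hl0]; exact hl1
      linarith
    have him : ((1 + 1 / l : ℝ) + I * t : ℂ).im = t := by simp
    have hone : ∀ s : ℂ, 1 < s.re → LSeriesSummable 1 s := fun s hs => LSeriesSummable_one_iff.2 hs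
    rw [norm_logMul_eq (a := fun n : ℕ => (vonMangoldt n : ℂ) - 1) (F := Pz) k (fun s hs => (ArithmeticFunction.LSeriesSummable_vonMangoldt hs).sub (hone s hs)) ?_ hs]
    · refine (hLD _ hs hs2).trans ?_
      rw [him, VV]
      have : 1 ≤ l ^ D := one_le_pow₀ hl1
      calc C * ((1 : ℕ) * (|t| + 2)) = C * 1 * (|t| + 2) := by push_cast; ring
        _ ≤ _ := by gcongr
    · intro s hs
      have hs1 : s ≠ 1 := by rintro rfl; simp at hs
      have hL1 : ∀ z : ℂ, 1 < z.re → LFunction (1 : DirichletCharacter ℂ 1) z = LSeries 1 z := by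
        intro z hz
        rw [LFunction_eq_LSeries _ hz]
        apply LSeries_congr
        intro n hn
        simp [Subsingleton.elim (n : ZMod 1) 1]
      have hne : LFunction (1 : DirichletCharacter ℂ 1) s ≠ 0 := by
        rw [LFunction_eq_LSeries _ hs]
        exact LSeries_ne_zero_of_one_lt_re _ hs
      rw [Pz_eq hs1 hne]
      have h2 : (fun n : ℕ => (vonMangoldt n : ℂ) - 1) = (fun n : ℕ => (vonMangoldt n : ℂ)) - 1 := rfl
      rw [h2, LSeries_sub (ArithmeticFunction.LSeriesSummable_vonMangoldt hs) (hone s hs), ArithmeticFunction.LSeries_vonMangoldt_eq hs]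
      have h4 : LFunction (1 : DirichletCharacter ℂ 1) =ᶠ[𝓝 s] LSeries 1 := by
        filter_upwards [(isOpen_lt continuous_const continuous_re).mem_nhds hs] with z hz using hL1 z hz
      simp only [logDeriv_apply]
      rw [h4.deriv_eq, h4.eq_of_nhds, neg_div]

end PQ


namespace PQ
open Finset MeasureTheory Filter Topology Complex
open DirichletCharacter hiding LFunction_ne_zero_of_one_le_re
open ArithmeticFunction (vonMangoldt)

/-! ### Major arcs -/

/-- `c_q(1)/φ(q)` -/
noncomputable def kap (q : ℕ) [NeZero q] : ℂ := (∑ x : (ZMod q)ˣ, ZMod.stdAddChar (x : ZMod q)) / (q.totient : ℂ)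

lemma norm_std (q : ℕ) [NeZero q] (x : ZMod q) : ‖ZMod.stdAddChar x‖ = 1 := by
  rw [ZMod.stdAddChar_apply]; exact Circle.norm_coe _

lemma totpos (q : ℕ) [NeZero q] : 0 < q.totient := Nat.totient_pos.2 (NeZero.pos q)

lemma kap_norm (q : ℕ) [NeZero q] : ‖kap q‖ ≤ 1 := by
  unfold kap
  have hp : (0 : ℝ) < q.totient := by exact_mod_cast totpos q
  rw [norm_div, norm_natCast, div_le_one hp]
  refine (norm_sum_le _ _).trans ?_
  simp only [norm_std]
  rw [sum_const, card_univ, ZMod.card_units_eq_totient]; simp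

lemma kap_conj (q : ℕ) [NeZero q] : (starRingEnd ℂ) (kap q) = kap q := by
  unfold kap
  rw [map_div₀, map_sum, map_natCast]
  congr 1
  rw [← Equiv.sum_comp (Equiv.neg (ZMod q)ˣ)]
  refine sum_congr rfl fun x _ => ?_
  simp only [Equiv.neg_apply, Units.val_neg]
  rw [← AddChar.map_neg_eq_conj, neg_neg]

lemma kap_one : kap 1 = 1 := by
  unfold kap
  simp only [univ_unique, sum_singleton, Nat.totient_one, Nat.cast_one, div_one]
  rw [Subsingleton.elim ((default : (ZMod 1)ˣ) : ZMod 1) 0, AddChar.map_zero_eq_one]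

lemma char_expand (q : ℕ) [NeZero q] (a y : ZMod q) :
    (if IsUnit y then ZMod.stdAddChar (a * y) else (0 : ℂ)) =
      (q.totient : ℂ)⁻¹ * ∑ χ : DirichletCharacter ℂ q,
        (∑ x : (ZMod q)ˣ, χ ((x : ZMod q)⁻¹) * ZMod.stdAddChar (a * (x : ZMod q))) * χ y := by
  have hp : (q.totient : ℂ) ≠ 0 := by exact_mod_cast (totpos q).ne'
  by_cases hy : IsUnit y
  · rw [if_pos hy]
    obtain ⟨u, rfl⟩ := hy
    have h1 : ∑ χ : DirichletCharacter ℂ q, (∑ x : (ZMod q)ˣ, χ ((x : ZMod q)⁻¹) * ZMod.stdAddChar (a * (x : ZMod q))) * χ (u : ZMod q) =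
        ∑ x : (ZMod q)ˣ, ZMod.stdAddChar (a * (x : ZMod q)) * ∑ χ : DirichletCharacter ℂ q, χ ((x : ZMod q)⁻¹) * χ (u : ZMod q) := by
      simp_rw [sum_mul, mul_sum]
      rw [sum_comm]
      exact sum_congr rfl fun x _ => sum_congr rfl fun χ _ => by ring
    rw [h1]
    have h2 : ∀ x : (ZMod q)ˣ, ∑ χ : DirichletCharacter ℂ q, χ ((x : ZMod q)⁻¹) * χ (u : ZMod q) = if x = u then (q.totient : ℂ) else 0 := by
      intro x
      rw [DirichletCharacter.sum_char_inv_mul_char_eq ℂ x.isUnit (u : ZMod q)]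
      simp only [Units.val_inj]
    simp_rw [h2, mul_ite, mul_zero, sum_ite_eq' univ u, if_pos (mem_univ u)]
    field_simp
  · rw [if_neg hy]
    have : ∀ χ : DirichletCharacter ℂ q, χ y = 0 := fun χ => MulChar.map_nonunit χ hy
    simp [this]

lemma major_id (q : ℕ) [NeZero q] (a : ZMod q) (ha : IsUnit a) (N : ℕ) (F : ℕ → ℂ) (T : ℝ) (hT0 : 0 ≤ T)
    (hT : ∀ χ : DirichletCharacter ℂ q, χ ≠ 1 → ‖∑ n ∈ Icc 1 N, χ (n : ZMod q) * F n‖ ≤ T) :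
    ‖∑ n ∈ Icc 1 N, F n * ZMod.stdAddChar (a * (n : ZMod q)) - kap q * ∑ n ∈ Icc 1 N, F n‖ ≤
      2 * ∑ n ∈ (Icc 1 N).filter (fun n : ℕ => ¬ IsUnit (n : ZMod q)), ‖F n‖ + q * T := by
  classical
  have hp : (q.totient : ℂ) ≠ 0 := by exact_mod_cast (totpos q).ne'
  have hpR : (0 : ℝ) < q.totient := by exact_mod_cast (totpos q)
  set g : DirichletCharacter ℂ q → ℂ := fun χ => ∑ x : (ZMod q)ˣ, χ ((x : ZMod q)⁻¹) * ZMod.stdAddChar (a * (x : ZMod q)) with hg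
  have hgn : ∀ χ, ‖g χ‖ ≤ q.totient := by
    intro χ
    refine (norm_sum_le _ _).trans ?_
    calc _ ≤ ∑ x : (ZMod q)ˣ, (1 : ℝ) := sum_le_sum fun x _ => by
          rw [norm_mul, norm_std, mul_one]; exact χ.norm_le_one _
      _ = _ := by rw [sum_const, card_univ, ZMod.card_units_eq_totient]; simp
  have hg1 : g 1 = q.totient * kap q := by
    obtain ⟨u, rfl⟩ := ha
    simp only [hg, kap]
    rw [mul_div_cancel₀ _ hp, ← Equiv.sum_comp (Equiv.mulLeft u) (fun x : (ZMod q)ˣ => ZMod.stdAddChar (x : ZMod q))]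
    refine sum_congr rfl fun x _ => ?_
    have hx : IsUnit ((x : ZMod q)⁻¹) := by rw [ZMod.inv_coe_unit]; exact (x⁻¹).isUnit
    rw [MulChar.one_apply hx, one_mul, Equiv.coe_mulLeft, Units.val_mul]
  have hsplit : ∑ n ∈ Icc 1 N, F n * ZMod.stdAddChar (a * (n : ZMod q)) =
      (q.totient : ℂ)⁻¹ * ∑ χ : DirichletCharacter ℂ q, g χ * ∑ n ∈ Icc 1 N, χ (n : ZMod q) * F n
      + ∑ n ∈ (Icc 1 N).filter (fun n : ℕ => ¬ IsUnit (n : ZMod q)), F n * ZMod.stdAddChar (a * (n : ZMod q)) := by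
    rw [← sum_filter_add_sum_filter_not (Icc 1 N) (fun n : ℕ => IsUnit (n : ZMod q))]
    congr 1
    rw [sum_filter]
    have : ∀ n : ℕ, (if IsUnit (n : ZMod q) then F n * ZMod.stdAddChar (a * (n : ZMod q)) else 0) =
        (q.totient : ℂ)⁻¹ * ∑ χ : DirichletCharacter ℂ q, g χ * (χ (n : ZMod q) * F n) := by
      intro n
      have h1 := char_expand q a (n : ZMod q)
      have h2 : (if IsUnit (n : ZMod q) then F n * ZMod.stdAddChar (a * (n : ZMod q)) else 0) =
        F n * (if IsUnit (n : ZMod q) then ZMod.stdAddChar (a * (n : ZMod q)) else 0) := by split_ifs <;> simp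
      rw [h2, h1, mul_left_comm, mul_sum]
      congr 1
      exact sum_congr rfl fun χ _ => by simp only [hg]; ring
    rw [sum_congr rfl fun n _ => this n, ← mul_sum, sum_comm]
    congr 1
    exact sum_congr rfl fun χ _ => by rw [mul_sum]
  have hone : ∑ n ∈ Icc 1 N, (1 : DirichletCharacter ℂ q) (n : ZMod q) * F n =
      ∑ n ∈ Icc 1 N, F n - ∑ n ∈ (Icc 1 N).filter (fun n : ℕ => ¬ IsUnit (n : ZMod q)), F n := by
    rw [← sum_filter_add_sum_filter_not (Icc 1 N) (fun n : ℕ => IsUnit (n : ZMod q)) F, add_sub_cancel_right, sum_filter]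
    refine sum_congr rfl fun n _ => ?_
    split_ifs with h
    · rw [MulChar.one_apply h, one_mul]
    · rw [MulChar.map_nonunit _ h, zero_mul]
  set R := (Icc 1 N).filter (fun n : ℕ => ¬ IsUnit (n : ZMod q)) with hR
  have hmain : ∑ n ∈ Icc 1 N, F n * ZMod.stdAddChar (a * (n : ZMod q)) - kap q * ∑ n ∈ Icc 1 N, F n =
      (q.totient : ℂ)⁻¹ * ∑ χ ∈ univ.erase (1 : DirichletCharacter ℂ q), g χ * ∑ n ∈ Icc 1 N, χ (n : ZMod q) * F n
      + ∑ n ∈ R, F n * ZMod.stdAddChar (a * (n : ZMod q)) - kap q * ∑ n ∈ R, F n := by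
    rw [hsplit, ← add_sum_erase univ _ (mem_univ (1 : DirichletCharacter ℂ q)), hone, hg1]
    field_simp
    ring
  rw [hmain]
  have b1 : ‖(q.totient : ℂ)⁻¹ * ∑ χ ∈ univ.erase (1 : DirichletCharacter ℂ q), g χ * ∑ n ∈ Icc 1 N, χ (n : ZMod q) * F n‖ ≤ q * T := by
    have c1 : ∀ χ ∈ univ.erase (1 : DirichletCharacter ℂ q), ‖g χ * ∑ n ∈ Icc 1 N, χ (n : ZMod q) * F n‖ ≤ q.totient * T := by
      intro χ hχ
      rw [norm_mul]
      exact mul_le_mul (hgn χ) (hT χ (ne_of_mem_erase hχ)) (norm_nonneg _) hpR.le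
    have c2 : ((univ.erase (1 : DirichletCharacter ℂ q)).card : ℝ) ≤ q := by
      have : (univ.erase (1 : DirichletCharacter ℂ q)).card ≤ q := by
        refine (card_erase_le).trans ?_
        rw [card_univ, ← Nat.card_eq_fintype_card, DirichletCharacter.card_eq_totient_of_hasEnoughRootsOfUnity]
        exact Nat.totient_le q
      exact_mod_cast this
    rw [norm_mul, norm_inv, Complex.norm_natCast, inv_mul_le_iff₀ hpR]
    refine (norm_sum_le_of_le _ c1).trans ?_
    rw [sum_const, nsmul_eq_mul]
    calc _ ≤ (q : ℝ) * (q.totient * T) := by gcongr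
      _ = _ := by ring
  have b2 : ‖∑ n ∈ R, F n * ZMod.stdAddChar (a * (n : ZMod q))‖ ≤ ∑ n ∈ R, ‖F n‖ := by
    refine norm_sum_le_of_le _ fun n _ => ?_
    rw [norm_mul, norm_std, mul_one]
  have b3 : ‖kap q * ∑ n ∈ R, F n‖ ≤ ∑ n ∈ R, ‖F n‖ := by
    rw [norm_mul]
    calc _ ≤ 1 * ∑ n ∈ R, ‖F n‖ := mul_le_mul (kap_norm q) (norm_sum_le _ _) (norm_nonneg _) (by norm_num)
      _ = _ := one_mul _
  calc _ ≤ _ := norm_sub_le _ _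
    _ ≤ _ := add_le_add_left (norm_add_le _ _) _
    _ ≤ _ := by linarith

end PQ


namespace PQ
open Finset MeasureTheory Filter Topology Complex
open DirichletCharacter hiding LFunction_ne_zero_of_one_le_re
open ArithmeticFunction (vonMangoldt)

lemma nonunit_sum (q : ℕ) [NeZero q] (N : ℕ) :
    ∑ n ∈ (Icc 1 N).filter (fun n : ℕ => ¬ IsUnit (n : ZMod q)), vonMangoldt n ≤ (q + 1) * (Nat.log 2 N + 1) * Real.log N := by
  classical
  set R := (Icc 1 N).filter (fun n : ℕ => ¬ IsUnit (n : ZMod q)) with hR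
  have h1 : ∑ n ∈ R, vonMangoldt n = ∑ n ∈ R.filter (fun n => vonMangoldt n ≠ 0), vonMangoldt n := (sum_filter_ne_zero R).symm
  rw [h1]
  have hsub : R.filter (fun n => vonMangoldt n ≠ 0) ⊆ (range (q + 1) ×ˢ range (Nat.log 2 N + 1)).image (fun x => x.1 ^ x.2) := by
    intro n hn
    rw [mem_filter, hR, mem_filter, mem_Icc] at hn
    obtain ⟨⟨⟨n1, n2⟩, n3⟩, n4⟩ := hn
    rw [ZMod.isUnit_iff_coprime] at n3
    rw [Ne, ArithmeticFunction.vonMangoldt_eq_zero_iff, not_not, isPrimePow_nat_iff] at n4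
    obtain ⟨p, k, hp, hk, rfl⟩ := n4
    have hpq : p ∣ q := by
      by_contra hc
      exact n3 (Nat.Coprime.pow_left k ((Nat.Prime.coprime_iff_not_dvd hp).2 hc))
    rw [mem_image]
    refine ⟨(p, k), ?_, rfl⟩
    rw [mem_product, mem_range, mem_range]
    have hle := Nat.le_of_dvd (NeZero.pos q) hpq
    refine ⟨by simp only; omega, ?_⟩
    have : k ≤ Nat.log 2 N := Nat.le_log_of_pow_le (by norm_num) ((Nat.pow_le_pow_left hp.two_le k).trans n2)
    simp only; omega
  have hcard : ((R.filter (fun n => vonMangoldt n ≠ 0)).card : ℝ) ≤ (q + 1) * (Nat.log 2 N + 1) := by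
    have := (card_le_card hsub).trans card_image_le
    rw [card_product, card_range, card_range] at this
    exact_mod_cast this
  have hb : ∀ n ∈ R.filter (fun n => vonMangoldt n ≠ 0), vonMangoldt n ≤ Real.log N := by
    intro n hn
    rw [mem_filter, hR, mem_filter, mem_Icc] at hn
    refine (vM_le n).trans (Real.log_le_log (by exact_mod_cast hn.1.1.1) (by exact_mod_cast hn.1.1.2))
  refine (sum_le_card_nsmul _ _ _ hb).trans ?_
  rw [nsmul_eq_mul]
  have : 0 ≤ Real.log N := Real.log_natCast_nonneg N
  gcongr

instance ratNeZero (r : ℚ) : NeZero r.den := ⟨r.den_nz⟩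

lemma e_rat (r : ℚ) (n : ℕ) : e (n * (r : ℝ)) = ZMod.stdAddChar ((r.num : ZMod r.den) * (n : ZMod r.den)) := by
  have : ((r.num : ZMod r.den) * (n : ZMod r.den)) = ((r.num * n : ℤ) : ZMod r.den) := by push_cast; ring
  rw [this, ZMod.stdAddChar_coe]
  unfold e
  congr 1
  have h := Rat.cast_def (K := ℂ) r
  push_cast
  rw [h]
  ring

lemma rat_unit (r : ℚ) : IsUnit (r.num : ZMod r.den) := by
  have h := r.reduced
  have h2 : (r.num : ZMod r.den) = ((r.num.natAbs : ℕ) : ZMod r.den) ∨ (r.num : ZMod r.den) = -((r.num.natAbs : ℕ) : ZMod r.den) := by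
    rcases Int.natAbs_eq r.num with h1 | h1
    · left
      have := congrArg (fun z : ℤ => (z : ZMod r.den)) h1
      simpa only [Int.cast_natCast, Int.cast_neg] using this
    · right
      have := congrArg (fun z : ℤ => (z : ZMod r.den)) h1
      simpa only [Int.cast_natCast, Int.cast_neg] using this
  have h3 : IsUnit ((r.num.natAbs : ℕ) : ZMod r.den) := (ZMod.isUnit_iff_coprime _ _).2 h
  rcases h2 with h2 | h2 <;> rw [h2]
  · exact h3
  · exact h3.neg

lemma wt_nonneg (η cc l : ℝ) (n : ℕ) : 0 ≤ wt η cc l n := tent_nonneg _ _ _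
lemma wt_le_one {η cc l : ℝ} (hcc : 0 < cc) (hl : 0 < l) (n : ℕ) : wt η cc l n ≤ 1 := tent_le_one (by positivity)
lemma wt_zero {η cc l : ℝ} (hcc : 0 < cc) (hcc1 : cc ≤ 1) (hl : 2 ≤ l) (hl2 : 2 * (|Real.log η| + 1) ≤ l) : wt η cc l 0 = 0 := by
  by_contra h
  have h1 : |Real.log (0 : ℕ) - (Real.log η + l)| ≤ cc / l := by
    by_contra hc; push Not at hc
    exact h (tent_out (by positivity) hc.le)
  have := (wt_range hcc hcc1 hl hl2 h1).1
  simp at this; linarith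

lemma pow_exp_small (c : ℝ) (m : ℕ) : ∃ L0 : ℝ, ∀ l, L0 ≤ l → c * l ^ m ≤ Real.exp l := by
  have h := (Real.isLittleO_pow_exp_atTop (n := m)).const_mul_left c
  have h2 := h.bound (c := 1) one_pos
  obtain ⟨L0, hL⟩ := eventually_atTop.1 h2
  refine ⟨L0, fun l hl => ?_⟩
  have := hL l hl
  rw [one_mul, Real.norm_eq_abs, Real.norm_eq_abs, abs_of_pos (Real.exp_pos l)] at this
  exact (le_abs_self _).trans this

lemma natlog_le {N : ℕ} (hN : 1 ≤ N) : (Nat.log 2 N : ℝ) ≤ 2 * Real.log N := by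
  have h1 : 2 ^ Nat.log 2 N ≤ N := Nat.pow_log_le_self 2 (by omega)
  have h2 : ((2 : ℝ)) ^ Nat.log 2 N ≤ N := by exact_mod_cast h1
  have h3 := Real.log_le_log (by positivity) h2
  rw [Real.log_pow] at h3
  have h4 : (1 : ℝ) / 2 ≤ Real.log 2 := by linarith [Real.log_two_gt_d9]
  have h5 : (Nat.log 2 N : ℝ) * (1 / 2) ≤ Nat.log 2 N * Real.log 2 := by gcongr
  linarith

lemma major (η cc : ℝ) (hη : 0 < η) (hcc : 0 < cc) (hcc1 : cc ≤ 1) (D A : ℕ) : ∃ L0 : ℝ, ∀ l, L0 ≤ l →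
    ∀ N : ℕ, 1 ≤ N → Real.log N ≤ 2 * l → (∀ n, N < n → wt η cc l n = 0) → ∀ r : ℚ, (r.den : ℝ) ≤ l ^ D →
    ∀ b : ℝ, |b| ≤ l ^ D / Real.exp l →
    ‖∑ n ∈ Icc 1 N, (vonMangoldt n : ℂ) * ((wt η cc l n : ℂ) * e (n * (r + b))) -
      kap r.den * ∑ n ∈ Icc 1 N, (wt η cc l n : ℂ) * e (n * b)‖ ≤ Real.exp l / l ^ A := by
  obtain ⟨L1, h1⟩ := sw_char η cc hη hcc hcc1 D (D + A + 2)
  obtain ⟨L2, h2⟩ := sw_one η cc hη hcc hcc1 D (A + 2)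
  obtain ⟨L3, h3⟩ := pow_exp_small 40 (D + 2 + A + 2)
  refine ⟨max (max L1 L2) (max L3 (max 2 (2 * (|Real.log η| + 1)))), ?_⟩
  intro l hl N hN1 hN hsupp r hr b hb
  simp only [max_le_iff] at hl
  obtain ⟨⟨hl1, hl2⟩, hl3, hl4, hl5⟩ := hl
  have hl0 : 0 < l := by linarith
  have hw0 := wt_zero hcc hcc1 hl4 hl5
  have hfin : ∀ f : ℕ → ℂ, ∑' n, f n * ((wt η cc l n : ℂ) * e (n * b)) = ∑ n ∈ Icc 1 N, f n * ((wt η cc l n : ℂ) * e (n * b)) := by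
    intro f
    refine tsum_eq_sum fun n hn => ?_
    have : wt η cc l n = 0 := by
      rcases Nat.eq_zero_or_pos n with rfl | hn0
      · exact hw0
      · refine hsupp n ?_
        rw [mem_Icc] at hn; omega
    rw [this]; simp
  set q := r.den with hq
  haveI : NeZero q := ⟨r.den_nz⟩
  set F : ℕ → ℂ := fun n => (vonMangoldt n : ℂ) * ((wt η cc l n : ℂ) * e (n * b)) with hF
  have hT : ∀ χ : DirichletCharacter ℂ q, χ ≠ 1 → ‖∑ n ∈ Icc 1 N, χ (n : ZMod q) * F n‖ ≤ Real.exp l / l ^ (D + A + 2) := by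
    intro χ hχ
    have := h1 l hl1 q χ hχ hr b hb
    rw [hfin (fun n => χ (n : ZMod q) * (vonMangoldt n : ℂ))] at this
    simp only [hF]
    simpa only [mul_assoc] using this
  have hid := major_id q (r.num : ZMod q) (rat_unit r) N F _ (by positivity) hT
  have hS : ∑ n ∈ Icc 1 N, F n * ZMod.stdAddChar ((r.num : ZMod q) * (n : ZMod q)) =
      ∑ n ∈ Icc 1 N, (vonMangoldt n : ℂ) * ((wt η cc l n : ℂ) * e (n * (r + b))) := by
    refine sum_congr rfl fun n _ => ?_
    rw [← e_rat r n, mul_add, e_add]; simp only [hF]; ring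
  rw [hS] at hid
  have hone := h2 l hl2 b hb
  rw [hfin (fun n => (vonMangoldt n : ℂ) - 1)] at hone
  have hone2 : ∑ n ∈ Icc 1 N, ((vonMangoldt n : ℂ) - 1) * ((wt η cc l n : ℂ) * e (n * b)) =
      ∑ n ∈ Icc 1 N, F n - ∑ n ∈ Icc 1 N, (wt η cc l n : ℂ) * e (n * b) := by
    rw [← sum_sub_distrib]; exact sum_congr rfl fun n _ => by simp only [hF]; ring
  rw [hone2] at hone
  have hrest : ∑ n ∈ (Icc 1 N).filter (fun n : ℕ => ¬ IsUnit (n : ZMod q)), ‖F n‖ ≤ 20 * l ^ (D + 2) := by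
    have e1 : ∑ n ∈ (Icc 1 N).filter (fun n : ℕ => ¬ IsUnit (n : ZMod q)), ‖F n‖ ≤
        ∑ n ∈ (Icc 1 N).filter (fun n : ℕ => ¬ IsUnit (n : ZMod q)), vonMangoldt n := by
      refine sum_le_sum fun n _ => ?_
      simp only [hF]
      rw [norm_mul, norm_mul, norm_real, norm_real, norm_e, Real.norm_eq_abs, Real.norm_eq_abs, mul_one,
        abs_of_nonneg ArithmeticFunction.vonMangoldt_nonneg, abs_of_nonneg (wt_nonneg _ _ _ _)]
      exact mul_le_of_le_one_right ArithmeticFunction.vonMangoldt_nonneg (wt_le_one hcc hl0 n)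
    refine (e1.trans (nonunit_sum q N)).trans ?_
    have e2 := natlog_le hN1
    have e3 : 1 ≤ l ^ D := one_le_pow₀ (by linarith)
    have e4 : 0 ≤ Real.log N := Real.log_natCast_nonneg N
    calc _ ≤ (l ^ D + l ^ D) * (2 * (2 * l) + l) * (2 * l) := by gcongr <;> linarith
      _ = _ := by ring
  have hl3' := h3 l hl3
  have p0 : 0 < l ^ A := by positivity
  have f1 : 2 * (20 * l ^ (D + 2)) ≤ Real.exp l / l ^ (A + 2) := by
    rw [le_div_iff₀ (by positivity)]
    calc _ = 40 * l ^ (D + 2 + A + 2) := by ring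
      _ ≤ _ := hl3'
  have f2 : q * (Real.exp l / l ^ (D + A + 2)) ≤ Real.exp l / l ^ (A + 2) := by
    calc q * (Real.exp l / l ^ (D + A + 2)) ≤ l ^ D * (Real.exp l / l ^ (D + A + 2)) := by gcongr
      _ = _ := by rw [show l ^ (D + A + 2) = l ^ D * l ^ (A + 2) by ring]; field_simp
  have f3 : 3 * (Real.exp l / l ^ (A + 2)) ≤ Real.exp l / l ^ A := by
    rw [pow_add, ← div_div, mul_div_assoc', div_le_iff₀ (by positivity)]
    have : 0 < Real.exp l / l ^ A := by positivity
    have h4 : 3 ≤ l ^ 2 := by nlinarith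
    rw [mul_comm]
    exact mul_le_mul_of_nonneg_left h4 this.le
  have f4 : ‖kap q * (∑ n ∈ Icc 1 N, F n - ∑ n ∈ Icc 1 N, (wt η cc l n : ℂ) * e (n * b))‖ ≤ Real.exp l / l ^ (A + 2) := by
    rw [norm_mul]
    calc _ ≤ 1 * (Real.exp l / l ^ (A + 2)) := mul_le_mul (kap_norm q) hone (norm_nonneg _) (by norm_num)
      _ = _ := one_mul _
  have := norm_add_le (∑ n ∈ Icc 1 N, (vonMangoldt n : ℂ) * ((wt η cc l n : ℂ) * e (n * (r + b))) - kap q * ∑ n ∈ Icc 1 N, F n)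
    (kap q * (∑ n ∈ Icc 1 N, F n - ∑ n ∈ Icc 1 N, (wt η cc l n : ℂ) * e (n * b)))
  rw [mul_sub, sub_add_sub_cancel, ← mul_sub] at this
  linarith

end PQ


namespace PQ
open Finset MeasureTheory Filter Topology Complex
open ArithmeticFunction (vonMangoldt)

/-! ### The weight as a bounded variation sequence; the Farey model -/

lemma log_nat_mono : Monotone (fun n : ℕ => Real.log n) := by
  intro m n hmn
  rcases Nat.eq_zero_or_pos m with rfl | hm
  · simp only [Nat.cast_zero, Real.log_zero]; exact Real.log_natCast_nonneg n
  · exact Real.log_le_log (by exact_mod_cast hm) (by exact_mod_cast hmn)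

lemma tent_eq_sub {u0 h : ℝ} (hh : 0 < h) (u : ℝ) :
    tent u0 h u = max 0 (min 1 (1 + (u - u0) / h)) - max 0 (min 1 ((u - u0) / h)) := by
  unfold tent
  rcases le_total 0 (u - u0) with h1 | h1
  · have h2 : 0 ≤ (u - u0) / h := by positivity
    rw [abs_of_nonneg h1, min_eq_left (by linarith : 1 ≤ 1 + (u - u0) / h), max_eq_right (by norm_num : (0 : ℝ) ≤ 1),
      max_eq_right (le_min (by norm_num) h2)]
    rcases le_total 1 ((u - u0) / h) with h3 | h3
    · rw [min_eq_left h3, max_eq_left (by linarith)]; ring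
    · rw [min_eq_right h3, max_eq_right (by linarith)]
  · have h2 : (u - u0) / h ≤ 0 := div_nonpos_of_nonpos_of_nonneg h1 hh.le
    rw [abs_of_nonpos h1, min_eq_right (by linarith : 1 + (u - u0) / h ≤ 1), min_eq_right (by linarith : (u - u0) / h ≤ 1),
      max_eq_left h2, sub_zero]
    congr 1; ring

lemma clamp_tv {u : ℕ → ℝ} (hu : Monotone u) (M : ℕ) : TV (fun m => max 0 (min 1 (u m))) M ≤ 1 := by
  rw [TV_mono _ M (fun m n hmn => max_le_max le_rfl (min_le_min le_rfl (hu hmn))) (le_max_left _ _)]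
  exact max_le (by norm_num) (min_le_left _ _)

lemma wt_tv {η cc l : ℝ} (hcc : 0 < cc) (hl : 0 < l) (k M : ℕ) : TV (fun m => wt η cc l (m * k)) M ≤ 2 := by
  have hh : 0 < cc / l := by positivity
  have hm : Monotone (fun m : ℕ => (Real.log (m * k : ℕ) - (Real.log η + l)) / (cc / l)) := by
    intro m n hmn
    have := log_nat_mono (Nat.mul_le_mul_right k hmn)
    simp only at this ⊢
    gcongr
  have e1 : (fun m => wt η cc l (m * k)) = fun m : ℕ => max 0 (min 1 (1 + (Real.log (m * k : ℕ) - (Real.log η + l)) / (cc / l))) -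
      max 0 (min 1 ((Real.log (m * k : ℕ) - (Real.log η + l)) / (cc / l))) := by
    funext m; exact tent_eq_sub hh _
  rw [e1]
  refine (TV_sub _ _ M).trans ?_
  have h1 := clamp_tv hm M
  have h2 := clamp_tv (u := fun m : ℕ => 1 + (Real.log (m * k : ℕ) - (Real.log η + l)) / (cc / l)) (fun m n hmn => by
    have := hm hmn; simp only at this ⊢; linarith) M
  linarith

lemma wt_supp {η cc l : ℝ} (hcc : 0 < cc) (hl : 0 < l) {n : ℕ} (hn : wt η cc l n ≠ 0) :
    |Real.log n - (Real.log η + l)| ≤ cc / l := by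
  by_contra hc; push Not at hc
  exact hn (tent_out (by positivity) hc.le)

lemma wt_large {η cc l : ℝ} (hη : 0 < η) (hcc : 0 < cc) (hcc1 : cc ≤ 1) (hl : 2 ≤ l) (hl2 : 2 * (|Real.log η| + 1) ≤ l) {n : ℕ} (hn : wt η cc l n ≠ 0) :
    1 ≤ n ∧ (n : ℝ) ≤ 3 * η * Real.exp l := by
  have h0 : n ≠ 0 := by rintro rfl; exact hn (wt_zero hcc hcc1 hl hl2)
  have hn1 : (0 : ℝ) < n := by positivity
  have := exp_range hη hcc1 hl (wt_supp hcc (by linarith) hn)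
  rw [Real.exp_log hn1] at this
  exact ⟨by omega, this⟩

lemma wt_Wt {η cc l : ℝ} (hη : 0 < η) (hcc : 0 < cc) (hcc1 : cc ≤ 1) (hl : 2 ≤ l) (hl2 : 2 * (|Real.log η| + 1) ≤ l)
    {U N : ℕ} (hU : Real.log U < l / 2) (hN : 3 * η * Real.exp l ≤ N) : Wt (wt η cc l) U N where
  nn := wt_nonneg η cc l
  le1 := wt_le_one hcc (by linarith)
  small := fun n hn => by
    by_contra hc
    have h1 := (wt_range hcc hcc1 hl hl2 (wt_supp hcc (by linarith) hc)).1
    have h2 := log_nat_mono hn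
    simp only at h2; linarith
  large := fun n hn => by
    by_contra hc
    have h1 := (wt_large hη hcc hcc1 hl hl2 hc).2
    have : (N : ℝ) < n := by exact_mod_cast hn
    linarith
  tv := fun k M _ => wt_tv hcc (by linarith) k M

/-- Fourier transform of a weight -/
noncomputable def wh (w : ℕ → ℝ) (N : ℕ) (α : ℝ) : ℂ := ∑ n ∈ Icc 1 N, (w n : ℂ) * e (n * α)

lemma wh_bound {w : ℕ → ℝ} {U N : ℕ} (hw : Wt w U N) (α : ℝ) : ‖wh w N α‖ * nint α ≤ 1 := by
  have h := bv_sum w (N + 1) (hw.large _ (by omega)) α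
  rw [sum_range_Icc N _ (by rw [hw.small 0 (Nat.zero_le _)]; simp)] at h
  have h2 := hw.tv 1 (N + 1) le_rfl
  simp only [mul_one] at h2
  unfold wh
  linarith

lemma wh_int (w : ℕ → ℝ) (N : ℕ) (α : ℝ) (m : ℤ) : wh w N (α + m) = wh w N α := by
  unfold wh
  refine sum_congr rfl fun n _ => ?_
  congr 1
  have : (n : ℝ) * (α + m) = n * α + ((n * m : ℤ) : ℝ) := by push_cast; ring
  rw [this, e_add_int]

/-- Farey fractions of level `Q` in `[0,1)` -/
def farey (Q : ℕ) : Finset ℚ := (Icc 1 Q ×ˢ range Q).image (fun x => (x.2 : ℚ) / x.1) |>.filter (fun r => r < 1 ∧ r.den ≤ Q)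

lemma farey_card (Q : ℕ) : (farey Q).card ≤ Q ^ 2 := by
  refine (card_filter_le _ _).trans (card_image_le.trans ?_)
  rw [card_product]; simp [sq]

lemma mem_farey {Q : ℕ} {r : ℚ} : r ∈ farey Q ↔ 0 ≤ r ∧ r < 1 ∧ r.den ≤ Q := by
  unfold farey
  rw [mem_filter, mem_image]
  constructor
  · rintro ⟨⟨x, hx, rfl⟩, h1, h2⟩
    exact ⟨by positivity, h1, h2⟩
  · rintro ⟨h0, h1, h2⟩
    refine ⟨⟨(r.den, r.num.toNat), ?_, ?_⟩, h1, h2⟩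
    · rw [mem_product, mem_Icc, mem_range]
      refine ⟨⟨r.den_pos, h2⟩, ?_⟩
      have h3 : r.num < r.den := by
        have hd : (0 : ℚ) < r.den := by exact_mod_cast r.den_pos
        rw [← Rat.num_div_den r, div_lt_one hd] at h1
        exact_mod_cast h1
      have h4 : 0 ≤ r.num := Rat.num_nonneg.2 h0
      simp only; omega
    · have h4 : 0 ≤ r.num := Rat.num_nonneg.2 h0
      have h5 : ((r.num.toNat : ℕ) : ℚ) = (r.num : ℚ) := by
        have : ((r.num.toNat : ℕ) : ℤ) = r.num := Int.toNat_of_nonneg h4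
        exact_mod_cast congrArg (Int.cast : ℤ → ℚ) this
      simp only [h5]
      exact Rat.num_div_den r

lemma rat_nint {r : ℚ} (hr : ∀ m : ℤ, r ≠ m) : 1 / (r.den : ℝ) ≤ nint r := by
  unfold nint
  set m := round (r : ℝ)
  have h1 : (r : ℝ) - m = ((r - m : ℚ) : ℝ) := by push_cast; ring
  have h2 : r - m ≠ 0 := sub_ne_zero.2 (hr m)
  have h3 : (r - m).den = r.den := by
    have := Rat.sub_intCast_den r m
    exact this
  rw [h1, ← Rat.cast_abs]
  have h4 : |r - m| = (|(r - m).num| : ℚ) / (r - m).den := by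
    conv_lhs => rw [← Rat.num_div_den (r - m), abs_div]
    simp
  rw [h4, h3]
  push_cast
  have h5 : (1 : ℝ) ≤ |((r - m).num : ℝ)| := by
    have : 1 ≤ |(r - m).num| := Int.one_le_abs (Rat.num_ne_zero.2 h2)
    exact_mod_cast this
  gcongr

lemma nint_add_ge (x y : ℝ) : nint x - |y| ≤ nint (x + y) := by
  have h := nint_le x (round (x + y))
  have h2 : |x - round (x + y)| ≤ |x + y - round (x + y)| + |y| := by
    calc |x - round (x + y)| = |(x + y - round (x + y)) - y| := by congr 1; ring
      _ ≤ _ := abs_sub _ _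
  unfold nint at *
  linarith

lemma off_bound {w : ℕ → ℝ} {U N : ℕ} (hw : Wt w U N) {α : ℝ} {r θ : ℚ} {Q : ℕ} (hQ : θ.den ≤ Q)
    (hne : ∀ m : ℤ, r - θ ≠ m) (hb : |α - r| ≤ 1 / (2 * r.den * Q)) : ‖wh w N (α - θ)‖ ≤ 2 * r.den * Q := by
  have hQ0 : 0 < Q := lt_of_lt_of_le θ.den_pos hQ
  have hQ0' : (0 : ℝ) < Q := by exact_mod_cast hQ0
  have hr0 : (0 : ℝ) < r.den := by exact_mod_cast r.den_pos
  have h1 := rat_nint hne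
  have h2 : ((r - θ).den : ℝ) ≤ r.den * Q := by
    have : (r - θ).den ≤ r.den * θ.den := Nat.le_of_dvd (Nat.mul_pos r.den_pos θ.den_pos) (Rat.sub_den_dvd r θ)
    exact_mod_cast this.trans (Nat.mul_le_mul_left _ hQ)
  have h3 : 1 / ((r.den : ℝ) * Q) ≤ 1 / ((r - θ).den : ℝ) := by
    have : (0 : ℝ) < (r - θ).den := by exact_mod_cast (r - θ).den_pos
    gcongr
  have h4 := nint_add_ge ((r - θ : ℚ) : ℝ) (α - r)
  have h5 : (((r - θ : ℚ) : ℝ)) + (α - r) = α - θ := by push_cast; ring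
  rw [h5] at h4
  have h6 : 1 / (2 * (r.den : ℝ) * Q) ≤ nint (α - θ) := by
    have : 1 / ((r.den : ℝ) * Q) = 2 * (1 / (2 * r.den * Q)) := by field_simp
    linarith
  have h7 := wh_bound hw (α - θ)
  have h8 : ‖wh w N (α - θ)‖ * (1 / (2 * r.den * Q)) ≤ 1 := le_trans (by gcongr) h7
  rwa [mul_one_div, div_le_one (by positivity)] at h8

/-- Farey model of the prime exponential sum -/
noncomputable def Mh (w : ℕ → ℝ) (N Q : ℕ) (α : ℝ) : ℂ := ∑ θ ∈ farey Q, kap θ.den * wh w N (α - θ)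

/-- The prime exponential sum. -/
noncomputable def Sh (w : ℕ → ℝ) (N : ℕ) (α : ℝ) : ℂ := ∑ n ∈ Icc 1 N, (vonMangoldt n : ℂ) * ((w n : ℂ) * e (n * α))

lemma Mh_far {w : ℕ → ℝ} {U N : ℕ} (hw : Wt w U N) {α : ℝ} {r : ℚ} {Q : ℕ} (hb : |α - r| ≤ 1 / (2 * r.den * Q)) (hrQ : Q < r.den) :
    ‖Mh w N Q α‖ ≤ Q ^ 2 * (2 * r.den * Q) := by
  unfold Mh
  have : ∀ θ ∈ farey Q, ‖kap θ.den * wh w N (α - θ)‖ ≤ 2 * r.den * Q := by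
    intro θ hθ
    have hd := (mem_farey.1 hθ).2.2
    rw [norm_mul]
    have h1 := off_bound hw hd (r := r) (fun m hm => by
      have : r = θ + m := by linarith
      have h2 : r.den = θ.den := by rw [this]; exact Rat.add_intCast_den θ m
      omega) hb
    calc _ ≤ 1 * (2 * (r.den : ℝ) * Q) := mul_le_mul (kap_norm _) h1 (norm_nonneg _) (by norm_num)
      _ = _ := one_mul _
  refine (norm_sum_le_of_le _ this).trans ?_
  rw [sum_const, nsmul_eq_mul]
  gcongr
  exact_mod_cast farey_card Q

lemma kap_congr {a b : ℕ} [NeZero a] [NeZero b] (h : a = b) : kap a = kap b := by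
  subst h; rfl

lemma Mh_near {w : ℕ → ℝ} {U N : ℕ} (hw : Wt w U N) {α : ℝ} {r : ℚ} {Q : ℕ} (hb : |α - r| ≤ 1 / (2 * r.den * Q)) (hrQ : r.den ≤ Q) :
    ‖Mh w N Q α - kap r.den * wh w N (α - r)‖ ≤ Q ^ 2 * (2 * r.den * Q) := by
  unfold Mh
  have hf : Int.fract r ∈ farey Q := by
    rw [mem_farey]
    refine ⟨Int.fract_nonneg r, Int.fract_lt_one r, ?_⟩
    unfold Int.fract
    rw [Rat.sub_intCast_den]; exact hrQ
  have hden : (Int.fract r).den = r.den := by unfold Int.fract; exact Rat.sub_intCast_den _ _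
  rw [← add_sum_erase _ _ hf]
  have h0 : wh w N (α - (Int.fract r : ℚ)) = wh w N (α - r) := by
    rw [← wh_int w N (α - r) ⌊r⌋]
    congr 1
    unfold Int.fract; push_cast; ring
  have hk : kap (Int.fract r).den = kap r.den := kap_congr hden
  rw [h0, hk, add_sub_cancel_left]
  have : ∀ θ ∈ (farey Q).erase (Int.fract r), ‖kap θ.den * wh w N (α - θ)‖ ≤ 2 * r.den * Q := by
    intro θ hθ
    rw [mem_erase] at hθ
    obtain ⟨g0, g1, hd⟩ := (mem_farey.1 hθ.2)
    rw [norm_mul]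
    have h1 := off_bound hw hd (r := r) (fun m hm => by
      have h2 : r = θ + m := by linarith
      apply hθ.1
      rw [h2, Int.fract_add_intCast, Int.fract_eq_self.2 ⟨g0, g1⟩]) hb
    calc _ ≤ 1 * (2 * (r.den : ℝ) * Q) := mul_le_mul (kap_norm _) h1 (norm_nonneg _) (by norm_num)
      _ = _ := one_mul _
  refine (norm_sum_le_of_le _ this).trans ?_
  rw [sum_const, nsmul_eq_mul]
  gcongr
  exact_mod_cast (card_erase_le).trans (farey_card Q)

end PQ


namespace PQ
open Finset MeasureTheory Filter Topology Complex
open ArithmeticFunction (vonMangoldt)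

/-! ### Uniform approximation of the prime exponential sum by its Farey model -/

set_option maxHeartbeats 1000000 in
lemma sup_bound (η cc H : ℝ) (hη : 0 < η) (hcc : 0 < cc) (hcc1 : cc ≤ 1) (hH : 1 ≤ H) (A D : ℕ) (hD : 2 * A + 8 ≤ D) :
    ∃ L0 : ℝ, ∀ l, L0 ≤ l → ∀ N : ℕ, Real.exp l ≤ N → (N : ℝ) ≤ H * Real.exp l → 3 * η * Real.exp l ≤ N →
      ∀ Q : ℕ, (Q : ℝ) ≤ l ^ D → l ^ D ≤ 2 * Q → ∀ α : ℝ,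
        ‖Sh (wt η cc l) N α - Mh (wt η cc l) N Q α‖ ≤ Real.exp l / l ^ A := by
  obtain ⟨L1, h1⟩ := major η cc hη hcc hcc1 (4 * D) (A + 1)
  obtain ⟨L2, h2⟩ := pow_exp_small 2 (5 * D + A + 1)
  obtain ⟨L3, h3⟩ := pow_exp_small H 0
  set C : ℝ := 6400 * 1024 * (3 * H ^ 2) * 2 with hC
  refine ⟨max (max L1 L2) (max L3 (max 2 (max (2 * (|Real.log η| + 1)) (4 * C)))), ?_⟩
  intro l hl N hN1 hN2 hN3 Q hQ1 hQ2 α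
  simp only [max_le_iff] at hl
  obtain ⟨⟨g1, g2⟩, g3, g4, g5, g6⟩ := hl
  have hl0 : 0 < l := by linarith
  have hl1 : 1 ≤ l := by linarith
  have h2' := h2 l g2
  have h3' := h3 l g3
  simp only [pow_zero, mul_one] at h3'
  specialize h1 l g1
  set X := Real.exp l with hX
  have hX0 : 0 < X := Real.exp_pos l
  have hlD : 1 ≤ l ^ D := one_le_pow₀ hl1
  have hQ0' : 0 < Q := by
    rcases Nat.eq_zero_or_pos Q with h | h
    · subst h; simp at hQ2; linarith
    · exact h
  have hQ0 : (1 : ℝ) ≤ Q := by exact_mod_cast hQ0'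
  have hQ5 : 2 * (Q : ℝ) ^ 5 * l ^ (A + 1) ≤ X := by
    calc 2 * (Q : ℝ) ^ 5 * l ^ (A + 1) ≤ 2 * (l ^ D) ^ 5 * l ^ (A + 1) := by gcongr
      _ = 2 * l ^ (5 * D + A + 1) := by ring
      _ ≤ X := h2'
  have hlA : 1 ≤ l ^ (A + 1) := one_le_pow₀ hl1
  have hQ5' : 2 * (Q : ℝ) ^ 5 ≤ X := le_trans (le_mul_of_one_le_right (by positivity) hlA) hQ5
  have hNpos : 1 ≤ N := by
    have : (0 : ℝ) < N := by linarith
    exact_mod_cast this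
  have hNr : (1 : ℝ) ≤ N := by exact_mod_cast hNpos
  have hlogN : Real.log N ≤ 2 * l := by
    have : (N : ℝ) ≤ X * X := hN2.trans (by gcongr)
    calc Real.log N ≤ Real.log (X * X) := Real.log_le_log (by linarith) this
      _ = 2 * l := by rw [Real.log_mul hX0.ne' hX0.ne', hX, Real.log_exp]; ring
  have hlogQ : Real.log Q < l / 2 := by
    have h5 : (Q : ℝ) ^ 5 ≤ X := by
      have : (0 : ℝ) ≤ (Q : ℝ) ^ 5 := by positivity
      linarith
    have h6 := Real.log_le_log (by positivity) h5
    rw [Real.log_pow, hX, Real.log_exp] at h6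
    push_cast at h6
    linarith
  have hW := wt_Wt hη hcc hcc1 g4 g5 hlogQ hN3
  set R := ⌊X / (Q : ℝ) ^ 4⌋₊ with hR
  have hXQ : 2 * (Q : ℝ) ≤ X / (Q : ℝ) ^ 4 := by
    rw [le_div_iff₀ (by positivity)]
    calc 2 * (Q : ℝ) * Q ^ 4 = 2 * Q ^ 5 := by ring
      _ ≤ X := hQ5'
  have hR1 : 0 < R := Nat.floor_pos.2 (by linarith)
  have hRle : (R : ℝ) ≤ X / (Q : ℝ) ^ 4 := Nat.floor_le (by positivity)
  have hRlt : X / (Q : ℝ) ^ 4 < R + 1 := Nat.lt_floor_add_one _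
  obtain ⟨r, hr1, hr2⟩ := Real.exists_rat_abs_sub_le_and_den_le α hR1
  have hd0 : (1 : ℝ) ≤ r.den := by exact_mod_cast r.den_pos
  have hdR : (r.den : ℝ) ≤ R := by exact_mod_cast hr2
  have hb : |α - r| ≤ 1 / (2 * r.den * Q) := by
    refine hr1.trans ?_
    apply one_div_le_one_div_of_le (by positivity)
    have : 2 * (Q : ℝ) ≤ R + 1 := by linarith
    nlinarith
  have hQ34 : (Q : ℝ) ^ 4 ≤ Q ^ 5 := pow_le_pow_right₀ hQ0 (by norm_num)
  have hdX : (r.den : ℝ) ≤ X / Q ^ 4 := hdR.trans hRle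
  rcases le_or_gt r.den Q with hdQ | hdQ
  · have hdQr : (r.den : ℝ) ≤ Q := by exact_mod_cast hdQ
    have hb2 : |α - r| ≤ l ^ (4 * D) / X := by
      refine hr1.trans ?_
      rw [div_le_div_iff₀ (by positivity) hX0, one_mul]
      rw [div_lt_iff₀ (by positivity)] at hRlt
      have : (Q : ℝ) ^ 4 ≤ l ^ (4 * D) := by
        rw [mul_comm, pow_mul]; gcongr
      calc X ≤ (R + 1) * (Q : ℝ) ^ 4 := hRlt.le
        _ ≤ ((R + 1) * r.den) * l ^ (4 * D) := by
          gcongr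
          exact le_mul_of_one_le_right (by positivity) hd0
        _ = _ := by ring
    have hd4 : (r.den : ℝ) ≤ l ^ (4 * D) := hdQr.trans (hQ1.trans (pow_le_pow_right₀ hl1 (by omega)))
    have k1 := h1 N hNpos hlogN hW.large r hd4 (α - r) hb2
    have k2 := Mh_near hW hb hdQ
    have e1 : (r : ℝ) + (α - r) = α := by ring
    rw [e1] at k1
    have k3 : (Q : ℝ) ^ 2 * (2 * r.den * Q) ≤ X / l ^ (A + 1) := by
      rw [le_div_iff₀ (by positivity)]
      calc (Q : ℝ) ^ 2 * (2 * r.den * Q) * l ^ (A + 1) ≤ (Q : ℝ) ^ 2 * (2 * Q * Q) * l ^ (A + 1) := by gcongr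
        _ = 2 * (Q : ℝ) ^ 4 * l ^ (A + 1) := by ring
        _ ≤ 2 * (Q : ℝ) ^ 5 * l ^ (A + 1) := by gcongr
        _ ≤ X := hQ5
    have k4 : ‖Sh (wt η cc l) N α - Mh (wt η cc l) N Q α‖ ≤ X / l ^ (A + 1) + X / l ^ (A + 1) := by
      calc ‖Sh (wt η cc l) N α - Mh (wt η cc l) N Q α‖ = ‖(Sh (wt η cc l) N α - kap r.den * wh (wt η cc l) N (α - r)) -
          (Mh (wt η cc l) N Q α - kap r.den * wh (wt η cc l) N (α - r))‖ := by congr 1; ring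
        _ ≤ _ := norm_sub_le _ _
        _ ≤ _ := add_le_add k1 (k2.trans k3)
    refine k4.trans ?_
    have : X / l ^ (A + 1) + X / l ^ (A + 1) = (X / l ^ A) * (2 / l) := by
      rw [pow_succ]; field_simp; ring
    rw [this]
    exact mul_le_of_le_one_right (by positivity) ((div_le_one hl0).2 g4)
  · have hdQr : (Q : ℝ) ≤ r.den := by exact_mod_cast hdQ.le
    have hα : |α - r| ≤ 1 / (r.den : ℝ) ^ 2 := by
      refine hr1.trans ?_
      apply one_div_le_one_div_of_le (by positivity)
      nlinarith
    have hX4 : X / (Q : ℝ) ^ 4 ≤ X / Q := by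
      gcongr
      exact le_self_pow₀ hQ0 (by norm_num)
    have hXQ1 : X / (Q : ℝ) ≤ X := div_le_self hX0.le hQ0
    have hdN : r.den ≤ N := by
      have : (r.den : ℝ) ≤ N := by linarith
      exact_mod_cast this
    have hQ3 : Q ^ 3 ≤ N := by
      have : (Q : ℝ) ^ 3 ≤ N := by
        have : (Q : ℝ) ^ 3 ≤ Q ^ 5 := pow_le_pow_right₀ hQ0 (by norm_num)
        have : (0 : ℝ) ≤ Q ^ 5 := by positivity
        linarith
      exact_mod_cast this
    have hLg : 1 + Real.log (2 * N) ≤ 3 * l + 1 := by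
      rw [Real.log_mul (by norm_num) (by positivity)]
      have : Real.log 2 ≤ 1 := by have := Real.log_two_lt_d9; linarith
      linarith
    have hLg2 : 1 + Real.log (2 * N) ≤ 4 * l := by linarith
    have m1 := minor_arc _ Q N hW α r hα (4 * l) hNpos hLg2 hdN hQ0' hQ3
    have m2 := Mh_far hW hb hdQ
    have hQl : X / Q ≤ 2 * X / l ^ D := by
      rw [div_le_div_iff₀ (by positivity) (by positivity)]
      calc X * l ^ D ≤ X * (2 * Q) := by gcongr
        _ = _ := by ring
    have b1 : (N : ℝ) ^ 2 / r.den + N ^ 2 / Q + N * r.den ≤ 3 * H ^ 2 * X * (X / Q) := by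
      have c1 : (N : ℝ) ^ 2 / r.den ≤ (H * X) ^ 2 / Q := by gcongr
      have c2 : (N : ℝ) ^ 2 / Q ≤ (H * X) ^ 2 / Q := by gcongr
      have c3 : (N : ℝ) * r.den ≤ (H * X) * (H * (X / Q)) := by
        gcongr
        calc (r.den : ℝ) ≤ X / Q := hdX.trans hX4
          _ ≤ _ := le_mul_of_one_le_left (by positivity) hH
      calc _ ≤ (H * X) ^ 2 / Q + (H * X) ^ 2 / Q + (H * X) * (H * (X / Q)) := by linarith
        _ = _ := by ring
    have b2 : ‖Sh (wt η cc l) N α‖ ^ 2 ≤ 6400 * (4 * l) ^ 5 * (3 * H ^ 2 * X * (2 * X / l ^ D)) := by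
      refine m1.trans ?_
      gcongr 6400 * (4 * l) ^ 5 * ?_
      refine b1.trans ?_
      gcongr
    obtain ⟨D', rfl⟩ : ∃ D', D = D' + (2 * A + 8) := ⟨D - (2 * A + 8), by omega⟩
    have hD' : 1 ≤ l ^ D' := one_le_pow₀ hl1
    have b3 : ‖Sh (wt η cc l) N α‖ ^ 2 ≤ (X / (2 * l ^ A)) ^ 2 := by
      refine b2.trans ?_
      have d1 : 6400 * (4 * l) ^ 5 * (3 * H ^ 2 * X * (2 * X / l ^ (D' + (2 * A + 8)))) =
          (X / (2 * l ^ A)) ^ 2 * (4 * C / (l ^ 3 * l ^ D')) := by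
        rw [hC]
        field_simp
        ring
      rw [d1]
      refine mul_le_of_le_one_right (by positivity) ?_
      rw [div_le_one (by positivity)]
      calc 4 * C ≤ l := g6
        _ ≤ l ^ 3 := le_self_pow₀ hl1 (by norm_num)
        _ ≤ _ := le_mul_of_one_le_right (by positivity) hD'
    have b4 : ‖Sh (wt η cc l) N α‖ ≤ X / (2 * l ^ A) := by
      exact (pow_le_pow_iff_left₀ (norm_nonneg _) (by positivity) (by norm_num)).1 b3
    have b5 : (Q : ℝ) ^ 2 * (2 * r.den * Q) ≤ X / (2 * l ^ A) := by
      calc (Q : ℝ) ^ 2 * (2 * r.den * Q) ≤ (Q : ℝ) ^ 2 * (2 * (X / Q ^ 4) * Q) := by gcongr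
        _ = 2 * (X / Q) := by field_simp
        _ ≤ 2 * (2 * X / l ^ (D' + (2 * A + 8))) := by gcongr
        _ = X / (2 * l ^ A) * (8 / (l ^ 3 * (l ^ 5 * l ^ A * l ^ D'))) := by field_simp; ring
        _ ≤ X / (2 * l ^ A) := by
          refine mul_le_of_le_one_right (by positivity) ?_
          rw [div_le_one (by positivity)]
          have e1 : (8 : ℝ) ≤ l ^ 3 := by
            calc (8 : ℝ) = 2 ^ 3 := by norm_num
              _ ≤ l ^ 3 := by gcongr
          have e2 : 1 ≤ l ^ 5 * l ^ A * l ^ D' := by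
            have := one_le_pow₀ (n := 5) hl1
            have := one_le_pow₀ (n := A) hl1
            exact one_le_mul_of_one_le_of_one_le (one_le_mul_of_one_le_of_one_le (by assumption) this) hD'
          exact e1.trans (le_mul_of_one_le_right (by positivity) e2)
    calc ‖Sh (wt η cc l) N α - Mh (wt η cc l) N Q α‖ ≤ ‖Sh (wt η cc l) N α‖ + ‖Mh (wt η cc l) N Q α‖ := norm_sub_le _ _
      _ ≤ X / (2 * l ^ A) + X / (2 * l ^ A) := add_le_add b4 (m2.trans b5)
      _ = X / l ^ A := by field_simp; ring

end PQ


namespace PQ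
open Finset MeasureTheory Filter Topology Complex
open ArithmeticFunction (vonMangoldt)

/-! ### Discrete Fourier analysis -/

/-- Average over the `K`-th roots of unity. -/
noncomputable def av (K : ℕ) (F : ℝ → ℂ) : ℂ := (∑ k ∈ range K, F ((k : ℝ) / K)) / K

/-- A general exponential sum. -/
noncomputable def ES (a : ℕ → ℂ) (N : ℕ) (α : ℝ) : ℂ := ∑ n ∈ Icc 1 N, a n * e (n * α)

lemma av_e (K : ℕ) (hK : 0 < K) (m : ℤ) (hm : |m| < K) : av K (fun α => e (m * α)) = if m = 0 then 1 else 0 := by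
  have hK0 : (K : ℝ) ≠ 0 := by positivity
  have hKc : (K : ℂ) ≠ 0 := by exact_mod_cast hK.ne'
  unfold av
  have h1 : ∀ k ∈ range K, e ((m : ℝ) * ((k : ℝ) / K)) = e (m / K) ^ k := by
    intro k _
    rw [← e_nat_mul]; congr 1; ring
  rw [sum_congr rfl h1]
  split_ifs with h
  · subst h; simp [e_zero, hKc]
  · have h2 : e ((m : ℝ) / K) ≠ 1 := by
      intro h3
      unfold e at h3
      rw [Complex.exp_eq_one_iff] at h3
      obtain ⟨n, hn⟩ := h3
      have h4 : ((m : ℝ) / K : ℝ) = n := by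
        have h5 : (2 * (Real.pi : ℂ) * I) ≠ 0 := Complex.two_pi_I_ne_zero
        have h6 : (2 * (Real.pi : ℂ) * I) * (((m : ℝ) / K : ℝ) : ℂ) = (2 * (Real.pi : ℂ) * I) * ((n : ℝ) : ℂ) := by
          push_cast at hn ⊢
          linear_combination hn
        exact_mod_cast mul_left_cancel₀ h5 h6
      rw [div_eq_iff hK0] at h4
      have h5 : m = n * K := by exact_mod_cast h4
      have hn0 : n ≠ 0 := by rintro rfl; simp at h5; exact h h5
      have h6 : (K : ℤ) ≤ |m| := by
        rw [h5, abs_mul]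
        have h7 : 1 ≤ |n| := Int.one_le_abs hn0
        have h8 : |(K : ℤ)| = K := abs_of_nonneg (by positivity)
        rw [h8]
        nlinarith
      omega
    rw [geom_sum_eq h2, ← e_nat_mul]
    have : (K : ℝ) * (m / K) = (m : ℤ) := by field_simp
    rw [this, e_int]; simp

lemma av_sum {ι : Type*} (K : ℕ) (s : Finset ι) (F : ι → ℝ → ℂ) : av K (fun α => ∑ i ∈ s, F i α) = ∑ i ∈ s, av K (F i) := by
  unfold av
  rw [sum_comm, sum_div]

lemma av_smul (K : ℕ) (c : ℂ) (F : ℝ → ℂ) : av K (fun α => c * F α) = c * av K F := by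
  unfold av
  rw [← mul_sum, mul_div_assoc]

lemma av_add (K : ℕ) (F G : ℝ → ℂ) : av K (fun α => F α + G α) = av K F + av K G := by
  unfold av
  rw [sum_add_distrib, add_div]

lemma av_congr {K : ℕ} {F G : ℝ → ℂ} (h : ∀ α, F α = G α) : av K F = av K G := by
  have : F = G := funext h
  rw [this]

lemma e_sum {ι : Type*} (s : Finset ι) (x : ι → ℝ) : ∏ i ∈ s, e (x i) = e (∑ i ∈ s, x i) := by
  classical
  induction s using Finset.induction_on with
  | empty => simp [e_zero]
  | insert a s ha ih => rw [prod_insert ha, sum_insert ha, e_add, ih]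

/-- The set of solutions. -/
noncomputable def sol (β : Fin 4 → ℤ) (N : ℕ) : Finset (Fin 4 → ℕ) :=
  (Fintype.piFinset (fun _ : Fin 4 => Icc 1 N)).filter (fun n => ∑ j, β j * (n j : ℤ) = 0)

lemma orth (β : Fin 4 → ℤ) (hβ : ∀ j, β j = 1 ∨ β j = -1) (a : Fin 4 → ℕ → ℂ) (N K : ℕ) (hK : 4 * N < K) :
    av K (fun α => ∏ j, ES (a j) N (β j * α)) = ∑ n ∈ sol β N, ∏ j, a j (n j) := by
  have h1 : ∀ α : ℝ, ∏ j, ES (a j) N (β j * α) = ∑ n ∈ Fintype.piFinset (fun _ : Fin 4 => Icc 1 N),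
      (∏ j, a j (n j)) * e (((∑ j, β j * (n j : ℤ) : ℤ) : ℝ) * α) := by
    intro α
    unfold ES
    rw [prod_univ_sum]
    refine sum_congr rfl fun n _ => ?_
    rw [prod_mul_distrib, e_sum]
    congr 2
    push_cast
    rw [sum_mul]
    refine sum_congr rfl fun j _ => by ring
  rw [av_congr h1, av_sum]
  unfold sol
  rw [sum_filter]
  refine sum_congr rfl fun n hn => ?_
  rw [av_smul, av_e K (by omega)]
  · split_ifs <;> simp
  · rw [Fintype.mem_piFinset] at hn
    have h2 : ∀ j, |β j * (n j : ℤ)| ≤ N := by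
      intro j
      have := (mem_Icc.1 (hn j)).2
      rcases hβ j with h | h <;> rw [h, abs_mul] <;> simp [this]
    calc |∑ j, β j * (n j : ℤ)| ≤ ∑ j, |β j * (n j : ℤ)| := abs_sum_le_sum_abs _ _
      _ ≤ ∑ j : Fin 4, (N : ℤ) := sum_le_sum fun j _ => h2 j
      _ = 4 * N := by simp
      _ < K := by exact_mod_cast hK

/-- Sup and mean-square control -/
def Nice (K N : ℕ) (T : ℝ) (F : ℝ → ℂ) : Prop :=
  (∀ α, ‖F α‖ ≤ T * N) ∧ (∑ k ∈ range K, ‖F ((k : ℝ) / K)‖ ^ 2) / K ≤ T ^ 2 * N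

lemma nice_ES (a : ℕ → ℂ) (N K : ℕ) (hK : 4 * N < K) (T : ℝ) (ha : ∀ n ∈ Icc 1 N, ‖a n‖ ≤ T) (σ : ℤ) (hσ : σ = 1 ∨ σ = -1) :
    Nice K N T (fun α => ES a N (σ * α)) := by
  constructor
  · intro α
    unfold ES
    refine (norm_sum_le _ _).trans ?_
    calc ∑ n ∈ Icc 1 N, ‖a n * e (n * (σ * α))‖ ≤ ∑ n ∈ Icc 1 N, T := by
          refine sum_le_sum fun n hn => ?_
          rw [norm_mul, norm_e, mul_one]; exact ha n hn
      _ = T * N := by rw [sum_const]; simp [mul_comm]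
  · have h1 : (((∑ k ∈ range K, ‖ES a N (σ * ((k : ℝ) / K))‖ ^ 2) / K : ℝ) : ℂ) =
        av K (fun α => ∑ m ∈ Icc 1 N, ∑ n ∈ Icc 1 N, (starRingEnd ℂ (a m) * a n) * e (((σ * ((n : ℤ) - m) : ℤ) : ℝ) * α)) := by
      unfold av
      push_cast
      congr 1
      refine sum_congr rfl fun k _ => ?_
      rw [← Complex.conj_mul']
      unfold ES
      rw [map_sum, sum_mul_sum]
      refine sum_congr rfl fun m _ => sum_congr rfl fun n _ => ?_
      rw [map_mul, ← e_neg]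
      have : (σ : ℝ) * ((n : ℝ) - m) * (k / K) = -(m * (σ * (k / K))) + n * (σ * (k / K)) := by ring
      rw [this, e_add]; ring
    rw [av_sum] at h1
    have h2 : ∀ m ∈ Icc 1 N, av K (fun α => ∑ n ∈ Icc 1 N, (starRingEnd ℂ (a m) * a n) * e (((σ * ((n : ℤ) - m) : ℤ) : ℝ) * α)) =
        ((‖a m‖ ^ 2 : ℝ) : ℂ) := by
      intro m hm
      rw [av_sum, sum_eq_single m]
      · rw [av_smul]
        simp only [sub_self, mul_zero]
        rw [av_e K (by omega) 0 (by simp; omega), if_pos rfl, mul_one, Complex.conj_mul']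
        push_cast; rfl
      · intro n hn hne
        rw [av_smul, av_e K (by omega), if_neg, mul_zero]
        · rcases hσ with h | h <;> rw [h] <;> omega
        · have := mem_Icc.1 hm
          have := mem_Icc.1 hn
          rw [abs_lt]
          rcases hσ with h | h <;> rw [h] <;> constructor <;> omega
      · intro h; exact absurd hm h
    rw [sum_congr rfl h2, ← ofReal_sum] at h1
    have h3 : (∑ k ∈ range K, ‖ES a N (σ * ((k : ℝ) / K))‖ ^ 2) / K = ∑ m ∈ Icc 1 N, ‖a m‖ ^ 2 := by exact_mod_cast h1
    rw [h3]
    calc ∑ m ∈ Icc 1 N, ‖a m‖ ^ 2 ≤ ∑ m ∈ Icc 1 N, T ^ 2 := by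
          refine sum_le_sum fun m hm => ?_
          have := ha m hm
          gcongr
      _ = T ^ 2 * N := by rw [sum_const]; simp [mul_comm]

lemma nice_bound {K N : ℕ} {T S : ℝ} {F G P : ℝ → ℂ} (hF : Nice K N T F) (hG : Nice K N T G) (hP : ∀ α, ‖P α‖ ≤ S) :
    ‖av K (fun α => P α * (F α * G α))‖ ≤ S * (T ^ 2 * N) := by
  have hS : 0 ≤ S := (norm_nonneg _).trans (hP 0)
  have hF2 := hF.2
  have hG2 := hG.2
  unfold av
  rw [norm_div, Complex.norm_natCast]
  have h1 : ‖∑ k ∈ range K, P (k / K) * (F (k / K) * G (k / K))‖ ≤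
      ∑ k ∈ range K, S * ((‖F ((k : ℝ) / K)‖ ^ 2 + ‖G ((k : ℝ) / K)‖ ^ 2) / 2) := by
    refine (norm_sum_le _ _).trans (sum_le_sum fun k _ => ?_)
    rw [norm_mul, norm_mul]
    gcongr
    · exact hP _
    · nlinarith [sq_nonneg (‖F ((k : ℝ) / K)‖ - ‖G ((k : ℝ) / K)‖)]
  calc _ ≤ (∑ k ∈ range K, S * ((‖F ((k : ℝ) / K)‖ ^ 2 + ‖G ((k : ℝ) / K)‖ ^ 2) / 2)) / (K : ℝ) := by gcongr
    _ = S * (((∑ k ∈ range K, ‖F ((k : ℝ) / K)‖ ^ 2) / K + (∑ k ∈ range K, ‖G ((k : ℝ) / K)‖ ^ 2) / K) / 2) := by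
      rw [← mul_sum, ← sum_div, sum_add_distrib]; ring
    _ ≤ S * (T ^ 2 * N) := by gcongr; linarith

end PQ


namespace PQ
open Finset MeasureTheory Filter Topology Complex
open ArithmeticFunction (vonMangoldt)

/-! ### Telescoping and the main term -/

lemma telescope {K N : ℕ} (S M : Fin 4 → ℝ → ℂ) (T ε : Fin 4 → ℝ)
    (hM : ∀ i j, j < i → Nice K N (T i) (M j)) (hS : ∀ i j, i < j → Nice K N (T i) (S j))
    (hE : ∀ i α, ‖S i α - M i α‖ ≤ ε i) :
    ‖av K (fun α => ∏ j, S j α) - av K (fun α => ∏ j, M j α)‖ ≤ ∑ i, ε i * T i ^ 3 * N ^ 2 := by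
  have h0 := nice_bound (hS 0 2 (by decide)) (hS 0 3 (by decide)) (P := fun α => (S 0 α - M 0 α) * S 1 α) (S := ε 0 * (T 0 * N))
    (fun α => by
      rw [norm_mul]
      have := (hS 0 1 (by decide)).1 α
      have := hE 0 α
      gcongr
      exact (norm_nonneg _).trans this)
  have h1 := nice_bound (hS 1 2 (by decide)) (hS 1 3 (by decide)) (P := fun α => (S 1 α - M 1 α) * M 0 α) (S := ε 1 * (T 1 * N))
    (fun α => by
      rw [norm_mul]
      have := (hM 1 0 (by decide)).1 α
      have := hE 1 α
      gcongr
      exact (norm_nonneg _).trans this)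
  have h2 := nice_bound (hM 2 1 (by decide)) (hS 2 3 (by decide)) (P := fun α => (S 2 α - M 2 α) * M 0 α) (S := ε 2 * (T 2 * N))
    (fun α => by
      rw [norm_mul]
      have := (hM 2 0 (by decide)).1 α
      have := hE 2 α
      gcongr
      exact (norm_nonneg _).trans this)
  have h3 := nice_bound (hM 3 1 (by decide)) (hM 3 2 (by decide)) (P := fun α => (S 3 α - M 3 α) * M 0 α) (S := ε 3 * (T 3 * N))
    (fun α => by
      rw [norm_mul]
      have := (hM 3 0 (by decide)).1 α
      have := hE 3 α
      gcongr
      exact (norm_nonneg _).trans this)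
  have key : av K (fun α => ∏ j, S j α) = av K (fun α => ∏ j, M j α) +
      (((av K (fun α => (S 0 α - M 0 α) * S 1 α * (S 2 α * S 3 α)) + av K (fun α => (S 1 α - M 1 α) * M 0 α * (S 2 α * S 3 α))) +
      av K (fun α => (S 2 α - M 2 α) * M 0 α * (M 1 α * S 3 α))) + av K (fun α => (S 3 α - M 3 α) * M 0 α * (M 1 α * M 2 α))) := by
    rw [← av_add, ← av_add, ← av_add, ← av_add]
    apply av_congr
    intro α
    simp only [Fin.prod_univ_four]
    ring
  rw [key, add_sub_cancel_left]
  refine (norm_add_le _ _).trans ?_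
  refine (add_le_add ((norm_add_le _ _).trans (add_le_add (norm_add_le _ _) le_rfl)) le_rfl).trans ?_
  rw [Fin.sum_univ_four]
  refine (add_le_add (add_le_add (add_le_add h0 h1) h2) h3).trans (le_of_eq ?_)
  ring

lemma nint_sub_le (x y : ℝ) : nint (x - y) ≤ nint x + nint y := by
  have h := nint_le (x - y) (round x - round y)
  refine h.trans ?_
  unfold nint
  have : x - y - ((round x - round y : ℤ) : ℝ) = (x - round x) - (y - round y) := by push_cast; ring
  rw [this]
  exact abs_sub _ _

lemma nint_neg_le (x : ℝ) : nint (-x) ≤ nint x := by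
  have h := nint_le (-x) (-round x)
  refine h.trans (le_of_eq ?_)
  unfold nint
  push_cast
  rw [← abs_neg]; congr 1; ring

lemma nint_sign (σ : ℤ) (hσ : σ = 1 ∨ σ = -1) (α : ℝ) (θ : ℚ) : nint (α - ((σ * θ : ℚ) : ℝ)) ≤ nint (σ * α - θ) := by
  rcases hσ with rfl | rfl
  · simp
  · refine (le_of_eq ?_).trans (nint_neg_le _)
    congr 1; push_cast; ring

lemma wh_sup {w : ℕ → ℝ} {U N : ℕ} (hw : Wt w U N) (α : ℝ) : ‖wh w N α‖ ≤ N := by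
  unfold wh
  refine (norm_sum_le _ _).trans ?_
  calc ∑ n ∈ Icc 1 N, ‖(w n : ℂ) * e (n * α)‖ ≤ ∑ n ∈ Icc 1 N, (1 : ℝ) := by
        refine sum_le_sum fun n _ => ?_
        rw [norm_mul, norm_e, mul_one, Complex.norm_real, Real.norm_of_nonneg (hw.nn n)]
        exact hw.le1 n
    _ = N := by simp

lemma wh_pair {w v : ℕ → ℝ} {U N : ℕ} (hw : Wt w U N) (hv : Wt v U N) (σ τ : ℤ) (hσ : σ = 1 ∨ σ = -1) (hτ : τ = 1 ∨ τ = -1)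
    (θ φ : ℚ) (Q : ℕ) (hθ : θ.den ≤ Q) (hφ : φ.den ≤ Q) (hne : ∀ m : ℤ, (σ * θ - τ * φ : ℚ) ≠ m) (α : ℝ) :
    ‖wh w N (σ * α - θ) * wh v N (τ * α - φ)‖ ≤ 2 * Q ^ 2 * N := by
  have hQ0 : 0 < Q := lt_of_lt_of_le θ.den_pos hθ
  have hQ : (0 : ℝ) < Q := by exact_mod_cast hQ0
  have hd : ∀ (ρ : ℤ) (x : ℚ), (ρ = 1 ∨ ρ = -1) → ((ρ : ℚ) * x).den = x.den := by
    rintro ρ x (rfl | rfl) <;> simp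
  have h1 := rat_nint hne
  have h2 : ((σ * θ - τ * φ : ℚ).den : ℝ) ≤ Q ^ 2 := by
    have : (σ * θ - τ * φ : ℚ).den ≤ (σ * θ : ℚ).den * (τ * φ : ℚ).den :=
      Nat.le_of_dvd (Nat.mul_pos (Rat.den_pos _) (Rat.den_pos _)) (Rat.sub_den_dvd _ _)
    rw [hd σ θ hσ, hd τ φ hτ] at this
    have h3 := this.trans (Nat.mul_le_mul hθ hφ)
    rw [sq]; exact_mod_cast h3
  have h3 : 1 / (Q : ℝ) ^ 2 ≤ nint ((σ * θ - τ * φ : ℚ) : ℝ) := by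
    refine le_trans ?_ h1
    have : (0 : ℝ) < (σ * θ - τ * φ : ℚ).den := by exact_mod_cast Rat.den_pos _
    gcongr
  have h4 := nint_sub_le (α - ((τ * φ : ℚ) : ℝ)) (α - ((σ * θ : ℚ) : ℝ))
  have h5 : (α - ((τ * φ : ℚ) : ℝ)) - (α - ((σ * θ : ℚ) : ℝ)) = ((σ * θ - τ * φ : ℚ) : ℝ) := by push_cast; ring
  rw [h5] at h4
  have h6 := nint_sign σ hσ α θ
  have h7 := nint_sign τ hτ α φ
  have key : ∀ {u : ℕ → ℝ} (x : ℝ), Wt u U N → 1 / (2 * (Q : ℝ) ^ 2) ≤ nint x → ‖wh u N x‖ ≤ 2 * Q ^ 2 := by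
    intro u x hu hx
    have := wh_bound hu x
    have h8 : ‖wh u N x‖ * (1 / (2 * (Q : ℝ) ^ 2)) ≤ 1 := le_trans (by gcongr) this
    rwa [mul_one_div, div_le_one (by positivity)] at h8
  rw [norm_mul]
  have h9 : 1 / (Q : ℝ) ^ 2 = 2 * (1 / (2 * (Q : ℝ) ^ 2)) := by field_simp
  rcases le_or_gt (1 / (2 * (Q : ℝ) ^ 2)) (nint (σ * α - θ)) with h | h
  · have := key _ hw h
    have := wh_sup hv (τ * α - φ)
    gcongr
  · have := key (τ * α - φ) hv (by linarith)
    have := wh_sup hw (σ * α - θ)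
    calc _ ≤ (N : ℝ) * (2 * Q ^ 2) := by gcongr
      _ = _ := by ring

lemma wh_shift (w : ℕ → ℝ) (N : ℕ) (x y : ℝ) : wh w N (x - y) = ES (fun n => w n * e (-(n * y))) N x := by
  unfold wh ES
  refine sum_congr rfl fun n _ => ?_
  have : (n : ℝ) * (x - y) = -(n * y) + n * x := by ring
  rw [this, e_add]; ring

lemma wh_nice {w : ℕ → ℝ} {U N K : ℕ} (hw : Wt w U N) (hK : 4 * N < K) (σ : ℤ) (hσ : σ = 1 ∨ σ = -1) (y : ℝ) :
    Nice K N 1 (fun α => wh w N (σ * α - y)) := by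
  have := nice_ES (fun n => w n * e (-(n * y))) N K hK 1 (fun n _ => by
    rw [norm_mul, norm_e, mul_one, Complex.norm_real, Real.norm_of_nonneg (hw.nn n)]
    exact hw.le1 n) σ hσ
  simpa only [wh_shift] using this

lemma unmatched {β : Fin 4 → ℤ} (hβ : ∀ j, β j = 1 ∨ β j = -1) {w : Fin 4 → ℕ → ℝ} {U N K : ℕ} (hw : ∀ j, Wt (w j) U N)
    (hK : 4 * N < K) (θ : Fin 4 → ℚ) (Q : ℕ) (hθ : ∀ j, (θ j).den ≤ Q) (j : Fin 4) (hj : ∀ m : ℤ, (β 0 * θ 0 - β j * θ j : ℚ) ≠ m) :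
    ‖av K (fun α => ∏ i, wh (w i) N (β i * α - θ i))‖ ≤ 2 * Q ^ 2 * N ^ 2 := by
  have hp := wh_pair (hw 0) (hw j) (β 0) (β j) (hβ 0) (hβ j) (θ 0) (θ j) Q (hθ 0) (hθ j) hj
  have hn := fun i => wh_nice (hw i) hK (β i) (hβ i) (θ i)
  have key : ∀ i k, (∀ α : ℝ, ∏ i, wh (w i) N (β i * α - θ i) = (wh (w 0) N (β 0 * α - θ 0) * wh (w j) N (β j * α - θ j)) *
      (wh (w i) N (β i * α - θ i) * wh (w k) N (β k * α - θ k))) →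
      ‖av K (fun α => ∏ i, wh (w i) N (β i * α - θ i))‖ ≤ 2 * Q ^ 2 * N ^ 2 := by
    intro i k h
    rw [av_congr h]
    refine (nice_bound (hn i) (hn k) hp).trans (le_of_eq ?_)
    ring
  fin_cases j
  · exact absurd (by simp) (hj 0)
  · exact key 2 3 fun α => by simp only [Fin.prod_univ_four]; simp; ring
  · exact key 1 3 fun α => by simp only [Fin.prod_univ_four]; simp; ring
  · exact key 1 2 fun α => by simp only [Fin.prod_univ_four]; simp; ring

/-- The singular integral, in discrete form. -/
noncomputable def JJ (β : Fin 4 → ℤ) (w : Fin 4 → ℕ → ℝ) (N : ℕ) : ℝ := ∑ n ∈ sol β N, ∏ j, w j (n j)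

lemma matched {β : Fin 4 → ℤ} (hβ : ∀ j, β j = 1 ∨ β j = -1) {w : Fin 4 → ℕ → ℝ} {N K : ℕ}
    (hK : 4 * N < K) (θ : Fin 4 → ℚ) (hj : ∀ j, ∃ m : ℤ, (β 0 * θ 0 - β j * θ j : ℚ) = m) :
    av K (fun α => ∏ i, wh (w i) N (β i * α - θ i)) = JJ β w N := by
  choose m hm using hj
  set ψ : ℝ := ((β 0 * θ 0 : ℚ) : ℝ) with hψ
  have h1 : ∀ (i : Fin 4) (α : ℝ), wh (w i) N (β i * α - θ i) = ES (fun n => w i n * e (-(n * (β i * ψ)))) N (β i * α) := by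
    intro i α
    rw [← wh_shift, ← wh_int _ _ (β i * α - β i * ψ) (β i * m i)]
    congr 1
    have h2 : (ψ : ℝ) - β i * θ i = m i := by
      rw [hψ]; exact_mod_cast congrArg (Rat.cast : ℚ → ℝ) (hm i)
    push_cast
    have h3 : (β i : ℝ) * β i = 1 := by
      rcases hβ i with h | h <;> rw [h] <;> norm_num
    rw [← h2]
    linear_combination (θ i : ℝ) * h3
  have h4 : ∀ α : ℝ, ∏ i, wh (w i) N (β i * α - θ i) = ∏ i, ES (fun n => w i n * e (-(n * (β i * ψ)))) N (β i * α) :=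
    fun α => prod_congr rfl fun i _ => h1 i α
  rw [av_congr h4, orth β hβ _ N K hK]
  unfold JJ
  push_cast
  refine sum_congr rfl fun n hn => ?_
  rw [prod_mul_distrib, e_sum]
  have h5 : ∑ i, -((n i : ℝ) * (β i * ψ)) = 0 := by
    have h6 := (mem_filter.1 hn).2
    have h7 : (∑ j, (β j : ℝ) * (n j : ℝ)) = 0 := by exact_mod_cast h6
    calc ∑ i, -((n i : ℝ) * (β i * ψ)) = (∑ j, (β j : ℝ) * (n j : ℝ)) * (-ψ) := by
          rw [sum_mul]; exact sum_congr rfl fun i _ => by ring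
      _ = 0 := by rw [h7, zero_mul]
  rw [h5, e_zero, mul_one]

lemma matched_kap {β : Fin 4 → ℤ} (hβ : ∀ j, β j = 1 ∨ β j = -1) (θ : Fin 4 → ℚ) (hj : ∀ j, ∃ m : ℤ, (β 0 * θ 0 - β j * θ j : ℚ) = m) :
    ∏ j, kap (θ j).den = (((kap (θ 0).den).re ^ 4 : ℝ) : ℂ) := by
  have h1 : ∀ j, kap (θ j).den = kap (θ 0).den := by
    intro j
    apply kap_congr
    obtain ⟨m, hm⟩ := hj j
    have hd : ∀ (ρ : ℤ) (x : ℚ), (ρ = 1 ∨ ρ = -1) → ((ρ : ℚ) * x).den = x.den := by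
      rintro ρ x (rfl | rfl) <;> simp
    rw [← hd (β j) (θ j) (hβ j), ← hd (β 0) (θ 0) (hβ 0)]
    have : (β 0 * θ 0 : ℚ) = β j * θ j + m := by linarith
    rw [this, Rat.add_intCast_den]
  have h2 : ((kap (θ 0).den).re : ℂ) = kap (θ 0).den := Complex.conj_eq_iff_re.1 (kap_conj _)
  rw [prod_congr rfl fun j _ => h1 j]
  push_cast
  rw [h2]; simp

lemma main_term {β : Fin 4 → ℤ} (hβ : ∀ j, β j = 1 ∨ β j = -1) {w : Fin 4 → ℕ → ℝ} {U N K : ℕ} (hw : ∀ j, Wt (w j) U N)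
    (hK : 4 * N < K) (Q : Fin 4 → ℕ) (Qm : ℕ) (hQ1 : ∀ j, 1 ≤ Q j) (hQ : ∀ j, Q j ≤ Qm) :
    JJ β w N - 2 * Qm ^ 10 * N ^ 2 ≤ (av K (fun α => ∏ j, Mh (w j) N (Q j) (β j * α))).re := by
  classical
  have hJ : 0 ≤ JJ β w N := sum_nonneg fun n _ => prod_nonneg fun j _ => (hw j).nn _
  have h1 : ∀ α : ℝ, ∏ j, Mh (w j) N (Q j) (β j * α) = ∑ θ ∈ Fintype.piFinset (fun j => farey (Q j)),
      (∏ j, kap (θ j).den) * ∏ j, wh (w j) N (β j * α - θ j) := by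
    intro α
    unfold Mh
    rw [prod_univ_sum]
    exact sum_congr rfl fun θ _ => prod_mul_distrib
  rw [av_congr h1, av_sum, Complex.re_sum]
  set b : ℝ := 2 * Qm ^ 2 * N ^ 2 with hb
  have hb0 : 0 ≤ b := by positivity
  have h2 : ∀ θ ∈ Fintype.piFinset (fun j => farey (Q j)), (if θ = 0 then JJ β w N else 0) - b ≤
      (av K (fun α => (∏ j, kap (θ j).den) * ∏ j, wh (w j) N (β j * α - θ j))).re := by
    intro θ hθ
    rw [av_smul]
    by_cases hj : ∀ j, ∃ m : ℤ, (β 0 * θ 0 - β j * θ j : ℚ) = m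
    · rw [matched hβ hK θ hj, matched_kap hβ θ hj, ← ofReal_mul, ofReal_re]
      split_ifs with h0
      · subst h0
        have : kap ((0 : Fin 4 → ℚ) 0).den = 1 := by
          rw [← kap_one]; exact kap_congr (by simp)
        rw [this]; simp; linarith
      · have : 0 ≤ (kap (θ 0).den).re ^ 4 * JJ β w N := by positivity
        linarith
    · push Not at hj
      obtain ⟨j, hj⟩ := hj
      have h0 : θ ≠ 0 := by rintro rfl; exact hj 0 (by simp)
      rw [if_neg h0, zero_sub]
      rw [Fintype.mem_piFinset] at hθ
      have h3 := unmatched hβ hw hK θ Qm (fun j => (mem_farey.1 (hθ j)).2.2.trans (hQ j)) j hj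
      have h4 : ‖(∏ j, kap (θ j).den) * av K (fun α => ∏ i, wh (w i) N (β i * α - θ i))‖ ≤ b := by
        rw [norm_mul, norm_prod]
        have : ∏ j, ‖kap (θ j).den‖ ≤ 1 := prod_le_one (fun _ _ => norm_nonneg _) fun j _ => kap_norm _
        calc _ ≤ 1 * b := by gcongr
          _ = b := one_mul _
      have h5 := Complex.abs_re_le_norm ((∏ j, kap (θ j).den) * av K (fun α => ∏ i, wh (w i) N (β i * α - θ i)))
      have h6 := neg_abs_le ((∏ j, kap (θ j).den) * av K (fun α => ∏ i, wh (w i) N (β i * α - θ i))).re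
      linarith
  refine le_trans ?_ (sum_le_sum h2)
  rw [sum_sub_distrib, sum_ite_eq' , if_pos]
  · rw [sum_const, nsmul_eq_mul]
    have hc : ((Fintype.piFinset (fun j => farey (Q j))).card : ℝ) ≤ Qm ^ 8 := by
      have : (Fintype.piFinset (fun j => farey (Q j))).card ≤ Qm ^ 8 := by
        rw [Fintype.card_piFinset]
        calc ∏ j, (farey (Q j)).card ≤ ∏ j : Fin 4, Qm ^ 2 := prod_le_prod' fun j _ => (farey_card _).trans (Nat.pow_le_pow_left (hQ j) 2)
          _ = Qm ^ 8 := by simp; ring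
      exact_mod_cast this
    have : ((Fintype.piFinset (fun j => farey (Q j))).card : ℝ) * b ≤ Qm ^ 8 * b := by gcongr
    have h9 : (Qm : ℝ) ^ 8 * b = 2 * Qm ^ 10 * N ^ 2 := by rw [hb]; ring
    linarith
  · rw [Fintype.mem_piFinset]
    intro j
    rw [mem_farey]
    simpa using hQ1 j

end PQ


namespace PQ
open Finset MeasureTheory Filter Topology Complex
open ArithmeticFunction (vonMangoldt)

/-! ### Lower bound for the singular integral -/

lemma abs_log_le {t : ℝ} (ht : |t| ≤ 1 / 2) : |Real.log (1 + t)| ≤ 2 * |t| := by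
  have h1 := abs_le.1 ht
  have hp : 0 < 1 + t := by linarith
  have h2 := Real.log_le_sub_one_of_pos hp
  have h3 := Real.one_sub_inv_le_log_of_pos hp
  have h4 : 1 - (1 + t)⁻¹ = t / (1 + t) := by field_simp; ring
  rw [h4] at h3
  have h5 : -(2 * |t|) ≤ t / (1 + t) := by
    rw [le_div_iff₀ hp]
    rcases le_total 0 t with h | h
    · rw [abs_of_nonneg h]; nlinarith
    · rw [abs_of_nonpos h]; nlinarith
  rw [abs_le]
  constructor
  · linarith
  · have := le_abs_self t
    have := abs_nonneg t
    linarith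

lemma wt_half {η cc l : ℝ} (hη : 0 < η) (hcc : 0 < cc) (hcc1 : cc ≤ 1) (hl : 2 ≤ l) {ε : ℝ} (hε : ε ≤ η * cc / 4) {n : ℕ}
    (hn : |(n : ℝ) - η * Real.exp l| ≤ ε * Real.exp l / l) : 1 / 2 ≤ wt η cc l n := by
  have hX := Real.exp_pos l
  set X := Real.exp l with hXd
  have hl0 : 0 < l := by linarith
  have hp : 0 < η * X := by positivity
  set t := (n : ℝ) / (η * X) - 1 with ht
  have ht1 : |t| ≤ cc / (4 * l) := by
    have : t = ((n : ℝ) - η * X) / (η * X) := by rw [ht]; field_simp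
    rw [this, abs_div, abs_of_pos hp, div_le_iff₀ hp]
    refine hn.trans ?_
    calc ε * X / l ≤ (η * cc / 4) * X / l := by gcongr
      _ = _ := by field_simp
  have hcl : cc / (4 * l) ≤ 1 / 2 := by
    rw [div_le_div_iff₀ (by positivity) (by norm_num)]; nlinarith
  have h1 := abs_log_le (ht1.trans hcl)
  have e1 : 1 + t = n / (η * X) := by rw [ht]; ring
  have hnp : (n : ℝ) ≠ 0 := by
    intro h
    have := (abs_le.1 (ht1.trans hcl)).1
    rw [ht, h] at this; norm_num at this
  rw [e1, Real.log_div hnp hp.ne', Real.log_mul hη.ne' hX.ne', hXd, Real.log_exp] at h1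
  unfold wt tent
  refine le_trans ?_ (le_max_right _ _)
  have h2 : |Real.log n - (Real.log η + l)| / (cc / l) ≤ 1 / 2 := by
    rw [div_le_iff₀ (by positivity)]
    refine h1.trans ?_
    calc 2 * |t| ≤ 2 * (cc / (4 * l)) := by gcongr
      _ = _ := by field_simp; ring
  linarith

lemma icc_card {a δ : ℝ} (hδ : 1 ≤ δ) (ha : δ ≤ a) : δ ≤ ((Icc ⌈a - δ⌉₊ ⌊a + δ⌋₊).card : ℝ) := by
  rw [Nat.card_Icc]
  have h1 : (⌈a - δ⌉₊ : ℝ) < a - δ + 1 := Nat.ceil_lt_add_one (by linarith)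
  have h2 : a + δ < ⌊a + δ⌋₊ + 1 := Nat.lt_floor_add_one _
  have h3 : ⌈a - δ⌉₊ ≤ ⌊a + δ⌋₊ + 1 := by
    have : (⌈a - δ⌉₊ : ℝ) ≤ ((⌊a + δ⌋₊ + 1 : ℕ) : ℝ) := by push_cast; linarith
    exact_mod_cast this
  rw [Nat.cast_sub h3]
  push_cast; linarith

lemma mem_icc_abs {a δ : ℝ} (ha : 0 ≤ a) (hδ : 0 ≤ δ) {n : ℕ} (hn : n ∈ Icc ⌈a - δ⌉₊ ⌊a + δ⌋₊) : |(n : ℝ) - a| ≤ δ := by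
  rw [mem_Icc] at hn
  have h1 := Nat.ceil_le.1 hn.1
  have h2 := (Nat.le_floor_iff (by linarith)).1 hn.2
  rw [abs_le]; constructor <;> linarith

lemma JJ_lower (β : Fin 4 → ℤ) (hβ : ∀ j, β j = 1 ∨ β j = -1) (η : Fin 4 → ℝ) (hη : ∀ j, 0 < η j)
    (hrel : ∑ j, (β j : ℝ) * η j = 0) (cc : ℝ) (hcc : 0 < cc) (hcc1 : cc ≤ 1) :
    ∃ c > 0, ∃ L0 : ℝ, ∀ l, L0 ≤ l → ∀ N : ℕ, (∀ j, 3 * η j * Real.exp l ≤ N) →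
      c * (Real.exp l / l) ^ 3 ≤ JJ β (fun j => wt (η j) cc l) N := by
  obtain ⟨ε, hε0, hε⟩ : ∃ ε > 0, ∀ j, ε ≤ η j * cc / 4 := by
    refine ⟨univ.inf' univ_nonempty (fun j => η j * cc / 4), ?_, fun j => inf'_le _ (mem_univ j)⟩
    rw [gt_iff_lt, lt_inf'_iff]
    intro j _
    have := hη j
    positivity
  obtain ⟨L1, h1⟩ := pow_exp_small (4 / ε) 1
  refine ⟨(1 / 16) * (ε / 4) ^ 3, by positivity, max (max L1 2) (∑ j, 2 * (|Real.log (η j)| + 1)), ?_⟩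
  intro l hl N hN
  simp only [max_le_iff] at hl
  obtain ⟨⟨g1, g2⟩, g3⟩ := hl
  have g3' : ∀ j, 2 * (|Real.log (η j)| + 1) ≤ l := fun j => by
    refine le_trans ?_ g3
    exact single_le_sum (f := fun j => 2 * (|Real.log (η j)| + 1)) (fun i _ => by positivity) (mem_univ j)
  have h1' := h1 l g1
  have hX := Real.exp_pos l
  set X := Real.exp l with hXd
  have hl0 : 0 < l := by linarith
  set δ := ε / 4 * (X / l) with hδ
  have hδ1 : 1 ≤ δ := by
    rw [hδ]
    rw [pow_one, div_mul_eq_mul_div, div_le_iff₀ hε0] at h1'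
    have : ε / 4 * (X / l) = (X * ε) / (4 * l) := by field_simp
    rw [this, le_div_iff₀ (by positivity)]; linarith
  have hδη : ∀ j, δ ≤ η j * X := by
    intro j
    have := hε j
    have := hη j
    calc δ ≤ (η j * cc / 4) / 4 * (X / 1) := by rw [hδ]; gcongr; linarith
      _ = η j * X * (cc / 16) := by ring
      _ ≤ η j * X * 1 := by gcongr; linarith
      _ = _ := mul_one _
  classical
  set V : Fin 4 → Finset ℕ := fun j => Icc ⌈η j * X - δ⌉₊ ⌊η j * X + δ⌋₊ with hV
  set G := (sol β N).filter (fun n => ∀ j, 1 / 2 ≤ wt (η j) cc l (n j)) with hG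
  have hcard : (V 1 ×ˢ V 2 ×ˢ V 3).card ≤ G.card := by
    refine card_le_card_of_injOn (fun x => ![(-(β 0 * (β 1 * (x.1 : ℤ) + β 2 * (x.2.1 : ℤ) + β 3 * (x.2.2 : ℤ)))).toNat, x.1, x.2.1, x.2.2]) ?_ ?_
    · rintro ⟨a, b, c⟩ hx
      simp only [coe_product, Set.mem_prod, mem_coe] at hx
      obtain ⟨ha, hb, hc⟩ := hx
      have ha' := mem_icc_abs (by have := hη 1; positivity) (by linarith) ha
      have hb' := mem_icc_abs (by have := hη 2; positivity) (by linarith) hb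
      have hc' := mem_icc_abs (by have := hη 3; positivity) (by linarith) hc
      set z : ℤ := -(β 0 * (β 1 * (a : ℤ) + β 2 * (b : ℤ) + β 3 * (c : ℤ))) with hz
      have hb0 : (β 0 : ℝ) * β 0 = 1 := by rcases hβ 0 with h | h <;> rw [h] <;> norm_num
      have hb0' : β 0 * β 0 = 1 := by rcases hβ 0 with h | h <;> rw [h] <;> norm_num
      have hab : ∀ j, |(β j : ℝ)| = 1 := fun j => by rcases hβ j with h | h <;> rw [h] <;> norm_num
      rw [Fin.sum_univ_four] at hrel
      have hzr : (z : ℝ) - η 0 * X = -(β 0 * (β 1 * (a - η 1 * X) + β 2 * (b - η 2 * X) + β 3 * (c - η 3 * X))) := by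
        rw [hz]; push_cast
        linear_combination (-(β 0 : ℝ) * X) * hrel + (η 0 * X) * hb0
      have hzb : |(z : ℝ) - η 0 * X| ≤ 3 * δ := by
        rw [hzr, abs_neg, abs_mul, hab, one_mul]
        refine (abs_add_le _ _).trans ?_
        have := abs_add_le ((β 1 : ℝ) * (a - η 1 * X)) (β 2 * (b - η 2 * X))
        rw [abs_mul, hab, one_mul, abs_mul, hab, one_mul] at this
        rw [abs_mul (β 3 : ℝ), hab, one_mul]
        linarith
      have hz0 : 0 ≤ z := by
        have h5 := (abs_le.1 hzb).1
        have : 3 * δ ≤ η 0 * X := by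
          have := hε 0
          have := hη 0
          calc 3 * δ ≤ 3 * ((η 0 * cc / 4) / 4 * (X / 1)) := by rw [hδ]; gcongr; linarith
            _ = η 0 * X * (3 * cc / 16) := by ring
            _ ≤ η 0 * X * 1 := by gcongr; linarith
            _ = _ := mul_one _
        have h6 : (0 : ℝ) ≤ z := by linarith
        exact_mod_cast h6
      have hzt : ((z.toNat : ℕ) : ℤ) = z := Int.toNat_of_nonneg hz0
      have hztr : ((z.toNat : ℕ) : ℝ) = z := by exact_mod_cast congrArg (Int.cast : ℤ → ℝ) hzt
      have hδε : 4 * δ = ε * X / l := by rw [hδ]; ring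
      have hw : ∀ j, 1 / 2 ≤ wt (η j) cc l ((![z.toNat, a, b, c] : Fin 4 → ℕ) j) := by
        intro j
        apply wt_half (hη j) hcc hcc1 g2 (hε j)
        rw [← hXd, ← hδε]
        fin_cases j
        · simp only [Fin.zero_eta, Matrix.cons_val_zero]; rw [hztr]; linarith
        · simp; linarith
        · simp; linarith
        · simp; linarith
      simp only [hG, coe_filter, Set.mem_setOf_eq, ← hz]
      refine ⟨?_, hw⟩
      unfold sol
      rw [mem_filter, Fintype.mem_piFinset]
      refine ⟨fun j => ?_, ?_⟩
      · have h7 : wt (η j) cc l ((![z.toNat, a, b, c] : Fin 4 → ℕ) j) ≠ 0 := by have := hw j; positivity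
        have h8 := wt_large (hη j) hcc hcc1 g2 (g3' j) h7
        rw [mem_Icc]
        refine ⟨h8.1, ?_⟩
        have := h8.2.trans (hN j)
        exact_mod_cast this
      · rw [Fin.sum_univ_four]
        simp only [Matrix.cons_val_zero, Matrix.cons_val_one, Matrix.cons_val]
        rw [hzt, hz]
        linear_combination (-(β 1 * (a : ℤ) + β 2 * (b : ℤ) + β 3 * (c : ℤ))) * hb0'
    · rintro ⟨a, b, c⟩ _ ⟨a', b', c'⟩ _ h
      have h1 := congrFun h 1
      have h2 := congrFun h 2
      have h3 := congrFun h 3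
      simp at h1 h2 h3
      simp [h1, h2, h3]
  have hcr : δ ^ 3 ≤ (G.card : ℝ) := by
    refine le_trans ?_ (Nat.cast_le.2 hcard)
    rw [card_product, card_product]
    push_cast
    have k1 := icc_card hδ1 (hδη 1)
    have k2 := icc_card hδ1 (hδη 2)
    have k3 := icc_card hδ1 (hδη 3)
    calc δ ^ 3 = δ * (δ * δ) := by ring
      _ ≤ _ := by
        have : 0 ≤ δ := by linarith
        gcongr
  unfold JJ
  calc 1 / 16 * (ε / 4) ^ 3 * (X / l) ^ 3 = δ ^ 3 * (1 / 16) := by rw [hδ]; ring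
    _ ≤ (G.card : ℝ) * (1 / 16) := by gcongr
    _ = ∑ n ∈ G, (1 / 16 : ℝ) := by rw [sum_const, nsmul_eq_mul]
    _ ≤ ∑ n ∈ G, ∏ j, wt (η j) cc l (n j) := by
      refine sum_le_sum fun n hn => ?_
      have h := (mem_filter.1 hn).2
      calc (1 / 16 : ℝ) = ∏ j : Fin 4, (1 / 2 : ℝ) := by simp; norm_num
        _ ≤ _ := prod_le_prod (fun _ _ => by norm_num) fun j _ => h j
    _ ≤ ∑ n ∈ sol β N, ∏ j, wt (η j) cc l (n j) :=
      sum_le_sum_of_subset_of_nonneg (filter_subset _ _) fun n _ _ => prod_nonneg fun j _ => wt_nonneg _ _ _ _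

end PQ


namespace PQ
open Finset MeasureTheory Filter Topology Complex
open ArithmeticFunction (vonMangoldt)

/-! ### The weighted count -/

lemma levels : ∃ t A D : Fin 4 → ℕ, (∀ i, A i = 3 * t i + 4) ∧ (∀ i, 2 * A i + 8 ≤ D i) ∧ (∀ i j, j < i → 2 * D j ≤ t i) ∧ ∀ i, 2 ≤ t i := by
  refine ⟨![2, 56, 704, 8480], ![10, 172, 2116, 25444], ![28, 352, 4240, 50896], ?_, ?_, ?_, ?_⟩ <;> decide

lemma Mh_ES (w : ℕ → ℝ) (N Q : ℕ) (α : ℝ) :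
    Mh w N Q α = ES (fun n => w n * ∑ θ ∈ farey Q, kap θ.den * e (-(n * (θ : ℝ)))) N α := by
  unfold Mh
  simp only [wh_shift]
  unfold ES
  simp only [mul_sum, sum_mul]
  rw [sum_comm]
  refine sum_congr rfl fun n _ => sum_congr rfl fun θ _ => ?_
  ring

lemma Sh_ES (w : ℕ → ℝ) (N : ℕ) (α : ℝ) : Sh w N α = ES (fun n => (vonMangoldt n : ℂ) * w n) N α := by
  unfold Sh ES
  exact sum_congr rfl fun n _ => by ring

/-- The weighted count of solutions. -/
noncomputable def WS (β : Fin 4 → ℤ) (w : Fin 4 → ℕ → ℝ) (N : ℕ) : ℝ := ∑ n ∈ sol β N, ∏ j, (vonMangoldt (n j) * w j (n j))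

lemma weighted_lower (β : Fin 4 → ℤ) (hβ : ∀ j, β j = 1 ∨ β j = -1) (η : Fin 4 → ℝ) (hη : ∀ j, 0 < η j)
    (hrel : ∑ j, (β j : ℝ) * η j = 0) (cc H : ℝ) (hcc : 0 < cc) (hcc1 : cc ≤ 1) (hH : 1 ≤ H) :
    ∃ c > 0, ∃ L0 : ℝ, ∀ l, L0 ≤ l → ∀ N : ℕ, Real.exp l ≤ N → (N : ℝ) ≤ H * Real.exp l → (∀ j, 3 * η j * Real.exp l ≤ N) →
      Real.log N ≤ 2 * l ∧ c * (Real.exp l / l) ^ 3 ≤ WS β (fun j => wt (η j) cc l) N := by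
  obtain ⟨t, A, D, hA, hD, htD, ht2⟩ := levels
  obtain ⟨c, hc, L1, h1⟩ := JJ_lower β hβ η hη hrel cc hcc hcc1
  choose L2 h2 using fun j => sup_bound (η j) cc H (hη j) hcc hcc1 hH (A j) (D j) (hD j)
  set Dm := ∑ j, D j with hDm
  obtain ⟨L3, h3⟩ := pow_exp_small (8 * H ^ 2 / c) (10 * Dm + 3)
  obtain ⟨L4, h4⟩ := pow_exp_small H 0
  refine ⟨c / 2, by positivity, max (max L1 (∑ j, |L2 j|)) (max (max L3 L4) (max (max 2 (16 * H ^ 2 / c)) (∑ j, 2 * (|Real.log (η j)| + 1)))), ?_⟩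
  intro l hl N hN1 hN2 hN3
  simp only [max_le_iff] at hl
  obtain ⟨⟨g1, g2⟩, ⟨g3, g4⟩, ⟨g5, g6⟩, g7⟩ := hl
  have g2' : ∀ j, L2 j ≤ l := fun j => (le_abs_self _).trans
    ((single_le_sum (f := fun j => |L2 j|) (fun i _ => abs_nonneg _) (mem_univ j)).trans g2)
  have g7' : ∀ j, 2 * (|Real.log (η j)| + 1) ≤ l := fun j =>
    (single_le_sum (f := fun j => 2 * (|Real.log (η j)| + 1)) (fun i _ => by positivity) (mem_univ j)).trans g7
  have hl0 : 0 < l := by linarith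
  have hl1 : 1 ≤ l := by linarith
  have h3' := h3 l g3
  have h4' := h4 l g4
  simp only [pow_zero, mul_one] at h4'
  have h1' := h1 l g1 N hN3
  have h2' := fun j => h2 j l (g2' j) N hN1 hN2 (hN3 j)
  have hX := Real.exp_pos l
  set X := Real.exp l with hXd
  have hNpos : 1 ≤ N := by
    have : (0 : ℝ) < N := by linarith
    exact_mod_cast this
  have hNr : (1 : ℝ) ≤ N := by exact_mod_cast hNpos
  have hlogN : Real.log N ≤ 2 * l := by
    have : (N : ℝ) ≤ X * X := hN2.trans (by gcongr)
    calc Real.log N ≤ Real.log (X * X) := Real.log_le_log (by linarith) this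
      _ = 2 * l := by rw [Real.log_mul hX.ne' hX.ne', hXd, Real.log_exp]; ring
  refine ⟨hlogN, ?_⟩
  set w : Fin 4 → ℕ → ℝ := fun j => wt (η j) cc l with hw
  have hW : ∀ j, Wt (w j) 0 N := fun j => wt_Wt (hη j) hcc hcc1 g5 (g7' j) (by simp; linarith) (hN3 j)
  set K := 4 * N + 1 with hK
  have hKN : 4 * N < K := by omega
  set Q : Fin 4 → ℕ := fun j => ⌊l ^ D j⌋₊ with hQ
  have hQ1 : ∀ j, 1 ≤ Q j := fun j => Nat.le_floor (by simpa using one_le_pow₀ hl1)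
  have hQle : ∀ j, (Q j : ℝ) ≤ l ^ D j := fun j => Nat.floor_le (by positivity)
  have hQge : ∀ j, l ^ D j ≤ 2 * Q j := fun j => by
    have h5 := Nat.lt_floor_add_one (l ^ D j)
    have h6 : (1 : ℝ) ≤ Q j := by exact_mod_cast hQ1 j
    simp only [hQ] at h6 ⊢
    linarith
  set Qm := ⌊l ^ Dm⌋₊ with hQm
  have hQQ : ∀ j, Q j ≤ Qm := fun j => Nat.floor_le_floor (pow_le_pow_right₀ hl1 (single_le_sum (fun _ _ => Nat.zero_le _) (mem_univ j)))
  have hQmle : (Qm : ℝ) ≤ l ^ Dm := Nat.floor_le (by positivity)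
  have hwn : ∀ j n, ‖(w j n : ℂ)‖ ≤ 1 := fun j n => by
    rw [Complex.norm_real, Real.norm_of_nonneg ((hW j).nn n)]; exact (hW j).le1 n
  have htel := telescope (K := K) (N := N) (fun j α => Sh (w j) N (β j * α)) (fun j α => Mh (w j) N (Q j) (β j * α))
    (fun i => l ^ t i) (fun i => X / l ^ A i) (by
      intro i j hji
      simp only [Mh_ES]
      refine nice_ES _ N K hKN _ (fun n _ => ?_) (β j) (hβ j)
      rw [norm_mul]
      have h5 : ‖∑ θ ∈ farey (Q j), kap θ.den * e (-(n * (θ : ℝ)))‖ ≤ l ^ t i := by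
        refine (norm_sum_le_of_le (n := fun _ => 1) _ fun θ _ => ?_).trans ?_
        · rw [norm_mul, norm_e, mul_one]; exact kap_norm _
        · rw [sum_const, nsmul_eq_mul, mul_one]
          calc ((farey (Q j)).card : ℝ) ≤ (Q j : ℝ) ^ 2 := by exact_mod_cast farey_card _
            _ ≤ (l ^ D j) ^ 2 := by have := hQle j; gcongr
            _ = l ^ (2 * D j) := by ring
            _ ≤ l ^ t i := pow_le_pow_right₀ hl1 (htD i j hji)
      calc _ ≤ 1 * l ^ t i := by have := hwn j n; gcongr
        _ = _ := one_mul _)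
    (by
      intro i j _
      simp only [Sh_ES]
      refine nice_ES _ N K hKN _ (fun n hn => ?_) (β j) (hβ j)
      rw [norm_mul, Complex.norm_real, Real.norm_of_nonneg ArithmeticFunction.vonMangoldt_nonneg]
      have h5 : vonMangoldt n ≤ l ^ t i := by
        have h6 := log_nat_mono (mem_Icc.1 hn).2
        simp only at h6
        calc vonMangoldt n ≤ Real.log n := vM_le n
          _ ≤ 2 * l := h6.trans hlogN
          _ ≤ l * l := by gcongr
          _ = l ^ 2 := by ring
          _ ≤ l ^ t i := pow_le_pow_right₀ hl1 (ht2 i)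
      calc _ ≤ l ^ t i * 1 := by have := hwn j n; gcongr
        _ = _ := mul_one _)
    (fun i α => h2' i (Q i) (hQle i) (hQge i) (β i * α))
  have hmain := main_term hβ hW hKN Q Qm hQ1 hQQ
  have hWS : av K (fun α => ∏ j, Sh (w j) N (β j * α)) = (WS β w N : ℂ) := by
    simp only [Sh_ES]
    rw [orth β hβ _ N K hKN]
    unfold WS
    push_cast
    rfl
  rw [hWS] at htel
  have hre := (Complex.abs_re_le_norm _).trans htel
  rw [Complex.sub_re, Complex.ofReal_re] at hre
  have hre2 := (abs_le.1 hre).1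
  have e1 : ∀ i, X / l ^ A i * (l ^ t i) ^ 3 * (N : ℝ) ^ 2 ≤ H ^ 2 * X ^ 3 / l ^ 4 := by
    intro i
    calc X / l ^ A i * (l ^ t i) ^ 3 * (N : ℝ) ^ 2 ≤ X / l ^ A i * (l ^ t i) ^ 3 * (H * X) ^ 2 := by gcongr
      _ = H ^ 2 * X ^ 3 / l ^ 4 := by
        rw [hA i]
        have : l ^ (3 * t i + 4) = (l ^ t i) ^ 3 * l ^ 4 := by ring
        rw [this]; field_simp
  have e2 : ∑ i, X / l ^ A i * (l ^ t i) ^ 3 * (N : ℝ) ^ 2 ≤ c / 4 * (X / l) ^ 3 := by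
    calc _ ≤ ∑ i : Fin 4, H ^ 2 * X ^ 3 / l ^ 4 := sum_le_sum fun i _ => e1 i
      _ = 4 * (H ^ 2 * X ^ 3 / l ^ 4) := by simp
      _ = (16 * H ^ 2 / c) * (c / 4 * X ^ 3 / l ^ 4) := by field_simp; norm_num
      _ ≤ l * (c / 4 * X ^ 3 / l ^ 4) := by gcongr
      _ = _ := by field_simp
  have e3 : 2 * (Qm : ℝ) ^ 10 * N ^ 2 ≤ c / 4 * (X / l) ^ 3 := by
    calc 2 * (Qm : ℝ) ^ 10 * N ^ 2 ≤ 2 * (l ^ Dm) ^ 10 * (H * X) ^ 2 := by gcongr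
      _ = (8 * H ^ 2 / c * l ^ (10 * Dm + 3)) * (c / 4 * X ^ 2 / l ^ 3) := by
        have : l ^ (10 * Dm + 3) = (l ^ Dm) ^ 10 * l ^ 3 := by ring
        rw [this]; field_simp; ring
      _ ≤ X * (c / 4 * X ^ 2 / l ^ 3) := by gcongr
      _ = _ := by ring
  linarith

end PQ


namespace PQ
open Finset MeasureTheory Filter Topology Complex
open ArithmeticFunction (vonMangoldt)

/-! ### Removing weights and prime powers -/

lemma sol_det {β : Fin 4 → ℤ} (hβ : ∀ j, β j = 1 ∨ β j = -1) {N : ℕ} {n m : Fin 4 → ℕ} (hn : n ∈ sol β N) (hm : m ∈ sol β N)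
    (r : Fin 4) (h : ∀ i, i ≠ r → n i = m i) : n = m := by
  have h1 := (mem_filter.1 hn).2
  have h2 := (mem_filter.1 hm).2
  rw [← add_sum_erase _ _ (mem_univ r)] at h1 h2
  have h3 : ∑ x ∈ univ.erase r, β x * (n x : ℤ) = ∑ x ∈ univ.erase r, β x * (m x : ℤ) :=
    sum_congr rfl fun i hi => by rw [h i (ne_of_mem_erase hi)]
  have h4 : β r * (n r : ℤ) = β r * (m r : ℤ) := by linarith
  have h5 : β r ≠ 0 := by rcases hβ r with h | h <;> rw [h] <;> norm_num
  have h6 : (n r : ℤ) = m r := mul_left_cancel₀ h5 h4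
  funext i
  by_cases hi : i = r
  · subst hi; exact_mod_cast h6
  · exact h i hi

lemma fiber_card {β : Fin 4 → ℤ} (hβ : ∀ j, β j = 1 ∨ β j = -1) (N : ℕ) (j : Fin 4) (m : ℕ) :
    ((sol β N).filter (fun n => n j = m)).card ≤ N ^ 2 := by
  obtain ⟨i, k, r, h⟩ : ∃ i k r : Fin 4, ∀ x, x ≠ r → x = i ∨ x = k ∨ x = j := by
    fin_cases j
    · exact ⟨1, 2, 3, by decide⟩
    · exact ⟨0, 2, 3, by decide⟩
    · exact ⟨0, 1, 3, by decide⟩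
    · exact ⟨0, 1, 2, by decide⟩
  have h1 : ((sol β N).filter (fun n => n j = m)).card ≤ (Icc 1 N ×ˢ Icc 1 N).card := by
    refine card_le_card_of_injOn (fun n => (n i, n k)) ?_ ?_
    · intro n hn
      have h2 := Fintype.mem_piFinset.1 (mem_filter.1 (mem_filter.1 hn).1).1
      simp only [coe_product, Set.mem_prod, mem_coe]
      exact ⟨h2 i, h2 k⟩
    · intro n hn n' hn' heq
      obtain ⟨a1, a2⟩ := mem_filter.1 hn
      obtain ⟨b1, b2⟩ := mem_filter.1 hn'
      simp only [Prod.mk.injEq] at heq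
      refine sol_det hβ a1 b1 r fun x hx => ?_
      rcases h x hx with rfl | rfl | rfl
      · exact heq.1
      · exact heq.2
      · rw [a2, b2]
  refine h1.trans (le_of_eq ?_)
  rw [card_product]; simp [sq]

lemma nonprime_sum (N : ℕ) (hN : 1 ≤ N) : ∑ m ∈ (Icc 1 N).filter (fun m => ¬ m.Prime), vonMangoldt m ≤ 2 * Real.sqrt N * Real.log N := by
  have h1 := Chebyshev.psi_sub_theta_le (x := (N : ℝ)) (by exact_mod_cast hN)
  rw [Chebyshev.psi_sub_theta_eq_sum_not_prime, Nat.floor_natCast] at h1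
  exact h1

lemma sol_nonprime {β : Fin 4 → ℤ} (hβ : ∀ j, β j = 1 ∨ β j = -1) (N : ℕ) (hN : 1 ≤ N) (j : Fin 4) :
    ∑ n ∈ (sol β N).filter (fun n => ¬ (n j).Prime), vonMangoldt (n j) ≤ N ^ 2 * (2 * Real.sqrt N * Real.log N) := by
  classical
  have hmaps : ∀ n ∈ (sol β N).filter (fun n => ¬ (n j).Prime), n j ∈ (Icc 1 N).filter (fun m => ¬ m.Prime) := by
    intro n hn
    obtain ⟨h1, h2⟩ := mem_filter.1 hn
    exact mem_filter.2 ⟨Fintype.mem_piFinset.1 (mem_filter.1 h1).1 j, h2⟩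
  rw [← sum_fiberwise_of_maps_to hmaps]
  calc _ ≤ ∑ m ∈ (Icc 1 N).filter (fun m => ¬ m.Prime), (N : ℝ) ^ 2 * vonMangoldt m := by
        refine sum_le_sum fun m _ => ?_
        have h3 : ∀ n ∈ ((sol β N).filter (fun n => ¬ (n j).Prime)).filter (fun n => n j = m), vonMangoldt (n j) = vonMangoldt m := by
          intro n hn; rw [(mem_filter.1 hn).2]
        rw [sum_congr rfl h3, sum_const, nsmul_eq_mul]
        have h4 : (((sol β N).filter (fun n => ¬ (n j).Prime)).filter (fun n => n j = m)).card ≤ N ^ 2 := by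
          refine le_trans (card_le_card ?_) (fiber_card hβ N j m)
          exact filter_subset_filter _ (filter_subset _ _)
        have h5 : ((((sol β N).filter (fun n => ¬ (n j).Prime)).filter (fun n => n j = m)).card : ℝ) ≤ (N : ℝ) ^ 2 := by exact_mod_cast h4
        have h6 : 0 ≤ vonMangoldt m := ArithmeticFunction.vonMangoldt_nonneg
        gcongr
    _ = (N : ℝ) ^ 2 * ∑ m ∈ (Icc 1 N).filter (fun m => ¬ m.Prime), vonMangoldt m := by rw [mul_sum]
    _ ≤ _ := by
      have := nonprime_sum N hN
      gcongr

lemma WS_upper {β : Fin 4 → ℤ} (hβ : ∀ j, β j = 1 ∨ β j = -1) {w : Fin 4 → ℕ → ℝ} {N : ℕ} (hN : 1 ≤ N)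
    (hw0 : ∀ j n, 0 ≤ w j n) (hw1 : ∀ j n, w j n ≤ 1) {L : ℝ} (hL : Real.log N ≤ L) :
    WS β w N ≤ L ^ 4 * (((sol β N).filter (fun n => (∀ j, (n j).Prime) ∧ ∀ j, w j (n j) ≠ 0)).card : ℝ) +
      4 * (L ^ 3 * (N ^ 2 * (2 * Real.sqrt N * L))) := by
  classical
  have hL0 : 0 ≤ L := (Real.log_natCast_nonneg N).trans hL
  have hf : ∀ n ∈ sol β N, ∀ j, 0 ≤ vonMangoldt (n j) * w j (n j) ∧ vonMangoldt (n j) * w j (n j) ≤ vonMangoldt (n j) ∧ vonMangoldt (n j) ≤ L := by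
    intro n hn j
    have h1 : 0 ≤ vonMangoldt (n j) := ArithmeticFunction.vonMangoldt_nonneg
    have h2 := Fintype.mem_piFinset.1 (mem_filter.1 hn).1 j
    have h3 := log_nat_mono (mem_Icc.1 h2).2
    simp only at h3
    exact ⟨mul_nonneg h1 (hw0 _ _), mul_le_of_le_one_right h1 (hw1 _ _), (vM_le _).trans (h3.trans hL)⟩
  have hpt : ∀ n ∈ sol β N, ∏ j, (vonMangoldt (n j) * w j (n j)) ≤
      (if (∀ j, (n j).Prime) ∧ ∀ j, w j (n j) ≠ 0 then L ^ 4 else 0) + ∑ j, (if ¬ (n j).Prime then L ^ 3 * vonMangoldt (n j) else 0) := by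
    intro n hn
    have hs0 : 0 ≤ ∑ j, (if ¬ (n j).Prime then L ^ 3 * vonMangoldt (n j) else 0) := by
      refine sum_nonneg fun j _ => ?_
      split_ifs
      · exact le_rfl
      · exact mul_nonneg (by positivity) ArithmeticFunction.vonMangoldt_nonneg
    by_cases hp : ∀ j, (n j).Prime
    · by_cases hw : ∀ j, w j (n j) ≠ 0
      · rw [if_pos ⟨hp, hw⟩]
        have : ∏ j, (vonMangoldt (n j) * w j (n j)) ≤ ∏ j : Fin 4, L :=
          prod_le_prod (fun j _ => (hf n hn j).1) fun j _ => (hf n hn j).2.1.trans (hf n hn j).2.2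
        rw [prod_const] at this
        simp only [card_univ, Fintype.card_fin] at this
        linarith
      · push Not at hw
        obtain ⟨j, hj⟩ := hw
        rw [prod_eq_zero (mem_univ j) (by rw [hj, mul_zero])]
        have : 0 ≤ (if (∀ j, (n j).Prime) ∧ ∀ j, w j (n j) ≠ 0 then L ^ 4 else 0) := by split_ifs <;> positivity
        linarith
    · have hp' := hp
      push Not at hp
      obtain ⟨j, hj⟩ := hp
      rw [if_neg (fun h => hp' h.1), zero_add]
      have h1 : (if ¬ (n j).Prime then L ^ 3 * vonMangoldt (n j) else 0) ≤ ∑ j, (if ¬ (n j).Prime then L ^ 3 * vonMangoldt (n j) else 0) := by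
        refine single_le_sum (f := fun j => (if ¬ (n j).Prime then L ^ 3 * vonMangoldt (n j) else 0)) (fun i _ => ?_) (mem_univ j)
        split_ifs
        · exact le_rfl
        · exact mul_nonneg (by positivity) ArithmeticFunction.vonMangoldt_nonneg
      refine le_trans ?_ h1
      rw [if_pos hj, ← mul_prod_erase _ _ (mem_univ j)]
      have h2 : ∏ i ∈ univ.erase j, (vonMangoldt (n i) * w i (n i)) ≤ ∏ i ∈ univ.erase j, L :=
        prod_le_prod (fun i _ => (hf n hn i).1) fun i _ => (hf n hn i).2.1.trans (hf n hn i).2.2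
      rw [prod_const, card_erase_of_mem (mem_univ j)] at h2
      simp only [card_univ, Fintype.card_fin] at h2
      have h3 := (hf n hn j).2.1
      have h4 : 0 ≤ ∏ i ∈ univ.erase j, (vonMangoldt (n i) * w i (n i)) := prod_nonneg fun i _ => (hf n hn i).1
      have h5 : 0 ≤ vonMangoldt (n j) := ArithmeticFunction.vonMangoldt_nonneg
      calc _ ≤ vonMangoldt (n j) * L ^ (4 - 1) := by gcongr
        _ = _ := by norm_num; ring
  unfold WS
  refine (sum_le_sum hpt).trans ?_
  rw [sum_add_distrib, ← sum_filter, sum_const, nsmul_eq_mul, sum_comm]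
  have h6 : ∑ j : Fin 4, ∑ n ∈ sol β N, (if ¬ (n j).Prime then L ^ 3 * vonMangoldt (n j) else 0) ≤
      ∑ j : Fin 4, L ^ 3 * (N ^ 2 * (2 * Real.sqrt N * L)) := by
    refine sum_le_sum fun j _ => ?_
    rw [← sum_filter, ← mul_sum]
    have := sol_nonprime hβ N hN j
    refine mul_le_mul_of_nonneg_left (this.trans ?_) (by positivity)
    gcongr
  rw [sum_const] at h6
  simp only [card_univ, Fintype.card_fin, nsmul_eq_mul] at h6
  push_cast at h6
  rw [mul_comm (L ^ 4)]
  linarith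

lemma wt_interval {η cc l : ℝ} (hη : 0 < η) (hcc : 0 < cc) (hcc1 : cc ≤ 1) (hcc2 : 6 * η * cc ≤ 1) (hl : 2 ≤ l)
    (hl2 : 2 * (|Real.log η| + 1) ≤ l) {n : ℕ}
    (hn : wt η cc l n ≠ 0) : |(n : ℝ) - η * Real.exp l| ≤ Real.exp l / (3 * l) := by
  have h0 := (wt_large hη hcc hcc1 hl hl2 hn).1
  have hn0 : (0 : ℝ) < n := by exact_mod_cast h0
  have hl0 : 0 < l := by linarith
  have h1 := wt_supp hcc hl0 hn
  set x := Real.log n - (Real.log η + l) with hx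
  have hx1 : |x| ≤ 1 := h1.trans (by rw [div_le_one hl0]; linarith)
  have h2 := Real.abs_exp_sub_one_le hx1
  have h3 : (n : ℝ) - η * Real.exp l = η * Real.exp l * (Real.exp x - 1) := by
    have : (n : ℝ) = Real.exp (x + (Real.log η + l)) := by rw [hx, sub_add_cancel, Real.exp_log hn0]
    rw [this, Real.exp_add, Real.exp_add, Real.exp_log hη]; ring
  rw [h3, abs_mul, abs_of_pos (by positivity)]
  calc η * Real.exp l * |Real.exp x - 1| ≤ η * Real.exp l * (2 * (cc / l)) := by gcongr; linarith
    _ = (6 * η * cc) * (Real.exp l / (3 * l)) := by field_simp; ring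
    _ ≤ 1 * (Real.exp l / (3 * l)) := by gcongr
    _ = _ := one_mul _

lemma primeQuad_finite (β : Fin 4 → ℤ) (η : Fin 4 → ℝ) (B : ℝ) : (primeQuad β η B).Finite := by
  refine Set.Finite.subset (Set.Finite.pi' (t := fun j : Fin 4 => Set.Iic ⌊η j * B ^ ((1 : ℝ) / 3) + B ^ ((1 : ℝ) / 3) / Real.log B⌋₊)
    fun j => Set.finite_Iic _) ?_
  intro p hp j
  exact Nat.le_floor (hp.1 j).2.2

end PQ

open PQ in
theorem prime_quadruple_count_lower
    (β : Fin 4 → ℤ) (hβ : ∀ j, β j = 1 ∨ β j = -1)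
    (η : Fin 4 → ℝ) (hη : ∀ j, 0 < η j)
    (hrel : (β 0 : ℝ) * η 0 + (β 1 : ℝ) * η 1 + (β 2 : ℝ) * η 2 + (β 3 : ℝ) * η 3 = 0) :
    ∃ c : ℝ, 0 < c ∧ ∃ B₀ : ℝ, ∀ B : ℝ, B₀ ≤ B →
      c * B / Real.log B ^ 7 ≤ ((primeQuad β η B).ncard : ℝ) := by
  classical
  set s := ∑ j, η j with hs
  have hs0 : 0 < s := Finset.sum_pos (fun j _ => hη j) Finset.univ_nonempty
  have hηs : ∀ j, η j ≤ s := fun j => Finset.single_le_sum (f := η) (fun i _ => (hη i).le) (Finset.mem_univ j)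
  set cc : ℝ := 1 / (6 * (1 + s)) with hcc
  have hcc0 : 0 < cc := by positivity
  have hcc1 : cc ≤ 1 := by rw [hcc, div_le_one (by positivity)]; linarith
  have hcc2 : ∀ j, 6 * η j * cc ≤ 1 := by
    intro j
    rw [hcc, mul_one_div, div_le_one (by positivity)]
    have := hηs j
    linarith
  set H : ℝ := 2 + 3 * s with hH
  obtain ⟨c, hc, L1, h1⟩ := weighted_lower β hβ η hη (by rw [Fin.sum_univ_four]; exact hrel) cc H hcc0 hcc1 (by linarith)
  obtain ⟨L2, h2⟩ := pow_exp_small (512 * H ^ 3 / c * 2 ^ 7) 7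
  refine ⟨c / 32 * 3 ^ 7, by positivity, Real.exp (3 * (max (max L1 (2 * L2)) (max 2 (∑ j, 2 * (|Real.log (η j)| + 1))))), ?_⟩
  intro B hB
  have hB0 : 0 < B := lt_of_lt_of_le (Real.exp_pos _) hB
  obtain ⟨l, hl⟩ : ∃ l, l = Real.log B / 3 := ⟨_, rfl⟩
  have hlB : Real.log B = 3 * l := by rw [hl]; ring
  have hll : max (max L1 (2 * L2)) (max 2 (∑ j, 2 * (|Real.log (η j)| + 1))) ≤ l := by
    have := (Real.le_log_iff_exp_le hB0).2 hB
    linarith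
  simp only [max_le_iff] at hll
  obtain ⟨⟨g1, g2⟩, g3, g4⟩ := hll
  have g4' : ∀ j, 2 * (|Real.log (η j)| + 1) ≤ l := fun j =>
    (Finset.single_le_sum (f := fun j => 2 * (|Real.log (η j)| + 1)) (fun i _ => by positivity) (Finset.mem_univ j)).trans g4
  have hl0 : 0 < l := by linarith
  have hXB : B ^ ((1 : ℝ) / 3) = Real.exp l := by
    rw [Real.rpow_def_of_pos hB0, hl]; congr 1; ring
  have hX3 : Real.exp l ^ 3 = B := by
    rw [← Real.exp_nat_mul]
    have : ((3 : ℕ) : ℝ) * l = Real.log B := by rw [hlB]; norm_num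
    rw [this, Real.exp_log hB0]
  have hX1 : 1 ≤ Real.exp l := Real.one_le_exp hl0.le
  have h2' := h2 (l / 2) (by linarith)
  have hXX : Real.exp (l / 2) ^ 2 = Real.exp l := by
    rw [← Real.exp_nat_mul]; congr 1; push_cast; ring
  set Y := Real.exp (l / 2) with hY
  have hY0 : 0 < Y := Real.exp_pos _
  set N := ⌈(1 + 3 * s) * Real.exp l⌉₊ with hN
  have hNle : (1 + 3 * s) * Real.exp l ≤ N := Nat.le_ceil _
  have hNlt : (N : ℝ) < (1 + 3 * s) * Real.exp l + 1 := Nat.ceil_lt_add_one (by positivity)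
  have hN1 : Real.exp l ≤ N := by nlinarith [Real.exp_pos l]
  have hN2 : (N : ℝ) ≤ H * Real.exp l := by rw [hH]; nlinarith
  have hN3 : ∀ j, 3 * η j * Real.exp l ≤ N := by
    intro j
    refine le_trans ?_ hNle
    have := hηs j
    gcongr
    linarith
  obtain ⟨hlog, hlow⟩ := h1 l g1 N hN1 hN2 hN3
  have hNpos : 1 ≤ N := by
    have : (0 : ℝ) < N := by linarith
    exact_mod_cast this
  have hup := WS_upper hβ (w := fun j => wt (η j) cc l) hNpos (fun j n => wt_nonneg _ _ _ _) (fun j n => wt_le_one hcc0 hl0 n) hlog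
  set G := (sol β N).filter (fun n => (∀ j, (n j).Prime) ∧ ∀ j, wt (η j) cc l (n j) ≠ 0) with hG
  have hGcard : G.card ≤ (primeQuad β η B).ncard := by
    rw [← Set.ncard_coe_finset]
    refine Set.ncard_le_ncard ?_ (primeQuad_finite β η B)
    intro n hn
    obtain ⟨a1, a2, a3⟩ := Finset.mem_filter.1 (Finset.mem_coe.1 hn)
    refine ⟨fun j => ⟨a2 j, ?_⟩, ?_⟩
    · have := wt_interval (hη j) hcc0 hcc1 (hcc2 j) g3 (g4' j) (a3 j)
      unfold shortInterval
      rw [hXB, hlB, Set.mem_Icc]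
      have h5 := abs_le.1 this
      constructor <;> linarith [h5.1, h5.2]
    · have := (Finset.mem_filter.1 a1).2
      rw [Fin.sum_univ_four] at this
      exact this
  have hGr : (G.card : ℝ) ≤ ((primeQuad β η B).ncard : ℝ) := by exact_mod_cast hGcard
  have hH1 : 1 ≤ H := by linarith
  have hsq : Real.sqrt N ≤ H * Y := by
    rw [Real.sqrt_le_left (by positivity)]
    calc (N : ℝ) ≤ H * Real.exp l := hN2
      _ = H * 1 * Y ^ 2 := by rw [hXX]; ring
      _ ≤ H * H * Y ^ 2 := by gcongr
      _ = (H * Y) ^ 2 := by ring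
  have herr : 4 * ((2 * l) ^ 3 * ((N : ℝ) ^ 2 * (2 * Real.sqrt N * (2 * l)))) ≤ c / 2 * (Real.exp l / l) ^ 3 := by
    calc 4 * ((2 * l) ^ 3 * ((N : ℝ) ^ 2 * (2 * Real.sqrt N * (2 * l))))
        ≤ 4 * ((2 * l) ^ 3 * ((H * Real.exp l) ^ 2 * (2 * (H * Y) * (2 * l)))) := by gcongr
      _ = (512 * H ^ 3 / c * 2 ^ 7 * (l / 2) ^ 7) * (c / 4 * Real.exp l ^ 2 * Y / l ^ 3) := by field_simp; ring
      _ ≤ Y * (c / 4 * Real.exp l ^ 2 * Y / l ^ 3) := by gcongr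
      _ = c / 4 * (Real.exp l / l) ^ 3 := by
          rw [div_pow (Real.exp l) l 3, show Real.exp l ^ 3 = Real.exp l ^ 2 * Y ^ 2 by rw [hXX]; ring]; ring
      _ ≤ c / 2 * (Real.exp l / l) ^ 3 := by gcongr; norm_num
  have hfin : c / 2 * (Real.exp l / l) ^ 3 ≤ (2 * l) ^ 4 * ((primeQuad β η B).ncard : ℝ) := by
    have h6 : (2 * l) ^ 4 * (G.card : ℝ) ≤ (2 * l) ^ 4 * ((primeQuad β η B).ncard : ℝ) := by gcongr
    have h7 : c / 2 * (Real.exp l / l) ^ 3 + c / 2 * (Real.exp l / l) ^ 3 = c * (Real.exp l / l) ^ 3 := by ring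
    linarith
  rw [hlB, div_le_iff₀ (by positivity)]
  rw [div_pow (Real.exp l) l 3, hX3] at hfin
  have h8 : c / 32 * 3 ^ 7 * B = (c / 2 * (B / l ^ 3)) * (3 ^ 7 * l ^ 3 / 16) := by field_simp; ring
  rw [h8]
  calc (c / 2 * (B / l ^ 3)) * (3 ^ 7 * l ^ 3 / 16) ≤ ((2 * l) ^ 4 * ((primeQuad β η B).ncard : ℝ)) * (3 ^ 7 * l ^ 3 / 16) := by gcongr
    _ = _ := by ring
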